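/- Fix t₀ > 0, a bounded measurable set Ω ⊆ (t₀,∞) × ℝ³, an integer n ≥ 1, real numbers γ > 0 and p > 0 with 4/p > n + 1. Then there exists a constant C > 0 (depending only on t₀, Ω, n, γ, p) such that: for every T > 0, every E ≥ 0, and every smooth solution (u,P) of the incompressible Navier–Stokes equations on (0,T) × ℝ³ satisfying (i) P(t,x) = (1/(4π)) ∫_{ℝ³} (Σ_{i,j} ∂ᵢuⱼ(t,y) ∂ⱼuᵢ(t,y)) / |x−y| dy for all (t,x) ∈ (0,T) × ℝ³, (ii) sup_{0<t<T} (∫_{ℝ³} |u(t,x)|² dx)^{1/2} ≤ E, and (iii) ∫₀^T ∫_{ℝ³} |∇u(t,x)|² dx dt ≤ E², one has ∫_{Ω ∩ ((0,T)×ℝ³)} |∇ⁿu(t,x)|^p dx dt ≤ C^p (E^{2(1+γ)/p} + 1)^p, where ∇ⁿu(t,x) is the n-th iterated spatial Fréchet derivative of u(t,·) at x with its operator norm. -/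

import Mathlib

open MeasureTheory Set Metric
open scoped ENNReal NNReal

noncomputable section

/-- `ℝ³` with the Euclidean norm. -/
abbrev E3 := EuclideanSpace ℝ (Fin 3)

/-- Spatial partial derivative `∂ⱼ f` of a scalar function. -/
def pd (f : E3 → ℝ) (j : Fin 3) (x : E3) : ℝ :=
  fderiv ℝ f x (EuclideanSpace.single j 1)

/-- `|∇f|² = Σ_{i,j} |∂ⱼ fᵢ|²`. -/
def gradSq (f : E3 → E3) (x : E3) : ℝ :=
  ∑ i, ∑ j, (pd (fun y => f y i) j x) ^ 2

/-- `(u,P)` is a smooth solution of the incompressible Navier–Stokes equations on the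
open set `U ⊆ ℝ × ℝ³`: `u` and `P` are infinitely differentiable on `U`, and on `U` one has
`∂ₜuᵢ + Σⱼ uⱼ ∂ⱼuᵢ + ∂ᵢP − Δuᵢ = 0` and `div u = 0`. -/
def IsNSSolution (u : ℝ → E3 → E3) (P : ℝ → E3 → ℝ) (U : Set (ℝ × E3)) : Prop :=
  ContDiffOn ℝ (⊤ : ℕ∞) (fun q : ℝ × E3 => u q.1 q.2) U ∧
  ContDiffOn ℝ (⊤ : ℕ∞) (fun q : ℝ × E3 => P q.1 q.2) U ∧
  (∀ q ∈ U, ∀ i : Fin 3,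
    deriv (fun s => u s q.2 i) q.1
      + (∑ j, u q.1 q.2 j * pd (fun y => u q.1 y i) j q.2)
      + pd (fun y => P q.1 y) i q.2
      - ∑ j, pd (pd (fun y => u q.1 y i) j) j q.2 = 0) ∧
  (∀ q ∈ U, ∑ i, pd (fun y => u q.1 y i) i q.2 = 0)

/-! ### Smooth functions on space-time and their partial derivatives -/

/-- Space-time `ℝ × ℝ³`. -/
abbrev Z := ℝ × E3

/-- The standard basis vectors of `ℝ³`. -/
abbrev eb (j : Fin 3) : E3 := EuclideanSpace.single j (1 : ℝ)

local notation "Sm" => ContDiff ℝ ((⊤ : ℕ∞) : WithTop ℕ∞)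

/-- Directional derivative as a function. -/
def dv {V : Type*} [NormedAddCommGroup V] [NormedSpace ℝ V] (w : V) (f : V → ℝ) (z : V) : ℝ :=
  fderiv ℝ f z w

/-- Time derivative. -/
abbrev dt (f : Z → ℝ) : Z → ℝ := dv ((1, 0) : Z) f

/-- Spatial partial derivative. -/
abbrev dx (j : Fin 3) (f : Z → ℝ) : Z → ℝ := dv ((0, eb j) : Z) f

/-- Spatial Laplacian. -/
def lap (f : Z → ℝ) (z : Z) : ℝ := ∑ j, dx j (dx j f) z

section dv
variable {V : Type*} [NormedAddCommGroup V] [NormedSpace ℝ V] {f g : V → ℝ}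

lemma _root_.ContDiff.diff (hf : Sm f) : Differentiable ℝ f := hf.differentiable (by simp)

@[fun_prop]
lemma dv_smooth (w : V) (hf : Sm f) : Sm (dv w f) := by
  unfold dv
  exact (hf.fderiv_right (m := ((⊤ : ℕ∞) : WithTop ℕ∞)) (by simp)).clm_apply contDiff_const

lemma dv_comm (w w' : V) (hf : Sm f) : dv w (dv w' f) = dv w' (dv w f) := by
  funext z
  have hd : DifferentiableAt ℝ (fderiv ℝ f) z :=
    ((hf.fderiv_right (m := ((⊤ : ℕ∞) : WithTop ℕ∞)) (by simp)).differentiable (by simp)) z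
  have key : ∀ a b : V, dv a (dv b f) z = fderiv ℝ (fderiv ℝ f) z a b := by
    intro a b
    unfold dv
    rw [fderiv_clm_apply hd (differentiableAt_const b)]
    simp
  rw [key, key]
  have := (hf.contDiffAt (x := z)).isSymmSndFDerivAt (by simpa using WithTop.coe_le_coe.2 (le_top : (2 : ℕ∞) ≤ ⊤))
  exact this w w'

lemma dv_add (w : V) (hf : Sm f) (hg : Sm g) (z : V) :
    dv w (fun z => f z + g z) z = dv w f z + dv w g z := by
  unfold dv; rw [fderiv_fun_add (hf.diff z) (hg.diff z)]; rfl

lemma dv_sub (w : V) (hf : Sm f) (hg : Sm g) (z : V) :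
    dv w (fun z => f z - g z) z = dv w f z - dv w g z := by
  unfold dv; rw [fderiv_fun_sub (hf.diff z) (hg.diff z)]; rfl

lemma dv_neg (w : V) (z : V) :
    dv w (fun z => - f z) z = - dv w f z := by
  unfold dv; rw [fderiv_fun_neg]; rfl

lemma dv_mul (w : V) (hf : Sm f) (hg : Sm g) (z : V) :
    dv w (fun z => f z * g z) z = f z * dv w g z + g z * dv w f z := by
  unfold dv; rw [fderiv_fun_mul (hf.diff z) (hg.diff z)]; simp

lemma dv_const (w : V) (c : ℝ) (z : V) : dv w (fun _ => c) z = 0 := by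
  unfold dv; simp

lemma dv_const_mul (w : V) (c : ℝ) (hf : Sm f) (z : V) :
    dv w (fun z => c * f z) z = c * dv w f z := by
  rw [dv_mul w contDiff_const hf, dv_const]; ring

lemma dv_sq (w : V) (hf : Sm f) (z : V) :
    dv w (fun z => f z ^ 2) z = 2 * (f z * dv w f z) := by
  simp only [sq]; rw [dv_mul w hf hf]; ring

lemma dv_sum {ι : Type*} (s : Finset ι) (w : V) (F : ι → V → ℝ) (hF : ∀ i, Sm (F i)) (z : V) :
    dv w (fun z => ∑ i ∈ s, F i z) z = ∑ i ∈ s, dv w (F i) z := by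
  unfold dv; rw [fderiv_fun_sum (fun i _ => (hF i).diff z)]; simp

lemma dv_eq_zero_of_eventually {w : V} {z : V} (h : ∀ᶠ y in nhds z, f y = 0) : dv w f z = 0 := by
  unfold dv
  have : f =ᶠ[nhds z] fun _ => (0 : ℝ) := h
  rw [this.fderiv_eq]; simp

end dv

lemma lap_smooth {f : Z → ℝ} (hf : Sm f) : Sm (lap f) := by
  unfold lap; fun_prop

lemma slice_smooth {f : Z → ℝ} (hf : Sm f) (s : ℝ) : Sm (fun x => f (s, x)) := by
  exact hf.comp (contDiff_const.prodMk contDiff_id)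

lemma dx_slice {f : Z → ℝ} (hf : Sm f) (j : Fin 3) (s : ℝ) (x : E3) :
    dv (eb j) (fun y => f (s, y)) x = dx j f (s, x) := by
  unfold dx dv
  have h1 : HasFDerivAt (fun y : E3 => (s, y)) (ContinuousLinearMap.inr ℝ ℝ E3) x :=
    hasFDerivAt_prodMk_right s x
  have h2 := ((hf.diff (s, x)).hasFDerivAt).comp x h1
  have h3 : fderiv ℝ (fun y => f (s, y)) x = _ := h2.fderiv
  rw [h3]; simp

lemma hasDerivAt_slice {f : Z → ℝ} (hf : Sm f) (s : ℝ) (x : E3) :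
    HasDerivAt (fun s => f (s, x)) (dt f (s, x)) s := by
  have h1 : HasFDerivAt (fun s : ℝ => (s, x)) (ContinuousLinearMap.inl ℝ ℝ E3) s :=
    hasFDerivAt_prodMk_left s x
  have h2 := (((hf.diff (s, x)).hasFDerivAt).comp s h1).hasDerivAt
  have h3 : fderiv ℝ f (s, x) ((ContinuousLinearMap.inl ℝ ℝ E3) 1) = dt f (s, x) := by
    simp [dt, dv]
  rw [ContinuousLinearMap.comp_apply, h3] at h2
  exact h2

/-! ### Functions with compact spatial support -/

/-- `f (s, x) = 0` for `‖x‖ > R`. -/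
def XSupp (R : ℝ) (f : Z → ℝ) : Prop := ∀ s x, R < ‖x‖ → f (s, x) = 0

lemma XSupp.dv {R : ℝ} {f : Z → ℝ} (h : XSupp R f) (w : Z) : XSupp R (dv w f) := by
  intro s x hx
  apply dv_eq_zero_of_eventually
  have : ∀ᶠ z : Z in nhds (s, x), R < ‖z.2‖ :=
    (continuous_snd.norm.continuousAt (x := ((s, x) : Z))).eventually_const_lt hx
  filter_upwards [this] with z hz
  exact h z.1 z.2 hz

lemma XSupp.mul_left {R : ℝ} {f : Z → ℝ} (h : XSupp R f) (g : Z → ℝ) :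
    XSupp R (fun z => g z * f z) := fun s x hx => by simp [h s x hx]

lemma XSupp.mul_right {R : ℝ} {f : Z → ℝ} (h : XSupp R f) (g : Z → ℝ) :
    XSupp R (fun z => f z * g z) := fun s x hx => by simp [h s x hx]

lemma hasCompactSupport_of_zero {R : ℝ} {f : E3 → ℝ} (h : ∀ x, R < ‖x‖ → f x = 0) :
    HasCompactSupport f :=
  HasCompactSupport.intro (isCompact_closedBall (0 : E3) R) fun x hx => h x (by simpa using hx)

lemma integrable_of_zero {R : ℝ} {f : E3 → ℝ} (hf : Continuous f) (h : ∀ x, R < ‖x‖ → f x = 0) :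
    Integrable f :=
  hf.integrable_of_hasCompactSupport (hasCompactSupport_of_zero h)

lemma XSupp.integrable {R : ℝ} {f : Z → ℝ} (h : XSupp R f) (hf : Continuous f) (s : ℝ) :
    Integrable (fun x => f (s, x)) :=
  integrable_of_zero (by fun_prop) (fun x hx => h s x hx)

lemma XSupp.integral_eq {R : ℝ} {f : Z → ℝ} (h : XSupp R f) (s : ℝ) :
    ∫ x, f (s, x) = ∫ x in closedBall 0 R, f (s, x) := by
  symm
  apply setIntegral_eq_integral_of_forall_compl_eq_zero
  intro x hx
  exact h s x (by simpa using hx)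

lemma XSupp.continuous_integral {R : ℝ} {f : Z → ℝ} (h : XSupp R f) (hf : Continuous f) :
    Continuous (fun s => ∫ x, f (s, x)) := by
  simp_rw [h.integral_eq]
  exact continuous_parametric_integral_of_continuous (f := fun s x => f (s, x)) hf
    (isCompact_closedBall (0 : E3) R)

lemma XSupp.hasDerivAt_integral {R : ℝ} {f : Z → ℝ} (h : XSupp R f) (hf : Sm f) (s : ℝ) :
    HasDerivAt (fun s => ∫ x, f (s, x)) (∫ x, dt f (s, x)) s := by
  have hc : Continuous (dt f) := (dv_smooth _ hf).continuous
  have hK : IsCompact (Icc (s - 1) (s + 1) ×ˢ closedBall (0 : E3) R) :=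
    isCompact_Icc.prod (isCompact_closedBall _ _)
  obtain ⟨M, hM⟩ := hK.exists_bound_of_continuousOn hc.continuousOn
  refine (hasDerivAt_integral_of_dominated_loc_of_deriv_le (μ := volume)
    (F := fun s x => f (s, x)) (F' := fun s x => dt f (s, x)) (x₀ := s) (s := Icc (s - 1) (s + 1))
    (bound := (closedBall (0 : E3) R).indicator fun _ => M) (Icc_mem_nhds (by linarith)
      (by linarith)) ?_ ?_ ?_ ?_ ?_ ?_).2
  · filter_upwards with s'
    exact (h.integrable hf.continuous s').aestronglyMeasurable
  · exact h.integrable hf.continuous s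
  · exact ((h.dv _).integrable hc s).aestronglyMeasurable
  · filter_upwards with x s' hs'
    by_cases hx : R < ‖x‖
    · rw [show dt f (s', x) = 0 from h.dv _ s' x hx, norm_zero]
      simp [indicator_of_notMem, hx]
    · have hx' : x ∈ closedBall (0 : E3) R := by simpa using hx
      rw [indicator_of_mem hx']
      exact hM (s', x) ⟨hs', hx'⟩
  · exact (integrable_indicator_iff measurableSet_closedBall).2
      (integrableOn_const (measure_closedBall_lt_top.ne))
  · filter_upwards with x s' _
    exact hasDerivAt_slice hf s' x

lemma integral_dv_eq_zero {R : ℝ} {f : E3 → ℝ} (hf : Sm f) (h : ∀ x, R < ‖x‖ → f x = 0) (w : E3) :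
    ∫ x, dv w f x = 0 := by
  have hs := hasCompactSupport_of_zero h
  have h1 : Integrable (dv w f) :=
    (dv_smooth w hf).continuous.integrable_of_hasCompactSupport (hs.fderiv_apply ℝ w)
  have h2 := integral_mul_fderiv_eq_neg_fderiv_mul_of_integrable (μ := (volume : Measure E3))
    (f := fun _ : E3 => (1 : ℝ)) (g := f) (v := w) (by simp)
    (by simp only [one_mul]; exact h1)
    (by simpa using integrable_of_zero hf.continuous h) (fun x _ => by fun_prop)
    (fun x _ => hf.diff x)
  simpa [dv] using h2

lemma XSupp.integral_dx {R : ℝ} {f : Z → ℝ} (h : XSupp R f) (hf : Sm f) (j : Fin 3) (s : ℝ) :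
    ∫ x, dx j f (s, x) = 0 := by
  have := integral_dv_eq_zero (slice_smooth hf s) (h s) (eb j)
  simpa only [dx_slice hf] using this

/-! ### Functional inequalities on `ℝ³` -/

/-- `|∇f|²` for scalar `f` on `ℝ³`. -/
def gs (f : E3 → ℝ) (x : E3) : ℝ := ∑ j, (dv (eb j) f x) ^ 2

lemma gs_nonneg (f : E3 → ℝ) (x : E3) : 0 ≤ gs f x := Finset.sum_nonneg fun _ _ => sq_nonneg _

lemma gs_continuous {f : E3 → ℝ} (hf : Sm f) : Continuous (gs f) := by
  unfold gs
  exact continuous_finsetSum _ fun j _ => ((dv_smooth _ hf).continuous).pow 2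

lemma dv_zero_of_zero {R : ℝ} {f : E3 → ℝ} (h : ∀ x, R < ‖x‖ → f x = 0) (w : E3) :
    ∀ x, R < ‖x‖ → dv w f x = 0 := by
  intro x hx
  apply dv_eq_zero_of_eventually
  filter_upwards [(continuous_norm.continuousAt (x := x)).eventually_const_lt hx] with z hz
  exact h z hz

lemma gs_zero_of_zero {R : ℝ} {f : E3 → ℝ} (h : ∀ x, R < ‖x‖ → f x = 0) :
    ∀ x, R < ‖x‖ → gs f x = 0 := by
  intro x hx
  simp [gs, dv_zero_of_zero h _ x hx]

lemma E3_decomp (v : E3) : v = ∑ j, v j • eb j := by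
  ext i
  fin_cases i <;> simp [Fin.sum_univ_three, eb]

lemma sq_fderiv_apply_le (f : E3 → ℝ) (x v : E3) :
    (fderiv ℝ f x v) ^ 2 ≤ gs f x * ‖v‖ ^ 2 := by
  have h1 : fderiv ℝ f x v = ∑ j, dv (eb j) f x * v j := by
    conv_lhs => rw [E3_decomp v]
    rw [map_sum]
    refine Finset.sum_congr rfl fun j _ => ?_
    rw [map_smul, smul_eq_mul, mul_comm]; rfl
  rw [h1, EuclideanSpace.norm_sq_eq]
  simpa [gs] using Finset.sum_mul_sq_le_sq_mul_sq Finset.univ (fun j => dv (eb j) f x) (fun j => v j)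

lemma norm_fderiv_sq_le (f : E3 → ℝ) (x : E3) : ‖fderiv ℝ f x‖ ^ 2 ≤ gs f x := by
  have : ‖fderiv ℝ f x‖ ≤ Real.sqrt (gs f x) := by
    refine ContinuousLinearMap.opNorm_le_bound _ (Real.sqrt_nonneg _) fun v => ?_
    rw [Real.norm_eq_abs]
    apply abs_le_of_sq_le_sq _ (by positivity)
    rw [mul_pow, Real.sq_sqrt (gs_nonneg f x)]
    exact sq_fderiv_apply_le f x v
  calc _ ≤ Real.sqrt (gs f x) ^ 2 := by gcongr
    _ = _ := Real.sq_sqrt (gs_nonneg f x)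

section CS
variable {α : Type*} [MeasurableSpace α] {μ : Measure α}

lemma integrable_mul_of_sq {f g : α → ℝ} (hf : AEStronglyMeasurable f μ)
    (hg : AEStronglyMeasurable g μ) (hf2 : Integrable (fun x => f x ^ 2) μ)
    (hg2 : Integrable (fun x => g x ^ 2) μ) : Integrable (fun x => f x * g x) μ := by
  refine (hf2.add hg2).mono' (hf.mul hg) ?_
  filter_upwards with x
  simp only [Pi.add_apply, Real.norm_eq_abs, abs_le]
  constructor <;> nlinarith [sq_nonneg (f x + g x), sq_nonneg (f x - g x), sq_nonneg (f x),
    sq_nonneg (g x)]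

/-- Cauchy–Schwarz, squared form. -/
lemma sq_integral_mul_le {f g : α → ℝ} (hf : AEStronglyMeasurable f μ)
    (hg : AEStronglyMeasurable g μ) (hf2 : Integrable (fun x => f x ^ 2) μ)
    (hg2 : Integrable (fun x => g x ^ 2) μ) :
    (∫ x, f x * g x ∂μ) ^ 2 ≤ (∫ x, f x ^ 2 ∂μ) * ∫ x, g x ^ 2 ∂μ := by
  have hfg := integrable_mul_of_sq hf hg hf2 hg2
  have key : ∀ t : ℝ, 0 ≤ (∫ x, g x ^ 2 ∂μ) * (t * t) + (2 * ∫ x, f x * g x ∂μ) * t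
      + ∫ x, f x ^ 2 ∂μ := by
    intro t
    have h0 : 0 ≤ ∫ x, (f x + t * g x) ^ 2 ∂μ := integral_nonneg fun x => sq_nonneg _
    have h1 : ∫ x, (f x + t * g x) ^ 2 ∂μ
        = ∫ x, (f x ^ 2 + (2 * t) * (f x * g x) + (t * t) * g x ^ 2) ∂μ := by
      congr 1; funext x; ring
    have h2 : Integrable (fun x => f x ^ 2 + (2 * t) * (f x * g x)) μ := hf2.add (hfg.const_mul _)
    rw [h1, integral_add h2 (hg2.const_mul _),
      integral_add hf2 (hfg.const_mul _), integral_const_mul, integral_const_mul] at h0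
    linarith
  have := discrim_le_zero key
  unfold discrim at this
  nlinarith

lemma integral_mul_le_sqrt {f g : α → ℝ} (hf : AEStronglyMeasurable f μ)
    (hg : AEStronglyMeasurable g μ) (hf2 : Integrable (fun x => f x ^ 2) μ)
    (hg2 : Integrable (fun x => g x ^ 2) μ) :
    |∫ x, f x * g x ∂μ| ≤ Real.sqrt (∫ x, f x ^ 2 ∂μ) * Real.sqrt (∫ x, g x ^ 2 ∂μ) := by
  rw [← Real.sqrt_mul (integral_nonneg fun x => sq_nonneg _), ← Real.sqrt_sq_eq_abs]
  exact Real.sqrt_le_sqrt (sq_integral_mul_le hf hg hf2 hg2)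

end CS

lemma sobolev_six : ∃ C : ℝ, 0 < C ∧ ∀ (R : ℝ) (f : E3 → ℝ), Sm f → (∀ x, R < ‖x‖ → f x = 0) →
    ∫ x, f x ^ 6 ≤ C * (∫ x, gs f x) ^ 3 := by
  set K : ℝ≥0 := SNormLESNormFDerivOfEqConst ℝ (volume : Measure E3) (2 : ℝ≥0)
  refine ⟨(K : ℝ) ^ 6 + 1, by positivity, fun R f hf h => ?_⟩
  have hcs := hasCompactSupport_of_zero h
  have hfin : Module.finrank ℝ E3 = 3 := by simp
  have h1 := eLpNorm_le_eLpNorm_fderiv_of_eq (volume : Measure E3) (u := f) (p := 2) (p' := 6)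
    (hf.of_le (by simp)) hcs (by norm_num) (by rw [hfin]; norm_num)
    (by rw [hfin]; norm_num)
  have h6 := eLpNorm_nnreal_pow_eq_lintegral (μ := (volume : Measure E3)) (f := f) (p := 6)
    (by norm_num)
  have h2 := eLpNorm_nnreal_pow_eq_lintegral (μ := (volume : Measure E3)) (f := fderiv ℝ f) (p := 2)
    (by norm_num)
  have e6 : ENNReal.ofReal (∫ x, f x ^ 6) = ∫⁻ x, ‖f x‖ₑ ^ ((6 : ℝ≥0) : ℝ) := by
    rw [ofReal_integral_eq_lintegral_ofReal (integrable_of_zero (by have := hf.continuous; fun_prop)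
      (R := R) (fun x hx => by simp [h x hx])) (by filter_upwards with x; positivity)]
    congr 1; funext x
    rw [Real.enorm_eq_ofReal_abs, ENNReal.ofReal_rpow_of_nonneg (abs_nonneg _) (by norm_num)]
    congr 1
    have : ((6 : ℝ≥0) : ℝ) = ((6 : ℕ) : ℝ) := by norm_num
    rw [this, Real.rpow_natCast]
    exact (Even.pow_abs (by decide) _).symm
  have e2 : ∫⁻ x, ‖fderiv ℝ f x‖ₑ ^ ((2 : ℝ≥0) : ℝ) ≤ ENNReal.ofReal (∫ x, gs f x) := by
    rw [ofReal_integral_eq_lintegral_ofReal (integrable_of_zero (gs_continuous hf)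
      (gs_zero_of_zero h)) (by filter_upwards with x; exact gs_nonneg f x)]
    refine lintegral_mono fun x => ?_
    rw [← ofReal_norm, ENNReal.ofReal_rpow_of_nonneg (norm_nonneg _) (by norm_num)]
    apply ENNReal.ofReal_le_ofReal
    have : ((2 : ℝ≥0) : ℝ) = ((2 : ℕ) : ℝ) := by norm_num
    rw [this, Real.rpow_natCast]
    exact norm_fderiv_sq_le f x
  have hI : 0 ≤ ∫ x, gs f x := integral_nonneg (gs_nonneg f)
  have h3 : ENNReal.ofReal (∫ x, f x ^ 6) ≤ ENNReal.ofReal ((K : ℝ) ^ 6 * (∫ x, gs f x) ^ 3) := by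
    rw [e6, ← h6]
    calc eLpNorm f (6 : ℝ≥0) volume ^ ((6 : ℝ≥0) : ℝ)
        ≤ (K * eLpNorm (fderiv ℝ f) (2 : ℝ≥0) volume) ^ ((6 : ℝ≥0) : ℝ) := by gcongr
      _ = (K : ℝ≥0∞) ^ 6 * (eLpNorm (fderiv ℝ f) (2 : ℝ≥0) volume ^ ((2 : ℝ≥0) : ℝ)) ^ 3 := by
        rw [ENNReal.mul_rpow_of_nonneg _ _ (by norm_num)]
        congr 1
        · have : ((6 : ℝ≥0) : ℝ) = ((6 : ℕ) : ℝ) := by norm_num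
          rw [this, ENNReal.rpow_natCast]
        · rw [← ENNReal.rpow_natCast, ← ENNReal.rpow_mul]; norm_num
      _ ≤ (K : ℝ≥0∞) ^ 6 * (ENNReal.ofReal (∫ x, gs f x)) ^ 3 := by
        rw [h2]; gcongr
      _ = _ := by
        rw [ENNReal.ofReal_mul (by positivity), ENNReal.ofReal_pow hI, ENNReal.ofReal_pow
          (by positivity), ENNReal.ofReal_coe_nnreal]
  have h4 := (ENNReal.ofReal_le_ofReal_iff (by positivity)).1 h3
  refine h4.trans ?_
  gcongr; linarith

lemma ladyzhenskaya : ∃ C : ℝ, 0 < C ∧ ∀ (R : ℝ) (f : E3 → ℝ), Sm f →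
    (∀ x, R < ‖x‖ → f x = 0) →
    (∫ x, f x ^ 4) ^ 2 ≤ C * (∫ x, f x ^ 2) * (∫ x, gs f x) ^ 3 := by
  obtain ⟨C, hC, H⟩ := sobolev_six
  refine ⟨C, hC, fun R f hf h => ?_⟩
  have hc := hf.continuous
  have h1 := sq_integral_mul_le (μ := (volume : Measure E3)) (f := f) (g := fun x => f x ^ 3)
    (by fun_prop) (by fun_prop)
    (integrable_of_zero (R := R) (by fun_prop) fun x hx => by simp [h x hx])
    (integrable_of_zero (R := R) (by fun_prop) fun x hx => by simp [h x hx])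
  have e1 : (fun x => f x * f x ^ 3) = fun x => f x ^ 4 := by funext x; ring
  have e2 : (fun x => (f x ^ 3) ^ 2) = fun x => f x ^ 6 := by funext x; ring
  rw [e1, e2] at h1
  have h2 : 0 ≤ ∫ x, f x ^ 2 := integral_nonneg fun x => sq_nonneg _
  calc _ ≤ _ := h1
    _ ≤ (∫ x, f x ^ 2) * (C * (∫ x, gs f x) ^ 3) := by gcongr; exact H R f hf h
    _ = _ := by ring

lemma integral_abs_cube_le : ∃ C : ℝ, 0 < C ∧ ∀ (R : ℝ) (f : E3 → ℝ), Sm f →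
    (∀ x, R < ‖x‖ → f x = 0) →
    (∫ x, |f x| ^ 3) ^ 4 ≤ C * (∫ x, f x ^ 2) ^ 3 * (∫ x, gs f x) ^ 3 := by
  obtain ⟨C, hC, H⟩ := ladyzhenskaya
  refine ⟨C, hC, fun R f hf h => ?_⟩
  have hc := hf.continuous
  have h1 := sq_integral_mul_le (μ := (volume : Measure E3)) (f := fun x => |f x|)
    (g := fun x => f x ^ 2) (by fun_prop) (by fun_prop)
    (integrable_of_zero (R := R) (by fun_prop) fun x hx => by simp [h x hx])
    (integrable_of_zero (R := R) (by fun_prop) fun x hx => by simp [h x hx])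
  have e1 : (fun x => |f x| * f x ^ 2) = fun x => |f x| ^ 3 := by funext x; rw [← sq_abs]; ring
  have e2 : (fun x => (f x ^ 2) ^ 2) = fun x => f x ^ 4 := by funext x; ring
  simp only [sq_abs] at h1
  rw [e1, e2] at h1
  have h2 : 0 ≤ ∫ x, f x ^ 2 := integral_nonneg fun x => sq_nonneg _
  calc (∫ x, |f x| ^ 3) ^ 4 = ((∫ x, |f x| ^ 3) ^ 2) ^ 2 := by ring
    _ ≤ ((∫ x, f x ^ 2) * ∫ x, f x ^ 4) ^ 2 := by gcongr
    _ = (∫ x, f x ^ 2) ^ 2 * (∫ x, f x ^ 4) ^ 2 := by ring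
    _ ≤ (∫ x, f x ^ 2) ^ 2 * (C * (∫ x, f x ^ 2) * (∫ x, gs f x) ^ 3) := by
      gcongr; exact H R f hf h
    _ = _ := by ring

/-! ### The averaging kernel and a Poincaré inequality -/

/-- A smooth bump function at the origin. -/
def bump0 : ContDiffBump (0 : E3) := ⟨1 / 2, 1, by norm_num, by norm_num⟩

/-- A smooth probability density supported in the unit ball. -/
def avk : E3 → ℝ := bump0.normed volume

lemma avk_smooth : Sm avk := bump0.contDiff_normed

lemma avk_nonneg (x : E3) : 0 ≤ avk x := bump0.nonneg_normed x

lemma avk_integral : ∫ x, avk x = 1 := bump0.integral_normed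

lemma avk_zero {x : E3} (hx : 1 ≤ ‖x‖) : avk x = 0 := by
  have := bump0.support_normed_eq (μ := (volume : Measure E3))
  by_contra h
  have h2 : x ∈ Function.support (bump0.normed volume) := h
  rw [this] at h2
  have : ‖x‖ < 1 := by simpa [bump0] using h2
  linarith

lemma avk_zero' : ∀ x : E3, 1 < ‖x‖ → avk x = 0 := fun _ hx => avk_zero hx.le

lemma avk_bdd : ∃ M : ℝ, 0 < M ∧ ∀ x, avk x ≤ M := by
  obtain ⟨M, hM⟩ := avk_smooth.continuous.bounded_above_of_compact_support
    (hasCompactSupport_of_zero avk_zero')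
  exact ⟨|M| + 1, by positivity, fun x => by
    have := (le_abs_self _).trans (hM x); have := le_abs_self M; linarith⟩

lemma lintegral_comp_affine {r : ℝ} (hr : 0 < r) (a : E3) {G : E3 → ℝ≥0∞} (hG : Measurable G) :
    ∫⁻ x, G (a + r • x) = ENNReal.ofReal ((r ^ 3)⁻¹) * ∫⁻ x, G x := by
  have h1 : ∫⁻ x, G (a + r • x) = ∫⁻ y, G (a + y) ∂(Measure.map (fun x : E3 => r • x) volume) := by
    rw [lintegral_map (by fun_prop) (by fun_prop)]
  rw [h1, Measure.map_addHaar_smul _ hr.ne', lintegral_smul_measure, lintegral_add_left_eq_self]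
  simp only [finrank_euclideanSpace, Fintype.card_fin, smul_eq_mul]
  rw [abs_of_pos (by positivity)]

lemma sq_sub_le_lintegral {f : E3 → ℝ} (hf : Sm f) (x y : E3) :
    ENNReal.ofReal ((f x - f y) ^ 2) ≤ ENNReal.ofReal (‖x - y‖ ^ 2) *
      ∫⁻ t in Icc (0 : ℝ) 1, ENNReal.ofReal (gs f (y + t • (x - y))) := by
  set g : ℝ → ℝ := fun t => fderiv ℝ f (y + t • (x - y)) (x - y) with hg
  have hgc : Continuous g := by
    have h1 : Continuous (fderiv ℝ f) := hf.continuous_fderiv (by simp)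
    exact (h1.comp (by fun_prop)).clm_apply continuous_const
  have h1 : f x - f y = ∫ t in (0 : ℝ)..1, g t := by
    have hd : ∀ t : ℝ, HasDerivAt (fun t : ℝ => f (y + t • (x - y))) (g t) t := by
      intro t
      have h2 : HasDerivAt (fun t : ℝ => y + t • (x - y)) (x - y) t := by
        simpa using ((hasDerivAt_id t).smul_const (x - y)).const_add y
      exact ((hf.diff _).hasFDerivAt).comp_hasDerivAt t h2
    rw [intervalIntegral.integral_eq_sub_of_hasDerivAt (fun t _ => hd t)
      (hgc.intervalIntegrable _ _)]
    simp
  have hgc2 : Continuous fun t : ℝ => gs f (y + t • (x - y)) := (gs_continuous hf).comp (by fun_prop)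
  have hintg : ∀ {h : ℝ → ℝ}, Continuous h → Integrable h (volume.restrict (Icc 0 1)) :=
    fun hh => hh.continuousOn.integrableOn_Icc
  have h2 : (f x - f y) ^ 2 ≤ ‖x - y‖ ^ 2 * ∫ t in Icc (0 : ℝ) 1, gs f (y + t • (x - y)) := by
    rw [h1, intervalIntegral.integral_of_le zero_le_one, ← integral_Icc_eq_integral_Ioc]
    have h3 := sq_integral_mul_le (μ := volume.restrict (Icc (0 : ℝ) 1)) (f := g) (g := fun _ => 1)
      (by fun_prop) (by fun_prop) (hintg (by fun_prop)) (hintg (by fun_prop))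
    simp only [mul_one, one_pow, integral_const, measureReal_restrict_apply_univ,
      Real.volume_real_Icc, sub_zero, smul_eq_mul, max_eq_left zero_le_one] at h3
    refine h3.trans ?_
    rw [← integral_const_mul]
    refine integral_mono (hintg (by fun_prop)) (hintg (by fun_prop)) fun t => ?_
    simp only
    rw [mul_comm]; exact sq_fderiv_apply_le f _ _
  calc _ ≤ _ := ENNReal.ofReal_le_ofReal h2
    _ = _ := by
      rw [ENNReal.ofReal_mul (by positivity), ofReal_integral_eq_lintegral_ofReal (hintg hgc2)
        (by filter_upwards with t; exact gs_nonneg _ _)]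

lemma lintegral_segment_le {G : E3 → ℝ≥0∞} (hG : Measurable G) (R : ℝ) {t : ℝ}
    (ht : t ∈ Icc (0 : ℝ) 1) :
    ∫⁻ x in closedBall (0 : E3) R, ∫⁻ y in closedBall (0 : E3) R, G (y + t • (x - y))
      ≤ 8 * volume (closedBall (0 : E3) R) * ∫⁻ x in closedBall (0 : E3) R, G x := by
  set B := closedBall (0 : E3) R
  have hB : MeasurableSet B := measurableSet_closedBall
  have main : ∀ (r : ℝ), r ∈ Icc (1 / 2 : ℝ) 1 → ∀ y ∈ B,
      ∫⁻ x in B, G ((1 - r) • y + r • x) ≤ 8 * ∫⁻ x in B, G x := by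
    intro r hr y hy
    have hr0 : 0 < r := by linarith [hr.1]
    calc ∫⁻ x in B, G ((1 - r) • y + r • x)
        ≤ ∫⁻ x, B.indicator G ((1 - r) • y + r • x) := by
          rw [← lintegral_indicator hB]
          refine lintegral_mono fun x => ?_
          by_cases hx : x ∈ B
          · have : (1 - r) • y + r • x ∈ B :=
              convex_closedBall (0 : E3) R hy hx (by linarith [hr.2]) hr0.le (by ring)
            simp [hx, this]
          · simp [hx]
      _ = ENNReal.ofReal ((r ^ 3)⁻¹) * ∫⁻ x in B, G x := by
          rw [lintegral_comp_affine hr0 _ (hG.indicator hB), lintegral_indicator hB]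
      _ ≤ _ := by
          gcongr
          have : (r ^ 3)⁻¹ ≤ 8 := by
            rw [inv_le_comm₀ (by positivity) (by norm_num)]
            calc (8 : ℝ)⁻¹ = (1 / 2) ^ 3 := by norm_num
              _ ≤ r ^ 3 := by gcongr; exact hr.1
          calc _ ≤ ENNReal.ofReal 8 := ENNReal.ofReal_le_ofReal this
            _ = 8 := by norm_num
  have fin : ∀ H : E3 → ℝ≥0∞, (∀ y ∈ B, H y ≤ 8 * ∫⁻ x in B, G x) →
      ∫⁻ y in B, H y ≤ 8 * volume B * ∫⁻ x in B, G x := by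
    intro H hH
    calc ∫⁻ y in B, H y ≤ ∫⁻ y in B, (8 * ∫⁻ x in B, G x) := setLIntegral_mono' hB hH
      _ = _ := by rw [setLIntegral_const]; ring
  rcases le_total t (1 / 2) with h | h
  · refine fin _ fun x hx => ?_
    have := main (1 - t) ⟨by linarith, by linarith [ht.1]⟩ x hx
    refine le_trans (le_of_eq ?_) this
    congr 1; funext y; congr 1; module
  · rw [lintegral_lintegral_swap (by
      refine Measurable.aemeasurable ?_
      simp only [Function.uncurry_def]
      fun_prop)]
    refine fin _ fun y hy => ?_
    have := main t ⟨h, ht.2⟩ y hy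
    refine le_trans (le_of_eq ?_) this
    congr 1; funext x; congr 1; module

/-- Poincaré inequality on a ball for functions with vanishing weighted mean. -/
lemma poincare_ball (R : ℝ) (hR : 1 ≤ R) : ∃ C : ℝ, 0 < C ∧ ∀ f : E3 → ℝ, Sm f →
    (∫ x, avk x * f x = 0) →
    ∫ x in closedBall (0 : E3) R, f x ^ 2 ≤ C * ∫ x in closedBall (0 : E3) R, gs f x := by
  obtain ⟨M, hM, hMb⟩ := avk_bdd
  set B := closedBall (0 : E3) R with hBdef
  have hB : MeasurableSet B := measurableSet_closedBall
  have hBv : volume B ≠ ∞ := measure_closedBall_lt_top.ne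
  set m := (volume B).toReal
  refine ⟨M * (2 * R) ^ 2 * 8 * m + 1, by positivity, fun f hf h0 => ?_⟩
  have hfc := hf.continuous
  have hintB : ∀ {h : E3 → ℝ}, Continuous h → Integrable h (volume.restrict B) :=
    fun hh => hh.continuousOn.integrableOn_compact (isCompact_closedBall _ _)
  have hac := avk_smooth.continuous
  have hinta : ∀ {h : E3 → ℝ}, Continuous h → Integrable (fun y => avk y * h y) :=
    fun hh => integrable_of_zero (R := 1) (by fun_prop) fun y hy => by simp [avk_zero' y hy]
  have h1 : ∀ x, f x ^ 2 ≤ M * ∫ y in B, (f x - f y) ^ 2 := by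
    intro x
    have e1 : f x = ∫ y, Real.sqrt (avk y) * (Real.sqrt (avk y) * (f x - f y)) := by
      have : ∀ y, Real.sqrt (avk y) * (Real.sqrt (avk y) * (f x - f y))
          = avk y * f x - avk y * f y := by
        intro y; rw [← mul_assoc, Real.mul_self_sqrt (avk_nonneg y)]; ring
      simp_rw [this]
      rw [integral_sub (hinta continuous_const) (hinta hfc), h0, integral_mul_const, avk_integral]
      ring
    have hs : Continuous fun y => Real.sqrt (avk y) := hac.sqrt
    have e2 := sq_integral_mul_le (μ := (volume : Measure E3)) (f := fun y => Real.sqrt (avk y))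
      (g := fun y => Real.sqrt (avk y) * (f x - f y)) (by fun_prop) (by fun_prop)
      (integrable_of_zero (R := 1) (by fun_prop) fun y hy => by simp [avk_zero' y hy])
      (integrable_of_zero (R := 1) (by fun_prop) fun y hy => by simp [avk_zero' y hy])
    rw [← e1] at e2
    simp_rw [mul_pow, Real.sq_sqrt (avk_nonneg _)] at e2
    rw [avk_integral, one_mul] at e2
    refine e2.trans ?_
    rw [← integral_const_mul, ← setIntegral_eq_integral_of_forall_compl_eq_zero (s := B)]
    · refine integral_mono (hintB (by fun_prop)) (hintB (by fun_prop)) fun y => ?_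
      exact mul_le_mul_of_nonneg_right (hMb y) (sq_nonneg _)
    · intro y hy
      have : 1 < ‖y‖ := lt_of_le_of_lt hR (by simpa [hBdef] using hy)
      simp [avk_zero' y this]
  have hgm : Measurable fun x => ENNReal.ofReal (gs f x) :=
    (gs_continuous hf).measurable.ennreal_ofReal
  have hgI : 0 ≤ ∫ x in B, gs f x := integral_nonneg (gs_nonneg f)
  have key : ENNReal.ofReal (∫ x in B, f x ^ 2)
      ≤ ENNReal.ofReal ((M * (2 * R) ^ 2 * 8 * m) * ∫ x in B, gs f x) := by
    rw [ofReal_integral_eq_lintegral_ofReal (hintB (by fun_prop))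
      (by filter_upwards with t; positivity)]
    calc ∫⁻ x in B, ENNReal.ofReal (f x ^ 2)
        ≤ ∫⁻ x in B, ENNReal.ofReal M * ∫⁻ y in B, ENNReal.ofReal ((2 * R) ^ 2) *
            ∫⁻ t in Icc (0 : ℝ) 1, ENNReal.ofReal (gs f (y + t • (x - y))) := by
          refine setLIntegral_mono' hB fun x hx => ?_
          refine (ENNReal.ofReal_le_ofReal (h1 x)).trans ?_
          rw [ENNReal.ofReal_mul hM.le, ofReal_integral_eq_lintegral_ofReal (hintB (by fun_prop))
            (by filter_upwards with t; positivity)]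
          refine mul_le_mul_right (setLIntegral_mono' hB fun y hy => ?_) _
          refine (sq_sub_le_lintegral hf x y).trans ?_
          gcongr
          have hx' : ‖x‖ ≤ R := by simpa [hBdef] using hx
          have hy' : ‖y‖ ≤ R := by simpa [hBdef] using hy
          linarith [norm_sub_le x y]
      _ = ENNReal.ofReal M * (ENNReal.ofReal ((2 * R) ^ 2) *
            ∫⁻ t in Icc (0 : ℝ) 1, ∫⁻ x in B, ∫⁻ y in B,
              ENNReal.ofReal (gs f (y + t • (x - y)))) := by
          rw [lintegral_const_mul' _ _ ENNReal.ofReal_ne_top]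
          simp_rw [lintegral_const_mul' _ _ (ENNReal.ofReal_ne_top (r := (2 * R) ^ 2))]
          congr 2
          have s1 : ∀ x, ∫⁻ y in B, ∫⁻ t in Icc (0 : ℝ) 1, ENNReal.ofReal (gs f (y + t • (x - y)))
              = ∫⁻ t in Icc (0 : ℝ) 1, ∫⁻ y in B, ENNReal.ofReal (gs f (y + t • (x - y))) := by
            intro x
            refine lintegral_lintegral_swap (Measurable.aemeasurable ?_)
            have h3 : Measurable fun q : E3 × ℝ => ENNReal.ofReal (gs f (q.1 + q.2 • (x - q.1))) :=
              hgm.comp (by fun_prop)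
            exact h3
          simp_rw [s1]
          refine lintegral_lintegral_swap (Measurable.aemeasurable ?_)
          have : Measurable fun q : (E3 × ℝ) × E3 =>
              ENNReal.ofReal (gs f (q.2 + q.1.2 • (q.1.1 - q.2))) :=
            hgm.comp (by fun_prop)
          exact this.lintegral_prod_right'
      _ ≤ ENNReal.ofReal M * (ENNReal.ofReal ((2 * R) ^ 2) *
            ∫⁻ t in Icc (0 : ℝ) 1, 8 * volume B * ∫⁻ x in B, ENNReal.ofReal (gs f x)) := by
          refine mul_le_mul_right (mul_le_mul_right ?_ _) _
          exact setLIntegral_mono' measurableSet_Icc fun t ht => lintegral_segment_le hgm R ht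
      _ = _ := by
          rw [setLIntegral_const, Real.volume_Icc, ENNReal.ofReal_mul (by positivity),
            ofReal_integral_eq_lintegral_ofReal (hintB (gs_continuous hf))
              (by filter_upwards with t; exact gs_nonneg f t),
            ENNReal.ofReal_mul (by positivity), ENNReal.ofReal_mul (by positivity),
            ENNReal.ofReal_mul (by positivity), ENNReal.ofReal_toReal hBv]
          simp only [sub_zero, ENNReal.ofReal_one, mul_one, ENNReal.ofReal_ofNat]
          ring
  have := (ENNReal.ofReal_le_ofReal_iff (by positivity)).1 key
  refine this.trans ?_
  gcongr; linarith

/-! ### Cut-off functions and local inequalities -/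

/-- A smooth cut-off equal to `1` on the unit ball and supported in the ball of radius `2`. -/
def cut0 : ContDiffBump (0 : E3) := ⟨1, 2, by norm_num, by norm_num⟩

/-- The cut-off `cut0` rescaled to the ball of radius `r` around `y₀`. -/
def cutoff (y₀ : E3) (r : ℝ) (x : E3) : ℝ := cut0 (r⁻¹ • (x - y₀))

lemma dv_comp_affine {f : E3 → ℝ} (hf : Sm f) (y₀ w : E3) (r : ℝ) (x : E3) :
    dv w (fun x => f (r • (x - y₀))) x = r * dv w f (r • (x - y₀)) := by
  unfold dv
  have h1 : HasFDerivAt (fun x : E3 => r • (x - y₀)) (r • ContinuousLinearMap.id ℝ E3) x :=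
    ((hasFDerivAt_id x).sub_const y₀).const_smul r
  have h2 := ((hf.diff _).hasFDerivAt).comp x h1
  have h3 : fderiv ℝ (fun x => f (r • (x - y₀))) x = _ := h2.fderiv
  rw [h3]; simp

@[fun_prop]
lemma cutoff_smooth (y₀ : E3) (r : ℝ) : Sm (cutoff y₀ r) :=
  cut0.contDiff.comp (by fun_prop)

lemma cutoff_nonneg (y₀ : E3) (r : ℝ) (x : E3) : 0 ≤ cutoff y₀ r x := cut0.nonneg

lemma cutoff_le_one (y₀ : E3) (r : ℝ) (x : E3) : cutoff y₀ r x ≤ 1 := cut0.le_one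

lemma cutoff_eq_one {y₀ : E3} {r : ℝ} (hr : 0 < r) {x : E3} (hx : ‖x - y₀‖ ≤ r) :
    cutoff y₀ r x = 1 := by
  apply cut0.one_of_mem_closedBall
  simp only [cut0, mem_closedBall, dist_zero_right, norm_smul, norm_inv, Real.norm_eq_abs,
    abs_of_pos hr]
  rw [inv_mul_le_iff₀ hr]; linarith

lemma cutoff_eq_zero {y₀ : E3} {r : ℝ} (hr : 0 < r) {x : E3} (hx : 2 * r ≤ ‖x - y₀‖) :
    cutoff y₀ r x = 0 := by
  apply cut0.zero_of_le_dist
  simp only [cut0, dist_zero_right, norm_smul, norm_inv, Real.norm_eq_abs, abs_of_pos hr]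
  rw [le_inv_mul_iff₀ hr]; linarith

lemma cutoff_gs : ∃ M : ℝ, 0 < M ∧ ∀ (y₀ : E3) (r : ℝ), 0 < r → ∀ x,
    gs (cutoff y₀ r) x ≤ M * (r ^ 2)⁻¹ := by
  have hs : Sm (cut0 : E3 → ℝ) := cut0.contDiff
  have hz : ∀ x : E3, 2 < ‖x‖ → cut0 x = 0 := fun x hx => cut0.zero_of_le_dist (by
    simpa [cut0] using hx.le)
  obtain ⟨M, hM⟩ := (gs_continuous hs).bounded_above_of_compact_support
    (hasCompactSupport_of_zero (gs_zero_of_zero hz))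
  refine ⟨|M| + 1, by positivity, fun y₀ r hr x => ?_⟩
  have h1 : gs (cutoff y₀ r) x = (r ^ 2)⁻¹ * gs cut0 (r⁻¹ • (x - y₀)) := by
    unfold gs
    rw [Finset.mul_sum]
    refine Finset.sum_congr rfl fun j _ => ?_
    have : dv (eb j) (cutoff y₀ r) x = _ := dv_comp_affine hs y₀ (eb j) r⁻¹ x
    rw [this]; ring
  rw [h1, mul_comm]
  gcongr
  have := (le_abs_self _).trans (hM (r⁻¹ • (x - y₀)))
  linarith [le_abs_self M]

lemma gs_mul_le {f g : E3 → ℝ} (hf : Sm f) (hg : Sm g) (x : E3) :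
    gs (fun x => f x * g x) x ≤ 2 * (f x ^ 2 * gs g x) + 2 * (g x ^ 2 * gs f x) := by
  unfold gs
  simp only [dv_mul _ hf hg, Finset.mul_sum, ← Finset.sum_add_distrib]
  gcongr with j _
  nlinarith [sq_nonneg (f x * dv (eb j) g x - g x * dv (eb j) f x)]

lemma integrableOn_ball {f : E3 → ℝ} (hf : Continuous f) (y : E3) (r : ℝ) :
    IntegrableOn f (closedBall y r) :=
  hf.continuousOn.integrableOn_compact (isCompact_closedBall _ _)

lemma setIntegral_ball_mono {f : E3 → ℝ} (hf : Continuous f) (h0 : ∀ x, 0 ≤ f x) {y y' : E3}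
    {r r' : ℝ} (h : closedBall y r ⊆ closedBall y' r') :
    ∫ x in closedBall y r, f x ≤ ∫ x in closedBall y' r', f x :=
  setIntegral_mono_set (integrableOn_ball hf _ _) (by filter_upwards with x using h0 x)
    h.eventuallyLE

/-- Energy of a function cut off to a ball. -/
lemma cutoff_energy : ∃ C : ℝ, 0 < C ∧ ∀ (f : E3 → ℝ) (y₀ : E3) (r : ℝ), Sm f → 0 < r →
    (∃ R : ℝ, ∀ x, R < ‖x‖ → f x * cutoff y₀ r x = 0) ∧
    ((∫ x, (f x * cutoff y₀ r x) ^ 2) ≤ ∫ x in closedBall y₀ (2 * r), f x ^ 2) ∧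
    ((∫ x, gs (fun x => f x * cutoff y₀ r x) x) ≤ C * ((∫ x in closedBall y₀ (2 * r), gs f x) +
      (r ^ 2)⁻¹ * ∫ x in closedBall y₀ (2 * r), f x ^ 2)) := by
  obtain ⟨M, hM, H⟩ := cutoff_gs
  refine ⟨2 + 2 * M, by positivity, fun f y₀ r hf hr => ?_⟩
  have hc := cutoff_smooth y₀ r
  have hcc := hc.continuous
  have hfc := hf.continuous
  have hgc := gs_continuous hf
  have z0 : ∀ x, x ∉ closedBall y₀ (2 * r) → cutoff y₀ r x = 0 := by
    intro x hx
    apply cutoff_eq_zero hr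
    simp only [mem_closedBall, dist_eq_norm, not_le] at hx
    exact hx.le
  have z1 : ∀ x, 2 * r + ‖y₀‖ < ‖x‖ → f x * cutoff y₀ r x = 0 := by
    intro x hx
    rw [z0 x, mul_zero]
    simp only [mem_closedBall, dist_eq_norm, not_le]
    linarith [norm_sub_norm_le x y₀]
  have hintg : IntegrableOn (gs f) (closedBall y₀ (2 * r)) := integrableOn_ball hgc _ _
  have hint2 : IntegrableOn (fun x => f x ^ 2) (closedBall y₀ (2 * r)) :=
    integrableOn_ball (by fun_prop) _ _
  refine ⟨⟨_, z1⟩, ?_, ?_⟩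
  · rw [← setIntegral_eq_integral_of_forall_compl_eq_zero (s := closedBall y₀ (2 * r))
      (fun x hx => by rw [z0 x hx]; ring)]
    refine integral_mono (integrableOn_ball (by fun_prop) _ _) hint2 fun x => ?_
    have h1 := cutoff_nonneg y₀ r x
    have h2 := cutoff_le_one y₀ r x
    simp only [mul_pow]
    exact mul_le_of_le_one_right (sq_nonneg _) (pow_le_one₀ h1 h2)
  · have hsm : Sm (fun x => f x * cutoff y₀ r x) := hf.mul hc
    have z2 : ∀ x, x ∉ closedBall y₀ (2 * r) → gs (fun x => f x * cutoff y₀ r x) x = 0 := by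
      intro x hx
      have hev : ∀ᶠ y in nhds x, f y * cutoff y₀ r y = 0 := by
        filter_upwards [isClosed_closedBall.isOpen_compl.mem_nhds hx] with y hy
        rw [z0 y hy, mul_zero]
      simp [gs, dv_eq_zero_of_eventually hev]
    rw [← setIntegral_eq_integral_of_forall_compl_eq_zero (s := closedBall y₀ (2 * r)) z2]
    have hb : ∀ x, gs (fun x => f x * cutoff y₀ r x) x
        ≤ (2 * gs f x) + (2 * M * (r ^ 2)⁻¹) * f x ^ 2 := by
      intro x
      have h1 := cutoff_nonneg y₀ r x
      have h2 := cutoff_le_one y₀ r x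
      have h3 : cutoff y₀ r x ^ 2 * gs f x ≤ gs f x :=
        mul_le_of_le_one_left (gs_nonneg f x) (pow_le_one₀ h1 h2)
      have h4 : f x ^ 2 * gs (cutoff y₀ r) x ≤ f x ^ 2 * (M * (r ^ 2)⁻¹) := by
        gcongr; exact H y₀ r hr x
      refine (gs_mul_le hf hc x).trans ?_
      linarith
    calc _ ≤ ∫ x in closedBall y₀ (2 * r), ((2 * gs f x) + (2 * M * (r ^ 2)⁻¹) * f x ^ 2) :=
          integral_mono (integrableOn_ball (gs_continuous hsm) _ _)
            ((hintg.const_mul _).add (hint2.const_mul _)) hb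
      _ = 2 * (∫ x in closedBall y₀ (2 * r), gs f x) + (2 * M * (r ^ 2)⁻¹) *
            ∫ x in closedBall y₀ (2 * r), f x ^ 2 := by
          rw [integral_add (hintg.const_mul _) (hint2.const_mul _), integral_const_mul,
            integral_const_mul]
      _ ≤ _ := by
          have h5 : 0 ≤ ∫ x in closedBall y₀ (2 * r), gs f x := integral_nonneg (gs_nonneg f)
          have h6 : 0 ≤ ∫ x in closedBall y₀ (2 * r), f x ^ 2 :=
            integral_nonneg fun x => sq_nonneg _
          have h7 : 0 ≤ (r ^ 2)⁻¹ * ∫ x in closedBall y₀ (2 * r), f x ^ 2 := by positivity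
          nlinarith

lemma setIntegral_le_integral_cutoff {y₀ : E3} {r : ℝ} (hr : 0 < r) {F : ℝ → ℝ}
    (hF : Continuous F) (h0 : ∀ x, 0 ≤ F x) (hF0 : F 0 = 0) {f : E3 → ℝ} (hf : Sm f) :
    ∫ x in closedBall y₀ r, F (f x) ≤ ∫ x, F (f x * cutoff y₀ r x) := by
  have hc := (cutoff_smooth y₀ r).continuous
  have hfc := hf.continuous
  have e : ∫ x in closedBall y₀ r, F (f x) = ∫ x in closedBall y₀ r, F (f x * cutoff y₀ r x) := by
    refine setIntegral_congr_fun measurableSet_closedBall fun x hx => ?_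
    rw [cutoff_eq_one hr (by simpa [dist_eq_norm] using hx), mul_one]
  rw [e]
  refine setIntegral_le_integral ?_ (by filter_upwards with x using h0 _)
  refine integrable_of_zero (R := 2 * r + ‖y₀‖) (by fun_prop) fun x hx => ?_
  rw [cutoff_eq_zero hr (by linarith [norm_sub_norm_le x y₀]), mul_zero, hF0]

lemma integral_cube_ball_le : ∃ C : ℝ, 0 < C ∧ ∀ (f : E3 → ℝ) (y₀ : E3) (r : ℝ), Sm f → 0 < r →
    (∫ x in closedBall y₀ r, |f x| ^ 3) ^ 4 ≤ C * (∫ x in closedBall y₀ (2 * r), f x ^ 2) ^ 3 *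
      ((∫ x in closedBall y₀ (2 * r), gs f x) +
      (r ^ 2)⁻¹ * ∫ x in closedBall y₀ (2 * r), f x ^ 2) ^ 3 := by
  obtain ⟨C1, hC1, H1⟩ := cutoff_energy
  obtain ⟨C2, hC2, H2⟩ := integral_abs_cube_le
  refine ⟨C2 * C1 ^ 3, by positivity, fun f y₀ r hf hr => ?_⟩
  obtain ⟨⟨R, hR⟩, ha, hb⟩ := H1 f y₀ r hf hr
  have h := H2 R _ (hf.mul (cutoff_smooth y₀ r)) hR
  have h1 := setIntegral_le_integral_cutoff (y₀ := y₀) hr (F := fun t => |t| ^ 3) (by fun_prop)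
    (fun x => by positivity) (by simp) hf
  have i1 : 0 ≤ ∫ x, (f x * cutoff y₀ r x) ^ 2 := integral_nonneg fun x => sq_nonneg _
  have i2 : 0 ≤ ∫ x, gs (fun x => f x * cutoff y₀ r x) x := integral_nonneg fun x => gs_nonneg _ x
  have i3 : 0 ≤ ∫ x in closedBall y₀ r, |f x| ^ 3 := integral_nonneg fun x => by positivity
  calc _ ≤ (∫ x, |f x * cutoff y₀ r x| ^ 3) ^ 4 := by gcongr
    _ ≤ _ := h
    _ ≤ C2 * (∫ x in closedBall y₀ (2 * r), f x ^ 2) ^ 3 * (C1 * ((∫ x in closedBall y₀ (2 * r),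
        gs f x) + (r ^ 2)⁻¹ * ∫ x in closedBall y₀ (2 * r), f x ^ 2)) ^ 3 := by gcongr
    _ = _ := by ring

lemma local_estimates : ∃ C : ℝ, 0 < C ∧ ∀ f : E3 → ℝ, Sm f → (∫ x, avk x * f x = 0) →
    (∫ x in closedBall (0 : E3) 2, f x ^ 2 ≤ C * ∫ x in closedBall (0 : E3) 2, gs f x) ∧
    (∫ x in closedBall (0 : E3) 1, f x ^ 4 ≤ C * (∫ x in closedBall (0 : E3) 2, gs f x) ^ 2) := by
  obtain ⟨C1, hC1, H1⟩ := cutoff_energy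
  obtain ⟨C2, hC2, H2⟩ := ladyzhenskaya
  obtain ⟨C3, hC3, H3⟩ := poincare_ball 2 (by norm_num)
  set K := C2 * C3 * (C1 * (1 + C3)) ^ 3
  refine ⟨C3 + K + 1, by positivity, fun f hf h0 => ?_⟩
  have hp := H3 f hf h0
  set G := ∫ x in closedBall (0 : E3) 2, gs f x
  have hG : 0 ≤ G := integral_nonneg (gs_nonneg f)
  have hK : 0 < K := by positivity
  refine ⟨by nlinarith, ?_⟩
  obtain ⟨⟨R, hR⟩, ha, hb⟩ := H1 f 0 1 hf one_pos
  simp only [mul_one, one_pow, inv_one, one_mul] at ha hb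
  have h := H2 R _ (hf.mul (cutoff_smooth 0 1)) hR
  have h1 := setIntegral_le_integral_cutoff (y₀ := 0) one_pos (F := fun t => t ^ 4) (by fun_prop)
    (fun x => by positivity) (by simp) hf
  have i1 : 0 ≤ ∫ x, (f x * cutoff 0 1 x) ^ 2 := integral_nonneg fun x => sq_nonneg _
  have i2 : 0 ≤ ∫ x, gs (fun x => f x * cutoff 0 1 x) x := integral_nonneg fun x => gs_nonneg _ x
  have hb' : ∫ x, gs (fun x => f x * cutoff 0 1 x) x ≤ C1 * (1 + C3) * G := by
    refine hb.trans ?_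
    rw [mul_assoc]; gcongr; linarith
  have h2 : (∫ x, (f x * cutoff 0 1 x) ^ 4) ^ 2 ≤ ((K + 1) * G ^ 2) ^ 2 := by
    calc _ ≤ _ := h
      _ ≤ C2 * (C3 * G) * (C1 * (1 + C3) * G) ^ 3 := by gcongr; exact ha.trans hp
      _ = K * (G ^ 2) ^ 2 := by ring
      _ ≤ _ := by
        rw [mul_pow]; gcongr; nlinarith
  have h3 := abs_le_of_sq_le_sq' h2 (by positivity)
  refine h1.trans (h3.2.trans ?_)
  gcongr; linarith

/-! ### Newtonian potentials of divergences -/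

/-- A smooth function on the line that equals `τ ^ (-1/2)` for `τ ≥ 1/2`. -/
def invSqrtReg (τ : ℝ) : ℝ := Real.smoothTransition (4 * τ - 1) * (Real.sqrt τ)⁻¹

lemma invSqrtReg_smooth : Sm invSqrtReg := by
  rw [contDiff_iff_contDiffAt]
  intro τ
  rcases lt_or_ge τ (1 / 8) with h | h
  · have : invSqrtReg =ᶠ[nhds τ] fun _ => 0 := by
      filter_upwards [Iio_mem_nhds (show τ < 1 / 4 by linarith)] with t ht
      simp only [mem_Iio] at ht
      unfold invSqrtReg
      rw [Real.smoothTransition.zero_of_nonpos (by linarith), zero_mul]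
    exact contDiffAt_const.congr_of_eventuallyEq this
  · have h0 : τ ≠ 0 := by linarith
    have h1 : Real.sqrt τ ≠ 0 := (Real.sqrt_pos.2 (by linarith)).ne'
    unfold invSqrtReg
    refine ContDiffAt.mul ?_ ((Real.contDiffAt_sqrt h0).inv h1)
    exact (Real.smoothTransition.contDiff.comp (by fun_prop : Sm fun t : ℝ => 4 * t - 1)).contDiffAt

lemma invSqrtReg_eq {τ : ℝ} (h : 1 / 2 ≤ τ) : invSqrtReg τ = (Real.sqrt τ)⁻¹ := by
  unfold invSqrtReg
  rw [Real.smoothTransition.one_of_one_le (by linarith), one_mul]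

/-- Smooth regularisation of `1 / ‖z‖` at unit scale. -/
def newtReg (z : E3) : ℝ := invSqrtReg (‖z‖ ^ 2)

@[fun_prop]
lemma newtReg_smooth : Sm newtReg := invSqrtReg_smooth.comp (contDiff_norm_sq ℝ)

lemma newtReg_eq {z : E3} (h : 1 ≤ ‖z‖) : newtReg z = ‖z‖⁻¹ := by
  unfold newtReg
  rw [invSqrtReg_eq (by nlinarith), Real.sqrt_sq (norm_nonneg _)]

lemma newtReg_nonneg (z : E3) : 0 ≤ newtReg z :=
  mul_nonneg (Real.smoothTransition.nonneg _) (by positivity)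

lemma newtReg_le (z : E3) : newtReg z ≤ ‖z‖⁻¹ := by
  unfold newtReg invSqrtReg
  rw [Real.sqrt_sq (norm_nonneg _)]
  exact mul_le_of_le_one_left (by positivity) (Real.smoothTransition.le_one _)

lemma norm_eb (j : Fin 3) : ‖eb j‖ = 1 := by simp

lemma newtReg_dv_bdd : ∃ C : ℝ, 0 < C ∧ ∀ j z, |dv (eb j) newtReg z| ≤ C := by
  have h1 : ∀ j, ∃ C : ℝ, ∀ z ∈ closedBall (0 : E3) 2, ‖dv (eb j) newtReg z‖ ≤ C := fun j =>
    (isCompact_closedBall (0 : E3) 2).exists_bound_of_continuousOn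
      (dv_smooth (eb j) newtReg_smooth).continuous.continuousOn
  choose C hC using h1
  refine ⟨∑ j, |C j| + 1, by positivity, fun j z => ?_⟩
  have hs : |C j| ≤ ∑ j, |C j| :=
    Finset.single_le_sum (f := fun j => |C j|) (fun _ _ => abs_nonneg _) (Finset.mem_univ j)
  rcases le_or_gt ‖z‖ 2 with h | h
  · have := hC j z (by simpa using h)
    rw [Real.norm_eq_abs] at this
    linarith [le_abs_self (C j)]
  · have hz : z ≠ 0 := by rintro rfl; simp at h; linarith
    have hev : newtReg =ᶠ[nhds z] fun z => (Real.sqrt (‖z‖ ^ 2))⁻¹ := by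
      filter_upwards [(continuous_norm.continuousAt (x := z)).eventually_const_lt h] with y hy
      rw [newtReg_eq (by linarith), Real.sqrt_sq (norm_nonneg _)]
    have hn : (0 : ℝ) < ‖z‖ ^ 2 := by positivity
    have hd := (hasDerivAt_inv (Real.sqrt_pos.2 hn).ne').comp_hasFDerivAt z
      ((hasStrictFDerivAt_norm_sq z).hasFDerivAt.sqrt hn.ne')
    have e := (hd.congr_of_eventuallyEq hev).fderiv
    unfold dv
    rw [e]
    simp only [Real.sqrt_sq (norm_nonneg _), _root_.smul_apply, innerSL_apply_apply,
      smul_eq_mul, nsmul_eq_mul]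
    have hi : |inner ℝ z (eb j)| ≤ ‖z‖ := by
      have := abs_real_inner_le_norm z (eb j)
      rwa [norm_eb, mul_one] at this
    rw [abs_mul, abs_mul, abs_mul]
    have h3 : |-(‖z‖ ^ 2)⁻¹| ≤ 1 := by
      rw [abs_neg, abs_of_pos (by positivity)]
      exact inv_le_one_of_one_le₀ (by nlinarith)
    have h4 : |1 / (2 * ‖z‖)| * (|((2 : ℕ) : ℝ)| * |inner ℝ z (eb j)|) ≤ 1 := by
      rw [abs_of_pos (by positivity : (0 : ℝ) < 1 / (2 * ‖z‖)), div_mul_eq_mul_div,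
        div_le_one (by positivity)]
      norm_num
      linarith
    calc _ ≤ (1 : ℝ) * 1 := by gcongr
      _ ≤ _ := by linarith [Finset.sum_nonneg (fun j (_ : j ∈ Finset.univ) => abs_nonneg (C j))]

lemma newtReg_dv_lip : ∃ L : ℝ, 0 < L ∧ ∀ j, ∀ a ∈ closedBall (0 : E3) 3,
    ∀ b ∈ closedBall (0 : E3) 3, |dv (eb j) newtReg a - dv (eb j) newtReg b| ≤ L * ‖a - b‖ := by
  have h1 : ∀ j, ∃ C : ℝ, ∀ z ∈ closedBall (0 : E3) 3, ‖fderiv ℝ (dv (eb j) newtReg) z‖ ≤ C :=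
    fun j => (isCompact_closedBall (0 : E3) 3).exists_bound_of_continuousOn
      ((dv_smooth (eb j) newtReg_smooth).continuous_fderiv (by simp)).continuousOn
  choose C hC using h1
  refine ⟨∑ j, |C j| + 1, by positivity, fun j a ha b hb => ?_⟩
  have hs : |C j| ≤ ∑ j, |C j| :=
    Finset.single_le_sum (f := fun j => |C j|) (fun _ _ => abs_nonneg _) (Finset.mem_univ j)
  have := (convex_closedBall (0 : E3) 3).norm_image_sub_le_of_norm_fderiv_le (𝕜 := ℝ)
    (fun x _ => (dv_smooth (eb j) newtReg_smooth).diff x) (hC j) hb ha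
  rw [Real.norm_eq_abs] at this
  refine this.trans ?_
  gcongr
  linarith [le_abs_self (C j)]

/-- The kernel `1 / ‖z‖` truncated at distance `R`. -/
def invTrunc (R : ℝ) (z : E3) : ℝ := (Iio R).indicator (fun t : ℝ => t⁻¹) ‖z‖

lemma invTrunc_nonneg (R : ℝ) (z : E3) : 0 ≤ invTrunc R z := by
  unfold invTrunc
  by_cases h : ‖z‖ < R
  · simp [h]
  · simp [h]

lemma invTrunc_meas (R : ℝ) : Measurable (invTrunc R) := by
  unfold invTrunc
  exact (measurable_inv.indicator measurableSet_Iio).comp measurable_norm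

/-- Total mass constant of `‖z‖⁻²` on balls. -/
def invSqMass : ℝ := 3 * (volume : Measure E3).real (ball 0 1)

lemma invSqMass_nonneg : 0 ≤ invSqMass := by unfold invSqMass; positivity

lemma invTrunc_sq (R : ℝ) (hR : 0 < R) :
    Integrable (fun z => invTrunc R z ^ 2) ∧ ∫ z, invTrunc R z ^ 2 = invSqMass * R := by
  have e : (fun z => invTrunc R z ^ 2)
      = fun z : E3 => (fun t : ℝ => ((Iio R).indicator (fun t : ℝ => t⁻¹) t) ^ 2) ‖z‖ := by
    funext z; simp [invTrunc]
  have e2 : ∀ y ∈ Ioi (0 : ℝ), y ^ 2 • ((Iio R).indicator (fun t : ℝ => t⁻¹) y) ^ 2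
      = (Iio R).indicator (fun _ => (1 : ℝ)) y := by
    intro y hy
    simp only [mem_Ioi] at hy
    by_cases h : y < R
    · simp [h, hy.ne']
    · simp [h]
  constructor
  · rw [e]
    refine (integrable_fun_norm_addHaar (volume : Measure E3)
      (f := fun t : ℝ => ((Iio R).indicator (fun t : ℝ => t⁻¹) t) ^ 2)).2 ?_
    simp only [finrank_euclideanSpace, Fintype.card_fin, Nat.add_one_sub_one]
    rw [integrableOn_congr_fun e2 measurableSet_Ioi]
    refine (integrable_indicator_iff measurableSet_Iio).2 ?_
    refine ⟨by fun_prop, ?_⟩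
    rw [hasFiniteIntegral_const_iff]
    right
    rw [isFiniteMeasure_restrict, Measure.restrict_apply measurableSet_Iio]
    have : Iio R ∩ Ioi 0 = Ioo 0 R := by ext; simp [and_comm]
    rw [this]; simp
  · rw [e]
    refine (integral_fun_norm_addHaar (volume : Measure E3)
      (fun t : ℝ => ((Iio R).indicator (fun t : ℝ => t⁻¹) t) ^ 2)).trans ?_
    simp only [finrank_euclideanSpace, Fintype.card_fin, Nat.add_one_sub_one]
    rw [setIntegral_congr_fun measurableSet_Ioi e2, integral_indicator measurableSet_Iio,
      Measure.restrict_restrict measurableSet_Iio]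
    have : Iio R ∩ Ioi 0 = Ioo 0 R := by ext; simp [and_comm]
    rw [this]
    simp [hR.le, invSqMass]
    ring

/-- Rescaled kernel. -/
def newtR (R : ℝ) (y x : E3) : ℝ := R⁻¹ * newtReg (R⁻¹ • (x - y))

@[fun_prop]
lemma newtR_smooth (R : ℝ) (y : E3) : Sm (newtR R y) :=
  contDiff_const.mul (newtReg_smooth.comp (by fun_prop))

lemma newtR_eq {R : ℝ} (hR : 0 < R) {y x : E3} (h : R ≤ ‖x - y‖) : newtR R y x = ‖x - y‖⁻¹ := by
  have e : ‖R⁻¹ • (x - y)‖ = R⁻¹ * ‖x - y‖ := by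
    rw [norm_smul, norm_inv, Real.norm_eq_abs, abs_of_pos hR]
  unfold newtR
  rw [newtReg_eq, e]
  · field_simp
  · rw [e, le_inv_mul_iff₀ hR]; linarith

lemma abs_inv_sub_newtR {R : ℝ} (hR : 0 < R) (y x : E3) :
    |‖x - y‖⁻¹ - newtR R y x| ≤ invTrunc R (x - y) := by
  by_cases h : R ≤ ‖x - y‖
  · rw [newtR_eq hR h, sub_self, abs_zero]; exact invTrunc_nonneg _ _
  · have e : ‖R⁻¹ • (x - y)‖ = R⁻¹ * ‖x - y‖ := by
      rw [norm_smul, norm_inv, Real.norm_eq_abs, abs_of_pos hR]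
    have h1 : invTrunc R (x - y) = ‖x - y‖⁻¹ := by
      simp [invTrunc, not_le.1 h]
    have h2 : 0 ≤ newtR R y x := mul_nonneg (by positivity) (newtReg_nonneg _)
    have h3 : newtR R y x ≤ ‖x - y‖⁻¹ := by
      unfold newtR
      calc _ ≤ R⁻¹ * ‖R⁻¹ • (x - y)‖⁻¹ := by gcongr; exact newtReg_le _
        _ = _ := by rw [e]; field_simp
    rw [h1, abs_of_nonneg (by linarith)]; linarith

lemma newtR_dv (R : ℝ) (y x : E3) (j : Fin 3) :
    dv (eb j) (newtR R y) x = R⁻¹ ^ 2 * dv (eb j) newtReg (R⁻¹ • (x - y)) := by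
  have : dv (eb j) (newtR R y) x = _ :=
    dv_const_mul (eb j) R⁻¹ (f := fun x => newtReg (R⁻¹ • (x - y)))
      (newtReg_smooth.comp (by fun_prop)) x
  rw [this, dv_comp_affine newtReg_smooth]; ring

lemma integral_div_mul_eq {q : Fin 3 → E3 → ℝ} (hq : ∀ i, Sm (q i)) {R : ℝ}
    (h0 : ∀ i x, R < ‖x‖ → q i x = 0) {m : E3 → ℝ} (hm : Sm m) :
    ∫ x, (∑ i, dv (eb i) (q i) x) * m x = - ∫ x, ∑ i, q i x * dv (eb i) m x := by
  have hi : ∀ i, Integrable (fun x => dv (eb i) (q i) x * m x) := fun i =>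
    integrable_of_zero (R := R) ((dv_smooth _ (hq i)).continuous.mul hm.continuous)
      fun x hx => by simp [dv_zero_of_zero (h0 i) _ x hx]
  have hi' : ∀ i, Integrable (fun x => q i x * dv (eb i) m x) := fun i =>
    integrable_of_zero (R := R) ((hq i).continuous.mul (dv_smooth _ hm).continuous)
      fun x hx => by simp [h0 i x hx]
  simp only [Finset.sum_mul]
  rw [integral_finsetSum _ fun i _ => hi i, integral_finsetSum _ fun i _ => hi' i,
    ← Finset.sum_neg_distrib]
  refine Finset.sum_congr rfl fun i _ => ?_
  have := integral_dv_eq_zero (R := R) ((hq i).mul hm)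
    (fun x hx => by simp [h0 i x hx]) (eb i)
  simp only [dv_mul _ (hq i) hm] at this
  rw [integral_add (hi' i) ((hi i).congr (by filter_upwards with x; ring))] at this
  have e : ∫ x, m x * dv (eb i) (q i) x = ∫ x, dv (eb i) (q i) x * m x := by
    congr 1; funext x; ring
  linarith

/-- The Newtonian potential of `h` (without normalisation). -/
def newt (h : E3 → ℝ) (y : E3) : ℝ := ∫ x, h x * ‖x - y‖⁻¹

lemma integrable_mul_invTrunc {h : E3 → ℝ} (hc : Continuous h) {r : ℝ}
    (h0 : ∀ x, r < ‖x‖ → h x = 0) {R : ℝ} (hR : 0 < R) (y : E3) :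
    Integrable (fun x => |h x| * invTrunc R (x - y)) ∧
    ∫ x, |h x| * invTrunc R (x - y) ≤
      Real.sqrt (∫ x in closedBall y R, h x ^ 2) * Real.sqrt (invSqMass * R) := by
  obtain ⟨i1, e1⟩ := invTrunc_sq R hR
  have i2 : Integrable (fun x => invTrunc R (x - y) ^ 2) := i1.comp_sub_right y
  have e2 : ∫ x, invTrunc R (x - y) ^ 2 = invSqMass * R := by
    rw [← e1, integral_sub_right_eq_self (fun z => invTrunc R z ^ 2)]
  have m2 : AEStronglyMeasurable (fun x => invTrunc R (x - y)) volume :=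
    ((invTrunc_meas R).comp (measurable_id.sub_const y)).aestronglyMeasurable
  set f : E3 → ℝ := (closedBall y R).indicator fun x => |h x|
  have hB : MeasurableSet (closedBall y R) := measurableSet_closedBall
  have fm : AEStronglyMeasurable f volume :=
    (hc.abs.measurable.indicator hB).aestronglyMeasurable
  have fe : (fun x => f x ^ 2) = (closedBall y R).indicator fun x => h x ^ 2 := by
    funext x; by_cases hx : x ∈ closedBall y R <;> simp [f, hx]
  have i3 : Integrable (fun x => f x ^ 2) := by
    rw [fe, integrable_indicator_iff hB]
    exact integrableOn_ball (by fun_prop) _ _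
  have e3 : ∀ x, |h x| * invTrunc R (x - y) = f x * invTrunc R (x - y) := by
    intro x
    by_cases hx : x ∈ closedBall y R
    · simp [f, hx]
    · have : invTrunc R (x - y) = 0 := by
        have h2 : ¬ ‖x - y‖ < R := by
          rw [mem_closedBall, dist_eq_norm] at hx; linarith
        simp [invTrunc, h2]
      rw [this, mul_zero, mul_zero]
  simp only [e3]
  refine ⟨integrable_mul_of_sq fm m2 i3 i2, ?_⟩
  refine (le_abs_self _).trans ((integral_mul_le_sqrt fm m2 i3 i2).trans ?_)
  rw [e2, fe, integral_indicator hB]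

lemma newt_split {h : E3 → ℝ} (hc : Continuous h) {r : ℝ}
    (h0 : ∀ x, r < ‖x‖ → h x = 0) {R : ℝ} (hR : 0 < R) (y : E3) :
    Integrable (fun x => h x * ‖x - y‖⁻¹) ∧
    |newt h y - ∫ x, h x * newtR R y x| ≤
      Real.sqrt (∫ x in closedBall y R, h x ^ 2) * Real.sqrt (invSqMass * R) := by
  obtain ⟨i1, e1⟩ := integrable_mul_invTrunc hc h0 hR y
  have i2 : Integrable (fun x => h x * newtR R y x) :=
    integrable_of_zero (R := r) (hc.mul (newtR_smooth R y).continuous)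
      fun x hx => by simp [h0 x hx]
  have i3 : Integrable (fun x => h x * (‖x - y‖⁻¹ - newtR R y x)) := by
    refine i1.mono' ?_ ?_
    · have : Measurable fun x => h x * (‖x - y‖⁻¹ - newtR R y x) :=
        hc.measurable.mul ((measurable_id.sub_const y).norm.inv.sub
          (newtR_smooth R y).continuous.measurable)
      exact this.aestronglyMeasurable
    · filter_upwards with x
      rw [norm_mul, Real.norm_eq_abs, Real.norm_eq_abs]
      gcongr; exact abs_inv_sub_newtR hR y x
  have i4 : Integrable (fun x => h x * ‖x - y‖⁻¹) :=
    (i2.add i3).congr (by filter_upwards with x; simp only [Pi.add_apply]; ring)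
  refine ⟨i4, ?_⟩
  unfold newt
  rw [← integral_sub i4 i2]
  refine (abs_integral_le_integral_abs).trans (le_trans ?_ e1)
  refine integral_mono_of_nonneg (by filter_upwards with x using abs_nonneg _) i1 ?_
  filter_upwards with x
  rw [← mul_sub, abs_mul]
  gcongr; exact abs_inv_sub_newtR hR y x

lemma abs_integral_sum_le {q m : Fin 3 → E3 → ℝ} (hq : ∀ i, Continuous (q i)) {R c A : ℝ}
    (h0 : ∀ i x, R < ‖x‖ → q i x = 0) (hm : ∀ i x, ‖x‖ ≤ R → |m i x| ≤ c) (hc : 0 ≤ c)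
    (hA : ∫ x, ∑ i, |q i x| ≤ A) : |∫ x, ∑ i, q i x * m i x| ≤ c * A := by
  have i1 : Integrable (fun x => ∑ i, |q i x|) :=
    integrable_of_zero (R := R) (by fun_prop) fun x hx => by simp [h0 _ x hx]
  calc _ ≤ ∫ x, c * ∑ i, |q i x| := by
        refine (abs_integral_le_integral_abs).trans ?_
        refine integral_mono_of_nonneg (by filter_upwards with x using abs_nonneg _)
          (i1.const_mul c) ?_
        filter_upwards with x
        rw [Finset.mul_sum]
        refine (Finset.abs_sum_le_sum_abs _ _).trans (Finset.sum_le_sum fun i _ => ?_)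
        rw [abs_mul, mul_comm]
        by_cases hx : ‖x‖ ≤ R
        · gcongr; exact hm i x hx
        · simp [h0 i x (not_le.1 hx)]
    _ ≤ _ := by rw [integral_const_mul]; gcongr

/-- Pointwise bounds on the Newtonian potential of a divergence. -/
lemma newt_bound : ∃ C : ℝ, 0 < C ∧ ∀ (q : Fin 3 → E3 → ℝ) (A : ℝ), (∀ i, Sm (q i)) →
    (∀ i x, 1 < ‖x‖ → q i x = 0) → (∫ x, ∑ i, |q i x| ≤ A) →
    (∀ (y : E3) (R : ℝ), 0 < R → |newt (fun x => ∑ i, dv (eb i) (q i) x) y| ≤ C * (R⁻¹ ^ 2 * A +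
      Real.sqrt (R * ∫ x in closedBall y R, (∑ i, dv (eb i) (q i) x) ^ 2))) ∧
    ((∀ i, ∫ x, q i x = 0) → ∀ y : E3, 2 ≤ ‖y‖ →
      |newt (fun x => ∑ i, dv (eb i) (q i) x) y| ≤ C * (A * ‖y‖⁻¹ ^ 3)) := by
  obtain ⟨C1, hC1, H1⟩ := newtReg_dv_bdd
  obtain ⟨L, hL, HL⟩ := newtReg_dv_lip
  refine ⟨C1 + 8 * L + Real.sqrt invSqMass, by positivity, fun q A hq h0 hA => ?_⟩
  set h : E3 → ℝ := fun x => ∑ i, dv (eb i) (q i) x with hh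
  have hc : Continuous h := continuous_finsetSum _ fun i _ => (dv_smooth _ (hq i)).continuous
  have hz : ∀ x, 1 < ‖x‖ → h x = 0 := fun x hx => by
    simp [hh, dv_zero_of_zero (h0 _) _ x hx]
  have A0 : 0 ≤ A := le_trans (integral_nonneg fun x => Finset.sum_nonneg fun i _ => abs_nonneg _) hA
  have hs0 := Real.sqrt_nonneg invSqMass
  constructor
  · intro y R hR
    obtain ⟨-, e⟩ := newt_split hc hz hR y
    have e2 : |∫ x, h x * newtR R y x| ≤ (R⁻¹ ^ 2 * C1) * A := by
      rw [integral_div_mul_eq hq h0 (newtR_smooth R y), abs_neg]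
      refine abs_integral_sum_le (fun i => (hq i).continuous) h0 (fun i x _ => ?_)
        (by positivity) hA
      rw [newtR_dv, abs_mul, abs_of_nonneg (by positivity)]
      gcongr; exact H1 _ _
    have e3 : Real.sqrt (∫ x in closedBall y R, h x ^ 2) * Real.sqrt (invSqMass * R)
        = Real.sqrt invSqMass * Real.sqrt (R * ∫ x in closedBall y R, h x ^ 2) := by
      rw [Real.sqrt_mul invSqMass_nonneg, Real.sqrt_mul hR.le]; ring
    rw [e3] at e
    set S := Real.sqrt (R * ∫ x in closedBall y R, h x ^ 2)
    have hS : 0 ≤ S := Real.sqrt_nonneg _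
    have e4 := abs_sub_abs_le_abs_sub (newt h y) (∫ x, h x * newtR R y x)
    have p1 : 0 ≤ R⁻¹ ^ 2 * A := by positivity
    have p2 : 0 ≤ (8 * L + Real.sqrt invSqMass) * (R⁻¹ ^ 2 * A) := by positivity
    have p3 : 0 ≤ (C1 + 8 * L) * S := by positivity
    nlinarith
  · intro hq0 y hy
    set R := ‖y‖ / 2
    have hR : 0 < R := by simp only [R]; linarith
    have hyR : ‖y‖ = 2 * R := by simp only [R]; ring
    have e : newt h y = ∫ x, h x * newtR R y x := by
      unfold newt
      congr 1; funext x
      by_cases hx : ‖x‖ ≤ 1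
      · rw [newtR_eq hR]
        have := norm_sub_norm_le y x
        rw [norm_sub_rev] at this
        linarith
      · simp [hz x (not_le.1 hx)]
    have e2 : ∫ x, ∑ i, q i x * dv (eb i) (newtR R y) x
        = ∫ x, ∑ i, q i x * (dv (eb i) (newtR R y) x - dv (eb i) (newtR R y) 0) := by
      have hi : ∀ i, Integrable (fun x => q i x * dv (eb i) (newtR R y) x) := fun i =>
        integrable_of_zero (R := 1) ((hq i).continuous.mul
          (dv_smooth _ (newtR_smooth R y)).continuous) fun x hx => by simp [h0 i x hx]
      have hi2 : ∀ i, Integrable (fun x => q i x * dv (eb i) (newtR R y) 0) := fun i =>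
        integrable_of_zero (R := 1) ((hq i).continuous.mul continuous_const)
          fun x hx => by simp [h0 i x hx]
      simp only [mul_sub, Finset.sum_sub_distrib]
      rw [integral_sub (integrable_finsetSum _ fun i _ => hi i)
        (integrable_finsetSum _ fun i _ => hi2 i),
        integral_finsetSum _ fun i _ => hi2 i]
      simp [integral_mul_const, hq0]
    rw [e, integral_div_mul_eq hq h0 (newtR_smooth R y), abs_neg, e2]
    have e3 : |∫ x, ∑ i, q i x * (dv (eb i) (newtR R y) x - dv (eb i) (newtR R y) 0)|
        ≤ (R⁻¹ ^ 3 * L) * A := by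
      refine abs_integral_sum_le (fun i => (hq i).continuous) h0 (fun i x hx => ?_)
        (by positivity) hA
      rw [newtR_dv, newtR_dv, ← mul_sub, abs_mul, abs_of_nonneg (by positivity)]
      have k1 : ∀ z : E3, ‖z‖ ≤ 1 → R⁻¹ • (z - y) ∈ closedBall (0 : E3) 3 := by
        intro z hz1
        rw [mem_closedBall, dist_zero_right, norm_smul, norm_inv, Real.norm_eq_abs,
          abs_of_pos hR, inv_mul_le_iff₀ hR]
        have := norm_sub_le z y
        linarith
      have k2 := HL i _ (k1 x hx) _ (k1 0 (by simp))
      have k3 : ‖R⁻¹ • (x - y) - R⁻¹ • (0 - y)‖ ≤ R⁻¹ := by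
        rw [← smul_sub, norm_smul, norm_inv, Real.norm_eq_abs, abs_of_pos hR]
        simp only [zero_sub, sub_neg_eq_add, sub_add_cancel]
        exact mul_le_of_le_one_right (by positivity) hx
      calc _ ≤ R⁻¹ ^ 2 * (L * R⁻¹) := by
            gcongr
            exact k2.trans (by gcongr)
        _ = _ := by ring
    refine e3.trans ?_
    have e4 : R⁻¹ = 2 * ‖y‖⁻¹ := by rw [hyR]; field_simp
    rw [e4]
    have p : 0 ≤ A * ‖y‖⁻¹ ^ 3 := by positivity
    have p2 : 0 ≤ (C1 + Real.sqrt invSqMass) * (A * ‖y‖⁻¹ ^ 3) := by positivity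
    nlinarith

/-! ### Backward heat kernels -/

/-- A smooth positive function equal to `1 + x` for `x ≥ -1/2`. -/
def posReg (x : ℝ) : ℝ := 1 + x * Real.smoothTransition (2 + 2 * x)

lemma posReg_smooth : Sm posReg := by
  unfold posReg
  exact contDiff_const.add (contDiff_id.mul (Real.smoothTransition.contDiff.comp (by fun_prop)))

lemma posReg_eq {x : ℝ} (h : -1 / 2 ≤ x) : posReg x = 1 + x := by
  unfold posReg
  rw [Real.smoothTransition.one_of_one_le (by linarith), mul_one]

lemma posReg_pos (x : ℝ) : 0 < posReg x := by
  unfold posReg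
  rcases le_or_gt x (-1) with h | h
  · rw [Real.smoothTransition.zero_of_nonpos (by linarith)]; linarith
  · have h1 := Real.smoothTransition.nonneg (2 + 2 * x)
    have h2 := Real.smoothTransition.le_one (2 + 2 * x)
    rcases le_or_gt x 0 with h0 | h0
    · nlinarith
    · nlinarith

/-- Backward clock: equal to `r² + s₀ - s` for `s ≤ s₀`, smooth and positive everywhere. -/
def clk (r s₀ s : ℝ) : ℝ := r ^ 2 * posReg ((s₀ - s) / r ^ 2)

@[fun_prop]
lemma clk_smooth (r s₀ : ℝ) : Sm (clk r s₀) := by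
  unfold clk
  exact contDiff_const.mul (posReg_smooth.comp (by fun_prop))

lemma clk_pos {r : ℝ} (hr : 0 < r) (s₀ s : ℝ) : 0 < clk r s₀ s :=
  mul_pos (by positivity) (posReg_pos _)

lemma clk_eq {r : ℝ} (hr : 0 < r) {s₀ s : ℝ} (h : s ≤ s₀ + r ^ 2 / 2) :
    clk r s₀ s = r ^ 2 + s₀ - s := by
  unfold clk
  rw [posReg_eq]
  · field_simp; ring
  · rw [le_div_iff₀ (by positivity)]; linarith

lemma clk_hasDerivAt {r : ℝ} (hr : 0 < r) {s₀ s : ℝ} (h : s ≤ s₀) :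
    HasDerivAt (clk r s₀) (-1) s := by
  have h1 : HasDerivAt (fun s => r ^ 2 + s₀ - s) (-1) s := by
    simpa using (hasDerivAt_id s).const_sub (r ^ 2 + s₀)
  refine h1.congr_of_eventuallyEq ?_
  have : s < s₀ + r ^ 2 / 2 := by nlinarith [sq_nonneg r, pow_pos hr 2]
  filter_upwards [Iio_mem_nhds this] with t ht
  exact clk_eq hr ht.le

/-- Exponent of the heat kernel. -/
def hkExp (r s₀ : ℝ) (y₀ : E3) (z : Z) : ℝ :=
  -(3 / 2) * Real.log (clk r s₀ z.1) - ‖z.2 - y₀‖ ^ 2 * (4 * clk r s₀ z.1)⁻¹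

/-- Backward heat kernel centred at `(s₀ + r², y₀)` (up to normalisation). -/
def hk (r s₀ : ℝ) (y₀ : E3) (z : Z) : ℝ := Real.exp (hkExp r s₀ y₀ z)

lemma hkExp_smooth {r : ℝ} (hr : 0 < r) (s₀ : ℝ) (y₀ : E3) : Sm (hkExp r s₀ y₀) := by
  have h1 : Sm fun z : Z => clk r s₀ z.1 := (clk_smooth r s₀).comp contDiff_fst
  have h2 : Sm fun z : Z => ‖z.2 - y₀‖ ^ 2 :=
    (contDiff_norm_sq ℝ).comp (contDiff_snd.sub contDiff_const)
  unfold hkExp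
  refine (contDiff_const.mul (h1.log fun z => (clk_pos hr _ _).ne')).sub (h2.mul ?_)
  exact (contDiff_const.mul h1).inv fun z => by have := clk_pos hr s₀ z.1; positivity

lemma hk_smooth {r : ℝ} (hr : 0 < r) (s₀ : ℝ) (y₀ : E3) : Sm (hk r s₀ y₀) :=
  (hkExp_smooth hr s₀ y₀).exp

lemma hk_pos (r s₀ : ℝ) (y₀ : E3) (z : Z) : 0 < hk r s₀ y₀ z := Real.exp_pos _

lemma dv_exp {f : Z → ℝ} (hf : Sm f) (w : Z) (z : Z) :
    dv w (fun z => Real.exp (f z)) z = Real.exp (f z) * dv w f z := by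
  unfold dv
  rw [fderiv_exp (hf.diff z)]; simp

lemma hkExp_dx {r : ℝ} (hr : 0 < r) (s₀ : ℝ) (y₀ : E3) (j : Fin 3) :
    dx j (hkExp r s₀ y₀) = fun z => -((z.2 - y₀) j * (2 * clk r s₀ z.1)⁻¹) := by
  funext ⟨s, x⟩
  rw [← dx_slice (hkExp_smooth hr s₀ y₀)]
  unfold hkExp dv
  have h1 : HasFDerivAt (fun y : E3 => ‖y - y₀‖ ^ 2) (2 • (innerSL ℝ (x - y₀))) x := by
    simpa using ((hasFDerivAt_id x).sub_const y₀).norm_sq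
  have h2 := (h1.mul_const ((4 * clk r s₀ s)⁻¹)).const_sub (-(3 / 2) * Real.log (clk r s₀ s))
  rw [h2.fderiv]
  have := clk_pos hr s₀ s
  simp [EuclideanSpace.inner_single_right]
  field_simp
  norm_num

lemma hkExp_dt {r : ℝ} (hr : 0 < r) {s₀ : ℝ} (y₀ : E3) {s : ℝ} (hs : s ≤ s₀) (x : E3) :
    dt (hkExp r s₀ y₀) (s, x) =
      3 / 2 * (clk r s₀ s)⁻¹ - ‖x - y₀‖ ^ 2 * (4 * (clk r s₀ s) ^ 2)⁻¹ := by
  have hp := clk_pos hr s₀ s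
  have h1 := clk_hasDerivAt hr hs
  have h2 := ((h1.log hp.ne').const_mul (-(3 / 2))).sub
    (((h1.const_mul 4).fun_inv (by positivity)).const_mul (‖x - y₀‖ ^ 2))
  have h3 := hasDerivAt_slice (hkExp_smooth hr s₀ y₀) s x
  have := h3.unique h2
  rw [this]
  field_simp

lemma hk_dx {r : ℝ} (hr : 0 < r) (s₀ : ℝ) (y₀ : E3) (j : Fin 3) :
    dx j (hk r s₀ y₀) = fun z => hk r s₀ y₀ z * -((z.2 - y₀) j * (2 * clk r s₀ z.1)⁻¹) := by
  funext z
  have : dx j (hk r s₀ y₀) z = _ := dv_exp (hkExp_smooth hr s₀ y₀) (0, eb j) z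
  rw [this, show dv ((0, eb j) : Z) (hkExp r s₀ y₀) z = _ from congrFun (hkExp_dx hr s₀ y₀ j) z]
  rfl

lemma hk_dxdx {r : ℝ} (hr : 0 < r) (s₀ : ℝ) (y₀ : E3) (i j : Fin 3) (z : Z) :
    dx i (dx j (hk r s₀ y₀)) z = hk r s₀ y₀ z * ((z.2 - y₀) i * (z.2 - y₀) j *
      (4 * clk r s₀ z.1 ^ 2)⁻¹ - (if i = j then 1 else 0) * (2 * clk r s₀ z.1)⁻¹) := by
  have hsm := hkExp_smooth hr s₀ y₀
  have e : dx j (hk r s₀ y₀) = fun z => hk r s₀ y₀ z * dx j (hkExp r s₀ y₀) z := by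
    rw [hk_dx hr, hkExp_dx hr]
  rw [e]
  have e2 : dx i (fun z => hk r s₀ y₀ z * dx j (hkExp r s₀ y₀) z) z = _ :=
    dv_mul (0, eb i) (hk_smooth hr s₀ y₀) (dv_smooth (0, eb j) hsm) z
  rw [e2]
  have e3 : dv ((0, eb i) : Z) (dx j (hkExp r s₀ y₀)) z
      = -((if i = j then 1 else 0) * (2 * clk r s₀ z.1)⁻¹) := by
    obtain ⟨s, x⟩ := z
    have := dx_slice (dv_smooth (0, eb j) hsm) i s x
    rw [show dv ((0, eb i) : Z) (dx j (hkExp r s₀ y₀)) (s, x) = _ from this.symm]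
    rw [show (fun y => dx j (hkExp r s₀ y₀) (s, y)) =
      fun y => -((y - y₀) j * (2 * clk r s₀ s)⁻¹) by rw [hkExp_dx hr]]
    have h1 : HasFDerivAt (fun y : E3 => (y - y₀) j) (EuclideanSpace.proj j : E3 →L[ℝ] ℝ) x := by
      have := (EuclideanSpace.proj j : E3 →L[ℝ] ℝ).hasFDerivAt.comp x
        ((hasFDerivAt_id x).sub_const y₀)
      simpa [Function.comp_def] using this
    unfold dv
    rw [(h1.mul_const _).fun_neg.fderiv]
    by_cases h : i = j
    · subst h; simp
    · simp [h, Ne.symm h]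
  have e4 : dv ((0, eb i) : Z) (hk r s₀ y₀) z = _ := congrFun (hk_dx hr s₀ y₀ i) z
  rw [e3, e4, show dv ((0, eb j) : Z) (hkExp r s₀ y₀) z = _ from congrFun (hkExp_dx hr s₀ y₀ j) z]
  have := clk_pos hr s₀ z.1
  field_simp
  ring

lemma norm_sq_eq_sum (x : E3) : ‖x‖ ^ 2 = ∑ j, x j * x j := by
  rw [EuclideanSpace.norm_sq_eq]
  refine Finset.sum_congr rfl fun j _ => ?_
  rw [Real.norm_eq_abs, sq_abs, sq]

/-- The backward heat equation. -/
lemma hk_heat {r : ℝ} (hr : 0 < r) {s₀ : ℝ} (y₀ : E3) {s : ℝ} (hs : s ≤ s₀) (x : E3) :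
    dt (hk r s₀ y₀) (s, x) + lap (hk r s₀ y₀) (s, x) = 0 := by
  have e1 : dt (hk r s₀ y₀) (s, x) = _ := dv_exp (hkExp_smooth hr s₀ y₀) (1, 0) (s, x)
  unfold lap
  simp only [hk_dxdx hr]
  rw [e1, show dv ((1, 0) : Z) (hkExp r s₀ y₀) (s, x) = _ from hkExp_dt hr y₀ hs x,
    norm_sq_eq_sum, Fin.sum_univ_three, Fin.sum_univ_three]
  have := clk_pos hr s₀ s
  simp only [hk, if_true]
  field_simp
  ring

/-- The parabolic distance appearing in kernel bounds. -/
def pdist (r s₀ : ℝ) (y₀ : E3) (z : Z) : ℝ := ‖z.2 - y₀‖ + Real.sqrt (clk r s₀ z.1)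

lemma pdist_pos {r : ℝ} (hr : 0 < r) (s₀ : ℝ) (y₀ : E3) (z : Z) : 0 < pdist r s₀ y₀ z :=
  add_pos_of_nonneg_of_pos (norm_nonneg _) (Real.sqrt_pos.2 (clk_pos hr _ _))

lemma pow_mul_exp_le (m : ℕ) : ∃ C : ℝ, 0 < C ∧ ∀ t : ℝ, 0 ≤ t →
    (1 + t) ^ m * Real.exp (-t ^ 2 / 4) ≤ C := by
  refine ⟨(m.factorial : ℝ) * Real.exp 2, by positivity, fun t ht => ?_⟩
  have h1 := Real.pow_div_factorial_le_exp (1 + t) (by linarith) m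
  rw [div_le_iff₀ (by positivity)] at h1
  calc _ ≤ Real.exp (1 + t) * (m.factorial : ℝ) * Real.exp (-t ^ 2 / 4) := by gcongr
    _ = (m.factorial : ℝ) * Real.exp ((1 + t) + -t ^ 2 / 4) := by rw [Real.exp_add (1 + t)]; ring
    _ ≤ _ := by
      gcongr
      nlinarith [sq_nonneg (t - 2)]

lemma exp_kernel_le (m : ℕ) : ∃ C : ℝ, 0 < C ∧ ∀ θ ρ : ℝ, 0 < θ → 0 ≤ ρ →
    θ⁻¹ ^ m * Real.exp (-(ρ ^ 2 * (4 * θ ^ 2)⁻¹)) ≤ C * (ρ + θ)⁻¹ ^ m := by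
  obtain ⟨C, hC, H⟩ := pow_mul_exp_le m
  refine ⟨C, hC, fun θ ρ hθ hρ => ?_⟩
  have := H (ρ / θ) (by positivity)
  have e : -(ρ / θ) ^ 2 / 4 = -(ρ ^ 2 * (4 * θ ^ 2)⁻¹) := by field_simp
  rw [e] at this
  have e2 : (1 + ρ / θ) = (ρ + θ) * θ⁻¹ := by field_simp; ring
  rw [e2, mul_pow] at this
  rw [inv_pow (ρ + θ), ← div_eq_mul_inv C, le_div_iff₀ (by positivity)]
  linarith

lemma hk_formula {r : ℝ} (hr : 0 < r) (s₀ : ℝ) (y₀ : E3) (z : Z) :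
    hk r s₀ y₀ z = (Real.sqrt (clk r s₀ z.1))⁻¹ ^ 3 *
      Real.exp (-(‖z.2 - y₀‖ ^ 2 * (4 * Real.sqrt (clk r s₀ z.1) ^ 2)⁻¹)) := by
  have hp := clk_pos hr s₀ z.1
  have hq := Real.sqrt_pos.2 hp
  unfold hk hkExp
  rw [Real.sq_sqrt hp.le, sub_eq_add_neg, Real.exp_add]
  congr 1
  rw [← Real.exp_log (by positivity : 0 < (Real.sqrt (clk r s₀ z.1))⁻¹ ^ 3)]
  congr 1
  rw [Real.log_pow, Real.log_inv, Real.log_sqrt hp.le]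
  push_cast; ring

lemma abs_coord_le (x : E3) (j : Fin 3) : |x j| ≤ ‖x‖ := by
  have := PiLp.norm_apply_le x j
  rwa [Real.norm_eq_abs] at this

/-- Kernel bounds for the heat kernel and its derivatives. -/
lemma hk_bounds : ∃ C : ℝ, 0 < C ∧ ∀ r s₀ : ℝ, ∀ y₀ : E3, ∀ z : Z, 0 < r →
    hk r s₀ y₀ z ≤ C * (pdist r s₀ y₀ z)⁻¹ ^ 3 ∧
    (∀ j, |dx j (hk r s₀ y₀) z| ≤ C * (pdist r s₀ y₀ z)⁻¹ ^ 4) ∧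
    (∀ i j, |dx i (dx j (hk r s₀ y₀)) z| ≤ C * (pdist r s₀ y₀ z)⁻¹ ^ 5) := by
  obtain ⟨C3, hC3, H3⟩ := exp_kernel_le 3
  obtain ⟨C5, hC5, H5⟩ := exp_kernel_le 5
  obtain ⟨C7, hC7, H7⟩ := exp_kernel_le 7
  refine ⟨C3 + C5 + C7, by positivity, fun r s₀ y₀ z hr => ?_⟩
  have hp := clk_pos hr s₀ z.1
  have hq := Real.sqrt_pos.2 hp
  have hf := hk_formula hr s₀ y₀ z
  have hD := pdist_pos hr s₀ y₀ z
  have hDe : pdist r s₀ y₀ z = ‖z.2 - y₀‖ + Real.sqrt (clk r s₀ z.1) := rfl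
  have ec : clk r s₀ z.1 = Real.sqrt (clk r s₀ z.1) ^ 2 := (Real.sq_sqrt hp.le).symm
  set θ := Real.sqrt (clk r s₀ z.1)
  set D := pdist r s₀ y₀ z
  set ρ := ‖z.2 - y₀‖ with hρ
  have h0 : 0 ≤ ρ := norm_nonneg _
  have hρD : ρ ≤ D := by linarith
  have a3 := H3 θ ρ hq h0
  have a5 := H5 θ ρ hq h0
  have a7 := H7 θ ρ hq h0
  rw [← hDe] at a3 a5 a7
  set e := Real.exp (-(ρ ^ 2 * (4 * θ ^ 2)⁻¹))
  have he : 0 < e := Real.exp_pos _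
  have hx : ∀ j, |(z.2 - y₀) j| ≤ ρ := abs_coord_le _
  have hDi : D * D⁻¹ = 1 := mul_inv_cancel₀ hD.ne'
  have b5 : D * (D⁻¹ ^ 5) = D⁻¹ ^ 4 := by
    calc D * (D⁻¹ ^ 5) = (D * D⁻¹) * D⁻¹ ^ 4 := by ring
      _ = _ := by rw [hDi, one_mul]
  have b7 : D ^ 2 * (D⁻¹ ^ 7) = D⁻¹ ^ 5 := by
    calc D ^ 2 * (D⁻¹ ^ 7) = (D * D⁻¹) ^ 2 * D⁻¹ ^ 5 := by ring
      _ = _ := by rw [hDi, one_pow, one_mul]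
  have p3 : 0 < D⁻¹ ^ 3 := by positivity
  have p4 : 0 < D⁻¹ ^ 4 := by positivity
  have p5 : 0 < D⁻¹ ^ 5 := by positivity
  refine ⟨?_, fun j => ?_, fun i j => ?_⟩
  · rw [hf]; nlinarith
  · rw [hk_dx hr]
    simp only
    rw [hf, ec, abs_mul (θ⁻¹ ^ 3 * e), abs_neg, abs_mul ((z.2 - y₀) j), abs_of_pos (by positivity : 0 < θ⁻¹ ^ 3 * e),
      abs_of_pos (by positivity : 0 < (2 * θ ^ 2)⁻¹)]
    calc _ ≤ θ⁻¹ ^ 3 * e * (D * (θ ^ 2)⁻¹) := by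
          gcongr
          · exact (hx j).trans hρD
          · nlinarith [sq_nonneg θ]
      _ = D * (θ⁻¹ ^ 5 * e) := by field_simp
      _ ≤ D * (C5 * D⁻¹ ^ 5) := by gcongr
      _ = C5 * D⁻¹ ^ 4 := by rw [← b5]; ring
      _ ≤ _ := by nlinarith
  · rw [hk_dxdx hr, hf, ec, abs_mul (θ⁻¹ ^ 3 * e), abs_of_pos (by positivity : 0 < θ⁻¹ ^ 3 * e)]
    have t1 : |(z.2 - y₀) i * (z.2 - y₀) j * (4 * (θ ^ 2) ^ 2)⁻¹
        - (if i = j then 1 else 0) * (2 * θ ^ 2)⁻¹| ≤ D * D * (θ⁻¹ ^ 4) + θ⁻¹ ^ 2 := by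
      refine (abs_sub _ _).trans ?_
      rw [abs_mul, abs_mul, abs_mul, abs_of_pos (by positivity : 0 < (2 * θ ^ 2)⁻¹),
        abs_of_pos (by positivity : 0 < (4 * (θ ^ 2) ^ 2)⁻¹)]
      have q1 : (4 * (θ ^ 2) ^ 2)⁻¹ ≤ θ⁻¹ ^ 4 := by
        rw [mul_inv, inv_pow, ← pow_mul]
        have : (0 : ℝ) ≤ (θ ^ 4)⁻¹ := by positivity
        norm_num; linarith
      have q2 : |if i = j then (1 : ℝ) else 0| * (2 * θ ^ 2)⁻¹ ≤ θ⁻¹ ^ 2 := by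
        rw [mul_inv, inv_pow]
        have : (0 : ℝ) < (θ ^ 2)⁻¹ := by positivity
        split_ifs <;> norm_num <;> linarith
      refine add_le_add ?_ q2
      gcongr
      · exact (hx i).trans hρD
      · exact (hx j).trans hρD
    calc _ ≤ θ⁻¹ ^ 3 * e * (D * D * (θ⁻¹ ^ 4) + θ⁻¹ ^ 2) := by gcongr
      _ = D ^ 2 * (θ⁻¹ ^ 7 * e) + θ⁻¹ ^ 5 * e := by ring
      _ ≤ D ^ 2 * (C7 * D⁻¹ ^ 7) + C5 * D⁻¹ ^ 5 := by gcongr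
      _ = C7 * D⁻¹ ^ 5 + C5 * D⁻¹ ^ 5 := by rw [← b7]; ring
      _ ≤ _ := by nlinarith

/-! ### Localised test functions -/

/-- Spatial bump equal to one on the ball of radius `1/2`. -/
def bumpX : ContDiffBump (0 : E3) := ⟨1 / 2, 3 / 4, by norm_num, by norm_num⟩

/-- Space-time cut-off, equal to one on `[-1/2, 0] × B_{1/2}`. -/
def xi (z : Z) : ℝ := Real.smoothTransition (4 * z.1 + 3) * bumpX z.2

@[fun_prop]
lemma xi_smooth : Sm xi := by
  unfold xi
  exact (Real.smoothTransition.contDiff.comp (by fun_prop)).mul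
    (bumpX.contDiff.comp contDiff_snd)

lemma xi_nonneg (z : Z) : 0 ≤ xi z := mul_nonneg (Real.smoothTransition.nonneg _) bumpX.nonneg

lemma xi_le_one (z : Z) : xi z ≤ 1 :=
  mul_le_one₀ (Real.smoothTransition.le_one _) bumpX.nonneg bumpX.le_one

lemma xi_xsupp : XSupp 1 xi := by
  intro s x hx
  have : bumpX x = 0 := bumpX.zero_of_le_dist (by simp only [bumpX, dist_zero_right]; linarith)
  simp [xi, this]

lemma xi_zero_of_time {s : ℝ} (hs : s ≤ -3 / 4) (x : E3) : xi (s, x) = 0 := by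
  unfold xi; rw [Real.smoothTransition.zero_of_nonpos (by simp only; linarith), zero_mul]

lemma xi_eq_one {s : ℝ} {x : E3} (hs : -1 / 2 ≤ s) (hx : ‖x‖ ≤ 1 / 2) : xi (s, x) = 1 := by
  unfold xi
  rw [Real.smoothTransition.one_of_one_le (by simp only; linarith), one_mul]
  exact bumpX.one_of_mem_closedBall (by simpa [bumpX] using hx)

lemma XSupp.exists_bound {R : ℝ} {f : Z → ℝ} (h : XSupp R f) (hf : Continuous f) :
    ∃ C : ℝ, 0 < C ∧ ∀ s ∈ Icc (-1 : ℝ) 0, ∀ x, |f (s, x)| ≤ C := by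
  obtain ⟨M, hM⟩ := (isCompact_Icc.prod (isCompact_closedBall (0 : E3) R)).exists_bound_of_continuousOn
    (s := Icc (-1 : ℝ) 0 ×ˢ closedBall (0 : E3) R) hf.continuousOn
  refine ⟨max M 1, by positivity, fun s hs x => ?_⟩
  by_cases hx : R < ‖x‖
  · rw [h s x hx]; simp
  · exact (hM (s, x) ⟨hs, by simpa using hx⟩).trans (le_max_left _ _)

/-- The square of the cut-off. -/
def xi2 (z : Z) : ℝ := xi z ^ 2

@[fun_prop]
lemma xi2_smooth : Sm xi2 := xi_smooth.pow 2

lemma xi2_xsupp : XSupp 1 xi2 := fun s x hx => by simp [xi2, xi_xsupp s x hx]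

/-- `f` is zero on the region where the cut-off is locally constant. -/
def FlatZ (f : Z → ℝ) : Prop := ∀ s x, -1 / 2 < s → ‖x‖ < 1 / 2 → f (s, x) = 0

lemma flat_nhds {s : ℝ} {x : E3} (hs : -1 / 2 < s) (hx : ‖x‖ < 1 / 2) :
    ∀ᶠ z : Z in nhds (s, x), -1 / 2 < z.1 ∧ ‖z.2‖ < 1 / 2 := by
  have h1 : ∀ᶠ z : Z in nhds (s, x), -1 / 2 < z.1 :=
    (continuous_fst.continuousAt (x := ((s, x) : Z))).eventually_const_lt hs
  have h2 : ∀ᶠ z : Z in nhds (s, x), ‖z.2‖ < 1 / 2 :=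
    (continuous_snd.norm.continuousAt (x := ((s, x) : Z))).eventually_lt_const hx
  exact h1.and h2

lemma FlatZ.dv {f : Z → ℝ} (h : FlatZ f) (w : Z) : FlatZ (dv w f) := by
  intro s x hs hx
  apply dv_eq_zero_of_eventually
  filter_upwards [flat_nhds hs hx] with z hz
  exact h z.1 z.2 hz.1 hz.2

lemma flat_dv_xi2 (w : Z) : FlatZ (dv w xi2) := by
  intro s x hs hx
  have h1 : dv w (fun z => xi2 z - 1) (s, x) = 0 := by
    apply dv_eq_zero_of_eventually
    filter_upwards [flat_nhds hs hx] with z hz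
    rw [xi2, show z = (z.1, z.2) from rfl, xi_eq_one hz.1.le hz.2.le]; norm_num
  rw [dv_sub w xi2_smooth contDiff_const, dv_const] at h1
  linarith

/-- The localised backward heat kernel. -/
def psi (r s₀ : ℝ) (y₀ : E3) (z : Z) : ℝ := hk r s₀ y₀ z * xi2 z

lemma psi_smooth {r : ℝ} (hr : 0 < r) (s₀ : ℝ) (y₀ : E3) : Sm (psi r s₀ y₀) :=
  (hk_smooth hr s₀ y₀).mul xi2_smooth

lemma psi_nonneg (r s₀ : ℝ) (y₀ : E3) (z : Z) : 0 ≤ psi r s₀ y₀ z :=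
  mul_nonneg (hk_pos _ _ _ _).le (sq_nonneg _)

lemma psi_xsupp (r s₀ : ℝ) (y₀ : E3) : XSupp 1 (psi r s₀ y₀) := xi2_xsupp.mul_left _

lemma psi_init (r s₀ : ℝ) (y₀ x : E3) : psi r s₀ y₀ (-1, x) = 0 := by
  unfold psi xi2; rw [xi_zero_of_time (by norm_num)]; simp

/-- The admissible centres and radii. -/
structure Adm (r s₀ : ℝ) (y₀ : E3) : Prop where
  r_pos : 0 < r
  r_le : r ≤ 1
  s_ge : -1 / 4 ≤ s₀
  s_le : s₀ ≤ 0
  y_le : ‖y₀‖ ≤ 1 / 4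

lemma Adm.pdist_ge {r s₀ : ℝ} {y₀ : E3} (h : Adm r s₀ y₀) {s : ℝ} {x : E3} (hs : s ≤ s₀)
    (h1 : ¬ (-1 / 2 < s ∧ ‖x‖ < 1 / 2)) : 1 / 4 ≤ pdist r s₀ y₀ (s, x) := by
  have hn := norm_nonneg (x - y₀)
  have hq := Real.sqrt_nonneg (clk r s₀ s)
  unfold pdist
  by_cases hx : ‖x‖ < 1 / 2
  · have hs' : s ≤ -1 / 2 := by by_contra hc; exact h1 ⟨by linarith, hx⟩
    have : (1 / 4 : ℝ) ≤ Real.sqrt (clk r s₀ s) := by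
      apply Real.le_sqrt_of_sq_le
      rw [clk_eq h.r_pos (by nlinarith [h.r_pos])]
      nlinarith [h.s_ge, h.r_pos]
    simp only; linarith
  · have := norm_sub_norm_le x y₀
    have := h.y_le
    simp only; linarith

lemma Adm.pdist_le {r s₀ : ℝ} {y₀ : E3} (h : Adm r s₀ y₀) {s : ℝ} {x : E3} (hs : s ≤ s₀)
    (hs1 : -1 ≤ s) (hx : ‖x‖ ≤ 1) : pdist r s₀ y₀ (s, x) ≤ 3 := by
  have h1 : Real.sqrt (clk r s₀ s) ≤ 3 / 2 := by
    apply Real.sqrt_le_iff.2 ⟨by norm_num, ?_⟩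
    rw [clk_eq h.r_pos (by nlinarith [h.r_pos])]
    nlinarith [h.s_le, h.r_pos, h.r_le]
  have := norm_sub_le x y₀
  have := h.y_le
  unfold pdist; simp only; linarith

/-- The commutator of the backward heat operator with the cut-off. -/
def hcom (r s₀ : ℝ) (y₀ : E3) (z : Z) : ℝ :=
  hk r s₀ y₀ z * (dt xi2 z + lap xi2 z) + 2 * ∑ j, dx j (hk r s₀ y₀) z * dx j xi2 z

lemma dt_add_lap_psi {r s₀ : ℝ} {y₀ : E3} (hr : 0 < r) {s : ℝ} (hs : s ≤ s₀) (x : E3) :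
    dt (psi r s₀ y₀) (s, x) + lap (psi r s₀ y₀) (s, x) = hcom r s₀ y₀ (s, x) := by
  have hk1 := hk_smooth hr s₀ y₀
  have e1 : dt (psi r s₀ y₀) (s, x) = _ := dv_mul (1, 0) hk1 xi2_smooth (s, x)
  have e2 : ∀ j, dx j (dx j (psi r s₀ y₀)) (s, x) =
      hk r s₀ y₀ (s, x) * dx j (dx j xi2) (s, x) + 2 * (dx j (hk r s₀ y₀) (s, x) * dx j xi2 (s, x))
      + xi2 (s, x) * dx j (dx j (hk r s₀ y₀)) (s, x) := by
    intro j
    have : dx j (psi r s₀ y₀) = fun z => hk r s₀ y₀ z * dx j xi2 z + xi2 z * dx j (hk r s₀ y₀) z :=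
      funext fun z => dv_mul _ hk1 xi2_smooth z
    rw [this]
    have d1 : Sm (dx j xi2) := dv_smooth _ xi2_smooth
    have d2 : Sm (dx j (hk r s₀ y₀)) := dv_smooth _ hk1
    have a1 : dx j (fun z => hk r s₀ y₀ z * dx j xi2 z + xi2 z * dx j (hk r s₀ y₀) z) (s, x) = _ :=
      dv_add _ (hk1.mul d1) (xi2_smooth.mul d2) (s, x)
    have a2 : dv ((0, eb j) : Z) (fun z => hk r s₀ y₀ z * dx j xi2 z) (s, x) = _ :=
      dv_mul _ hk1 d1 (s, x)
    have a3 : dv ((0, eb j) : Z) (fun z => xi2 z * dx j (hk r s₀ y₀) z) (s, x) = _ :=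
      dv_mul _ xi2_smooth d2 (s, x)
    rw [a1, a2, a3]
    unfold dx; ring
  have h3 := hk_heat hr y₀ hs x
  unfold lap at *
  simp only [e2]
  rw [e1, Finset.sum_add_distrib, Finset.sum_add_distrib, ← Finset.mul_sum, ← Finset.mul_sum,
    ← Finset.mul_sum]
  unfold hcom lap
  have h4 : xi2 (s, x) * (dt (hk r s₀ y₀) (s, x) + ∑ j, dx j (dx j (hk r s₀ y₀)) (s, x)) = 0 := by
    rw [h3, mul_zero]
  unfold dt at *
  linarith

lemma hcom_smooth {r : ℝ} (hr : 0 < r) (s₀ : ℝ) (y₀ : E3) : Sm (hcom r s₀ y₀) := by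
  have hk1 := hk_smooth hr s₀ y₀
  unfold hcom
  refine (hk1.mul ((dv_smooth _ xi2_smooth).add (lap_smooth xi2_smooth))).add
    (contDiff_const.mul (ContDiff.sum fun j _ => (dv_smooth _ hk1).mul (dv_smooth _ xi2_smooth)))

lemma lap_xi2_flat : FlatZ (lap xi2) := fun s x hs hx => by
  unfold lap
  exact Finset.sum_eq_zero fun j _ => (flat_dv_xi2 (0, eb j)).dv (0, eb j) s x hs hx

lemma lap_xi2_xsupp : XSupp 1 (lap xi2) := fun s x hx => by
  unfold lap
  exact Finset.sum_eq_zero fun j _ => (xi2_xsupp.dv (0, eb j)).dv (0, eb j) s x hx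

lemma hcom_dx {r : ℝ} (hr : 0 < r) (s₀ : ℝ) (y₀ : E3) (i : Fin 3) (z : Z) :
    dx i (hcom r s₀ y₀) z = hk r s₀ y₀ z * (dx i (dt xi2) z + dx i (lap xi2) z)
      + (dt xi2 z + lap xi2 z) * dx i (hk r s₀ y₀) z
      + 2 * ∑ j, (dx j (hk r s₀ y₀) z * dx i (dx j xi2) z
          + dx j xi2 z * dx i (dx j (hk r s₀ y₀)) z) := by
  have hk1 := hk_smooth hr s₀ y₀
  have s1 : Sm (dt xi2) := dv_smooth _ xi2_smooth
  have s2 : Sm (lap xi2) := lap_smooth xi2_smooth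
  have s3 : ∀ j, Sm fun z => dx j (hk r s₀ y₀) z * dx j xi2 z := fun j =>
    (dv_smooth _ hk1).mul (dv_smooth _ xi2_smooth)
  have e1 : dx i (hcom r s₀ y₀) z = _ := dv_add (0, eb i)
    (f := fun z => hk r s₀ y₀ z * (dt xi2 z + lap xi2 z))
    (g := fun z => 2 * ∑ j, dx j (hk r s₀ y₀) z * dx j xi2 z)
    (hk1.mul (s1.add s2)) (contDiff_const.mul (ContDiff.sum fun j _ => s3 j)) z
  rw [e1, dv_mul _ hk1 (s1.add s2), dv_add _ s1 s2, dv_const_mul _ _ (ContDiff.sum fun j _ => s3 j),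
    dv_sum _ _ _ s3]
  have e2 : ∀ j, dv ((0, eb i) : Z) (fun z => dx j (hk r s₀ y₀) z * dx j xi2 z) z = _ := fun j =>
    dv_mul _ (dv_smooth _ hk1) (dv_smooth _ xi2_smooth) z
  simp only [e2]

lemma Adm.inv_pdist_pow_le {r s₀ : ℝ} {y₀ : E3} (h : Adm r s₀ y₀) {s : ℝ} {x : E3} (hs : s ≤ s₀)
    (h1 : ¬ (-1 / 2 < s ∧ ‖x‖ < 1 / 2)) (m : ℕ) : (pdist r s₀ y₀ (s, x))⁻¹ ^ m ≤ 4 ^ m := by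
  have h2 := h.pdist_ge hs h1
  have : (pdist r s₀ y₀ (s, x))⁻¹ ≤ 4 := by
    rw [inv_le_comm₀ (by linarith) (by norm_num)]; linarith
  have h0 := inv_nonneg.2 (pdist_pos h.r_pos s₀ y₀ (s, x)).le
  gcongr

lemma hcom_bound : ∃ C : ℝ, 0 < C ∧ ∀ r s₀ : ℝ, ∀ y₀ : E3, Adm r s₀ y₀ →
    ∀ s, -1 ≤ s → s ≤ s₀ → ∀ x, |hcom r s₀ y₀ (s, x)| ≤ C ∧
      ∀ i, |dx i (hcom r s₀ y₀) (s, x)| ≤ C := by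
  obtain ⟨K, hK, HK⟩ := hk_bounds
  have s1 : Sm (dt xi2) := dv_smooth _ xi2_smooth
  have s2 : Sm (lap xi2) := lap_smooth xi2_smooth
  obtain ⟨A, hA, HA⟩ := (xi2_xsupp.dv (1, 0)).exists_bound s1.continuous
  obtain ⟨B, hB, HB⟩ := lap_xi2_xsupp.exists_bound s2.continuous
  have hx1 : ∀ j, ∃ C : ℝ, 0 < C ∧ ∀ s ∈ Icc (-1 : ℝ) 0, ∀ x, |dx j xi2 (s, x)| ≤ C := fun j =>
    (xi2_xsupp.dv (0, eb j)).exists_bound (dv_smooth _ xi2_smooth).continuous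
  have hx2 : ∀ i j, ∃ C : ℝ, 0 < C ∧ ∀ s ∈ Icc (-1 : ℝ) 0, ∀ x, |dx i (dx j xi2) (s, x)| ≤ C :=
    fun i j => ((xi2_xsupp.dv (0, eb j)).dv (0, eb i)).exists_bound
      (dv_smooth _ (dv_smooth _ xi2_smooth)).continuous
  have hx3 : ∀ i, ∃ C : ℝ, 0 < C ∧ ∀ s ∈ Icc (-1 : ℝ) 0, ∀ x, |dx i (dt xi2) (s, x)| ≤ C := fun i =>
    ((xi2_xsupp.dv (1, 0)).dv (0, eb i)).exists_bound (dv_smooth _ s1).continuous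
  have hx4 : ∀ i, ∃ C : ℝ, 0 < C ∧ ∀ s ∈ Icc (-1 : ℝ) 0, ∀ x, |dx i (lap xi2) (s, x)| ≤ C := fun i =>
    (lap_xi2_xsupp.dv (0, eb i)).exists_bound (dv_smooth _ s2).continuous
  choose a1 p1 H1 using hx1
  choose a2 p2 H2 using hx2
  choose a3 p3 H3 using hx3
  choose a4 p4 H4 using hx4
  set M := A + B + ∑ i, (a1 i + a3 i + a4 i + ∑ j, a2 i j) with hM
  have hi : ∀ i, a1 i + a3 i + a4 i + ∑ j, a2 i j ≤ ∑ i, (a1 i + a3 i + a4 i + ∑ j, a2 i j) :=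
    fun i => Finset.single_le_sum (f := fun i => a1 i + a3 i + a4 i + ∑ j, a2 i j)
      (fun i _ => by
        have := Finset.sum_nonneg fun j (_ : j ∈ Finset.univ) => (p2 i j).le
        linarith [p1 i, p3 i, p4 i]) (Finset.mem_univ i)
  have hj : ∀ i j, a2 i j ≤ ∑ j, a2 i j := fun i j =>
    Finset.single_le_sum (f := fun j => a2 i j) (fun j _ => (p2 i j).le) (Finset.mem_univ j)
  have hM0 : 0 < M := by
    have := hi 0
    have := hj 0 0
    linarith [p1 0, p3 0, p4 0, p2 0 0]
  set L := K * 4 ^ 5 with hL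
  have hL0 : 0 < L := by positivity
  refine ⟨20 * (L * M), by positivity, fun r s₀ y₀ h s hs1 hs x => ?_⟩
  have hLM : 0 < L * M := by positivity
  by_cases hz : -1 / 2 < s ∧ ‖x‖ < 1 / 2
  · have z1 : ∀ w, dv w xi2 (s, x) = 0 := fun w => flat_dv_xi2 w s x hz.1 hz.2
    have z2 : ∀ w w', dv w (dv w' xi2) (s, x) = 0 := fun w w' => (flat_dv_xi2 w').dv w s x hz.1 hz.2
    have z3 : lap xi2 (s, x) = 0 := lap_xi2_flat s x hz.1 hz.2
    have z4 : ∀ w, dv w (lap xi2) (s, x) = 0 := fun w => lap_xi2_flat.dv w s x hz.1 hz.2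
    constructor
    · unfold hcom dt; unfold dx; simp only [z1, z3]; simp; positivity
    · intro i
      rw [hcom_dx h.r_pos]
      unfold dt; unfold dx; simp only [z1, z2, z3, z4]; simp; positivity
  · have hsI : s ∈ Icc (-1 : ℝ) 0 := ⟨hs1, hs.trans h.s_le⟩
    obtain ⟨b3, b4, b5⟩ := HK r s₀ y₀ (s, x) h.r_pos
    have q := h.inv_pdist_pow_le hs hz
    have c3 : |hk r s₀ y₀ (s, x)| ≤ L := by
      rw [abs_of_pos (hk_pos _ _ _ _)]
      refine b3.trans ?_
      calc _ ≤ K * 4 ^ 3 := mul_le_mul_of_nonneg_left (q 3) hK.le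
        _ ≤ _ := by rw [hL]; gcongr <;> norm_num
    have c4 : ∀ j, |dx j (hk r s₀ y₀) (s, x)| ≤ L := fun j => by
      refine (b4 j).trans ?_
      calc _ ≤ K * 4 ^ 4 := mul_le_mul_of_nonneg_left (q 4) hK.le
        _ ≤ _ := by rw [hL]; gcongr <;> norm_num
    have c5 : ∀ i j, |dx i (dx j (hk r s₀ y₀)) (s, x)| ≤ L := fun i j => by
      refine (b5 i j).trans ?_
      calc _ ≤ K * 4 ^ 5 := mul_le_mul_of_nonneg_left (q 5) hK.le
        _ ≤ _ := by rw [hL]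
    have d0 : |dt xi2 (s, x) + lap xi2 (s, x)| ≤ M := by
      refine (abs_add_le _ _).trans ?_
      have := HA s hsI x
      have := HB s hsI x
      have := hi 0
      have := hj 0 0
      unfold dt
      linarith [p1 0, p3 0, p4 0, p2 0 0]
    have d1 : ∀ j, |dx j xi2 (s, x)| ≤ M := fun j => by
      have := H1 j s hsI x
      have := hi j
      have := hj j 0
      linarith [p1 j, p3 j, p4 j, p2 j 0]
    have d2 : ∀ i j, |dx i (dx j xi2) (s, x)| ≤ M := fun i j => by
      have := H2 i j s hsI x
      have := hi i
      have := hj i j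
      linarith [p1 i, p3 i, p4 i, p2 i j]
    have d3 : ∀ i, |dx i (dt xi2) (s, x) + dx i (lap xi2) (s, x)| ≤ M := fun i => by
      refine (abs_add_le _ _).trans ?_
      have := H3 i s hsI x
      have := H4 i s hsI x
      have := hi i
      have := hj i 0
      linarith [p1 i, p3 i, p4 i, p2 i 0]
    have mm : ∀ {a b : ℝ}, |a| ≤ L → |b| ≤ M → |a * b| ≤ L * M := fun ha hb => by
      rw [abs_mul]; exact mul_le_mul ha hb (abs_nonneg _) hL0.le
    constructor
    · unfold hcom
      refine (abs_add_le _ _).trans ?_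
      have t1 := mm c3 d0
      have t2 : |∑ j, dx j (hk r s₀ y₀) (s, x) * dx j xi2 (s, x)| ≤ 3 * (L * M) := by
        refine (Finset.abs_sum_le_sum_abs _ _).trans ?_
        refine (Finset.sum_le_sum fun j _ => mm (c4 j) (d1 j)).trans ?_
        simp
      rw [abs_mul 2, abs_two]
      linarith
    · intro i
      rw [hcom_dx h.r_pos]
      refine (abs_add_le _ _).trans ?_
      refine (add_le_add (abs_add_le _ _) le_rfl).trans ?_
      have t1 := mm c3 (d3 i)
      have t2 := mm (c4 i) d0
      rw [mul_comm] at t2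
      have t3 : |∑ j, (dx j (hk r s₀ y₀) (s, x) * dx i (dx j xi2) (s, x)
          + dx j xi2 (s, x) * dx i (dx j (hk r s₀ y₀)) (s, x))| ≤ 3 * (2 * (L * M)) := by
        refine (Finset.abs_sum_le_sum_abs _ _).trans ?_
        refine (Finset.sum_le_sum (g := fun _ => 2 * (L * M)) fun j _ => ?_).trans ?_
        · refine (abs_add_le _ _).trans ?_
          have u1 := mm (c4 j) (d2 i j)
          have u2 := mm (c5 i j) (d1 j)
          rw [mul_comm (dx j xi2 (s, x))]
          linarith
        · simp
      rw [abs_mul 2, abs_two]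
      linarith

lemma psi_dx {r : ℝ} (hr : 0 < r) (s₀ : ℝ) (y₀ : E3) (j : Fin 3) (z : Z) :
    dx j (psi r s₀ y₀) z = xi z * (xi z * dx j (hk r s₀ y₀) z + 2 * (hk r s₀ y₀ z * dx j xi z)) := by
  have e1 : dx j (psi r s₀ y₀) z = _ := dv_mul (0, eb j) (hk_smooth hr s₀ y₀) xi2_smooth z
  have e2 : dv ((0, eb j) : Z) xi2 z = _ := dv_sq (0, eb j) xi_smooth z
  rw [e1, e2]; unfold xi2 dx; ring

/-- Gradient bound for the test function. -/
lemma psi_dx_bound : ∃ C : ℝ, 0 < C ∧ ∀ r s₀ : ℝ, ∀ y₀ : E3, Adm r s₀ y₀ →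
    ∀ s, -1 ≤ s → s ≤ s₀ → ∀ x j, |dx j (psi r s₀ y₀) (s, x)| ≤
      C * (xi (s, x) * (pdist r s₀ y₀ (s, x))⁻¹ ^ 4) := by
  obtain ⟨K, hK, HK⟩ := hk_bounds
  have hx1 : ∀ j, ∃ C : ℝ, 0 < C ∧ ∀ s ∈ Icc (-1 : ℝ) 0, ∀ x, |dx j xi (s, x)| ≤ C := fun j =>
    (xi_xsupp.dv (0, eb j)).exists_bound (dv_smooth _ xi_smooth).continuous
  choose a p H using hx1
  have hi : ∀ i, a i ≤ ∑ i, a i := fun i => Finset.single_le_sum (fun i _ => (p i).le) (Finset.mem_univ i)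
  set M := ∑ i, a i
  have hM : 0 < M := (p 0).trans_le (hi 0)
  refine ⟨K + 6 * K * M, by positivity, fun r s₀ y₀ h s hs1 hs x j => ?_⟩
  have hx0 := xi_nonneg (s, x)
  by_cases hx : 1 < ‖x‖
  · rw [(psi_xsupp r s₀ y₀).dv (0, eb j) s x hx |> fun h => (h : dx j (psi r s₀ y₀) (s, x) = 0),
      abs_zero]
    have := pdist_pos h.r_pos s₀ y₀ (s, x)
    positivity
  obtain ⟨b3, b4, -⟩ := HK r s₀ y₀ (s, x) h.r_pos
  have hD := pdist_pos h.r_pos s₀ y₀ (s, x)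
  have hD3 := h.pdist_le hs hs1 (not_lt.1 hx)
  set D := pdist r s₀ y₀ (s, x)
  have c3 : D⁻¹ ^ 3 ≤ 3 * D⁻¹ ^ 4 := by
    have : D⁻¹ ^ 3 = D * D⁻¹ ^ 4 := by field_simp
    rw [this]; gcongr
  rw [psi_dx h.r_pos, abs_mul, abs_of_nonneg hx0]
  have : |xi (s, x) * dx j (hk r s₀ y₀) (s, x) + 2 * (hk r s₀ y₀ (s, x) * dx j xi (s, x))|
      ≤ (K + 6 * K * M) * D⁻¹ ^ 4 := by
    refine (abs_add_le _ _).trans ?_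
    have t1 : |xi (s, x) * dx j (hk r s₀ y₀) (s, x)| ≤ 1 * (K * D⁻¹ ^ 4) := by
      rw [abs_mul, abs_of_nonneg hx0]
      exact mul_le_mul (xi_le_one _) (b4 j) (abs_nonneg _) zero_le_one
    have t2 : |hk r s₀ y₀ (s, x) * dx j xi (s, x)| ≤ (K * (3 * D⁻¹ ^ 4)) * M := by
      rw [abs_mul, abs_of_pos (hk_pos _ _ _ _)]
      refine mul_le_mul (b3.trans (by gcongr)) ((H j s ⟨hs1, hs.trans h.s_le⟩ x).trans (hi j))
        (abs_nonneg _) (by positivity)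
    rw [abs_mul 2, abs_two]
    linarith
  calc _ ≤ xi (s, x) * ((K + 6 * K * M) * D⁻¹ ^ 4) := by gcongr
    _ = _ := by ring

lemma psi_half_le {r s₀ : ℝ} {y₀ : E3} (hr : 0 < r) {s : ℝ} (hs : s ≤ s₀) (x : E3) :
    psi (r / 2) s₀ y₀ (s, x) ≤ 8 * psi r s₀ y₀ (s, x) := by
  unfold psi
  rw [← mul_assoc]
  refine mul_le_mul_of_nonneg_right ?_ (sq_nonneg _)
  have hr2 : 0 < r / 2 := by positivity
  rw [hk_formula hr2, hk_formula hr]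
  have e1 := clk_eq hr (s := s) (s₀ := s₀) (by nlinarith)
  have e2 := clk_eq hr2 (s := s) (s₀ := s₀) (by nlinarith)
  have p1 := clk_pos hr s₀ s
  have p2 := clk_pos hr2 s₀ s
  have q1 := Real.sqrt_pos.2 p1
  have q2 := Real.sqrt_pos.2 p2
  have l1 : Real.sqrt (clk (r / 2) s₀ s) ≤ Real.sqrt (clk r s₀ s) := by
    apply Real.sqrt_le_sqrt; rw [e1, e2]; nlinarith
  have l2 : Real.sqrt (clk r s₀ s) ≤ 2 * Real.sqrt (clk (r / 2) s₀ s) := by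
    apply Real.sqrt_le_iff.2 ⟨by positivity, ?_⟩
    rw [mul_pow, Real.sq_sqrt p2.le, e1, e2]; nlinarith
  simp only
  set θ := Real.sqrt (clk r s₀ s)
  set θ' := Real.sqrt (clk (r / 2) s₀ s)
  have i1 : θ'⁻¹ ≤ 2 * θ⁻¹ := by
    rw [← div_eq_mul_inv, le_div_iff₀ q1, inv_mul_le_iff₀ q2]; linarith
  calc _ ≤ (2 * θ⁻¹) ^ 3 * Real.exp (-(‖x - y₀‖ ^ 2 * (4 * θ ^ 2)⁻¹)) := by gcongr
    _ = _ := by ring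

lemma hk_lower {r s₀ : ℝ} {y₀ : E3} (hr : 0 < r) {s : ℝ} (hs : s ≤ s₀) {x : E3}
    (h1 : ‖x - y₀‖ ≤ 2 * r) (h2 : s₀ - s ≤ 4 * r ^ 2) :
    Real.exp (-1) / 27 * r⁻¹ ^ 3 ≤ hk r s₀ y₀ (s, x) := by
  rw [hk_formula hr]
  have e1 := clk_eq hr (s := s) (s₀ := s₀) (by nlinarith)
  have p1 := clk_pos hr s₀ s
  have q1 := Real.sqrt_pos.2 p1
  have l1 : Real.sqrt (clk r s₀ s) ≤ 3 * r := by
    apply Real.sqrt_le_iff.2 ⟨by positivity, ?_⟩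
    rw [e1]; nlinarith
  have l2 : r ≤ Real.sqrt (clk r s₀ s) := by
    apply Real.le_sqrt_of_sq_le; rw [e1]; linarith
  simp only
  set θ := Real.sqrt (clk r s₀ s)
  have i1 : (3 * r)⁻¹ ≤ θ⁻¹ := by gcongr
  have i2 : ‖x - y₀‖ ^ 2 * (4 * θ ^ 2)⁻¹ ≤ 1 := by
    rw [← div_eq_mul_inv, div_le_one (by positivity)]
    have : ‖x - y₀‖ ≤ 2 * θ := by linarith
    nlinarith [norm_nonneg (x - y₀)]
  calc _ = (3 * r)⁻¹ ^ 3 * Real.exp (-1) := by rw [mul_inv]; ring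
    _ ≤ _ := by gcongr

lemma psi_lower {r s₀ : ℝ} {y₀ : E3} (hr : 0 < r) {s : ℝ} (hs : s ≤ s₀) {x : E3}
    (h1 : ‖x - y₀‖ ≤ 2 * r) (h2 : s₀ - s ≤ 4 * r ^ 2) :
    Real.exp (-1) / 27 * r⁻¹ ^ 3 * xi2 (s, x) ≤ psi r s₀ y₀ (s, x) :=
  mul_le_mul_of_nonneg_right (hk_lower hr hs h1 h2) (sq_nonneg _)

/-- On the unit scale the test function dominates the cut-off. -/
lemma xi2_le_psi_one {s₀ : ℝ} {y₀ : E3} (h : Adm 1 s₀ y₀) {s : ℝ} (hs1 : -1 ≤ s) (hs : s ≤ s₀)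
    (x : E3) : Real.exp (-1) / 27 * xi2 (s, x) ≤ psi 1 s₀ y₀ (s, x) := by
  by_cases hx : 1 < ‖x‖
  · rw [xi2_xsupp s x hx, psi_xsupp 1 s₀ y₀ s x hx]; simp
  · have := psi_lower (y₀ := y₀) h.r_pos hs (x := x)
      (by have := norm_sub_le x y₀; have := h.y_le; linarith) (by have := h.s_le; linarith)
    simpa using this

lemma integral_hk {r : ℝ} (hr : 0 < r) (s₀ : ℝ) (y₀ : E3) (s : ℝ) :
    Integrable (fun x => hk r s₀ y₀ (s, x)) ∧
    ∫ x, hk r s₀ y₀ (s, x) = ∫ x : E3, Real.exp (-(1 / 4) * ‖x‖ ^ 2) := by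
  have hp := clk_pos hr s₀ s
  have hq := Real.sqrt_pos.2 hp
  have hf : (fun x => hk r s₀ y₀ (s, x)) = fun x => (Real.sqrt (clk r s₀ s))⁻¹ ^ 3 *
      (fun x : E3 => Real.exp (-(1 / 4) * ‖(Real.sqrt (clk r s₀ s))⁻¹ • x‖ ^ 2)) (x - y₀) := by
    funext x
    rw [hk_formula hr]
    simp only
    rw [norm_smul, norm_inv, Real.norm_of_nonneg hq.le]
    congr 2
    field_simp
  rw [hf]
  set θ := Real.sqrt (clk r s₀ s)
  have hg : Integrable fun x : E3 => Real.exp (-(1 / 4) * ‖x‖ ^ 2) := by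
    have := GaussianFourier.integrable_cexp_neg_mul_sq_norm_add (V := E3) (b := 1 / 4)
      (by norm_num) 0 0
    have h2 := this.norm
    simpa [Complex.norm_exp, ← Complex.ofReal_pow] using h2
  have hg2 : Integrable fun x : E3 => Real.exp (-(1 / 4) * ‖θ⁻¹ • x‖ ^ 2) :=
    hg.comp_smul (inv_ne_zero hq.ne')
  refine ⟨(hg2.comp_sub_right y₀).const_mul _, ?_⟩
  rw [integral_const_mul, integral_sub_right_eq_self (μ := (volume : Measure E3))
    (fun x : E3 => Real.exp (-(1 / 4) * ‖θ⁻¹ • x‖ ^ 2)) y₀,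
    Measure.integral_comp_smul (μ := (volume : Measure E3))
      (fun x : E3 => Real.exp (-(1 / 4) * ‖x‖ ^ 2)) θ⁻¹]
  simp only [finrank_euclideanSpace, Fintype.card_fin, smul_eq_mul]
  rw [abs_of_pos (by positivity), ← mul_assoc, ← mul_inv_cancel₀ (show (θ⁻¹ ^ 3 : ℝ) ≠ 0 by positivity),
    ]
  rw [mul_inv_cancel₀ (show (θ⁻¹ ^ 3 : ℝ) ≠ 0 by positivity), one_mul]

lemma integral_psi_le : ∃ C : ℝ, 0 < C ∧ ∀ r s₀ : ℝ, ∀ y₀ : E3, 0 < r → ∀ s,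
    ∫ x, psi r s₀ y₀ (s, x) ≤ C := by
  refine ⟨(∫ x : E3, Real.exp (-(1 / 4) * ‖x‖ ^ 2)) + 1, by positivity, fun r s₀ y₀ hr s => ?_⟩
  obtain ⟨h1, h2⟩ := integral_hk hr s₀ y₀ s
  rw [← h2]
  refine le_add_of_le_of_nonneg (integral_mono ((psi_xsupp r s₀ y₀).integrable
    (psi_smooth hr s₀ y₀).continuous s) h1 fun x => ?_) zero_le_one
  have : xi2 (s, x) ≤ 1 := pow_le_one₀ (xi_nonneg _) (xi_le_one _)
  exact mul_le_of_le_one_right (hk_pos _ _ _ _).le this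

/-- `∫ D⁻⁴ dx = C / θ`. -/
lemma integral_inv_pow_four : ∃ C : ℝ, 0 < C ∧ ∀ r s₀ : ℝ, ∀ y₀ : E3, ∀ s, 0 < r →
    Integrable (fun x => (pdist r s₀ y₀ (s, x))⁻¹ ^ 4) ∧
    ∫ x, (pdist r s₀ y₀ (s, x))⁻¹ ^ 4 ≤ C * (Real.sqrt (clk r s₀ s))⁻¹ := by
  refine ⟨(∫ x : E3, (1 + ‖x‖)⁻¹ ^ 4) + 1, by positivity, fun r s₀ y₀ s hr => ?_⟩
  have hp := clk_pos hr s₀ s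
  have hq := Real.sqrt_pos.2 hp
  unfold pdist
  simp only
  set θ := Real.sqrt (clk r s₀ s)
  have hg : Integrable fun x : E3 => (1 + ‖x‖)⁻¹ ^ 4 := by
    have := integrable_one_add_norm (E := E3) (μ := volume) (r := 4) (by simp; norm_num)
    refine this.congr (Filter.Eventually.of_forall fun x => ?_)
    simp only
    rw [Real.rpow_neg (by positivity), inv_pow]; norm_cast
  have hf : (fun x : E3 => (‖x - y₀‖ + θ)⁻¹ ^ 4) = fun x => θ⁻¹ ^ 4 *
      (fun x : E3 => (1 + ‖θ⁻¹ • x‖)⁻¹ ^ 4) (x - y₀) := by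
    funext x
    simp only
    rw [norm_smul, norm_inv, Real.norm_of_nonneg hq.le, ← mul_pow, ← mul_inv]
    congr 2
    field_simp
    ring
  rw [hf]
  have hg2 : Integrable fun x : E3 => (1 + ‖θ⁻¹ • x‖)⁻¹ ^ 4 := hg.comp_smul (inv_ne_zero hq.ne')
  refine ⟨(hg2.comp_sub_right y₀).const_mul _, ?_⟩
  rw [integral_const_mul, integral_sub_right_eq_self (μ := (volume : Measure E3))
    (fun x : E3 => (1 + ‖θ⁻¹ • x‖)⁻¹ ^ 4) y₀,
    Measure.integral_comp_smul (μ := (volume : Measure E3))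
      (fun x : E3 => (1 + ‖x‖)⁻¹ ^ 4) θ⁻¹]
  simp only [finrank_euclideanSpace, Fintype.card_fin, smul_eq_mul]
  rw [abs_of_pos (by positivity), ← mul_assoc]
  have : θ⁻¹ ^ 4 * (θ⁻¹ ^ 3)⁻¹ = θ⁻¹ := by field_simp
  rw [this]
  have : 0 < θ⁻¹ := by positivity
  nlinarith

/-- Concentration: averages against the test functions control point values. -/
lemma psi_conc : ∃ C : ℝ, 0 < C ∧ ∀ (s₀ : ℝ) (y₀ : E3), Adm 1 s₀ y₀ → ∀ f : E3 → ℝ, Continuous f →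
    ∀ B : ℝ, (∀ k : ℕ, |∫ x, f x * psi ((1 / 2) ^ k) s₀ y₀ (s₀, x)| ≤ B) → |f y₀| ≤ C * B := by
  set G := ∫ x : E3, Real.exp (-(1 / 4) * ‖x‖ ^ 2) with hG
  have hg : Integrable fun x : E3 => Real.exp (-(1 / 4) * ‖x‖ ^ 2) := by
    have := GaussianFourier.integrable_cexp_neg_mul_sq_norm_add (V := E3) (b := 1 / 4)
      (by norm_num) 0 0
    have h2 := this.norm
    simpa [Complex.norm_exp, ← Complex.ofReal_pow] using h2
  have hG0 : 0 < G := by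
    rw [hG]
    exact integral_exp_pos hg
  refine ⟨G⁻¹, by positivity, fun s₀ y₀ h f hf B hB => ?_⟩
  have hcont : Continuous fun x => f x * xi2 (s₀, x) :=
    hf.mul (xi2_smooth.continuous.comp (by fun_prop))
  obtain ⟨M, hM⟩ := hcont.bounded_above_of_compact_support
    (hasCompactSupport_of_zero (R := 1) fun x hx => by rw [xi2_xsupp s₀ x hx, mul_zero])
  have key : ∀ k : ℕ, ∫ x, f x * psi ((1 / 2) ^ k) s₀ y₀ (s₀, x) =
      ∫ x, Real.exp (-(1 / 4) * ‖x‖ ^ 2) * (fun x => f x * xi2 (s₀, x)) (y₀ + (1 / 2 : ℝ) ^ k • x) := by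
    intro k
    have hr : (0 : ℝ) < (1 / 2) ^ k := by positivity
    set r : ℝ := (1 / 2) ^ k
    have e := clk_eq hr (s := s₀) (s₀ := s₀) (by nlinarith)
    have e2 : Real.sqrt (clk r s₀ s₀) = r := by
      rw [e, show r ^ 2 + s₀ - s₀ = r ^ 2 by ring, Real.sqrt_sq hr.le]
    set F := fun x => f x * xi2 (s₀, x)
    have h1 : (fun x => f x * psi r s₀ y₀ (s₀, x)) =
        fun x => (fun x => r⁻¹ ^ 3 * (Real.exp (-(1 / 4) * ‖r⁻¹ • x‖ ^ 2) *
          F (y₀ + r • (r⁻¹ • x)))) (x - y₀) := by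
      funext x
      unfold psi
      rw [hk_formula hr]
      simp only
      rw [e2, smul_smul, mul_inv_cancel₀ hr.ne', one_smul, add_sub_cancel, norm_smul, norm_inv,
        Real.norm_of_nonneg hr.le]
      rw [show -(‖x - y₀‖ ^ 2 * (4 * r ^ 2)⁻¹) = -(1 / 4) * (r⁻¹ * ‖x - y₀‖) ^ 2 by field_simp]
      simp only [F]; ring
    rw [h1, integral_sub_right_eq_self (μ := (volume : Measure E3)) (fun x => r⁻¹ ^ 3 *
      (Real.exp (-(1 / 4) * ‖r⁻¹ • x‖ ^ 2) * F (y₀ + r • (r⁻¹ • x)))) y₀, integral_const_mul,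
      Measure.integral_comp_smul (μ := (volume : Measure E3))
        (fun x : E3 => Real.exp (-(1 / 4) * ‖x‖ ^ 2) * F (y₀ + r • x)) r⁻¹]
    simp only [finrank_euclideanSpace, Fintype.card_fin, smul_eq_mul]
    rw [abs_of_pos (by positivity), ← mul_assoc, mul_inv_cancel₀ (by positivity), one_mul]
  have lim : Filter.Tendsto (fun k : ℕ => ∫ x, f x * psi ((1 / 2) ^ k) s₀ y₀ (s₀, x)) Filter.atTop
      (nhds (∫ x : E3, Real.exp (-(1 / 4) * ‖x‖ ^ 2) * f y₀)) := by
    simp only [key]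
    refine tendsto_integral_of_dominated_convergence
      (fun x => Real.exp (-(1 / 4) * ‖x‖ ^ 2) * M) (fun k => ?_) (hg.mul_const M) (fun k => ?_) ?_
    · refine Continuous.aestronglyMeasurable (Continuous.mul (by fun_prop) (hcont.comp (by fun_prop)))
    · filter_upwards with x
      rw [norm_mul, Real.norm_of_nonneg (Real.exp_pos _).le]
      gcongr
      exact hM _
    · filter_upwards with x
      refine Filter.Tendsto.const_mul _ ?_
      have h1 : Filter.Tendsto (fun k : ℕ => y₀ + (1 / 2 : ℝ) ^ k • x) Filter.atTop (nhds y₀) := by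
        have := (tendsto_pow_atTop_nhds_zero_of_lt_one (r := (1 / 2 : ℝ)) (by norm_num)
          (by norm_num)).smul_const x
        simpa using this.const_add y₀
      have h2 := (hcont.tendsto y₀).comp h1
      have h3 : xi2 (s₀, y₀) = 1 := by
        rw [xi2, xi_eq_one (by linarith [h.s_ge]) (by linarith [h.y_le]), one_pow]
      simpa [h3, Function.comp_def] using h2
  have h2 := le_of_tendsto lim.abs (Filter.Eventually.of_forall hB)
  rw [integral_mul_const, abs_mul, abs_of_pos hG0] at h2
  rw [← div_eq_inv_mul, le_div_iff₀ hG0]; linarith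

/-- Dyadic decomposition of the singular weight. -/
lemma dyadic_weight (m : ℕ) {s₀ : ℝ} {y₀ : E3} (k : ℕ) {s : ℝ} (hs : s ≤ s₀) (x : E3) :
    (pdist ((1 / 2) ^ k) s₀ y₀ (s, x))⁻¹ ^ m ≤ 16 ^ m * (1 + ∑ j ∈ Finset.Icc 4 k,
      if ‖x - y₀‖ ≤ (1 / 2) ^ j ∧ s₀ - s ≤ ((1 / 2) ^ j) ^ 2 then ((2 : ℝ) ^ j) ^ m else 0) := by
  have hr : (0 : ℝ) < (1 / 2) ^ k := by positivity
  have e := clk_eq hr (s := s) (s₀ := s₀) (by nlinarith)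
  have hD := pdist_pos hr s₀ y₀ (s, x)
  have hDdef : pdist ((1 / 2) ^ k) s₀ y₀ (s, x) = ‖x - y₀‖ + Real.sqrt (clk ((1 / 2) ^ k) s₀ s) := rfl
  have hq := Real.sqrt_nonneg (clk ((1 / 2) ^ k) s₀ s)
  have hk1 : ((1 : ℝ) / 2) ^ k ≤ Real.sqrt (clk ((1 / 2) ^ k) s₀ s) := by
    apply Real.le_sqrt_of_sq_le; rw [e]; linarith
  have hsq : Real.sqrt (clk ((1 / 2) ^ k) s₀ s) ^ 2 = clk ((1 / 2) ^ k) s₀ s :=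
    Real.sq_sqrt (clk_pos hr _ _).le
  set D := pdist ((1 / 2) ^ k) s₀ y₀ (s, x)
  set θ := Real.sqrt (clk ((1 / 2) ^ k) s₀ s)
  have hn := norm_nonneg (x - y₀)
  have hterm : ∀ j, 0 ≤ (if ‖x - y₀‖ ≤ (1 / 2) ^ j ∧ s₀ - s ≤ ((1 / 2) ^ j) ^ 2 then
    ((2 : ℝ) ^ j) ^ m else 0) := fun j => by split_ifs <;> positivity
  rcases le_or_gt (1 / 16) D with h | h
  · have h1 : D⁻¹ ≤ 16 := by rw [inv_le_comm₀ hD (by norm_num)]; linarith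
    calc D⁻¹ ^ m ≤ 16 ^ m := by gcongr
      _ ≤ _ := le_mul_of_one_le_right (by positivity)
        (le_add_of_nonneg_right (Finset.sum_nonneg fun j _ => hterm j))
  · obtain ⟨j, hj1, hj2⟩ := exists_nat_pow_near_of_lt_one hD (by linarith : D ≤ 1)
      (by norm_num : (0 : ℝ) < 1 / 2) (by norm_num)
    have hj4 : 4 ≤ j := by
      by_contra hc
      have : j + 1 ≤ 4 := by omega
      have := pow_le_pow_of_le_one (by norm_num : (0 : ℝ) ≤ 1 / 2) (by norm_num) this
      norm_num at this; linarith
    have hjk : j ≤ k := by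
      by_contra hc
      have : k + 1 ≤ j := by omega
      have := pow_le_pow_of_le_one (by norm_num : (0 : ℝ) ≤ 1 / 2) (by norm_num) this
      rw [pow_succ] at this; linarith
    have hcond : ‖x - y₀‖ ≤ (1 / 2) ^ j ∧ s₀ - s ≤ ((1 / 2) ^ j) ^ 2 := by
      refine ⟨by linarith, ?_⟩
      have : θ ≤ (1 / 2) ^ j := by linarith
      have : θ ^ 2 ≤ ((1 / 2) ^ j) ^ 2 := by gcongr
      rw [hsq, e] at this
      nlinarith
    have h1 : D⁻¹ ≤ 2 * 2 ^ j := by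
      rw [inv_le_comm₀ hD (by positivity)]
      refine le_trans (le_of_eq ?_) hj1.le
      rw [pow_succ, one_div, inv_pow, mul_inv]; ring
    calc D⁻¹ ^ m ≤ (2 * 2 ^ j) ^ m := by gcongr
      _ = 2 ^ m * (2 ^ j) ^ m := by rw [mul_pow]
      _ ≤ 16 ^ m * (2 ^ j) ^ m := by gcongr; norm_num
      _ ≤ _ := by
        gcongr
        have := Finset.single_le_sum (f := fun j => if ‖x - y₀‖ ≤ (1 / 2) ^ j ∧
          s₀ - s ≤ ((1 / 2) ^ j) ^ 2 then ((2 : ℝ) ^ j) ^ m else 0) (fun j _ => hterm j)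
          (Finset.mem_Icc.2 ⟨hj4, hjk⟩)
        rw [if_pos hcond] at this
        linarith

/-! ### Local solutions in a moving frame and the localised energy identity -/

/-- `|v|²`. -/
def S2 (v : Fin 3 → Z → ℝ) (z : Z) : ℝ := ∑ i, v i z ^ 2

/-- `|∇v|²`. -/
def G2 (v : Fin 3 → Z → ℝ) (z : Z) : ℝ := ∑ i, ∑ j, (dx j (v i) z) ^ 2

/-- `∑ ∂ᵢvⱼ ∂ⱼvᵢ`. -/
def gp (v : Fin 3 → Z → ℝ) (z : Z) : ℝ := ∑ i, ∑ j, dx i (v j) z * dx j (v i) z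

/-- Smooth solutions on `[-1,0] × ℝ³` of the Navier–Stokes equations in a moving frame, with
vanishing local mean. -/
structure CSol (v : Fin 3 → Z → ℝ) (P : Z → ℝ) (c : Fin 3 → ℝ → ℝ) : Prop where
  sm : ∀ i, Sm (v i)
  smP : Sm P
  eq : ∀ s ∈ Icc (-1 : ℝ) 0, ∀ x i, dt (v i) (s, x) + ∑ j, v j (s, x) * dx j (v i) (s, x)
    + dx i P (s, x) + c i s - lap (v i) (s, x) = 0
  div : ∀ s ∈ Icc (-1 : ℝ) 0, ∀ x, ∑ i, dx i (v i) (s, x) = 0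
  mean : ∀ s ∈ Icc (-1 : ℝ) 0, ∀ i, ∫ x, avk x * v i (s, x) = 0
  pres : ∀ᵐ s, s ∈ Icc (-1 : ℝ) 0 → ∀ x, P (s, x) = (1 / (4 * Real.pi)) * ∫ y, gp v (s, y) / ‖x - y‖
  fin : ∀ᵐ s, s ∈ Icc (-1 : ℝ) 0 → ∫⁻ y, ENNReal.ofReal (G2 v (s, y)) < ⊤

section
variable {v : Fin 3 → Z → ℝ}

lemma S2_smooth (hv : ∀ i, Sm (v i)) : Sm (S2 v) := by
  unfold S2; exact ContDiff.sum fun i _ => (hv i).pow 2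

lemma S2_nonneg (v : Fin 3 → Z → ℝ) (z : Z) : 0 ≤ S2 v z := Finset.sum_nonneg fun _ _ => sq_nonneg _

lemma G2_smooth (hv : ∀ i, Sm (v i)) : Sm (G2 v) := by
  unfold G2; exact ContDiff.sum fun i _ => ContDiff.sum fun j _ => (dv_smooth _ (hv i)).pow 2

lemma G2_nonneg (v : Fin 3 → Z → ℝ) (z : Z) : 0 ≤ G2 v z :=
  Finset.sum_nonneg fun _ _ => Finset.sum_nonneg fun _ _ => sq_nonneg _

lemma gp_smooth (hv : ∀ i, Sm (v i)) : Sm (gp v) := by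
  unfold gp
  exact ContDiff.sum fun i _ => ContDiff.sum fun j _ => (dv_smooth _ (hv j)).mul (dv_smooth _ (hv i))

lemma abs_gp_le (v : Fin 3 → Z → ℝ) (z : Z) : |gp v z| ≤ G2 v z := by
  unfold gp G2
  have h1 : ∑ i, ∑ j, (dx j (v i) z) ^ 2 =
      ∑ i, ∑ j, ((dx j (v i) z) ^ 2 + (dx i (v j) z) ^ 2) / 2 := by
    have : ∑ i, ∑ j, (dx i (v j) z) ^ 2 = ∑ i, ∑ j, (dx j (v i) z) ^ 2 := Finset.sum_comm
    simp only [add_div, Finset.sum_add_distrib]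
    simp only [← Finset.sum_div]
    rw [this]; ring
  rw [h1]
  refine (Finset.abs_sum_le_sum_abs _ _).trans (Finset.sum_le_sum fun i _ => ?_)
  refine (Finset.abs_sum_le_sum_abs _ _).trans (Finset.sum_le_sum fun j _ => ?_)
  rw [abs_le]
  constructor <;> nlinarith [sq_nonneg (dx j (v i) z + dx i (v j) z),
    sq_nonneg (dx j (v i) z - dx i (v j) z)]

end

section
variable {v : Fin 3 → Z → ℝ} {P : Z → ℝ} {c : Fin 3 → ℝ → ℝ}

/-- The flux in the local energy identity. -/
def flux (v : Fin 3 → Z → ℝ) (P ψ : Z → ℝ) (j : Fin 3) (z : Z) : ℝ :=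
  (∑ i, v i z * dx j (v i) z) * ψ z - 1 / 2 * (S2 v z * (v j z * ψ z)) - P z * (v j z * ψ z)
    - 1 / 2 * (S2 v z * dx j ψ z)

lemma dv_S2 (hv : ∀ i, Sm (v i)) (w z : Z) : dv w (S2 v) z = 2 * ∑ i, v i z * dv w (v i) z := by
  have e : dv w (S2 v) z = _ := dv_sum Finset.univ w (fun i z => v i z ^ 2) (fun i => (hv i).pow 2) z
  rw [e, Finset.mul_sum]
  refine Finset.sum_congr rfl fun i _ => ?_
  rw [dv_sq w (hv i)]

lemma flux_smooth (hv : ∀ i, Sm (v i)) (hP : Sm P) {ψ : Z → ℝ} (hψ : Sm ψ) (j : Fin 3) :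
    Sm (flux v P ψ j) := by
  unfold flux
  have h1 : Sm fun z => ∑ i, v i z * dx j (v i) z :=
    ContDiff.sum fun i _ => (hv i).mul (dv_smooth _ (hv i))
  have h2 := S2_smooth hv
  have h3 : Sm (dx j ψ) := dv_smooth _ hψ
  exact (((h1.mul hψ).sub (contDiff_const.mul (h2.mul ((hv j).mul hψ)))).sub
    (hP.mul ((hv j).mul hψ))).sub (contDiff_const.mul (h2.mul h3))

lemma dx_flux (hv : ∀ i, Sm (v i)) (hP : Sm P) {ψ : Z → ℝ} (hψ : Sm ψ) (j : Fin 3) (z : Z) :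
    dx j (flux v P ψ j) z =
      (∑ i, v i z * dx j (v i) z) * dx j ψ z
      + ψ z * ∑ i, (v i z * dx j (dx j (v i)) z + dx j (v i) z ^ 2)
      - 1 / 2 * (S2 v z * (v j z * dx j ψ z + ψ z * dx j (v j) z)
          + (v j z * ψ z) * (2 * ∑ i, v i z * dx j (v i) z))
      - (P z * (v j z * dx j ψ z + ψ z * dx j (v j) z) + (v j z * ψ z) * dx j P z)
      - 1 / 2 * (S2 v z * dx j (dx j ψ) z + dx j ψ z * (2 * ∑ i, v i z * dx j (v i) z)) := by
  have h1 : Sm fun z => ∑ i, v i z * dx j (v i) z :=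
    ContDiff.sum fun i _ => (hv i).mul (dv_smooth _ (hv i))
  have h2 := S2_smooth hv
  have h3 : Sm (dx j ψ) := dv_smooth _ hψ
  have hvj := (hv j).mul hψ
  have e1 : dx j (flux v P ψ j) z = _ := dv_sub (0, eb j)
    (f := fun z => (∑ i, v i z * dx j (v i) z) * ψ z - 1 / 2 * (S2 v z * (v j z * ψ z))
      - P z * (v j z * ψ z)) (g := fun z => 1 / 2 * (S2 v z * dx j ψ z))
    (((h1.mul hψ).sub (contDiff_const.mul (h2.mul hvj))).sub (hP.mul hvj))
    (contDiff_const.mul (h2.mul h3)) z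
  rw [e1, dv_sub _ ((h1.mul hψ).sub (contDiff_const.mul (h2.mul hvj))) (hP.mul hvj),
    dv_sub _ (h1.mul hψ) (contDiff_const.mul (h2.mul hvj)), dv_mul _ h1 hψ,
    dv_const_mul _ _ (h2.mul hvj), dv_mul _ h2 hvj, dv_mul _ (hv j) hψ, dv_mul _ hP hvj,
    dv_mul _ (hv j) hψ, dv_const_mul _ _ (h2.mul h3), dv_mul _ h2 h3, dv_S2 hv,
    dv_sum _ _ _ fun i => (hv i).mul (dv_smooth _ (hv i))]
  have e2 : ∀ i, dv ((0, eb j) : Z) (fun z => v i z * dx j (v i) z) z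
      = v i z * dx j (dx j (v i)) z + dx j (v i) z ^ 2 := fun i => by
    have : dv ((0, eb j) : Z) (fun z => v i z * dx j (v i) z) z = _ :=
      dv_mul _ (hv i) (dv_smooth _ (hv i)) z
    rw [this]; unfold dx; ring
  simp only [e2]

/-- The pointwise localised energy identity. -/
lemma CSol.pointwise_energy (h : CSol v P c) {ψ : Z → ℝ} (hψ : Sm ψ) {s : ℝ}
    (hs : s ∈ Icc (-1 : ℝ) 0) (x : E3) :
    dt (fun z => 1 / 2 * (S2 v z * ψ z)) (s, x) =
      - (G2 v (s, x) * ψ (s, x)) + 1 / 2 * (S2 v (s, x) * (dt ψ (s, x) + lap ψ (s, x)))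
      + 1 / 2 * (S2 v (s, x) * ∑ j, v j (s, x) * dx j ψ (s, x))
      + P (s, x) * (∑ j, v j (s, x) * dx j ψ (s, x))
      - (∑ i, c i s * (v i (s, x) * ψ (s, x)))
      + ∑ j, dx j (flux v P ψ j) (s, x) := by
  have e1 : dt (fun z => 1 / 2 * (S2 v z * ψ z)) (s, x) = _ :=
    dv_const_mul (1, 0) (1 / 2) ((S2_smooth h.sm).mul hψ) (s, x)
  rw [e1, dv_mul _ (S2_smooth h.sm) hψ, dv_S2 h.sm]
  have heq := fun i => h.eq s hs x i
  have hdiv := h.div s hs x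
  have e2 : ∀ i, dv ((1, 0) : Z) (v i) (s, x) = lap (v i) (s, x) - c i s - dx i P (s, x)
      - ∑ j, v j (s, x) * dx j (v i) (s, x) := fun i => by
    have := heq i; unfold dt at this; linarith
  simp only [e2, dx_flux h.sm h.smP hψ]
  unfold lap G2
  unfold dt
  simp only [Fin.sum_univ_three] at hdiv ⊢
  have hd2 : dx 2 (v 2) (s, x) = - dx 0 (v 0) (s, x) - dx 1 (v 1) (s, x) := by linarith
  rw [hd2]
  ring

/-- The integrated localised energy identity. -/
lemma CSol.energy (h : CSol v P c) {ψ : Z → ℝ} (hψ : Sm ψ) (hx : XSupp 1 ψ) {s : ℝ}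
    (hs : s ∈ Icc (-1 : ℝ) 0) :
    HasDerivAt (fun s => 1 / 2 * ∫ x, S2 v (s, x) * ψ (s, x))
      (- (∫ x, G2 v (s, x) * ψ (s, x)) + 1 / 2 * (∫ x, S2 v (s, x) * (dt ψ (s, x) + lap ψ (s, x)))
      + 1 / 2 * (∫ x, S2 v (s, x) * ∑ j, v j (s, x) * dx j ψ (s, x))
      + (∫ x, P (s, x) * (∑ j, v j (s, x) * dx j ψ (s, x)))
      - (∑ i, c i s * ∫ x, v i (s, x) * ψ (s, x))) s := by
  have hS := S2_smooth h.sm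
  have h1 : Sm fun z => 1 / 2 * (S2 v z * ψ z) := contDiff_const.mul (hS.mul hψ)
  have hx1 : XSupp 1 fun z => 1 / 2 * (S2 v z * ψ z) := fun s x hz => by simp [hx s x hz]
  have hd := hx1.hasDerivAt_integral h1 s
  simp only [integral_const_mul] at hd
  refine hd.congr_deriv ?_
  simp only [h.pointwise_energy hψ hs]
  have hdx : ∀ j, Sm (dx j ψ) := fun j => dv_smooth _ hψ
  have z1 : ∀ w x, 1 < ‖x‖ → dv w ψ (s, x) = 0 := fun w x hz => hx.dv w s x hz
  have z2 : ∀ x, 1 < ‖x‖ → lap ψ (s, x) = 0 := fun x hz => by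
    unfold lap; exact Finset.sum_eq_zero fun j _ => (hx.dv (0, eb j)).dv (0, eb j) s x hz
  have hvd : Sm fun z => ∑ j, v j z * dx j ψ z := ContDiff.sum fun j _ => (h.sm j).mul (hdx j)
  have zvd : ∀ x, 1 < ‖x‖ → ∑ j, v j (s, x) * dx j ψ (s, x) = 0 := fun x hz =>
    Finset.sum_eq_zero fun j _ => by unfold dx; rw [z1 _ x hz, mul_zero]
  have hfl : ∀ j, XSupp 1 (flux v P ψ j) := fun j s x hz => by
    unfold flux
    rw [hx s x hz, show dx j ψ (s, x) = 0 from hx.dv _ s x hz]; ring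
  have hin : ∀ {f : Z → ℝ}, Continuous f → (∀ x, 1 < ‖x‖ → f (s, x) = 0) →
      Integrable fun x => f (s, x) := fun hf hz => integrable_of_zero (by fun_prop) hz
  have i1 : Integrable fun x => - (G2 v (s, x) * ψ (s, x)) :=
    (hin (f := fun z => G2 v z * ψ z) ((G2_smooth h.sm).mul hψ).continuous
      fun x hz => by simp [hx s x hz]).neg
  have i2 : Integrable fun x => 1 / 2 * (S2 v (s, x) * (dt ψ (s, x) + lap ψ (s, x))) :=
    (hin (f := fun z => S2 v z * (dt ψ z + lap ψ z))
      (hS.mul ((dv_smooth _ hψ).add (lap_smooth hψ))).continuous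
      fun x hz => by simp [z2 x hz, dt, z1 _ x hz]).const_mul _
  have i3 : Integrable fun x => 1 / 2 * (S2 v (s, x) * ∑ j, v j (s, x) * dx j ψ (s, x)) :=
    (hin (f := fun z => S2 v z * ∑ j, v j z * dx j ψ z) (hS.mul hvd).continuous
      fun x hz => by rw [zvd x hz, mul_zero]).const_mul _
  have i4 : Integrable fun x => P (s, x) * (∑ j, v j (s, x) * dx j ψ (s, x)) :=
    hin (f := fun z => P z * ∑ j, v j z * dx j ψ z) (h.smP.mul hvd).continuous
      fun x hz => by rw [zvd x hz, mul_zero]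
  have i5' : ∀ i, Integrable fun x => c i s * (v i (s, x) * ψ (s, x)) := fun i =>
    (hin (f := fun z => v i z * ψ z) ((h.sm i).mul hψ).continuous
      fun x hz => by simp [hx s x hz]).const_mul _
  have i5 : Integrable fun x => ∑ i, c i s * (v i (s, x) * ψ (s, x)) :=
    integrable_finsetSum _ fun i _ => i5' i
  have i6' : ∀ j, Integrable fun x => dx j (flux v P ψ j) (s, x) := fun j =>
    ((hfl j).dv _).integrable (dv_smooth _ (flux_smooth h.sm h.smP hψ j)).continuous s
  have i6 : Integrable fun x => ∑ j, dx j (flux v P ψ j) (s, x) :=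
    integrable_finsetSum _ fun i _ => i6' i
  have j2 : Integrable fun x => - (G2 v (s, x) * ψ (s, x))
      + 1 / 2 * (S2 v (s, x) * (dt ψ (s, x) + lap ψ (s, x))) := i1.add i2
  have j3 : Integrable fun x => - (G2 v (s, x) * ψ (s, x))
      + 1 / 2 * (S2 v (s, x) * (dt ψ (s, x) + lap ψ (s, x)))
      + 1 / 2 * (S2 v (s, x) * ∑ j, v j (s, x) * dx j ψ (s, x)) := j2.add i3
  have j4 : Integrable fun x => - (G2 v (s, x) * ψ (s, x))
      + 1 / 2 * (S2 v (s, x) * (dt ψ (s, x) + lap ψ (s, x)))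
      + 1 / 2 * (S2 v (s, x) * ∑ j, v j (s, x) * dx j ψ (s, x))
      + P (s, x) * (∑ j, v j (s, x) * dx j ψ (s, x)) := j3.add i4
  have j5 : Integrable fun x => - (G2 v (s, x) * ψ (s, x))
      + 1 / 2 * (S2 v (s, x) * (dt ψ (s, x) + lap ψ (s, x)))
      + 1 / 2 * (S2 v (s, x) * ∑ j, v j (s, x) * dx j ψ (s, x))
      + P (s, x) * (∑ j, v j (s, x) * dx j ψ (s, x))
      - (∑ i, c i s * (v i (s, x) * ψ (s, x))) := j4.sub i5
  rw [integral_add j5 i6, integral_sub j4 i5, integral_add j3 i4, integral_add j2 i3,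
    integral_add i1 i2, integral_neg, integral_const_mul,
    integral_const_mul, integral_finsetSum _ fun i _ => i5' i, integral_finsetSum _ fun j _ => i6' j]
  simp only [integral_const_mul, (hfl _).integral_dx (flux_smooth h.sm h.smP hψ _)]
  simp

end

/-! ### Elimination of the frame acceleration and of the pressure -/

/-- The averaging kernel as a function on space-time. -/
def avz (z : Z) : ℝ := avk z.2

lemma avz_smooth : Sm avz := avk_smooth.comp contDiff_snd

lemma avz_xsupp : XSupp 1 avz := fun _ x hx => avk_zero' _ hx

lemma avz_dt (z : Z) : dt avz z = 0 := by
  have h := hasDerivAt_slice avz_smooth z.1 z.2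
  exact h.unique (hasDerivAt_const z.1 (avk z.2))

section
variable {v : Fin 3 → Z → ℝ} {P : Z → ℝ} {c : Fin 3 → ℝ → ℝ}

/-- The mean force, pressure excluded. -/
def mfor (v : Fin 3 → Z → ℝ) (i : Fin 3) (s : ℝ) : ℝ :=
  ∫ x, (v i (s, x) * lap avz (s, x) + ∑ j, v i (s, x) * v j (s, x) * dx j avz (s, x))

lemma CSol.acceleration (h : CSol v P c) {s : ℝ} (hs : s ∈ Ioo (-1 : ℝ) 0) (i : Fin 3) :
    c i s = mfor v i s + ∫ x, P (s, x) * dx i avz (s, x) := by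
  have hs' : s ∈ Icc (-1 : ℝ) 0 := Ioo_subset_Icc_self hs
  have hφ := avz_smooth
  have hx := avz_xsupp
  have hdφ : ∀ j, Sm (dx j avz) := fun j => dv_smooth _ hφ
  have hd := (hx.mul_right (v i)).hasDerivAt_integral (hφ.mul (h.sm i)) s
  have h0 : HasDerivAt (fun s => ∫ x, avz (s, x) * v i (s, x)) 0 s := by
    refine (hasDerivAt_const s (0 : ℝ)).congr_of_eventuallyEq ?_
    filter_upwards [Ioo_mem_nhds hs.1 hs.2] with τ hτ
    exact h.mean τ (Ioo_subset_Icc_self hτ) i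
  have hz := hd.unique h0
  set F : Fin 3 → Z → ℝ := fun j z =>
    (avz z * dx j (v i) z - v i z * dx j avz z) - avz z * (v j z * v i z) with hF
  have sF1 : ∀ j, Sm fun z => avz z * dx j (v i) z := fun j => hφ.mul (dv_smooth _ (h.sm i))
  have sF2 : ∀ j, Sm fun z => v i z * dx j avz z := fun j => (h.sm i).mul (hdφ j)
  have sF3 : ∀ j, Sm fun z => avz z * (v j z * v i z) := fun j => hφ.mul ((h.sm j).mul (h.sm i))
  have sF : ∀ j, Sm (F j) := fun j => ((sF1 j).sub (sF2 j)).sub (sF3 j)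
  have xF : ∀ j, XSupp 1 (F j) := fun j s x hz => by
    simp only [hF]
    rw [hx s x hz, show dx j avz (s, x) = 0 from hx.dv _ s x hz]; ring
  have sP : Sm fun z => avz z * P z := hφ.mul h.smP
  have key : ∀ x, dt (fun z => avz z * v i z) (s, x) =
      (∑ j, dx j (F j) (s, x)) + (v i (s, x) * lap avz (s, x)
        + ∑ j, v i (s, x) * v j (s, x) * dx j avz (s, x)) - dx i (fun z => avz z * P z) (s, x)
        + P (s, x) * dx i avz (s, x) - c i s * avz (s, x) := by
    intro x
    have e1 : dt (fun z => avz z * v i z) (s, x) = _ := dv_mul _ hφ (h.sm i) (s, x)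
    have e2 : dv ((1, 0) : Z) avz (s, x) = 0 := avz_dt _
    have e3 : dv ((1, 0) : Z) (v i) (s, x) = lap (v i) (s, x) - c i s - dx i P (s, x)
      - ∑ j, v j (s, x) * dx j (v i) (s, x) := by
      have := h.eq s hs' x i; unfold dt at this; linarith
    have e4 : dx i (fun z => avz z * P z) (s, x) = _ := dv_mul _ hφ h.smP (s, x)
    have e5 : ∀ j, dx j (F j) (s, x) = (avz (s, x) * dx j (dx j (v i)) (s, x)
        + dx j (v i) (s, x) * dx j avz (s, x) - (v i (s, x) * dx j (dx j avz) (s, x)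
        + dx j avz (s, x) * dx j (v i) (s, x))) - (avz (s, x) * (v j (s, x) * dx j (v i) (s, x)
        + v i (s, x) * dx j (v j) (s, x)) + v j (s, x) * v i (s, x) * dx j avz (s, x)) := fun j => by
      have a1 : dx j (F j) (s, x) = _ := dv_sub (0, eb j) ((sF1 j).sub (sF2 j)) (sF3 j) (s, x)
      have a2 := dv_sub (0, eb j) (sF1 j) (sF2 j) (s, x)
      have a3 := dv_mul (0, eb j) hφ ((h.sm j).mul (h.sm i)) (s, x)
      have a4 := dv_mul (0, eb j) (h.sm j) (h.sm i) (s, x)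
      have a5 := dv_mul (0, eb j) hφ (dv_smooth (0, eb j) (h.sm i)) (s, x)
      have a6 := dv_mul (0, eb j) (h.sm i) (hdφ j) (s, x)
      rw [a1, a2, a3, a4]
      unfold dx at a6 ⊢
      rw [a5, a6]
    have hdiv := h.div s hs' x
    rw [e1, e2, e3, e4]
    simp only [e5]
    unfold lap
    unfold dx at hdiv ⊢
    simp only [Fin.sum_univ_three] at hdiv ⊢
    have hd2 : dv (0, eb 2) (v 2) (s, x) = - dv (0, eb 0) (v 0) (s, x) - dv (0, eb 1) (v 1) (s, x) := by
      linarith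
    rw [hd2]
    ring
  have hin : ∀ {f : Z → ℝ}, Continuous f → XSupp 1 f → Integrable fun x => f (s, x) :=
    fun hf hz => hz.integrable hf s
  have i1' : ∀ j, Integrable fun x => dx j (F j) (s, x) := fun j =>
    hin (dv_smooth _ (sF j)).continuous ((xF j).dv _)
  have i1 : Integrable fun x => ∑ j, dx j (F j) (s, x) := integrable_finsetSum _ fun j _ => i1' j
  have i2 : Integrable fun x => (v i (s, x) * lap avz (s, x)
        + ∑ j, v i (s, x) * v j (s, x) * dx j avz (s, x)) := by
    refine hin (f := fun z => v i z * lap avz z + ∑ j, v i z * v j z * dx j avz z) ?_ ?_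
    · exact (((h.sm i).mul (lap_smooth hφ)).add (ContDiff.sum fun j _ =>
        (((h.sm i).mul (h.sm j)).mul (hdφ j)))).continuous
    · intro s x hz
      have z1 : ∀ j, dx j avz (s, x) = 0 := fun j => hx.dv _ s x hz
      have z2 : lap avz (s, x) = 0 := Finset.sum_eq_zero fun j _ => (hx.dv _).dv _ s x hz
      simp [z1, z2]
  have i3 : Integrable fun x => dx i (fun z => avz z * P z) (s, x) :=
    hin (dv_smooth _ sP).continuous ((hx.mul_right P).dv _)
  have i4 : Integrable fun x => P (s, x) * dx i avz (s, x) :=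
    hin (f := fun z => P z * dx i avz z) (h.smP.mul (hdφ i)).continuous ((hx.dv _).mul_left P)
  have i5 : Integrable fun x => c i s * avz (s, x) :=
    (hin hφ.continuous hx).const_mul _
  have j2 : Integrable fun x => (∑ j, dx j (F j) (s, x)) + (v i (s, x) * lap avz (s, x)
        + ∑ j, v i (s, x) * v j (s, x) * dx j avz (s, x)) := i1.add i2
  have j3 : Integrable fun x => (∑ j, dx j (F j) (s, x)) + (v i (s, x) * lap avz (s, x)
        + ∑ j, v i (s, x) * v j (s, x) * dx j avz (s, x)) - dx i (fun z => avz z * P z) (s, x) :=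
    j2.sub i3
  have j4 : Integrable fun x => (∑ j, dx j (F j) (s, x)) + (v i (s, x) * lap avz (s, x)
        + ∑ j, v i (s, x) * v j (s, x) * dx j avz (s, x)) - dx i (fun z => avz z * P z) (s, x)
        + P (s, x) * dx i avz (s, x) := j3.add i4
  simp only [key] at hz
  rw [integral_sub j4 i5, integral_add j3 i4, integral_sub j2 i3, integral_add i1 i2,
    integral_finsetSum _ fun j _ => i1' j, integral_const_mul,
    (hx.mul_right P).integral_dx sP] at hz
  simp only [(xF _).integral_dx (sF _)] at hz
  have : ∫ x, avz (s, x) = 1 := avk_integral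
  rw [this] at hz
  unfold mfor
  simp at hz ⊢
  linarith

/-- The moment `∫ vᵢ ψ`. -/
def amo (v : Fin 3 → Z → ℝ) (ψ : Z → ℝ) (i : Fin 3) (s : ℝ) : ℝ := ∫ x, v i (s, x) * ψ (s, x)

/-- The mean-free field `vᵢ ψ - aᵢ φ`. -/
def qf (v : Fin 3 → Z → ℝ) (ψ : Z → ℝ) (s : ℝ) (i : Fin 3) (x : E3) : ℝ :=
  v i (s, x) * ψ (s, x) - amo v ψ i s * avk x

lemma qf_smooth (hv : ∀ i, Sm (v i)) {ψ : Z → ℝ} (hψ : Sm ψ) (s : ℝ) (i : Fin 3) :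
    Sm (qf v ψ s i) :=
  ((slice_smooth (hv i) s).mul (slice_smooth hψ s)).sub (contDiff_const.mul avk_smooth)

lemma qf_zero {ψ : Z → ℝ} (hx : XSupp 1 ψ) (s : ℝ) (i : Fin 3) (x : E3) (h : 1 < ‖x‖) :
    qf v ψ s i x = 0 := by
  unfold qf; rw [hx s x h, avk_zero' _ h]; ring

lemma qf_integral (hv : ∀ i, Sm (v i)) {ψ : Z → ℝ} (hψ : Sm ψ) (hx : XSupp 1 ψ) (s : ℝ)
    (i : Fin 3) : ∫ x, qf v ψ s i x = 0 := by
  unfold qf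
  rw [integral_sub, integral_const_mul, avk_integral]
  · unfold amo; ring
  · exact (hx.mul_left (v i)).integrable ((hv i).mul hψ).continuous s
  · exact (avz_xsupp.integrable avz_smooth.continuous s).const_mul _

/-- `∑ ∂ᵢ qᵢ`. -/
def qdiv (v : Fin 3 → Z → ℝ) (ψ : Z → ℝ) (s : ℝ) (x : E3) : ℝ := ∑ i, dv (eb i) (qf v ψ s i) x

lemma CSol.qdiv_eq (h : CSol v P c) {ψ : Z → ℝ} (hψ : Sm ψ) {s : ℝ} (hs : s ∈ Icc (-1 : ℝ) 0)
    (x : E3) : qdiv v ψ s x = ∑ i, v i (s, x) * dx i ψ (s, x)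
      - ∑ i, amo v ψ i s * dx i avz (s, x) := by
  have hdiv := h.div s hs x
  have e : ∀ i, dv (eb i) (qf v ψ s i) x = v i (s, x) * dx i ψ (s, x)
      + ψ (s, x) * dx i (v i) (s, x) - amo v ψ i s * dx i avz (s, x) := fun i => by
    have hs1 := slice_smooth (h.sm i) s
    have hs2 := slice_smooth hψ s
    have a1 : dv (eb i) (qf v ψ s i) x = _ :=
      dv_sub (eb i) (hs1.mul hs2) (contDiff_const.mul avk_smooth) x
    rw [a1, dv_mul _ hs1 hs2, dv_const_mul _ _ avk_smooth, dx_slice (h.sm i), dx_slice hψ,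
      ← dx_slice avz_smooth]
    rfl
  unfold qdiv
  simp only [e]
  rw [Finset.sum_sub_distrib, Finset.sum_add_distrib, ← Finset.mul_sum, hdiv]
  ring

lemma qdiv_continuous (hv : ∀ i, Sm (v i)) {ψ : Z → ℝ} (hψ : Sm ψ) (s : ℝ) :
    Continuous (qdiv v ψ s) :=
  continuous_finsetSum _ fun i _ => (dv_smooth _ (qf_smooth hv hψ s i)).continuous

lemma qdiv_zero {ψ : Z → ℝ} (hx : XSupp 1 ψ) (s : ℝ) (x : E3) (h : 1 < ‖x‖) :
    qdiv v ψ s x = 0 :=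
  Finset.sum_eq_zero fun i _ => dv_zero_of_zero (fun y hy => qf_zero hx s i y hy) _ x h

/-- Fubini's theorem for the Newtonian potential. -/
lemma integral_mul_newt {g h : E3 → ℝ} (hg : Integrable g) (hgc : Continuous g)
    (hc : Continuous h) (h0 : ∀ x, 1 < ‖x‖ → h x = 0) :
    Integrable (fun y => g y * newt h y) ∧
    ∫ x, (∫ y, g y / ‖x - y‖) * h x = ∫ y, g y * newt h y := by
  have hm : Measurable fun p : E3 × E3 => h p.1 * g p.2 * ‖p.1 - p.2‖⁻¹ := by fun_prop
  have ha : Continuous fun x => |h x| := hc.abs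
  have ha0 : ∀ x, 1 < ‖x‖ → |h x| = 0 := fun x hx => by rw [h0 x hx, abs_zero]
  set K := Real.sqrt (∫ x, |h x| ^ 2) * Real.sqrt (invSqMass * 1) + 2 * ∫ x, |h x| with hK
  have ia : Integrable fun x => |h x| := integrable_of_zero ha ha0
  have hb : ∀ y, newt (fun x => |h x|) y ≤ K := fun y => by
    have h1 := (abs_le.1 (newt_split ha ha0 one_pos y).2).2
    have h2 : ∫ x, |h x| * newtR 1 y x ≤ 2 * ∫ x, |h x| := by
      rw [← integral_const_mul]
      refine integral_mono (integrable_of_zero (ha.mul (newtR_smooth 1 y).continuous)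
        (R := 1) fun x hx => by simp [h0 x hx]) (ia.const_mul _) fun x => ?_
      have : newtR 1 y x ≤ 2 := by
        unfold newtR
        simp only [inv_one, one_smul, one_mul]
        by_cases hle : 1 / 2 ≤ ‖x - y‖
        · refine (newtReg_le _).trans ?_
          rw [inv_le_comm₀ (by linarith) (by norm_num)]; linarith
        · unfold newtReg invSqrtReg
          rw [Real.smoothTransition.zero_of_nonpos]
          · simp
          · nlinarith [norm_nonneg (x - y)]
      simp only
      nlinarith [abs_nonneg (h x)]
    have h3 : Real.sqrt (∫ x in closedBall y 1, |h x| ^ 2) ≤ Real.sqrt (∫ x, |h x| ^ 2) := by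
      refine Real.sqrt_le_sqrt (setIntegral_le_integral ?_ ?_)
      · exact integrable_of_zero (ha.pow 2) (R := 1) fun x hx => by simp [h0 x hx]
      · exact Filter.Eventually.of_forall fun x => sq_nonneg _
    have h4 := mul_le_mul_of_nonneg_right h3 (Real.sqrt_nonneg (invSqMass * 1))
    rw [hK]; linarith
  have hi : Integrable (fun p : E3 × E3 => h p.1 * g p.2 * ‖p.1 - p.2‖⁻¹)
      ((volume : Measure E3).prod volume) := by
    rw [integrable_prod_iff' hm.aestronglyMeasurable]
    constructor
    · refine Filter.Eventually.of_forall fun y => ?_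
      have := (newt_split hc h0 one_pos y).1.const_mul (g y)
      refine this.congr (Filter.Eventually.of_forall fun x => ?_)
      simp only; ring
    · refine (hg.abs.mul_const K).mono' hm.aestronglyMeasurable.norm.prod_swap.integral_prod_right'
        (Filter.Eventually.of_forall fun y => ?_)
      have e : ∫ x, ‖h x * g y * ‖x - y‖⁻¹‖ = |g y| * newt (fun x => |h x|) y := by
        unfold newt
        rw [← integral_const_mul]
        refine integral_congr_ae (Filter.Eventually.of_forall fun x => ?_)
        simp only [norm_mul, norm_inv, Real.norm_eq_abs, abs_norm]; ring
      have e0 : 0 ≤ ∫ x, ‖h x * g y * ‖x - y‖⁻¹‖ := integral_nonneg fun _ => norm_nonneg _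
      simp only
      rw [Real.norm_of_nonneg e0, e]
      exact mul_le_mul_of_nonneg_left (hb y) (abs_nonneg _)
  have e1 : ∀ y, ∫ x, h x * g y * ‖x - y‖⁻¹ = g y * newt h y := fun y => by
    unfold newt
    rw [← integral_const_mul]
    exact integral_congr_ae (Filter.Eventually.of_forall fun x => by simp only; ring)
  have e2 : ∀ x, ∫ y, h x * g y * ‖x - y‖⁻¹ = (∫ y, g y / ‖x - y‖) * h x := fun x => by
    rw [← integral_mul_const]
    exact integral_congr_ae (Filter.Eventually.of_forall fun y => by simp only; rw [div_eq_mul_inv]; ring)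
  constructor
  · have := hi.integral_prod_right
    simpa only [e1] using this
  · have := integral_integral_swap (f := fun x y => h x * g y * ‖x - y‖⁻¹) hi
    simpa only [e1, e2] using this

/-- The localised energy identity with the pressure and the acceleration eliminated. -/
lemma CSol.energy_newt (h : CSol v P c) {ψ : Z → ℝ} (hψ : Sm ψ) (hx : XSupp 1 ψ) :
    ∀ᵐ s, s ∈ Ioo (-1 : ℝ) 0 → Integrable (fun y => G2 v (s, y)) ∧
    Integrable (fun y => gp v (s, y) * newt (qdiv v ψ s) y) ∧
    HasDerivAt (fun s => 1 / 2 * ∫ x, S2 v (s, x) * ψ (s, x))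
      (- (∫ x, G2 v (s, x) * ψ (s, x)) + 1 / 2 * (∫ x, S2 v (s, x) * (dt ψ (s, x) + lap ψ (s, x)))
      + 1 / 2 * (∫ x, S2 v (s, x) * ∑ j, v j (s, x) * dx j ψ (s, x))
      + 1 / (4 * Real.pi) * (∫ y, gp v (s, y) * newt (qdiv v ψ s) y)
      - ∑ i, mfor v i s * amo v ψ i s) s := by
  filter_upwards [h.pres, h.fin] with s hp hf hs
  have hs' : s ∈ Icc (-1 : ℝ) 0 := Ioo_subset_Icc_self hs
  have hG : Integrable fun y => G2 v (s, y) := by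
    have := integrable_toReal_of_lintegral_ne_top
      (f := fun y => ENNReal.ofReal (G2 v (s, y)))
      ((G2_smooth h.sm).continuous.comp (by fun_prop : Continuous fun y : E3 => (s, y))).measurable.ennreal_ofReal.aemeasurable
      (hf hs').ne
    simpa only [ENNReal.toReal_ofReal (G2_nonneg v _)] using this
  have hgc : Continuous fun y => gp v (s, y) :=
    (gp_smooth h.sm).continuous.comp (by fun_prop : Continuous fun y : E3 => (s, y))
  have hgi : Integrable fun y => gp v (s, y) := by
    refine hG.mono' hgc.aestronglyMeasurable (Filter.Eventually.of_forall fun y => ?_)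
    rw [Real.norm_eq_abs]; exact abs_gp_le v _
  obtain ⟨hi, e⟩ := integral_mul_newt hgi hgc (qdiv_continuous h.sm hψ s) (qdiv_zero hx s)
  refine ⟨hG, hi, (h.energy hψ hx hs').congr_deriv ?_⟩
  have e1 : ∫ x, P (s, x) * qdiv v ψ s x = 1 / (4 * Real.pi) *
      ∫ y, gp v (s, y) * newt (qdiv v ψ s) y := by
    rw [← e, ← integral_const_mul]
    refine integral_congr_ae (Filter.Eventually.of_forall fun x => ?_)
    simp only
    rw [hp hs' x]; ring
  have hdφ : ∀ i, Sm (dx i avz) := fun i => dv_smooth _ avz_smooth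
  have i1 : Integrable fun x => P (s, x) * ∑ i, v i (s, x) * dx i ψ (s, x) := by
    refine XSupp.integrable (R := 1) (f := fun z => P z * ∑ i, v i z * dx i ψ z) ?_ ?_ s
    · intro s x hz
      have z1 : ∀ j, dx j ψ (s, x) = 0 := fun j => hx.dv _ s x hz
      simp [z1]
    · exact (h.smP.mul (ContDiff.sum fun i _ => (h.sm i).mul (dv_smooth _ hψ))).continuous
  have i2' : ∀ i, Integrable fun x => amo v ψ i s * (P (s, x) * dx i avz (s, x)) := fun i =>
    (XSupp.integrable (f := fun z => P z * dx i avz z) ((avz_xsupp.dv _).mul_left P)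
      (h.smP.mul (hdφ i)).continuous s).const_mul _
  have i2 : Integrable fun x => ∑ i, amo v ψ i s * (P (s, x) * dx i avz (s, x)) :=
    integrable_finsetSum _ fun i _ => i2' i
  have e2 : ∫ x, P (s, x) * qdiv v ψ s x = (∫ x, P (s, x) * ∑ i, v i (s, x) * dx i ψ (s, x))
      - ∑ i, amo v ψ i s * ∫ x, P (s, x) * dx i avz (s, x) := by
    simp only [← integral_const_mul]
    rw [← integral_finsetSum _ fun i _ => i2' i, ← integral_sub i1 i2]
    refine integral_congr_ae (Filter.Eventually.of_forall fun x => ?_)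
    simp only
    rw [h.qdiv_eq hψ hs' x, mul_sub]
    congr 1
    rw [Finset.mul_sum]
    exact Finset.sum_congr rfl fun i _ => by ring
  have e3 : ∑ i, c i s * ∫ x, v i (s, x) * ψ (s, x) = (∑ i, mfor v i s * amo v ψ i s)
      + ∑ i, amo v ψ i s * ∫ x, P (s, x) * dx i avz (s, x) := by
    rw [← Finset.sum_add_distrib]
    refine Finset.sum_congr rfl fun i _ => ?_
    rw [h.acceleration hs i]
    unfold amo; ring
  rw [e3, ← e1, e2]
  ring

end

/-! ### Bounds at a fixed time -/

/-- The weight `(1 + |y|)⁻³`. -/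
def wt (y : E3) : ℝ := ((1 + ‖y‖) ^ 3)⁻¹

lemma wt_pos (y : E3) : 0 < wt y := by unfold wt; positivity

lemma wt_le_one (y : E3) : wt y ≤ 1 :=
  inv_le_one_of_one_le₀ (one_le_pow₀ (by linarith [norm_nonneg y]))

lemma wt_continuous : Continuous wt := by
  unfold wt
  exact Continuous.inv₀ (by fun_prop) fun y => by positivity

lemma wt_ball {y : E3} (h : ‖y‖ ≤ 2) : 1 ≤ 27 * wt y := by
  unfold wt
  rw [← div_eq_mul_inv, le_div_iff₀ (by positivity)]
  have : (1 + ‖y‖) ^ 3 ≤ 3 ^ 3 := by gcongr; linarith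
  linarith

lemma wt_far {y : E3} (h : 2 ≤ ‖y‖) : ‖y‖⁻¹ ^ 3 ≤ 27 * wt y := by
  unfold wt
  rw [← inv_pow, show (27 : ℝ) = 3 ^ 3 by norm_num, ← mul_pow]
  gcongr
  rw [← div_eq_mul_inv, le_div_iff₀ (by positivity), inv_mul_le_iff₀ (by linarith)]
  linarith

/-- The weighted dissipation. -/
def pv (v : Fin 3 → Z → ℝ) (s : ℝ) : ℝ := ∫ y, G2 v (s, y) * wt y

section
variable {v : Fin 3 → Z → ℝ}

lemma continuous_slice {f : Z → ℝ} (hf : Continuous f) (s : ℝ) : Continuous fun y : E3 => f (s, y) :=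
  hf.comp (by fun_prop)

lemma pv_nonneg (v : Fin 3 → Z → ℝ) (s : ℝ) : 0 ≤ pv v s :=
  integral_nonneg fun y => mul_nonneg (G2_nonneg v _) (wt_pos y).le

lemma pv_integrable (hv : ∀ i, Sm (v i)) {s : ℝ} (hG : Integrable fun y => G2 v (s, y)) :
    Integrable fun y => G2 v (s, y) * wt y := by
  refine hG.mono' ((continuous_slice (G2_smooth hv).continuous s).mul
    wt_continuous).aestronglyMeasurable (Filter.Eventually.of_forall fun y => ?_)
  rw [Real.norm_of_nonneg (mul_nonneg (G2_nonneg v _) (wt_pos y).le)]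
  exact mul_le_of_le_one_right (G2_nonneg v _) (wt_le_one y)

lemma G2_ball_le (hv : ∀ i, Sm (v i)) {s : ℝ} (hG : Integrable fun y => G2 v (s, y)) :
    ∫ y in closedBall (0 : E3) 2, G2 v (s, y) ≤ 27 * pv v s := by
  have hi := (pv_integrable hv hG).const_mul 27
  calc ∫ y in closedBall (0 : E3) 2, G2 v (s, y)
      ≤ ∫ y in closedBall (0 : E3) 2, 27 * (G2 v (s, y) * wt y) := by
        refine setIntegral_mono_on hG.integrableOn hi.integrableOn measurableSet_closedBall
          fun y hy => ?_
        have := wt_ball (y := y) (by simpa using hy)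
        nlinarith [G2_nonneg v (s, y)]
    _ ≤ ∫ y, 27 * (G2 v (s, y) * wt y) :=
        setIntegral_le_integral hi (Filter.Eventually.of_forall fun y =>
          mul_nonneg (by norm_num) (mul_nonneg (G2_nonneg v _) (wt_pos y).le))
    _ = 27 * pv v s := by rw [integral_const_mul]; rfl

lemma gs_slice_le (hv : ∀ i, Sm (v i)) (i : Fin 3) (s : ℝ) (y : E3) :
    gs (fun y => v i (s, y)) y ≤ G2 v (s, y) := by
  unfold gs G2
  simp only [dx_slice (hv i)]
  exact Finset.single_le_sum (f := fun i => ∑ j, dx j (v i) (s, y) ^ 2)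
    (fun i _ => Finset.sum_nonneg fun _ _ => sq_nonneg _) (Finset.mem_univ i)

lemma sq_le_S2 (v : Fin 3 → Z → ℝ) (i : Fin 3) (z : Z) : v i z ^ 2 ≤ S2 v z :=
  Finset.single_le_sum (f := fun i => v i z ^ 2) (fun i _ => sq_nonneg _) (Finset.mem_univ i)

lemma slice_local : ∃ C : ℝ, 0 < C ∧ ∀ (v : Fin 3 → Z → ℝ), (∀ i, Sm (v i)) → ∀ s : ℝ,
    (∀ i, ∫ x, avk x * v i (s, x) = 0) → Integrable (fun y => G2 v (s, y)) →
    ∫ y in closedBall (0 : E3) 2, S2 v (s, y) ≤ C * pv v s ∧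
    ∫ y in closedBall (0 : E3) 1, S2 v (s, y) ^ 2 ≤ C * pv v s ^ 2 := by
  obtain ⟨C, hC, H⟩ := local_estimates
  refine ⟨81 * 81 * C, by positivity, fun v hv s hm hG => ?_⟩
  have hb := G2_ball_le hv hG
  have hp := pv_nonneg v s
  have hs := fun i => slice_smooth (hv i) s
  have hg : ∀ i, ∫ y in closedBall (0 : E3) 2, gs (fun y => v i (s, y)) y ≤ 27 * pv v s := fun i =>
    (setIntegral_mono (integrableOn_ball (gs_continuous (hs i)) _ _) hG.integrableOn
      fun y => gs_slice_le hv i s y).trans hb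
  have hg0 : ∀ i, 0 ≤ ∫ y in closedBall (0 : E3) 2, gs (fun y => v i (s, y)) y := fun _ =>
    integral_nonneg fun y => gs_nonneg _ _
  constructor
  · unfold S2
    rw [integral_finsetSum _ fun i _ => integrableOn_ball ((hs i).pow 2).continuous _ _]
    calc _ ≤ ∑ _i : Fin 3, C * (27 * pv v s) := Finset.sum_le_sum fun i _ =>
          (H _ (hs i) (hm i)).1.trans (mul_le_mul_of_nonneg_left (hg i) hC.le)
      _ ≤ _ := by simp only [Finset.sum_const, Finset.card_univ, Fintype.card_fin, nsmul_eq_mul]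
                  push_cast; nlinarith [mul_nonneg hC.le hp]
  · have h4 : ∀ y, S2 v (s, y) ^ 2 ≤ ∑ i, 3 * v i (s, y) ^ 4 := fun y => by
      unfold S2
      simp only [Fin.sum_univ_three]
      nlinarith [sq_nonneg (v 0 (s, y) ^ 2 - v 1 (s, y) ^ 2),
        sq_nonneg (v 0 (s, y) ^ 2 - v 2 (s, y) ^ 2), sq_nonneg (v 1 (s, y) ^ 2 - v 2 (s, y) ^ 2)]
    have hi : ∀ i, IntegrableOn (fun y => 3 * v i (s, y) ^ 4) (closedBall (0 : E3) 1) := fun i =>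
      integrableOn_ball (continuous_const.mul ((hs i).pow 4).continuous) _ _
    calc _ ≤ ∫ y in closedBall (0 : E3) 1, ∑ i, 3 * v i (s, y) ^ 4 :=
          setIntegral_mono (integrableOn_ball
            ((continuous_slice (S2_smooth hv).continuous s).pow 2) _ _)
            (integrable_finsetSum _ fun i _ => hi i) h4
      _ = ∑ i, 3 * ∫ y in closedBall (0 : E3) 1, v i (s, y) ^ 4 := by
          rw [integral_finsetSum _ fun i _ => hi i]; simp only [integral_const_mul]
      _ ≤ ∑ _i : Fin 3, 3 * (C * (27 * pv v s) ^ 2) := Finset.sum_le_sum fun i _ =>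
          mul_le_mul_of_nonneg_left ((H _ (hs i) (hm i)).2.trans
            (mul_le_mul_of_nonneg_left (pow_le_pow_left₀ (hg0 i) (hg i) 2) hC.le)) (by norm_num)
      _ ≤ _ := by simp only [Finset.sum_const, Finset.card_univ, Fintype.card_fin, nsmul_eq_mul]
                  push_cast; nlinarith [mul_nonneg hC.le (sq_nonneg (pv v s))]

lemma integral_eq_ball {f : E3 → ℝ} (h : ∀ x, 1 < ‖x‖ → f x = 0) :
    ∫ x, f x = ∫ x in closedBall (0 : E3) 1, f x := by
  symm
  apply setIntegral_eq_integral_of_forall_compl_eq_zero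
  intro x hx
  exact h x (by simpa using hx)

lemma S2_ball_one_le (hv : ∀ i, Sm (v i)) (s : ℝ) :
    ∫ y in closedBall (0 : E3) 1, S2 v (s, y) ≤ ∫ y in closedBall (0 : E3) 2, S2 v (s, y) :=
  setIntegral_ball_mono (continuous_slice (S2_smooth hv).continuous s) (fun _ => S2_nonneg v _)
    (closedBall_subset_closedBall (by norm_num))

/-- The term `∫ |v|² f` with `f` bounded and compactly supported. -/
lemma abs_integral_S2_mul_le (hv : ∀ i, Sm (v i)) {f : E3 → ℝ} (hf : Continuous f)
    (h : ∀ x, 1 < ‖x‖ → f x = 0) {K : ℝ} (hK : ∀ x, |f x| ≤ K) (s : ℝ) :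
    |∫ x, S2 v (s, x) * f x| ≤ K * ∫ y in closedBall (0 : E3) 2, S2 v (s, y) := by
  have hS := continuous_slice (S2_smooth hv).continuous s
  have hK0 : 0 ≤ K := (abs_nonneg _).trans (hK 0)
  rw [integral_eq_ball fun x hx => by rw [h x hx, mul_zero]]
  refine abs_integral_le_integral_abs.trans ?_
  refine le_trans ?_ (mul_le_mul_of_nonneg_left (S2_ball_one_le hv s) hK0)
  rw [← integral_const_mul]
  refine setIntegral_mono (integrableOn_ball (hS.mul hf).abs _ _)
    (integrableOn_ball (continuous_const.mul hS) _ _) fun x => ?_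
  simp only [abs_mul, abs_of_nonneg (S2_nonneg v (s, x))]
  nlinarith [hK x, S2_nonneg v (s, x)]

lemma mfor_bound : ∃ C : ℝ, 0 < C ∧ ∀ (v : Fin 3 → Z → ℝ), (∀ i, Sm (v i)) → ∀ s ∈ Icc (-1 : ℝ) 0,
    (∀ i, ∫ x, avk x * v i (s, x) = 0) → Integrable (fun y => G2 v (s, y)) →
    ∀ i, |mfor v i s| ≤ C * (Real.sqrt (pv v s) + pv v s) := by
  obtain ⟨C, hC, H⟩ := slice_local
  have hdφ : ∀ i, Sm (dx i avz) := fun i => dv_smooth _ avz_smooth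
  have hxl : XSupp 1 (lap avz) := fun s x hz =>
    Finset.sum_eq_zero fun j _ => (avz_xsupp.dv _).dv _ s x hz
  obtain ⟨K1, hK1, HK1⟩ := hxl.exists_bound (lap_smooth avz_smooth).continuous
  choose K2 hK2 HK2 using fun j => (avz_xsupp.dv (0, eb j)).exists_bound (hdφ j).continuous
  set K := K2 0 + K2 1 + K2 2 with hKdef
  have hK : ∀ j, K2 j ≤ K := fun j => by
    have := hK2 0; have := hK2 1; have := hK2 2
    fin_cases j <;> simp only [hKdef] <;> simp <;> linarith
  have hK0 : 0 < K := by have := hK2 0; have := hK2 1; have := hK2 2; linarith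
  set M := (volume : Measure E3).real (closedBall 0 1)
  refine ⟨K1 * (Real.sqrt C * Real.sqrt M) + 3 * K * C + 1, by positivity, fun v hv s hs hm hG i => ?_⟩
  obtain ⟨h2, -⟩ := H v hv s hm hG
  have h2' := (S2_ball_one_le hv s).trans h2
  have hp := pv_nonneg v s
  have hvi := continuous_slice (hv i).continuous s
  have hS := continuous_slice (S2_smooth hv).continuous s
  have e0 : mfor v i s = ∫ x in closedBall (0 : E3) 1, (v i (s, x) * lap avz (s, x)
      + ∑ j, v i (s, x) * v j (s, x) * dx j avz (s, x)) := by
    unfold mfor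
    refine integral_eq_ball fun x hx => ?_
    have z1 : ∀ j, dx j avz (s, x) = 0 := fun j => avz_xsupp.dv _ s x hx
    simp [z1, hxl s x hx]
  rw [e0]
  have hb : ∀ x, |v i (s, x) * lap avz (s, x) + ∑ j, v i (s, x) * v j (s, x) * dx j avz (s, x)|
      ≤ K1 * |v i (s, x)| + 3 * K * S2 v (s, x) := fun x => by
    have a1 : |v i (s, x) * lap avz (s, x)| ≤ K1 * |v i (s, x)| := by
      rw [abs_mul]; nlinarith [abs_nonneg (v i (s, x)), HK1 s hs x]
    have a2 : ∀ j, |v i (s, x) * v j (s, x) * dx j avz (s, x)| ≤ K * S2 v (s, x) := fun j => by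
      have b1 : |v i (s, x) * v j (s, x)| ≤ S2 v (s, x) := by
        rw [abs_le]
        constructor <;> nlinarith [sq_le_S2 v i (s, x), sq_le_S2 v j (s, x),
          sq_nonneg (v i (s, x) + v j (s, x)), sq_nonneg (v i (s, x) - v j (s, x))]
      have b2 : |dx j avz (s, x)| ≤ K := (HK2 j s hs x).trans (hK j)
      rw [abs_mul, mul_comm K]
      exact mul_le_mul b1 b2 (abs_nonneg _) (S2_nonneg v _)
    calc _ ≤ |v i (s, x) * lap avz (s, x)| + ∑ j, |v i (s, x) * v j (s, x) * dx j avz (s, x)| :=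
          (abs_add_le _ _).trans (by gcongr; exact Finset.abs_sum_le_sum_abs _ _)
      _ ≤ K1 * |v i (s, x)| + ∑ _j : Fin 3, K * S2 v (s, x) := by
          gcongr with j; exact a2 j
      _ = _ := by simp only [Finset.sum_const, Finset.card_univ, Fintype.card_fin, nsmul_eq_mul]
                  push_cast; ring
  have h1 : ∫ x in closedBall (0 : E3) 1, |v i (s, x)| ≤
      Real.sqrt C * Real.sqrt M * Real.sqrt (pv v s) := by
    have := integral_mul_le_sqrt (μ := volume.restrict (closedBall (0 : E3) 1))
      (f := fun x => |v i (s, x)|) (g := fun _ => (1 : ℝ)) hvi.abs.aestronglyMeasurable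
      aestronglyMeasurable_const (integrableOn_ball (hvi.abs.pow 2) _ _)
      (integrableOn_ball (by fun_prop) _ _)
    simp only [mul_one, sq_abs, one_pow] at this
    refine ((le_abs_self _).trans this).trans ?_
    have e1 : ∫ x in closedBall (0 : E3) 1, (1 : ℝ) = M := by simp [M]
    have e2 : ∫ x in closedBall (0 : E3) 1, v i (s, x) ^ 2 ≤ C * pv v s :=
      (setIntegral_mono (integrableOn_ball (hvi.pow 2) _ _) (integrableOn_ball hS _ _)
        fun x => sq_le_S2 v i (s, x)).trans h2'
    rw [e1]
    calc _ ≤ Real.sqrt (C * pv v s) * Real.sqrt M := by gcongr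
      _ = _ := by rw [Real.sqrt_mul hC.le]; ring
  refine abs_integral_le_integral_abs.trans ?_
  have hc1 : Continuous fun x => v i (s, x) * lap avz (s, x)
      + ∑ j, v i (s, x) * v j (s, x) * dx j avz (s, x) :=
    (hvi.mul (continuous_slice (lap_smooth avz_smooth).continuous s)).add
      (continuous_finsetSum _ fun j _ => (hvi.mul (continuous_slice (hv j).continuous s)).mul
        (continuous_slice (hdφ j).continuous s))
  calc _ ≤ ∫ x in closedBall (0 : E3) 1, (K1 * |v i (s, x)| + 3 * K * S2 v (s, x)) :=
        setIntegral_mono (integrableOn_ball hc1.abs _ _) (integrableOn_ball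
          ((continuous_const.mul hvi.abs).add (continuous_const.mul hS)) _ _) hb
    _ = K1 * (∫ x in closedBall (0 : E3) 1, |v i (s, x)|)
        + 3 * K * ∫ x in closedBall (0 : E3) 1, S2 v (s, x) := by
        have j1 : IntegrableOn (fun x => K1 * |v i (s, x)|) (closedBall (0 : E3) 1) :=
          integrableOn_ball (continuous_const.mul hvi.abs) _ _
        have j2 : IntegrableOn (fun x => 3 * K * S2 v (s, x)) (closedBall (0 : E3) 1) :=
          integrableOn_ball (continuous_const.mul hS) _ _
        rw [integral_add j1 j2, integral_const_mul, integral_const_mul]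
    _ ≤ K1 * (Real.sqrt C * Real.sqrt M * Real.sqrt (pv v s)) + 3 * K * (C * pv v s) := by gcongr
    _ ≤ _ := by
        have := Real.sqrt_nonneg (pv v s)
        have : 0 ≤ K1 * (Real.sqrt C * Real.sqrt M) := by positivity
        have : 0 ≤ 3 * K * C := by positivity
        nlinarith

/-- First moments against `ψ`. -/
lemma moment_bound : ∃ C : ℝ, 0 < C ∧ ∀ (v : Fin 3 → Z → ℝ), (∀ i, Sm (v i)) → ∀ (r s₀ : ℝ) (y₀ : E3),
    0 < r → ∀ (s B : ℝ), (∫ x, S2 v (s, x) * psi r s₀ y₀ (s, x) ≤ B) →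
    (∀ i, |amo v (psi r s₀ y₀) i s| ≤ C * Real.sqrt B) ∧
    (∫ x, ∑ i, |qf v (psi r s₀ y₀) s i x| ≤ C * Real.sqrt B) := by
  obtain ⟨C, hC, H⟩ := integral_psi_le
  refine ⟨6 * Real.sqrt C, by positivity, fun v hv r s₀ y₀ hr s B hB => ?_⟩
  set ψ := psi r s₀ y₀ with hψdef
  have hψ : Sm ψ := psi_smooth hr s₀ y₀
  have hx : XSupp 1 ψ := psi_xsupp r s₀ y₀
  have h0 : ∀ z, 0 ≤ ψ z := psi_nonneg r s₀ y₀
  have hψc := continuous_slice hψ.continuous s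
  have hvc := fun i => continuous_slice (hv i).continuous s
  have hSc := continuous_slice (S2_smooth hv).continuous s
  have hzero : ∀ x, 1 < ‖x‖ → ψ (s, x) = 0 := fun x => hx s x
  have h1 : ∀ i, ∫ x, |v i (s, x)| * ψ (s, x) ≤ Real.sqrt C * Real.sqrt B := fun i => by
    have hq := hψc.sqrt
    have := integral_mul_le_sqrt (μ := volume)
      (f := fun x => |v i (s, x)| * Real.sqrt (ψ (s, x))) (g := fun x => Real.sqrt (ψ (s, x)))
      ((hvc i).abs.mul hq).aestronglyMeasurable hq.aestronglyMeasurable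
      (integrable_of_zero (R := 1) (((hvc i).abs.mul hq).pow 2) fun x hx => by simp [hzero x hx])
      (integrable_of_zero (R := 1) (hq.pow 2) fun x hx => by simp [hzero x hx])
    simp only [mul_pow, sq_abs, Real.sq_sqrt (h0 _), mul_assoc, Real.mul_self_sqrt (h0 _)] at this
    refine ((le_abs_self _).trans this).trans ?_
    rw [mul_comm]
    gcongr
    · exact H r s₀ y₀ hr s
    · refine le_trans ?_ hB
      refine integral_mono (integrable_of_zero (R := 1) (((hvc i).pow 2).mul hψc)
        fun x hx => by simp [hzero x hx]) (integrable_of_zero (R := 1) (hSc.mul hψc)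
        fun x hx => by simp [hzero x hx]) fun x => ?_
      exact mul_le_mul_of_nonneg_right (sq_le_S2 v i _) (h0 _)
  have ha : ∀ i, |amo v ψ i s| ≤ Real.sqrt C * Real.sqrt B := fun i => by
    refine le_trans ?_ (h1 i)
    unfold amo
    refine abs_integral_le_integral_abs.trans (le_of_eq ?_)
    simp only [abs_mul, abs_of_nonneg (h0 _)]
  have hCB : 0 ≤ Real.sqrt C * Real.sqrt B := by positivity
  refine ⟨fun i => (ha i).trans (by nlinarith), ?_⟩
  have hφi : Integrable avk := avz_xsupp.integrable avz_smooth.continuous s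
  have hqi : ∀ i, Integrable fun x => |qf v ψ s i x| := fun i =>
    integrable_of_zero (R := 1) (qf_smooth hv hψ s i).continuous.abs
      fun x hz => by rw [qf_zero hx s i x hz, abs_zero]
  have hvi : ∀ i, Integrable fun x => |v i (s, x)| * ψ (s, x) := fun i =>
    integrable_of_zero (R := 1) ((hvc i).abs.mul hψc) fun x hx => by simp [hzero x hx]
  have h2 : ∀ i, ∫ x, |qf v ψ s i x| ≤ 2 * (Real.sqrt C * Real.sqrt B) := fun i => by
    calc _ ≤ ∫ x, (|v i (s, x)| * ψ (s, x) + |amo v ψ i s| * avk x) := by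
          refine integral_mono (hqi i) ((hvi i).add (hφi.const_mul _)) fun x => ?_
          unfold qf
          refine (abs_sub _ _).trans (le_of_eq ?_)
          rw [abs_mul, abs_mul, abs_of_nonneg (h0 _), abs_of_nonneg (avk_nonneg x)]
      _ = (∫ x, |v i (s, x)| * ψ (s, x)) + |amo v ψ i s| := by
          rw [integral_add (hvi i) (hφi.const_mul _), integral_const_mul, avk_integral, mul_one]
      _ ≤ _ := by linarith [h1 i, ha i]
  rw [integral_finsetSum _ fun i _ => hqi i]
  calc _ ≤ ∑ _i : Fin 3, 2 * (Real.sqrt C * Real.sqrt B) := Finset.sum_le_sum fun i _ => h2 i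
    _ = _ := by simp only [Finset.sum_const, Finset.card_univ, Fintype.card_fin, nsmul_eq_mul]
                push_cast; ring

end

/-! ### The cubic term -/

/-- Weighted energy at scale `2⁻ᵏ`. -/
def Ak (v : Fin 3 → Z → ℝ) (s₀ : ℝ) (y₀ : E3) (k : ℕ) (s : ℝ) : ℝ :=
  ∫ x, S2 v (s, x) * psi ((1 / 2) ^ k) s₀ y₀ (s, x)

/-- Weighted dissipation at scale `2⁻ᵏ`. -/
def Gk (v : Fin 3 → Z → ℝ) (s₀ : ℝ) (y₀ : E3) (k : ℕ) (s : ℝ) : ℝ :=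
  ∫ x, G2 v (s, x) * psi ((1 / 2) ^ k) s₀ y₀ (s, x)

open Classical in
/-- The dyadic contribution to the rate of change of the weighted energy. -/
def dsum (v : Fin 3 → Z → ℝ) (s₀ : ℝ) (y₀ : E3) (k : ℕ) (B s : ℝ) : ℝ :=
  ∑ j ∈ Finset.Icc 4 k, ((1 / 2) ^ j * Gk v s₀ y₀ j s
    + B * (if s₀ - s ≤ ((1 / 2 : ℝ) ^ j) ^ 2 then (2 : ℝ) ^ j else 0))

section
variable {v : Fin 3 → Z → ℝ}

lemma Gk_nonneg (v : Fin 3 → Z → ℝ) (s₀ : ℝ) (y₀ : E3) (k : ℕ) (s : ℝ) : 0 ≤ Gk v s₀ y₀ k s :=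
  integral_nonneg fun _ => mul_nonneg (G2_nonneg v _) (psi_nonneg _ _ _ _)

lemma Ak_nonneg (v : Fin 3 → Z → ℝ) (s₀ : ℝ) (y₀ : E3) (k : ℕ) (s : ℝ) : 0 ≤ Ak v s₀ y₀ k s :=
  integral_nonneg fun _ => mul_nonneg (S2_nonneg v _) (psi_nonneg _ _ _ _)

lemma xi2_nonneg (z : Z) : 0 ≤ xi2 z := sq_nonneg _

lemma integrable_mul_psi {f : E3 → ℝ} (hf : Continuous f) {r : ℝ} (hr : 0 < r) (s₀ : ℝ) (y₀ : E3)
    (s : ℝ) : Integrable fun x => f x * psi r s₀ y₀ (s, x) :=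
  integrable_of_zero (R := 1) (hf.mul (continuous_slice (psi_smooth hr s₀ y₀).continuous s))
    fun x hx => by rw [psi_xsupp r s₀ y₀ s x hx, mul_zero]

/-- Integrals over parabolic balls are controlled by integrals against `ψ`. -/
lemma xi2_ball {f : E3 → ℝ} (hf : Continuous f) (h0 : ∀ x, 0 ≤ f x) {r s₀ : ℝ} {y₀ : E3} (hr : 0 < r)
    {s : ℝ} (hs : s ≤ s₀) (h2 : s₀ - s ≤ 4 * r ^ 2) {y : E3} {R : ℝ}
    (hsub : closedBall y R ⊆ closedBall y₀ (2 * r)) :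
    ∫ x in closedBall y R, f x * xi2 (s, x) ≤
      27 * Real.exp 1 * r ^ 3 * ∫ x, f x * psi r s₀ y₀ (s, x) := by
  have hi := (integrable_mul_psi hf hr s₀ y₀ s).const_mul (27 * Real.exp 1 * r ^ 3)
  have hxc := continuous_slice xi2_smooth.continuous s
  rw [← integral_const_mul]
  refine le_trans (setIntegral_mono_on (integrableOn_ball (hf.mul hxc) _ _) hi.integrableOn
    measurableSet_closedBall fun x hx => ?_) (setIntegral_le_integral hi ?_)
  · have h1 : ‖x - y₀‖ ≤ 2 * r := by simpa [dist_eq_norm] using hsub hx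
    have := psi_lower hr hs h1 h2
    have e : Real.exp 1 * Real.exp (-1) = 1 := by rw [← Real.exp_add]; simp
    have e2 : xi2 (s, x) = 27 * Real.exp 1 * r ^ 3 * (Real.exp (-1) / 27 * r⁻¹ ^ 3 * xi2 (s, x)) := by
      have : r ^ 3 * r⁻¹ ^ 3 = 1 := by rw [← mul_pow, mul_inv_cancel₀ hr.ne', one_pow]
      linear_combination (-(r ^ 3 * r⁻¹ ^ 3) * xi2 (s, x)) * e - xi2 (s, x) * this
    have h3 : xi2 (s, x) ≤ 27 * Real.exp 1 * r ^ 3 * psi r s₀ y₀ (s, x) := by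
      rw [e2]; exact mul_le_mul_of_nonneg_left this (by positivity)
    calc _ ≤ f x * (27 * Real.exp 1 * r ^ 3 * psi r s₀ y₀ (s, x)) :=
          mul_le_mul_of_nonneg_left h3 (h0 x)
      _ = _ := by ring
  · exact Filter.Eventually.of_forall fun x => mul_nonneg (by positivity)
      (mul_nonneg (h0 x) (psi_nonneg _ _ _ _))

lemma xi2_total {f : E3 → ℝ} (hf : Continuous f) (h0 : ∀ x, 0 ≤ f x) {s₀ : ℝ} {y₀ : E3}
    (h : Adm 1 s₀ y₀) {s : ℝ} (hs1 : -1 ≤ s) (hs : s ≤ s₀) :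
    ∫ x, f x * xi2 (s, x) ≤ 27 * Real.exp 1 * ∫ x, f x * psi 1 s₀ y₀ (s, x) := by
  have hi := (integrable_mul_psi hf one_pos s₀ y₀ s).const_mul (27 * Real.exp 1)
  have hxc := continuous_slice xi2_smooth.continuous s
  rw [← integral_const_mul]
  refine integral_mono (integrable_of_zero (R := 1) (hf.mul hxc)
    fun x hx => by simp [xi2_xsupp s x hx]) hi fun x => ?_
  have := xi2_le_psi_one h hs1 hs x
  have e : Real.exp 1 * Real.exp (-1) = 1 := by rw [← Real.exp_add]; simp
  have e2 : xi2 (s, x) = 27 * Real.exp 1 * (Real.exp (-1) / 27 * xi2 (s, x)) := by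
    linear_combination (-xi2 (s, x)) * e
  have h3 : xi2 (s, x) ≤ 27 * Real.exp 1 * psi 1 s₀ y₀ (s, x) := by
    rw [e2]; exact mul_le_mul_of_nonneg_left this (by positivity)
  calc _ ≤ f x * (27 * Real.exp 1 * psi 1 s₀ y₀ (s, x)) :=
        mul_le_mul_of_nonneg_left h3 (h0 x)
    _ = _ := by ring

lemma xi2_eq_one_of {r s₀ : ℝ} {y₀ : E3} (h : Adm 1 s₀ y₀) (hr : 0 < r) (hr1 : r ≤ 1 / 16) {s : ℝ}
    (h2 : s₀ - s ≤ r ^ 2) {x : E3} (hx : x ∈ closedBall y₀ (2 * r)) : xi2 (s, x) = 1 := by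
  have h1 : ‖x - y₀‖ ≤ 2 * r := by simpa [dist_eq_norm] using hx
  have h3 : ‖x‖ ≤ ‖x - y₀‖ + ‖y₀‖ := by simpa using norm_add_le (x - y₀) y₀
  unfold xi2
  rw [xi_eq_one (by nlinarith [h.s_ge]) (by linarith [h.y_le]), one_pow]

lemma ball_le_psi {f : E3 → ℝ} (hf : Continuous f) (h0 : ∀ x, 0 ≤ f x) {r s₀ : ℝ} {y₀ : E3}
    (h : Adm 1 s₀ y₀) (hr : 0 < r) (hr1 : r ≤ 1 / 16) {s : ℝ} (hs : s ≤ s₀) (h2 : s₀ - s ≤ r ^ 2) :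
    ∫ x in closedBall y₀ (2 * r), f x ≤
      27 * Real.exp 1 * r ^ 3 * ∫ x, f x * psi r s₀ y₀ (s, x) := by
  refine le_trans (le_of_eq ?_) (xi2_ball hf h0 hr hs (by nlinarith) (subset_refl _))
  refine setIntegral_congr_fun measurableSet_closedBall fun x hx => ?_
  rw [xi2_eq_one_of h hr hr1 h2 hx, mul_one]

lemma sqrt_S2_cube_le (v : Fin 3 → Z → ℝ) (z : Z) :
    Real.sqrt (S2 v z) ^ 3 ≤ 9 * ∑ i, |v i z| ^ 3 := by
  have h1 : Real.sqrt (S2 v z) ≤ |v 0 z| + |v 1 z| + |v 2 z| := by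
    refine Real.sqrt_le_iff.2 ⟨by positivity, ?_⟩
    unfold S2
    simp only [Fin.sum_univ_three, ← sq_abs (v _ z)]
    nlinarith [mul_nonneg (abs_nonneg (v 0 z)) (abs_nonneg (v 1 z)),
      mul_nonneg (abs_nonneg (v 0 z)) (abs_nonneg (v 2 z)),
      mul_nonneg (abs_nonneg (v 1 z)) (abs_nonneg (v 2 z))]
  refine (pow_le_pow_left₀ (Real.sqrt_nonneg _) h1 3).trans ?_
  simp only [Fin.sum_univ_three]
  have ha := abs_nonneg (v 0 z); have hb := abs_nonneg (v 1 z); have hc := abs_nonneg (v 2 z)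
  set a := |v 0 z|; set b := |v 1 z|; set c := |v 2 z|
  nlinarith [mul_nonneg (add_nonneg ha hb) (sq_nonneg (a - b)),
    mul_nonneg (add_nonneg ha hc) (sq_nonneg (a - c)),
    mul_nonneg (add_nonneg hb hc) (sq_nonneg (b - c)),
    mul_nonneg ha (sq_nonneg (b - c)), mul_nonneg hb (sq_nonneg (a - c)),
    mul_nonneg hc (sq_nonneg (a - b))]

lemma cubic_ball : ∃ C : ℝ, 0 < C ∧ ∀ (v : Fin 3 → Z → ℝ), (∀ i, Sm (v i)) →
    ∀ (r s₀ : ℝ) (y₀ : E3), Adm 1 s₀ y₀ → 0 < r → r ≤ 1 / 16 → ∀ s B : ℝ, s ≤ s₀ → s₀ - s ≤ r ^ 2 →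
    (∫ x, S2 v (s, x) * psi r s₀ y₀ (s, x) ≤ B) →
    ∫ x in closedBall y₀ r, Real.sqrt (S2 v (s, x)) ^ 3 ≤
      C * (Real.sqrt B * (r ^ 3 * (r ^ 2 * (∫ x, G2 v (s, x) * psi r s₀ y₀ (s, x)) + B))) := by
  obtain ⟨C, hC, H⟩ := integral_cube_ball_le
  set c := 27 * Real.exp 1 with hc
  have hc0 : 0 < c := by positivity
  set K := C * c ^ 6 + 1 with hK
  have hK1 : 1 ≤ K := by rw [hK]; have : 0 < C * c ^ 6 := by positivity
                         linarith
  refine ⟨27 * K, by positivity, fun v hv r s₀ y₀ hA hr hr1 s B hs h2 hB => ?_⟩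
  set Γ := ∫ x, G2 v (s, x) * psi r s₀ y₀ (s, x) with hΓ
  have hΓ0 : 0 ≤ Γ := integral_nonneg fun _ => mul_nonneg (G2_nonneg v _) (psi_nonneg _ _ _ _)
  have hB0 : 0 ≤ B := le_trans
    (integral_nonneg fun _ => mul_nonneg (S2_nonneg v _) (psi_nonneg _ _ _ _)) hB
  have hvs := fun i => slice_smooth (hv i) s
  have hSc := continuous_slice (S2_smooth hv).continuous s
  have hGc := continuous_slice (G2_smooth hv).continuous s
  have hm : ∀ i, ∫ x in closedBall y₀ (2 * r), v i (s, x) ^ 2 ≤ c * r ^ 3 * B := fun i =>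
    calc _ ≤ ∫ x in closedBall y₀ (2 * r), S2 v (s, x) :=
          setIntegral_mono (integrableOn_ball ((hvs i).continuous.pow 2) _ _)
            (integrableOn_ball hSc _ _) fun x => sq_le_S2 v i _
      _ ≤ c * r ^ 3 * ∫ x, S2 v (s, x) * psi r s₀ y₀ (s, x) :=
          ball_le_psi hSc (fun _ => S2_nonneg v _) hA hr hr1 hs h2
      _ ≤ _ := by gcongr
  have hg : ∀ i, ∫ x in closedBall y₀ (2 * r), gs (fun y => v i (s, y)) x ≤ c * r ^ 3 * Γ := fun i =>
    calc _ ≤ ∫ x in closedBall y₀ (2 * r), G2 v (s, x) :=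
          setIntegral_mono (integrableOn_ball (gs_continuous (hvs i)) _ _)
            (integrableOn_ball hGc _ _) fun x => gs_slice_le hv i s x
      _ ≤ _ := ball_le_psi hGc (fun _ => G2_nonneg v _) hA hr hr1 hs h2
  set D := r ^ 2 * Γ + B with hD
  have hD0 : 0 ≤ D := by positivity
  have hX : ∀ i, ∫ x in closedBall y₀ r, |v i (s, x)| ^ 3 ≤ K * (Real.sqrt B * (r ^ 3 * D)) := by
    intro i
    have h4 := H (fun y => v i (s, y)) y₀ r (hvs i) hr
    have m0 : 0 ≤ ∫ x in closedBall y₀ (2 * r), v i (s, x) ^ 2 := integral_nonneg fun _ => sq_nonneg _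
    have g0 : 0 ≤ ∫ x in closedBall y₀ (2 * r), gs (fun y => v i (s, y)) x :=
      integral_nonneg fun _ => gs_nonneg _ _
    rw [← pow_le_pow_iff_left₀ (integral_nonneg fun _ => by positivity) (by positivity)
      (by norm_num : 4 ≠ 0)]
    have hA' : (∫ x in closedBall y₀ (2 * r), gs (fun y => v i (s, y)) x) + (r ^ 2)⁻¹ *
        ∫ x in closedBall y₀ (2 * r), v i (s, x) ^ 2 ≤ c * r * D := by
      have : (r ^ 2)⁻¹ * ∫ x in closedBall y₀ (2 * r), v i (s, x) ^ 2 ≤ (r ^ 2)⁻¹ * (c * r ^ 3 * B) :=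
        mul_le_mul_of_nonneg_left (hm i) (by positivity)
      have e : (r ^ 2)⁻¹ * (c * r ^ 3 * B) = c * r * B := by field_simp
      have := hg i
      rw [hD]
      nlinarith
    calc _ ≤ _ := h4
      _ ≤ C * (c * r ^ 3 * B) ^ 3 * (c * r * D) ^ 3 := by
          gcongr
          exact hm i
      _ = C * c ^ 6 * (r ^ 12 * (B ^ 2 * (B * D ^ 3))) := by ring
      _ ≤ C * c ^ 6 * (r ^ 12 * (B ^ 2 * (D * D ^ 3))) := by
          gcongr
          rw [hD]; nlinarith [mul_nonneg (sq_nonneg r) hΓ0]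
      _ ≤ K ^ 4 * (r ^ 12 * (B ^ 2 * (D * D ^ 3))) := by
          gcongr
          have : K ≤ K ^ 4 := le_self_pow₀ hK1 (by norm_num)
          linarith
      _ = K ^ 4 * (r ^ 12 * ((Real.sqrt B ^ 2) ^ 2 * (D * D ^ 3))) := by rw [Real.sq_sqrt hB0]
      _ = _ := by ring
  have hi : ∀ i, IntegrableOn (fun x => |v i (s, x)| ^ 3) (closedBall y₀ r) := fun i =>
    integrableOn_ball ((hvs i).continuous.abs.pow 3) _ _
  calc _ ≤ ∫ x in closedBall y₀ r, 9 * ∑ i, |v i (s, x)| ^ 3 :=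
        setIntegral_mono (integrableOn_ball (hSc.sqrt.pow 3) _ _)
          ((integrable_finsetSum _ fun i _ => hi i).const_mul _) fun x => sqrt_S2_cube_le v _
    _ = 9 * ∑ i, ∫ x in closedBall y₀ r, |v i (s, x)| ^ 3 := by
        rw [integral_const_mul, integral_finsetSum _ fun i _ => hi i]
    _ ≤ 9 * ∑ _i : Fin 3, K * (Real.sqrt B * (r ^ 3 * D)) := by
        gcongr with i; exact hX i
    _ = _ := by simp only [Finset.sum_const, Finset.card_univ, Fintype.card_fin, nsmul_eq_mul]
                push_cast; ring

lemma pdist_continuous {r : ℝ} (s₀ : ℝ) (y₀ : E3) (s : ℝ) :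
    Continuous fun x => pdist r s₀ y₀ (s, x) := by
  unfold pdist; fun_prop

open Classical in
/-- Integrals with powers of the parabolic distance, dyadically. -/
lemma dyadic_integral {W : E3 → ℝ} (hW : Continuous W) (h0 : ∀ x, 0 ≤ W x) (m k : ℕ) {s₀ : ℝ}
    {y₀ : E3} {s : ℝ} (hs : s ≤ s₀) (ρ : ℝ) :
    ∫ x in closedBall (0 : E3) ρ, W x * (pdist ((1 / 2) ^ k) s₀ y₀ (s, x))⁻¹ ^ m ≤
      16 ^ m * ((∫ x in closedBall (0 : E3) ρ, W x) + ∑ j ∈ Finset.Icc 4 k,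
        if s₀ - s ≤ ((1 / 2 : ℝ) ^ j) ^ 2 then
          ((2 : ℝ) ^ j) ^ m * ∫ x in closedBall y₀ ((1 / 2) ^ j), W x else 0) := by
  set D := closedBall (0 : E3) ρ
  set g : ℕ → E3 → ℝ := fun j x => if s₀ - s ≤ ((1 / 2 : ℝ) ^ j) ^ 2 then
    ((2 : ℝ) ^ j) ^ m * (closedBall y₀ ((1 / 2) ^ j)).indicator W x else 0 with hg
  have hgi : ∀ j, IntegrableOn (g j) D := fun j => by
    simp only [hg]
    split_ifs
    · exact (((integrableOn_ball hW _ _).integrable_indicator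
        measurableSet_closedBall).const_mul _).integrableOn
    · exact integrableOn_zero
  have hWi : IntegrableOn W D := integrableOn_ball hW _ _
  have hpc : Continuous fun x => (pdist ((1 / 2) ^ k) s₀ y₀ (s, x))⁻¹ ^ m :=
    ((pdist_continuous s₀ y₀ s).inv₀ fun x =>
      (pdist_pos (by positivity) s₀ y₀ (s, x)).ne').pow m
  have hsum : IntegrableOn (fun x => ∑ j ∈ Finset.Icc 4 k, g j x) D :=
    integrable_finsetSum _ fun j _ => hgi j
  have hadd : IntegrableOn (fun x => W x + ∑ j ∈ Finset.Icc 4 k, g j x) D := hWi.add hsum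
  calc _ ≤ ∫ x in D, 16 ^ m * (W x + ∑ j ∈ Finset.Icc 4 k, g j x) := by
        refine setIntegral_mono (integrableOn_ball (hW.mul hpc) _ _) (hadd.const_mul _) fun x => ?_
        have h1 := mul_le_mul_of_nonneg_left (dyadic_weight m k hs x (y₀ := y₀)) (h0 x)
        refine h1.trans (le_of_eq ?_)
        rw [mul_left_comm, mul_add, mul_one, Finset.mul_sum]
        congr 2
        refine Finset.sum_congr rfl fun j _ => ?_
        simp only [hg]
        by_cases hc : s₀ - s ≤ ((1 / 2 : ℝ) ^ j) ^ 2
        · by_cases hx : ‖x - y₀‖ ≤ (1 / 2) ^ j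
          · rw [if_pos ⟨hx, hc⟩, if_pos hc, indicator_of_mem (by simpa [dist_eq_norm] using hx)]
            ring
          · rw [if_neg fun h => hx h.1, if_pos hc, indicator_of_notMem (by simpa [dist_eq_norm] using hx)]
            ring
        · rw [if_neg fun h => hc h.2, if_neg hc, mul_zero]
    _ = 16 ^ m * ((∫ x in D, W x) + ∑ j ∈ Finset.Icc 4 k, ∫ x in D, g j x) := by
        rw [integral_const_mul, integral_add hWi hsum, integral_finsetSum _ fun j _ => hgi j]
    _ ≤ _ := by
        gcongr with j hj
        simp only [hg]
        split_ifs
        · rw [integral_const_mul]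
          refine mul_le_mul_of_nonneg_left ?_ (by positivity)
          exact (setIntegral_le_integral ((integrableOn_ball hW _ _).integrable_indicator
            measurableSet_closedBall) (Filter.Eventually.of_forall fun x =>
              indicator_nonneg (fun x _ => h0 x) x)).trans
                (le_of_eq (integral_indicator measurableSet_closedBall))
        · simp

end

lemma Adm.scale {s₀ : ℝ} {y₀ : E3} (h : Adm 1 s₀ y₀) (k : ℕ) : Adm ((1 / 2) ^ k) s₀ y₀ :=
  ⟨by positivity, pow_le_one₀ (by norm_num) (by norm_num), h.s_ge, h.s_le, h.y_le⟩

section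
variable {v : Fin 3 → Z → ℝ}

lemma half_pow_le {j : ℕ} (hj : 4 ≤ j) : (1 / 2 : ℝ) ^ j ≤ 1 / 16 := by
  calc (1 / 2 : ℝ) ^ j ≤ (1 / 2) ^ 4 := pow_le_pow_of_le_one (by norm_num) (by norm_num) hj
    _ = _ := by norm_num

lemma two_mul_half_pow (j : ℕ) : (2 : ℝ) ^ j * (1 / 2) ^ j = 1 := by
  rw [← mul_pow]; norm_num

lemma dsum_nonneg {s₀ : ℝ} {y₀ : E3} {k : ℕ} {B s : ℝ} (hB : 0 ≤ B) : 0 ≤ dsum v s₀ y₀ k B s := by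
  classical
  refine Finset.sum_nonneg fun j _ => add_nonneg (mul_nonneg (by positivity) (Gk_nonneg _ _ _ _ _)) ?_
  split_ifs <;> positivity

lemma cubic_bound : ∃ C : ℝ, 0 < C ∧ ∀ (v : Fin 3 → Z → ℝ), (∀ i, Sm (v i)) →
    ∀ (s₀ : ℝ) (y₀ : E3), Adm 1 s₀ y₀ → ∀ (k : ℕ) (s B : ℝ), -1 ≤ s → s ≤ s₀ →
    (∀ i, ∫ x, avk x * v i (s, x) = 0) → Integrable (fun y => G2 v (s, y)) →
    (∀ j ≤ k, Ak v s₀ y₀ j s ≤ B) →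
    |∫ x, S2 v (s, x) * ∑ j, v j (s, x) * dx j (psi ((1 / 2) ^ k) s₀ y₀) (s, x)| ≤
      C * (Real.sqrt B * (pv v s + dsum v s₀ y₀ k B s)) := by
  classical
  obtain ⟨C1, hC1, H1⟩ := psi_dx_bound
  obtain ⟨C2, hC2, H2⟩ := slice_local
  obtain ⟨C3, hC3, H3⟩ := cubic_ball
  set c := 27 * Real.exp 1 with hc
  have hc0 : 0 < c := by positivity
  set M := Real.sqrt C2 * Real.sqrt c + C3 with hM
  have hMp : 0 < M := by positivity
  refine ⟨3 * C1 * 16 ^ 4 * M, by positivity, fun v hv s₀ y₀ hA k s B hs1 hs hm hG hB => ?_⟩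
  have hk := hA.scale k
  have hB0 : 0 ≤ B := (Ak_nonneg v s₀ y₀ 0 s).trans (hB 0 (Nat.zero_le _))
  have hS := continuous_slice (S2_smooth hv).continuous s
  have hxi := continuous_slice xi_smooth.continuous s
  set W : E3 → ℝ := fun x => Real.sqrt (S2 v (s, x)) ^ 3 * xi (s, x) with hW
  have hWc : Continuous W := (hS.sqrt.pow 3).mul hxi
  have hW0 : ∀ x, 0 ≤ W x := fun x => mul_nonneg (by positivity) (xi_nonneg _)
  have hpt : ∀ x, |S2 v (s, x) * ∑ j, v j (s, x) * dx j (psi ((1 / 2) ^ k) s₀ y₀) (s, x)| ≤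
      3 * C1 * (W x * (pdist ((1 / 2) ^ k) s₀ y₀ (s, x))⁻¹ ^ 4) := fun x => by
    set D := (pdist ((1 / 2) ^ k) s₀ y₀ (s, x))⁻¹ ^ 4
    set q := Real.sqrt (S2 v (s, x)) with hq
    have hq2 : q ^ 2 = S2 v (s, x) := Real.sq_sqrt (S2_nonneg v _)
    have hq0 : 0 ≤ q := Real.sqrt_nonneg _
    rw [abs_mul, abs_of_nonneg (S2_nonneg v _), ← hq2]
    have : |∑ j, v j (s, x) * dx j (psi ((1 / 2) ^ k) s₀ y₀) (s, x)| ≤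
        ∑ _j : Fin 3, q * (C1 * (xi (s, x) * D)) := by
      refine (Finset.abs_sum_le_sum_abs _ _).trans (Finset.sum_le_sum fun j _ => ?_)
      rw [abs_mul]
      exact mul_le_mul (Real.abs_le_sqrt (sq_le_S2 v j _)) (H1 _ s₀ y₀ hk s hs1 hs x j)
        (abs_nonneg _) hq0
    calc _ ≤ q ^ 2 * _ := mul_le_mul_of_nonneg_left this (sq_nonneg _)
      _ = _ := by
        simp only [Finset.sum_const, Finset.card_univ, Fintype.card_fin, nsmul_eq_mul, hW]
        push_cast; ring
  have hpc : Continuous fun x => (pdist ((1 / 2) ^ k) s₀ y₀ (s, x))⁻¹ ^ 4 :=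
    ((pdist_continuous s₀ y₀ s).inv₀ fun x =>
      (pdist_pos (by positivity) s₀ y₀ (s, x)).ne').pow 4
  have hmain : ∫ x in closedBall (0 : E3) 1, W x ≤ M * (Real.sqrt B * pv v s) := by
    have h4 := integral_mul_le_sqrt (μ := volume.restrict (closedBall (0 : E3) 1))
      (f := fun x => S2 v (s, x)) (g := fun x => Real.sqrt (S2 v (s, x)) * xi (s, x))
      hS.aestronglyMeasurable (hS.sqrt.mul hxi).aestronglyMeasurable
      (integrableOn_ball (hS.pow 2) _ _) (integrableOn_ball ((hS.sqrt.mul hxi).pow 2) _ _)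
    have e1 : ∀ x, S2 v (s, x) * (Real.sqrt (S2 v (s, x)) * xi (s, x)) = W x := fun x => by
      simp only [hW]
      have := Real.sq_sqrt (S2_nonneg v (s, x))
      linear_combination (-(Real.sqrt (S2 v (s, x)) * xi (s, x))) * this
    have e2 : ∀ x, (Real.sqrt (S2 v (s, x)) * xi (s, x)) ^ 2 = S2 v (s, x) * xi2 (s, x) := fun x => by
      rw [mul_pow, Real.sq_sqrt (S2_nonneg v _)]; rfl
    simp only [e1, e2] at h4
    have h5 := (H2 v hv s hm hG).2
    have h6 : ∫ x in closedBall (0 : E3) 1, S2 v (s, x) * xi2 (s, x) ≤ c * B := by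
      rw [← integral_eq_ball fun x hx => by rw [xi2_xsupp s x hx, mul_zero]]
      refine (xi2_total hS (fun _ => S2_nonneg v _) hA hs1 hs).trans ?_
      have := hB 0 (Nat.zero_le _)
      simp only [Ak, pow_zero] at this
      exact mul_le_mul_of_nonneg_left this hc0.le
    have hp := pv_nonneg v s
    calc _ ≤ _ := le_abs_self _
      _ ≤ _ := h4
      _ ≤ Real.sqrt (C2 * pv v s ^ 2) * Real.sqrt (c * B) := by gcongr
      _ = Real.sqrt C2 * Real.sqrt c * (Real.sqrt B * pv v s) := by
        rw [Real.sqrt_mul hC2.le, Real.sqrt_mul hc0.le, Real.sqrt_sq hp]; ring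
      _ ≤ _ := by gcongr; rw [hM]; linarith
  have hj : ∀ j ∈ Finset.Icc 4 k, (if s₀ - s ≤ ((1 / 2 : ℝ) ^ j) ^ 2 then
      ((2 : ℝ) ^ j) ^ 4 * ∫ x in closedBall y₀ ((1 / 2) ^ j), W x else 0) ≤
      M * Real.sqrt B * ((1 / 2) ^ j * Gk v s₀ y₀ j s
        + B * (if s₀ - s ≤ ((1 / 2 : ℝ) ^ j) ^ 2 then (2 : ℝ) ^ j else 0)) := by
    intro j hj
    rw [Finset.mem_Icc] at hj
    have hg := Gk_nonneg v s₀ y₀ j s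
    split_ifs with hcond
    · have h7 := H3 v hv ((1 / 2) ^ j) s₀ y₀ hA (by positivity) (half_pow_le hj.1) s B hs hcond
        (hB j hj.2)
      have h8 : ∫ x in closedBall y₀ ((1 / 2) ^ j), W x ≤
          ∫ x in closedBall y₀ ((1 / 2) ^ j), Real.sqrt (S2 v (s, x)) ^ 3 :=
        setIntegral_mono (integrableOn_ball hWc _ _) (integrableOn_ball (hS.sqrt.pow 3) _ _)
          fun x => mul_le_of_le_one_right (by positivity) (xi_le_one _)
      have e := two_mul_half_pow j
      set t := (2 : ℝ) ^ j
      set r := (1 / 2 : ℝ) ^ j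
      have ht : 0 < t := by positivity
      have hr : 0 < r := by positivity
      calc _ ≤ t ^ 4 * (C3 * (Real.sqrt B * (r ^ 3 * (r ^ 2 * Gk v s₀ y₀ j s + B)))) :=
            mul_le_mul_of_nonneg_left (h8.trans h7) (by positivity)
        _ = C3 * Real.sqrt B * ((t * r) ^ 4 * (r * Gk v s₀ y₀ j s) + (t * r) ^ 3 * (B * t)) := by ring
        _ = C3 * Real.sqrt B * (r * Gk v s₀ y₀ j s + B * t) := by rw [e]; ring
        _ ≤ _ := by
          gcongr; rw [hM]; have : 0 < Real.sqrt C2 * Real.sqrt c := by positivity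
          linarith
    · positivity
  have hi1 : IntegrableOn (fun x => W x * (pdist ((1 / 2) ^ k) s₀ y₀ (s, x))⁻¹ ^ 4)
    (closedBall (0 : E3) 1) := integrableOn_ball (hWc.mul hpc) _ _
  have hF : Continuous fun x => S2 v (s, x) * ∑ j, v j (s, x) * dx j (psi ((1 / 2) ^ k) s₀ y₀) (s, x) :=
    hS.mul (continuous_finsetSum _ fun j _ => (continuous_slice (hv j).continuous s).mul
      (continuous_slice (dv_smooth _ (psi_smooth (by positivity) s₀ y₀)).continuous s))
  rw [integral_eq_ball fun x hx => by
    rw [Finset.sum_eq_zero fun j _ => by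
      rw [show dx j (psi ((1 / 2) ^ k) s₀ y₀) (s, x) = 0 from (psi_xsupp _ s₀ y₀).dv _ s x hx, mul_zero],
      mul_zero]]
  calc _ ≤ ∫ x in closedBall (0 : E3) 1, |S2 v (s, x) *
          ∑ j, v j (s, x) * dx j (psi ((1 / 2) ^ k) s₀ y₀) (s, x)| := abs_integral_le_integral_abs
    _ ≤ ∫ x in closedBall (0 : E3) 1, 3 * C1 * (W x * (pdist ((1 / 2) ^ k) s₀ y₀ (s, x))⁻¹ ^ 4) :=
        setIntegral_mono (integrableOn_ball hF.abs _ _) (hi1.const_mul _) hpt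
    _ = 3 * C1 * ∫ x in closedBall (0 : E3) 1, W x * (pdist ((1 / 2) ^ k) s₀ y₀ (s, x))⁻¹ ^ 4 :=
        integral_const_mul _ _
    _ ≤ 3 * C1 * (16 ^ 4 * (M * (Real.sqrt B * pv v s) + ∑ j ∈ Finset.Icc 4 k,
          M * Real.sqrt B * ((1 / 2) ^ j * Gk v s₀ y₀ j s
        + B * (if s₀ - s ≤ ((1 / 2 : ℝ) ^ j) ^ 2 then (2 : ℝ) ^ j else 0)))) := by
        refine mul_le_mul_of_nonneg_left ((dyadic_integral hWc hW0 4 k hs 1).trans ?_) (by positivity)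
        exact mul_le_mul_of_nonneg_left (add_le_add hmain (Finset.sum_le_sum hj)) (by positivity)
    _ = _ := by
        rw [← Finset.mul_sum, dsum]; ring

end

section
variable {v : Fin 3 → Z → ℝ} {P : Z → ℝ} {c : Fin 3 → ℝ → ℝ}

/-- Energy in parabolic balls about arbitrary points. -/
lemma S2_ball_pdist : ∃ C : ℝ, 0 < C ∧ ∀ (v : Fin 3 → Z → ℝ), (∀ i, Sm (v i)) →
    ∀ (s₀ : ℝ) (y₀ : E3), Adm 1 s₀ y₀ → ∀ (k : ℕ) (s B : ℝ), -1 ≤ s → s ≤ s₀ →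
    (∀ j ≤ k, Ak v s₀ y₀ j s ≤ B) → ∀ y d, d = pdist ((1 / 2) ^ k) s₀ y₀ (s, y) →
    ∫ x in closedBall y (d / 4), S2 v (s, x) * xi2 (s, x) ≤ C * (d ^ 3 * B) := by
  set c := 27 * Real.exp 1 with hc
  have hc0 : 0 < c := by positivity
  refine ⟨8 * c, by positivity, fun v hv s₀ y₀ hA k s B hs1 hs hB y d hd => ?_⟩
  have hB0 : 0 ≤ B := (Ak_nonneg v s₀ y₀ 0 s).trans (hB 0 (Nat.zero_le _))
  have hr : (0 : ℝ) < (1 / 2) ^ k := by positivity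
  have hd0 : 0 < d := hd ▸ pdist_pos hr s₀ y₀ (s, y)
  have hS := continuous_slice (S2_smooth hv).continuous s
  have hx2 := continuous_slice xi2_smooth.continuous s
  have hS0 : ∀ x, 0 ≤ S2 v (s, x) := fun _ => S2_nonneg v _
  rcases le_total 1 d with h1 | h1
  · have h3 : (1 : ℝ) ≤ d ^ 3 := one_le_pow₀ h1
    have h2 := xi2_total hS hS0 hA hs1 hs
    have h4 := hB 0 (Nat.zero_le _)
    simp only [Ak, pow_zero] at h4
    have h5 : ∫ x in closedBall y (d / 4), S2 v (s, x) * xi2 (s, x) ≤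
        ∫ x, S2 v (s, x) * xi2 (s, x) :=
      setIntegral_le_integral (integrable_of_zero (R := 1) (hS.mul hx2)
        fun x hx => by rw [xi2_xsupp s x hx, mul_zero])
        (Filter.Eventually.of_forall fun x => mul_nonneg (hS0 x) (xi2_nonneg _))
    calc _ ≤ c * B := h5.trans (h2.trans (mul_le_mul_of_nonneg_left h4 hc0.le))
      _ ≤ _ := by nlinarith [mul_nonneg hc0.le hB0, mul_le_mul_of_nonneg_left h3 (mul_nonneg hc0.le hB0)]
  · obtain ⟨n, hn1, hn2⟩ := exists_nat_pow_near_of_lt_one hd0 h1 (by norm_num : (0 : ℝ) < 1 / 2)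
      (by norm_num)
    have e := clk_eq hr (s := s) (s₀ := s₀) (by nlinarith)
    have hcp := clk_pos hr s₀ s
    have hnd : ‖y - y₀‖ ≤ d := by
      rw [hd]; exact le_add_of_nonneg_right (Real.sqrt_nonneg _)
    have hqd : Real.sqrt (clk ((1 / 2) ^ k) s₀ s) ≤ d := by
      rw [hd]; exact le_add_of_nonneg_left (norm_nonneg _)
    have hcd : clk ((1 / 2) ^ k) s₀ s ≤ d ^ 2 := by
      rw [← Real.sq_sqrt hcp.le]; exact pow_le_pow_left₀ (Real.sqrt_nonneg _) hqd 2
    have hnk : n ≤ k := by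
      have : (1 / 2 : ℝ) ^ k ≤ (1 / 2) ^ n := by
        refine le_trans ?_ hn2
        rw [← pow_le_pow_iff_left₀ hr.le hd0.le two_ne_zero]
        linarith
      exact (pow_le_pow_iff_right_of_lt_one₀ (by norm_num) (by norm_num)).1 this
    have hdn : d ^ 2 ≤ ((1 / 2) ^ n) ^ 2 := pow_le_pow_left₀ hd0.le hn2 2
    have hkk := sq_nonneg ((1 / 2 : ℝ) ^ k)
    have hsub : closedBall y (d / 4) ⊆ closedBall y₀ (2 * (1 / 2) ^ n) := by
      refine closedBall_subset_closedBall' ?_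
      rw [dist_eq_norm]; linarith
    have hrn : (0 : ℝ) < (1 / 2) ^ n := by positivity
    refine (xi2_ball hS hS0 hrn hs (by nlinarith) hsub).trans ?_
    have h6 : ((1 / 2 : ℝ) ^ n) ^ 3 ≤ (2 * d) ^ 3 := by
      refine pow_le_pow_left₀ hrn.le ?_ 3
      rw [pow_succ] at hn1; linarith
    calc _ ≤ c * (2 * d) ^ 3 * B := by
          rw [← hc]
          exact mul_le_mul (mul_le_mul_of_nonneg_left h6 hc0.le) (hB n hnk)
            (Ak_nonneg v s₀ y₀ n s) (by positivity)
      _ = _ := by ring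

lemma newt_ptwise : ∃ C : ℝ, 0 < C ∧ ∀ (v : Fin 3 → Z → ℝ) (P : Z → ℝ) (c : Fin 3 → ℝ → ℝ),
    CSol v P c → ∀ (s₀ : ℝ) (y₀ : E3), Adm 1 s₀ y₀ → ∀ (k : ℕ) (s B : ℝ), -1 ≤ s → s ≤ s₀ →
    (∀ j ≤ k, Ak v s₀ y₀ j s ≤ B) →
    (∀ y, ‖y‖ ≤ 2 → |newt (qdiv v (psi ((1 / 2) ^ k) s₀ y₀) s) y| ≤
      C * (Real.sqrt B * (pdist ((1 / 2) ^ k) s₀ y₀ (s, y))⁻¹ ^ 2)) ∧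
    (∀ y, 2 ≤ ‖y‖ → |newt (qdiv v (psi ((1 / 2) ^ k) s₀ y₀) s) y| ≤
      C * (Real.sqrt B * ‖y‖⁻¹ ^ 3)) := by
  obtain ⟨C1, hC1, H1⟩ := psi_dx_bound
  obtain ⟨C2, hC2, H2⟩ := moment_bound
  obtain ⟨C3, hC3, H3⟩ := newt_bound
  obtain ⟨C4, hC4, H4⟩ := S2_ball_pdist
  set Φ := ∫ x, gs avk x with hΦ
  have hgi : Integrable fun x => gs avk x := integrable_of_zero (R := 1) (gs_continuous avk_smooth)
    (gs_zero_of_zero avk_zero')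
  have hΦ0 : 0 ≤ Φ := integral_nonneg fun _ => gs_nonneg _ _
  set K := 6 * C1 ^ 2 * 2 ^ 8 * C4 + 6 * C2 ^ 2 * Φ * 4 ^ 5 with hK
  have hK0 : 0 ≤ K := by positivity
  set M := C3 * (16 * C2 + Real.sqrt K) with hM
  have hMp : 0 < M := by positivity
  refine ⟨M + C3 * C2, by positivity, fun v P c h s₀ y₀ hA k s B hs1 hs hB => ?_⟩
  have hk := hA.scale k
  set r := (1 / 2 : ℝ) ^ k with hr
  have hr0 : 0 < r := by positivity
  set ψ := psi r s₀ y₀ with hψ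
  have hψs : Sm ψ := psi_smooth hr0 s₀ y₀
  have hψx : XSupp 1 ψ := psi_xsupp r s₀ y₀
  have hB0 : 0 ≤ B := (Ak_nonneg v s₀ y₀ 0 s).trans (hB 0 (Nat.zero_le _))
  obtain ⟨hmo, hq1⟩ := H2 v h.sm r s₀ y₀ hr0 s B (hB k le_rfl)
  obtain ⟨hN, hF⟩ := H3 (fun i => qf v ψ s i) (C2 * Real.sqrt B) (fun i => qf_smooth h.sm hψs s i)
    (fun i x hx => qf_zero hψx s i x hx) hq1
  have hs' : s ∈ Icc (-1 : ℝ) 0 := ⟨hs1, hs.trans hA.s_le⟩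
  have hS := continuous_slice (S2_smooth h.sm).continuous s
  have hx2 := continuous_slice xi2_smooth.continuous s
  refine ⟨fun y hy => ?_, fun y hy => ?_⟩
  · set d := pdist r s₀ y₀ (s, y) with hd
    have hd0 : 0 < d := pdist_pos hr0 s₀ y₀ (s, y)
    have hd4 : d ≤ 4 := by
      have h1 : Real.sqrt (clk r s₀ s) ≤ 3 / 2 := by
        apply Real.sqrt_le_iff.2 ⟨by norm_num, ?_⟩
        rw [clk_eq hr0 (by nlinarith)]
        nlinarith [hk.s_le, hk.r_pos, hk.r_le]
      have := norm_sub_le y y₀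
      have := hA.y_le
      rw [hd]; unfold pdist; simp only; linarith
    have hpt : ∀ x ∈ closedBall y (d / 4), qdiv v ψ s x ^ 2 ≤
        6 * C1 ^ 2 * 2 ^ 8 * d⁻¹ ^ 8 * (S2 v (s, x) * xi2 (s, x)) + 6 * C2 ^ 2 * B * gs avk x := by
      intro x hx
      rw [mem_closedBall, dist_eq_norm] at hx
      have hdx : d ≤ 2 * pdist r s₀ y₀ (s, x) := by
        have h1 : ‖y - y₀‖ ≤ ‖x - y₀‖ + ‖x - y‖ := by
          have := norm_sub_le (x - y₀) (x - y)
          simpa using this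
        have h2 : d = ‖y - y₀‖ + Real.sqrt (clk r s₀ s) := rfl
        have h3 : pdist r s₀ y₀ (s, x) = ‖x - y₀‖ + Real.sqrt (clk r s₀ s) := rfl
        have := norm_nonneg (x - y₀)
        have := Real.sqrt_nonneg (clk r s₀ s)
        linarith
      have hinv : (pdist r s₀ y₀ (s, x))⁻¹ ≤ 2 * d⁻¹ := by
        rw [← div_eq_mul_inv, inv_le_comm₀ (pdist_pos hr0 s₀ y₀ _) (by positivity), inv_div]
        linarith
      have hinv0 := inv_nonneg.2 (pdist_pos hr0 s₀ y₀ (s, x)).le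
      rw [h.qdiv_eq hψs hs' x]
      have e1 : ∀ i, dx i avz (s, x) = dv (eb i) avk x := fun i => (dx_slice avz_smooth i s x).symm
      simp only [e1]
      have b1 : (∑ i, v i (s, x) * dx i ψ (s, x)) ^ 2 ≤
          S2 v (s, x) * (3 * (C1 ^ 2 * (xi2 (s, x) * (2 ^ 8 * d⁻¹ ^ 8)))) := by
        refine (Finset.sum_mul_sq_le_sq_mul_sq _ _ _).trans ?_
        refine mul_le_mul_of_nonneg_left ?_ (S2_nonneg v _)
        have : ∀ i ∈ Finset.univ, dx i ψ (s, x) ^ 2 ≤ C1 ^ 2 * (xi2 (s, x) * (2 ^ 8 * d⁻¹ ^ 8)) := by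
          intro i _
          rw [← sq_abs]
          have h5 := H1 r s₀ y₀ hk s hs1 hs x i
          have h6 : (pdist r s₀ y₀ (s, x))⁻¹ ^ 4 ≤ (2 * d⁻¹) ^ 4 := pow_le_pow_left₀ hinv0 hinv 4
          have h7 := h5.trans (mul_le_mul_of_nonneg_left
            (mul_le_mul_of_nonneg_left h6 (xi_nonneg _)) hC1.le)
          refine (pow_le_pow_left₀ (abs_nonneg _) h7 2).trans (le_of_eq ?_)
          unfold xi2; ring
        refine (Finset.sum_le_sum this).trans (le_of_eq ?_)
        simp only [Finset.sum_const, Finset.card_univ, Fintype.card_fin, nsmul_eq_mul]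
        push_cast; ring
      have b2 : (∑ i, amo v ψ i s * dv (eb i) avk x) ^ 2 ≤ 3 * (C2 ^ 2 * B) * gs avk x := by
        refine (Finset.sum_mul_sq_le_sq_mul_sq _ _ _).trans ?_
        refine mul_le_mul_of_nonneg_right ?_ (gs_nonneg _ _)
        have : ∀ i ∈ Finset.univ, amo v ψ i s ^ 2 ≤ C2 ^ 2 * B := by
          intro i _
          rw [← sq_abs]
          refine (pow_le_pow_left₀ (abs_nonneg _) (hmo i) 2).trans (le_of_eq ?_)
          rw [mul_pow, Real.sq_sqrt hB0]
        refine (Finset.sum_le_sum this).trans (le_of_eq ?_)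
        simp only [Finset.sum_const, Finset.card_univ, Fintype.card_fin, nsmul_eq_mul]
        push_cast; ring
      set a := ∑ i, v i (s, x) * dx i ψ (s, x)
      set b := ∑ i, amo v ψ i s * dv (eb i) avk x
      have : (a - b) ^ 2 ≤ 2 * a ^ 2 + 2 * b ^ 2 := by nlinarith [sq_nonneg (a + b)]
      linarith
    have hq2 : ∫ x in closedBall y (d / 4), qdiv v ψ s x ^ 2 ≤ K * (B * d⁻¹ ^ 5) := by
      have i1 : IntegrableOn (fun x => S2 v (s, x) * xi2 (s, x)) (closedBall y (d / 4)) :=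
        integrableOn_ball (hS.mul hx2) _ _
      have j1 : IntegrableOn (fun x => 6 * C1 ^ 2 * 2 ^ 8 * d⁻¹ ^ 8 * (S2 v (s, x) * xi2 (s, x)))
        (closedBall y (d / 4)) := i1.const_mul _
      have j2 : IntegrableOn (fun x => 6 * C2 ^ 2 * B * gs avk x) (closedBall y (d / 4)) :=
        (hgi.const_mul _).integrableOn
      have j3 : IntegrableOn (fun x => 6 * C1 ^ 2 * 2 ^ 8 * d⁻¹ ^ 8 * (S2 v (s, x) * xi2 (s, x))
        + 6 * C2 ^ 2 * B * gs avk x) (closedBall y (d / 4)) := j1.add j2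
      refine (setIntegral_mono_on (integrableOn_ball ((qdiv_continuous h.sm hψs s).pow 2) _ _) j3
        measurableSet_closedBall hpt).trans ?_
      rw [integral_add j1 j2, integral_const_mul, integral_const_mul]
      have g1 := H4 v h.sm s₀ y₀ hA k s B hs1 hs hB y d rfl
      have g2 : ∫ x in closedBall y (d / 4), gs avk x ≤ Φ := setIntegral_le_integral hgi
        (Filter.Eventually.of_forall fun x => gs_nonneg _ _)
      have e : d⁻¹ * d = 1 := inv_mul_cancel₀ hd0.ne'
      have g3 : (1 : ℝ) ≤ 4 ^ 5 * d⁻¹ ^ 5 := by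
        rw [← mul_pow]; refine one_le_pow₀ ?_
        rw [← div_eq_mul_inv, le_div_iff₀ hd0]; linarith
      calc _ ≤ 6 * C1 ^ 2 * 2 ^ 8 * d⁻¹ ^ 8 * (C4 * (d ^ 3 * B)) + 6 * C2 ^ 2 * B * Φ :=
            add_le_add (mul_le_mul_of_nonneg_left g1 (by positivity))
              (mul_le_mul_of_nonneg_left g2 (by positivity))
        _ = 6 * C1 ^ 2 * 2 ^ 8 * C4 * (B * d⁻¹ ^ 5) * (d⁻¹ * d) ^ 3 + 6 * C2 ^ 2 * B * Φ * 1 := by ring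
        _ ≤ 6 * C1 ^ 2 * 2 ^ 8 * C4 * (B * d⁻¹ ^ 5) * (d⁻¹ * d) ^ 3
              + 6 * C2 ^ 2 * B * Φ * (4 ^ 5 * d⁻¹ ^ 5) :=
            add_le_add_right (mul_le_mul_of_nonneg_left g3 (by positivity)) _
        _ = _ := by rw [e, hK]; ring
    have hn := hN y (d / 4) (by positivity)
    have hq3 : Real.sqrt (d / 4 * ∫ x in closedBall y (d / 4), (∑ i, dv (eb i) (qf v ψ s i) x) ^ 2) ≤
        Real.sqrt K * (Real.sqrt B * d⁻¹ ^ 2) := by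
      refine Real.sqrt_le_iff.2 ⟨by positivity, ?_⟩
      have e : d⁻¹ * d = 1 := inv_mul_cancel₀ hd0.ne'
      calc _ ≤ d / 4 * (K * (B * d⁻¹ ^ 5)) := mul_le_mul_of_nonneg_left hq2 (by positivity)
        _ = 1 / 4 * (K * (B * (d⁻¹ ^ 4 * (d⁻¹ * d)))) := by ring
        _ ≤ K * (B * d⁻¹ ^ 4) := by
          rw [e]; have : 0 ≤ K * (B * d⁻¹ ^ 4) := by positivity
          linarith
        _ = Real.sqrt K ^ 2 * (Real.sqrt B ^ 2 * d⁻¹ ^ 4) := by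
          rw [Real.sq_sqrt hK0, Real.sq_sqrt hB0]
        _ = _ := by ring
    calc _ ≤ _ := hn
      _ ≤ C3 * ((d / 4)⁻¹ ^ 2 * (C2 * Real.sqrt B) + Real.sqrt K * (Real.sqrt B * d⁻¹ ^ 2)) :=
          mul_le_mul_of_nonneg_left (add_le_add_right hq3 _) hC3.le
      _ = M * (Real.sqrt B * d⁻¹ ^ 2) := by rw [hM, inv_div]; ring
      _ ≤ _ := by
        refine mul_le_mul_of_nonneg_right ?_ (by positivity)
        have : 0 < C3 * C2 := by positivity
        linarith
  · calc _ ≤ _ := hF (fun i => qf_integral h.sm hψs hψx s i) y hy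
      _ = C3 * C2 * (Real.sqrt B * ‖y‖⁻¹ ^ 3) := by ring
      _ ≤ _ := by
        refine mul_le_mul_of_nonneg_right ?_ (by positivity)
        linarith

lemma pressure_bound : ∃ C : ℝ, 0 < C ∧ ∀ (v : Fin 3 → Z → ℝ) (P : Z → ℝ) (c : Fin 3 → ℝ → ℝ),
    CSol v P c → ∀ (s₀ : ℝ) (y₀ : E3), Adm 1 s₀ y₀ → ∀ (k : ℕ) (s B : ℝ), -1 ≤ s → s ≤ s₀ →
    Integrable (fun y => G2 v (s, y)) →
    Integrable (fun y => gp v (s, y) * newt (qdiv v (psi ((1 / 2) ^ k) s₀ y₀) s) y) →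
    (∀ j ≤ k, Ak v s₀ y₀ j s ≤ B) →
    |∫ y, gp v (s, y) * newt (qdiv v (psi ((1 / 2) ^ k) s₀ y₀) s) y| ≤
      C * (Real.sqrt B * (pv v s + dsum v s₀ y₀ k B s)) := by
  classical
  obtain ⟨C1, hC1, H1⟩ := newt_ptwise
  set c₀ := 27 * Real.exp 1 with hc
  have hc0 : 27 ≤ c₀ := by have := Real.add_one_le_exp (1 : ℝ); rw [hc]; nlinarith
  refine ⟨C1 * (16 ^ 2 * c₀) + C1 * 27, by positivity,
    fun v P c h s₀ y₀ hA k s B hs1 hs hG hi hB => ?_⟩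
  obtain ⟨hN, hF⟩ := H1 v P c h s₀ y₀ hA k s B hs1 hs hB
  set n := newt (qdiv v (psi ((1 / 2) ^ k) s₀ y₀) s) with hn
  set D := closedBall (0 : E3) 2
  have hB0 : 0 ≤ B := (Ak_nonneg v s₀ y₀ 0 s).trans (hB 0 (Nat.zero_le _))
  have hGc := continuous_slice (G2_smooth h.sm).continuous s
  have hG0 : ∀ x, 0 ≤ G2 v (s, x) := fun _ => G2_nonneg v _
  have hp := pv_nonneg v s
  have hpc : Continuous fun x => (pdist ((1 / 2) ^ k) s₀ y₀ (s, x))⁻¹ ^ 2 :=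
    ((pdist_continuous s₀ y₀ s).inv₀ fun x =>
      (pdist_pos (by positivity) s₀ y₀ (s, x)).ne').pow 2
  have hgn : ∀ y K, |n y| ≤ K → |gp v (s, y) * n y| ≤ G2 v (s, y) * K := fun y K hK => by
    rw [abs_mul]; exact mul_le_mul (abs_gp_le v _) hK (abs_nonneg _) (hG0 _)
  have hin : ∫ y in D, |gp v (s, y) * n y| ≤
      C1 * (16 ^ 2 * c₀) * (Real.sqrt B * (pv v s + dsum v s₀ y₀ k B s)) := by
    have i1 : IntegrableOn (fun x => G2 v (s, x) * (pdist ((1 / 2) ^ k) s₀ y₀ (s, x))⁻¹ ^ 2) D :=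
      integrableOn_ball (hGc.mul hpc) _ _
    have h1 : ∫ y in D, |gp v (s, y) * n y| ≤ ∫ y in D, C1 * Real.sqrt B *
        (G2 v (s, y) * (pdist ((1 / 2) ^ k) s₀ y₀ (s, y))⁻¹ ^ 2) := by
      refine setIntegral_mono_on hi.abs.integrableOn (i1.const_mul _) measurableSet_closedBall
        fun y hy => ?_
      refine (hgn y _ (hN y (by simpa [D] using hy))).trans (le_of_eq (by ring))
    refine h1.trans ?_
    rw [integral_const_mul]
    have h2 := dyadic_integral hGc hG0 2 k hs 2 (y₀ := y₀)
    have h3 : ∀ j ∈ Finset.Icc 4 k, (if s₀ - s ≤ ((1 / 2 : ℝ) ^ j) ^ 2 then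
      ((2 : ℝ) ^ j) ^ 2 * ∫ x in closedBall y₀ ((1 / 2) ^ j), G2 v (s, x) else 0) ≤
      c₀ * ((1 / 2) ^ j * Gk v s₀ y₀ j s
        + B * (if s₀ - s ≤ ((1 / 2 : ℝ) ^ j) ^ 2 then (2 : ℝ) ^ j else 0)) := by
      intro j hj
      rw [Finset.mem_Icc] at hj
      have hg := Gk_nonneg v s₀ y₀ j s
      split_ifs with hcond
      · have h4 := ball_le_psi hGc hG0 hA (by positivity) (half_pow_le hj.1) hs hcond
        have h5 : ∫ x in closedBall y₀ ((1 / 2) ^ j), G2 v (s, x) ≤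
            ∫ x in closedBall y₀ (2 * (1 / 2) ^ j), G2 v (s, x) :=
          setIntegral_ball_mono hGc hG0 (closedBall_subset_closedBall (by
            have : (0 : ℝ) < (1 / 2) ^ j := by positivity
            linarith))
        have e := two_mul_half_pow j
        rw [← hc] at h4
        change _ ≤ c₀ * ((1 / 2) ^ j) ^ 3 * Gk v s₀ y₀ j s at h4
        set t := (2 : ℝ) ^ j
        set r := (1 / 2 : ℝ) ^ j
        calc _ ≤ t ^ 2 * (c₀ * r ^ 3 * Gk v s₀ y₀ j s) :=
              mul_le_mul_of_nonneg_left (h5.trans h4) (by positivity)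
          _ = c₀ * ((t * r) ^ 2 * (r * Gk v s₀ y₀ j s)) := by ring
          _ ≤ _ := by
            rw [e, one_pow, one_mul]
            refine mul_le_mul_of_nonneg_left ?_ (by positivity)
            exact le_add_of_nonneg_right (by positivity)
      · positivity
    calc _ ≤ C1 * Real.sqrt B * (16 ^ 2 * (c₀ * pv v s + ∑ j ∈ Finset.Icc 4 k,
          c₀ * ((1 / 2) ^ j * Gk v s₀ y₀ j s
        + B * (if s₀ - s ≤ ((1 / 2 : ℝ) ^ j) ^ 2 then (2 : ℝ) ^ j else 0)))) := by
          refine mul_le_mul_of_nonneg_left (h2.trans ?_) (by positivity)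
          refine mul_le_mul_of_nonneg_left (add_le_add ?_ (Finset.sum_le_sum h3)) (by positivity)
          exact (G2_ball_le h.sm hG).trans (mul_le_mul_of_nonneg_right hc0 hp)
      _ = _ := by rw [← Finset.mul_sum, dsum]; ring
  have hout : ∫ y in Dᶜ, |gp v (s, y) * n y| ≤ C1 * 27 * (Real.sqrt B * pv v s) := by
    have i2 := (pv_integrable h.sm hG).const_mul (C1 * Real.sqrt B * 27)
    calc _ ≤ ∫ y in Dᶜ, C1 * Real.sqrt B * 27 * (G2 v (s, y) * wt y) := by
          refine setIntegral_mono_on hi.abs.integrableOn i2.integrableOn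
            measurableSet_closedBall.compl fun y hy => ?_
          have hy2 : 2 ≤ ‖y‖ := by
            have : ¬ ‖y‖ ≤ 2 := by simpa [D] using hy
            linarith
          refine (hgn y _ ((hF y hy2).trans (mul_le_mul_of_nonneg_left
            (mul_le_mul_of_nonneg_left (wt_far hy2) (Real.sqrt_nonneg _)) hC1.le))).trans
            (le_of_eq (by ring))
      _ ≤ ∫ y, C1 * Real.sqrt B * 27 * (G2 v (s, y) * wt y) :=
          setIntegral_le_integral i2 (Filter.Eventually.of_forall fun y => by
            have := wt_pos y
            have := hG0 y
            positivity)
      _ = _ := by rw [integral_const_mul]; unfold pv; ring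
  have hd := dsum_nonneg (v := v) (s₀ := s₀) (y₀ := y₀) (k := k) (s := s) hB0
  calc _ ≤ ∫ y, |gp v (s, y) * n y| := abs_integral_le_integral_abs
    _ = (∫ y in D, |gp v (s, y) * n y|) + ∫ y in Dᶜ, |gp v (s, y) * n y| :=
        (integral_add_compl measurableSet_closedBall hi.abs).symm
    _ ≤ _ := add_le_add hin hout
    _ ≤ C1 * (16 ^ 2 * c₀) * (Real.sqrt B * (pv v s + dsum v s₀ y₀ k B s))
        + C1 * 27 * (Real.sqrt B * (pv v s + dsum v s₀ y₀ k B s)) := by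
        gcongr; linarith
    _ = _ := by ring

end

/-! ### The local energy estimate -/

/-- The pivot quantity: dissipation in the unit past, with weight. -/
def pivot (v : Fin 3 → Z → ℝ) : ℝ≥0∞ :=
  ∫⁻ s in Icc (-1 : ℝ) 0, ∫⁻ y, ENNReal.ofReal (G2 v (s, y) * wt y)

section
variable {v : Fin 3 → Z → ℝ} {P : Z → ℝ} {c : Fin 3 → ℝ → ℝ}

lemma rate_bound : ∃ C : ℝ, 1 ≤ C ∧ ∀ (v : Fin 3 → Z → ℝ) (P : Z → ℝ) (c : Fin 3 → ℝ → ℝ),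
    CSol v P c → ∀ (s₀ : ℝ) (y₀ : E3), Adm 1 s₀ y₀ → ∀ (k : ℕ) (B : ℝ),
    (∀ j ≤ k, ∀ s ∈ Icc (-1 : ℝ) s₀, Ak v s₀ y₀ j s ≤ B) →
    ∀ᵐ s, s ∈ Ioo (-1 : ℝ) s₀ → ∃ D, HasDerivAt (fun s => 1 / 2 * Ak v s₀ y₀ k s) D s ∧
      D + Gk v s₀ y₀ k s ≤ C * (pv v s + Real.sqrt B * (Real.sqrt (pv v s) + pv v s)
        + Real.sqrt B * dsum v s₀ y₀ k B s) := by
  obtain ⟨C1, hC1, H1⟩ := hcom_bound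
  obtain ⟨C2, hC2, H2⟩ := slice_local
  obtain ⟨C3, hC3, H3⟩ := cubic_bound
  obtain ⟨C4, hC4, H4⟩ := pressure_bound
  obtain ⟨C5, hC5, H5⟩ := mfor_bound
  obtain ⟨C6, hC6, H6⟩ := moment_bound
  refine ⟨C1 * C2 + C3 + C4 + 3 * C5 * C6 + 1, by
    have := mul_pos hC1 hC2; have := mul_pos hC5 hC6; linarith,
    fun v P c h s₀ y₀ hA k B hB => ?_⟩
  have hk := hA.scale k
  set r := (1 / 2 : ℝ) ^ k with hr
  have hr0 : 0 < r := by positivity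
  set ψ := psi r s₀ y₀ with hψ
  have hψs : Sm ψ := psi_smooth hr0 s₀ y₀
  have hψx : XSupp 1 ψ := psi_xsupp r s₀ y₀
  filter_upwards [h.energy_newt hψs hψx] with s hs hs0
  have hs1 : -1 ≤ s := hs0.1.le
  have hs2 : s ≤ s₀ := hs0.2.le
  have hs' : s ∈ Icc (-1 : ℝ) 0 := ⟨hs1, hs2.trans hA.s_le⟩
  obtain ⟨hG, hi, hd⟩ := hs ⟨hs0.1, hs0.2.trans_le hA.s_le⟩
  have hm := h.mean s hs'
  have hBs : ∀ j ≤ k, Ak v s₀ y₀ j s ≤ B := fun j hj => hB j hj s ⟨hs1, hs2⟩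
  have hB0 : 0 ≤ B := (Ak_nonneg v s₀ y₀ 0 s).trans (hBs 0 (Nat.zero_le _))
  refine ⟨_, hd, ?_⟩
  have hp := pv_nonneg v s
  have hds := dsum_nonneg (v := v) (s₀ := s₀) (y₀ := y₀) (k := k) (s := s) hB0
  have g1 : |∫ x, S2 v (s, x) * (dt ψ (s, x) + lap ψ (s, x))| ≤ C1 * (C2 * pv v s) := by
    have hc : Continuous fun x => dt ψ (s, x) + lap ψ (s, x) :=
      continuous_slice ((dv_smooth _ hψs).add (lap_smooth hψs)).continuous s
    refine (abs_integral_S2_mul_le h.sm hc (fun x hx => ?_) (K := C1) (fun x => ?_) s).trans ?_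
    · rw [show dt ψ (s, x) = 0 from hψx.dv _ s x hx,
        show lap ψ (s, x) = 0 from Finset.sum_eq_zero fun j _ => (hψx.dv _).dv _ s x hx, add_zero]
    · rw [dt_add_lap_psi hr0 hs2]
      exact (H1 r s₀ y₀ hk s hs1 hs2 x).1
    · exact mul_le_mul_of_nonneg_left (H2 v h.sm s hm hG).1 hC1.le
  have g2 := H3 v h.sm s₀ y₀ hA k s B hs1 hs2 hm hG hBs
  have g3 := H4 v P c h s₀ y₀ hA k s B hs1 hs2 hG hi hBs
  have g4 : |∑ i, mfor v i s * amo v ψ i s| ≤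
      3 * C5 * C6 * (Real.sqrt B * (Real.sqrt (pv v s) + pv v s)) := by
    have : ∀ i ∈ Finset.univ, |mfor v i s * amo v ψ i s| ≤
        C5 * (Real.sqrt (pv v s) + pv v s) * (C6 * Real.sqrt B) := fun i _ => by
      rw [abs_mul]
      exact mul_le_mul (H5 v h.sm s hs' hm hG i) ((H6 v h.sm r s₀ y₀ hr0 s B (hBs k le_rfl)).1 i)
        (abs_nonneg _) (by positivity)
    refine (Finset.abs_sum_le_sum_abs _ _).trans ((Finset.sum_le_sum this).trans (le_of_eq ?_))
    simp only [Finset.sum_const, Finset.card_univ, Fintype.card_fin, nsmul_eq_mul]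
    push_cast; ring
  have hpi : 1 / (4 * Real.pi) ≤ 1 := by
    rw [div_le_one (by positivity)]; have := Real.pi_gt_three; linarith
  have hpi0 : 0 ≤ 1 / (4 * Real.pi) := by positivity
  have g5 : 1 / (4 * Real.pi) * (∫ y, gp v (s, y) * newt (qdiv v ψ s) y) ≤
      C4 * (Real.sqrt B * (pv v s + dsum v s₀ y₀ k B s)) :=
    (le_abs_self _).trans ((abs_mul _ _).le.trans (by
      rw [abs_of_nonneg hpi0]; exact (mul_le_of_le_one_left (abs_nonneg _) hpi).trans g3))
  have a1 := le_abs_self (∫ x, S2 v (s, x) * (dt ψ (s, x) + lap ψ (s, x)))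
  have a2 := le_abs_self (∫ x, S2 v (s, x) * ∑ j, v j (s, x) * dx j ψ (s, x))
  have a4 := neg_abs_le (∑ i, mfor v i s * amo v ψ i s)
  have e : Gk v s₀ y₀ k s = ∫ x, G2 v (s, x) * ψ (s, x) := rfl
  rw [e]
  set p := pv v s
  set b := Real.sqrt B
  set q := Real.sqrt p
  set d := dsum v s₀ y₀ k B s
  have hb : 0 ≤ b := Real.sqrt_nonneg _
  have hq : 0 ≤ q := Real.sqrt_nonneg _
  have n1 : 0 ≤ b * p := by positivity
  have n2 : 0 ≤ b * q := by positivity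
  have n3 : 0 ≤ b * d := by positivity
  have hc12 := mul_pos hC1 hC2
  have hc56 := mul_pos hC5 hC6
  have t0 : 0 ≤ C3 * (b * (p + d)) := by positivity
  have t1 : 0 ≤ C1 * (C2 * p) := by positivity
  set Y := p + b * (q + p) + b * d with hY
  have y0 : 0 ≤ Y := by positivity
  have y1 : p ≤ Y := by rw [hY]; nlinarith
  have y2 : b * (p + d) ≤ Y := by rw [hY]; nlinarith
  have y3 : b * (q + p) ≤ Y := by rw [hY]; nlinarith
  have z1 := mul_le_mul_of_nonneg_left y1 hc12.le
  have z2 := mul_le_mul_of_nonneg_left y2 hC3.le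
  have z3 := mul_le_mul_of_nonneg_left y2 hC4.le
  have z4 := mul_le_mul_of_nonneg_left y3 (by positivity : 0 ≤ 3 * C5 * C6)
  linarith

lemma pv_integrableOn {η : ℝ} (hv : ∀ i, Sm (v i)) (hp : pivot v ≤ ENNReal.ofReal η) (hη : 0 ≤ η) :
    IntegrableOn (pv v) (Icc (-1) 0) ∧ ∫ s in Icc (-1 : ℝ) 0, pv v s ≤ η := by
  have hm : Measurable fun z : Z => ENNReal.ofReal (G2 v z * wt z.2) :=
    ((G2_smooth hv).continuous.mul (wt_continuous.comp continuous_snd)).measurable.ennreal_ofReal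
  have hm2 : Measurable fun s : ℝ => ∫⁻ y, ENNReal.ofReal (G2 v (s, y) * wt y) :=
    hm.lintegral_prod_right'
  have e : pv v = fun s => (∫⁻ y, ENNReal.ofReal (G2 v (s, y) * wt y)).toReal := by
    funext s
    exact integral_eq_lintegral_of_nonneg_ae
      (Filter.Eventually.of_forall fun y => mul_nonneg (G2_nonneg v _) (wt_pos y).le)
      ((continuous_slice (G2_smooth hv).continuous s).mul wt_continuous).aestronglyMeasurable
  have hlt : pivot v < ⊤ := hp.trans_lt ENNReal.ofReal_lt_top
  refine ⟨?_, ?_⟩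
  · rw [e]; exact integrable_toReal_of_lintegral_ne_top hm2.aemeasurable hlt.ne
  · rw [e, integral_toReal hm2.aemeasurable (ae_lt_top hm2 hlt.ne)]
    exact ENNReal.toReal_le_of_le_ofReal hη hp

lemma sqrt_le_of_pos {p η : ℝ} (hη : 0 < η) (hp : 0 ≤ p) :
    Real.sqrt p ≤ (Real.sqrt η)⁻¹ / 2 * p + Real.sqrt η / 2 := by
  have h1 := Real.sq_sqrt hp
  have h2 := Real.sqrt_pos.2 hη
  set a := Real.sqrt p
  set b := Real.sqrt η
  have : b⁻¹ / 2 * p + b / 2 - a = b⁻¹ / 2 * (a - b) ^ 2 := by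
    rw [← h1]; field_simp; ring
  have : 0 ≤ b⁻¹ / 2 * (a - b) ^ 2 := by positivity
  linarith

lemma Gk_continuous (hv : ∀ i, Sm (v i)) (s₀ : ℝ) (y₀ : E3) (k : ℕ) : Continuous (Gk v s₀ y₀ k) :=
  ((psi_xsupp _ s₀ y₀).mul_left _).continuous_integral
    ((G2_smooth hv).mul (psi_smooth (by positivity) s₀ y₀)).continuous

lemma Ak_continuous (hv : ∀ i, Sm (v i)) (s₀ : ℝ) (y₀ : E3) (k : ℕ) : Continuous (Ak v s₀ y₀ k) :=
  ((psi_xsupp _ s₀ y₀).mul_left _).continuous_integral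
    ((S2_smooth hv).mul (psi_smooth (by positivity) s₀ y₀)).continuous

open Classical in
lemma integral_indicator_le (s₀ : ℝ) (j : ℕ) :
    IntegrableOn (fun s => if s₀ - s ≤ ((1 / 2 : ℝ) ^ j) ^ 2 then (2 : ℝ) ^ j else 0) (Ioc (-1) s₀) ∧
    ∫ s in Ioc (-1) s₀, (if s₀ - s ≤ ((1 / 2 : ℝ) ^ j) ^ 2 then (2 : ℝ) ^ j else 0) ≤ (1 / 2) ^ j := by
  set r := (1 / 2 : ℝ) ^ j with hr
  set g : ℝ → ℝ := fun s => if s₀ - s ≤ r ^ 2 then (2 : ℝ) ^ j else 0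
  have hmI : MeasurableSet {s : ℝ | s₀ - s ≤ r ^ 2} :=
    measurableSet_le (measurable_const.sub measurable_id) measurable_const
  have hg : Measurable g := Measurable.ite hmI measurable_const measurable_const
  have hi : Integrable ((Icc (s₀ - r ^ 2) s₀).indicator fun _ => (2 : ℝ) ^ j) :=
    (integrable_indicator_iff measurableSet_Icc).2 (integrableOn_const (by simp))
  have hle : ∀ s ∈ Ioc (-1) s₀, g s ≤ (Icc (s₀ - r ^ 2) s₀).indicator (fun _ => (2 : ℝ) ^ j) s := by
    intro s hs
    simp only [g]
    split_ifs with hc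
    · have : s ∈ Icc (s₀ - r ^ 2) s₀ := ⟨by linarith, hs.2⟩
      rw [indicator_of_mem this]
    · exact indicator_nonneg (fun _ _ => by positivity) _
  have hg0 : ∀ s, 0 ≤ g s := fun s => by simp only [g]; split_ifs <;> positivity
  have hgi : IntegrableOn g (Ioc (-1) s₀) := by
    refine Integrable.mono' hi.integrableOn hg.aestronglyMeasurable ?_
    refine (ae_restrict_iff' measurableSet_Ioc).2 (Filter.Eventually.of_forall fun s hs => ?_)
    rw [Real.norm_of_nonneg (hg0 s)]; exact hle s hs
  refine ⟨hgi, ?_⟩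
  refine (setIntegral_mono_on hgi hi.integrableOn measurableSet_Ioc hle).trans
    ((setIntegral_le_integral hi (Filter.Eventually.of_forall fun s =>
      indicator_nonneg (fun _ _ => by positivity) _)).trans (le_of_eq ?_))
  rw [integral_indicator measurableSet_Icc, setIntegral_const, Real.volume_real_Icc,
    max_eq_left (by have := sq_nonneg r; linarith), smul_eq_mul]
  have e := two_mul_half_pow j
  rw [← hr] at e
  linear_combination r * e

/-- The weighted energy bounds at scale `2⁻ᵏ`. -/
def EB (v : Fin 3 → Z → ℝ) (s₀ : ℝ) (y₀ : E3) (k : ℕ) (B : ℝ) : Prop :=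
  (∀ s ∈ Icc (-1 : ℝ) s₀, Ak v s₀ y₀ k s ≤ B) ∧ ∫ s in Ioc (-1 : ℝ) s₀, Gk v s₀ y₀ k s ≤ B

lemma sum_half_le (k : ℕ) : ∑ j ∈ Finset.Icc 4 k, (1 / 2 : ℝ) ^ j ≤ 1 / 8 := by
  have h : ∀ n : ℕ, ∑ j ∈ Finset.range n, (1 / 2 : ℝ) ^ (4 + j) ≤ 1 / 8 := fun n => by
    have := geom_sum_eq (x := (1 / 2 : ℝ)) (by norm_num) n
    simp only [pow_add, ← Finset.mul_sum]
    rw [this]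
    have h2 : (0 : ℝ) < (1 / 2) ^ n := by positivity
    have h3 : (1 / 2 : ℝ) ^ 4 * (((1 / 2) ^ n - 1) / (1 / 2 - 1)) = 1 / 8 - 1 / 8 * (1 / 2) ^ n := by
      ring
    rw [h3]; linarith
  have e : Finset.Icc 4 k = Finset.Ico 4 (k + 1) := by ext; simp
  rw [e, Finset.sum_Ico_eq_sum_range]
  exact h _

lemma integral_dsum_le (hv : ∀ i, Sm (v i)) {s₀ : ℝ} {y₀ : E3} {k : ℕ} {B : ℝ} (hB : 0 ≤ B)
    (h : ∀ j ≤ k, EB v s₀ y₀ j B) :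
    IntegrableOn (dsum v s₀ y₀ k B) (Ioc (-1) s₀) ∧
    ∫ s in Ioc (-1) s₀, dsum v s₀ y₀ k B s ≤ if k = 0 then 0 else B := by
  classical
  have hG : ∀ j, IntegrableOn (Gk v s₀ y₀ j) (Ioc (-1) s₀) := fun j =>
    ((Gk_continuous hv s₀ y₀ j).continuousOn.integrableOn_Icc).mono_set Ioc_subset_Icc_self
  have hI : ∀ j, IntegrableOn (fun s => (1 / 2) ^ j * Gk v s₀ y₀ j s
    + B * (if s₀ - s ≤ ((1 / 2 : ℝ) ^ j) ^ 2 then (2 : ℝ) ^ j else 0)) (Ioc (-1) s₀) := fun j =>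
    ((hG j).const_mul _).add ((integral_indicator_le s₀ j).1.const_mul _)
  refine ⟨integrable_finsetSum _ fun j _ => hI j, ?_⟩
  unfold dsum
  rw [integral_finsetSum _ fun j _ => hI j]
  split_ifs with hk
  · subst hk; simp
  · have : ∀ j ∈ Finset.Icc 4 k, ∫ s in Ioc (-1) s₀, ((1 / 2) ^ j * Gk v s₀ y₀ j s
      + B * (if s₀ - s ≤ ((1 / 2 : ℝ) ^ j) ^ 2 then (2 : ℝ) ^ j else 0)) ≤ 2 * B * (1 / 2) ^ j := by
      intro j hj
      rw [Finset.mem_Icc] at hj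
      rw [integral_add ((hG j).const_mul _) ((integral_indicator_le s₀ j).1.const_mul _),
        integral_const_mul, integral_const_mul]
      have h1 := mul_le_mul_of_nonneg_left (h j hj.2).2 (by positivity : (0 : ℝ) ≤ (1 / 2) ^ j)
      have h2 := mul_le_mul_of_nonneg_left (integral_indicator_le s₀ j).2 hB
      linarith
    refine (Finset.sum_le_sum this).trans ?_
    rw [← Finset.mul_sum]
    nlinarith [sum_half_le k]

lemma EB_step : ∃ C : ℝ, 1 ≤ C ∧ ∀ (v : Fin 3 → Z → ℝ) (P : Z → ℝ) (c : Fin 3 → ℝ → ℝ),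
    CSol v P c → ∀ η : ℝ, 0 < η → η ≤ 1 → pivot v ≤ ENNReal.ofReal η →
    ∀ (s₀ : ℝ) (y₀ : E3), Adm 1 s₀ y₀ → ∀ (k : ℕ) (B : ℝ), (∀ j ≤ k, EB v s₀ y₀ j B) →
    EB v s₀ y₀ k (C * (η + 2 * (Real.sqrt B * Real.sqrt η)
      + Real.sqrt B * (if k = 0 then 0 else B))) := by
  obtain ⟨C, hC, H⟩ := rate_bound
  refine ⟨2 * C, by linarith, fun v P c h η hη hη1 hp s₀ y₀ hA k B hB => ?_⟩
  have hB0 : 0 ≤ B := (Ak_nonneg v s₀ y₀ 0 (-1)).trans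
    ((hB 0 (Nat.zero_le _)).1 _ ⟨le_rfl, by linarith [hA.s_ge]⟩)
  obtain ⟨hpi, hpη⟩ := pv_integrableOn h.sm hp hη.le
  obtain ⟨hdi, hdB⟩ := integral_dsum_le h.sm hB0 hB
  set U := if k = 0 then 0 else B with hU
  have hsub : Ioc (-1 : ℝ) s₀ ⊆ Icc (-1) 0 :=
    fun s hs => ⟨hs.1.le, hs.2.trans hA.s_le⟩
  have hpi' : IntegrableOn (pv v) (Ioc (-1) s₀) := hpi.mono_set hsub
  have hpη' : ∫ s in Ioc (-1) s₀, pv v s ≤ η :=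
    (setIntegral_mono_set hpi (Filter.Eventually.of_forall fun s => pv_nonneg v s)
      (LE.le.eventuallyLE hsub)).trans hpη
  set b := Real.sqrt B with hb
  have hb0 : 0 ≤ b := Real.sqrt_nonneg _
  set e := Real.sqrt η with he
  have he0 : 0 < e := Real.sqrt_pos.2 hη
  have he2 : e ^ 2 = η := Real.sq_sqrt hη.le
  have he1 : e ≤ 1 := Real.sqrt_le_one.2 hη1
  -- majorant
  set F : ℝ → ℝ := fun s => C * (pv v s + b * (e⁻¹ / 2 * pv v s + e / 2 + pv v s)
    + b * dsum v s₀ y₀ k B s) with hF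
  have hcst : IntegrableOn (fun _ : ℝ => e / 2) (Ioc (-1) s₀) := integrableOn_const (by simp)
  have j1 : IntegrableOn (fun s => e⁻¹ / 2 * pv v s + e / 2) (Ioc (-1) s₀) :=
    (hpi'.const_mul _).add hcst
  have j2 : IntegrableOn (fun s => e⁻¹ / 2 * pv v s + e / 2 + pv v s) (Ioc (-1) s₀) := j1.add hpi'
  have j3 : IntegrableOn (fun s => pv v s + b * (e⁻¹ / 2 * pv v s + e / 2 + pv v s)) (Ioc (-1) s₀) :=
    hpi'.add (j2.const_mul _)
  have j4 : IntegrableOn (fun s => pv v s + b * (e⁻¹ / 2 * pv v s + e / 2 + pv v s)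
    + b * dsum v s₀ y₀ k B s) (Ioc (-1) s₀) := j3.add (hdi.const_mul _)
  have hFi : IntegrableOn F (Ioc (-1) s₀) := j4.const_mul _
  have hF0 : ∀ s, 0 ≤ F s := fun s => by
    have := pv_nonneg v s
    have := dsum_nonneg (v := v) (s₀ := s₀) (y₀ := y₀) (k := k) (s := s) hB0
    simp only [hF]; positivity
  have hFle : ∫ s in Ioc (-1) s₀, F s ≤ C * (η + 2 * (b * e) + b * U) := by
    simp only [hF]
    rw [integral_const_mul, integral_add j3 (hdi.const_mul _), integral_add hpi' (j2.const_mul _),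
      integral_const_mul, integral_const_mul, integral_add j1 hpi',
      integral_add (hpi'.const_mul _) hcst, integral_const_mul, setIntegral_const]
    refine mul_le_mul_of_nonneg_left ?_ (by linarith)
    have v1 : volume.real (Ioc (-1 : ℝ) s₀) ≤ 1 := by
      rw [Real.volume_real_Ioc]; exact max_le (by linarith [hA.s_le]) (by norm_num)
    have q1 : e⁻¹ / 2 * ∫ s in Ioc (-1) s₀, pv v s ≤ e / 2 := by
      have : e⁻¹ / 2 * η = e / 2 := by rw [← he2]; field_simp
      rw [← this]; exact mul_le_mul_of_nonneg_left hpη' (by positivity)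
    have q2 : volume.real (Ioc (-1 : ℝ) s₀) • (e / 2) ≤ e / 2 := by
      rw [smul_eq_mul]; exact mul_le_of_le_one_left (by positivity) v1
    have q3 : ∫ s in Ioc (-1) s₀, pv v s ≤ e := hpη'.trans (by rw [← he2]; nlinarith)
    have q4 := mul_le_mul_of_nonneg_left (add_le_add (add_le_add q1 q2) q3) hb0
    have q5 := mul_le_mul_of_nonneg_left hdB hb0
    linarith
  -- integrate
  have hae := H v P c h s₀ y₀ hA k B fun j hj => (hB j hj).1
  set f : ℝ → ℝ := fun s => 1 / 2 * Ak v s₀ y₀ k s with hf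
  have hsm : Sm fun z => S2 v z * psi ((1 / 2) ^ k) s₀ y₀ z :=
    (S2_smooth h.sm).mul (psi_smooth (by positivity) s₀ y₀)
  have hxs : XSupp 1 fun z => S2 v z * psi ((1 / 2) ^ k) s₀ y₀ z := (psi_xsupp _ s₀ y₀).mul_left _
  set f' : ℝ → ℝ := fun s => 1 / 2 * ∫ x, dt (fun z => S2 v z * psi ((1 / 2) ^ k) s₀ y₀ z) (s, x)
  have hd : ∀ s, HasDerivAt f (f' s) s := fun s => (hxs.hasDerivAt_integral hsm s).const_mul (1 / 2)
  have hf'c : Continuous f' :=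
    continuous_const.mul ((hxs.dv _).continuous_integral (dv_smooth _ hsm).continuous)
  have hGc := Gk_continuous h.sm s₀ y₀ k
  have main : ∀ σ ∈ Icc (-1) s₀, 1 / 2 * Ak v s₀ y₀ k σ + ∫ s in Ioc (-1) σ, Gk v s₀ y₀ k s ≤
      C * (η + 2 * (b * e) + b * U) := by
    intro σ hσ
    have h1 : ∫ s in (-1 : ℝ)..σ, f' s = f σ - f (-1) :=
      intervalIntegral.integral_eq_sub_of_hasDerivAt (fun s _ => hd s)
        (hf'c.intervalIntegrable _ _)
    have h2 : f (-1) = 0 := by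
      simp only [hf, Ak]
      simp only [psi_init, mul_zero, integral_zero]
    rw [h2, sub_zero, intervalIntegral.integral_of_le hσ.1] at h1
    change f σ + _ ≤ _
    have i1 : IntegrableOn f' (Ioc (-1) σ) := hf'c.integrableOn_Ioc
    have i2 : IntegrableOn (Gk v s₀ y₀ k) (Ioc (-1) σ) := hGc.integrableOn_Ioc
    rw [← h1, ← integral_add i1 i2]
    have hss : Ioc (-1) σ ⊆ Ioc (-1) s₀ := Ioc_subset_Ioc_right hσ.2
    refine le_trans ?_ ((setIntegral_mono_set hFi (Filter.Eventually.of_forall hF0)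
      (LE.le.eventuallyLE hss)).trans hFle)
    refine integral_mono_ae (i1.add i2) (hFi.mono_set hss) ?_
    have hne : ∀ᵐ s : ℝ, s ≠ s₀ := by
      simp [ae_iff]
    refine (ae_restrict_iff' measurableSet_Ioc).2 ?_
    filter_upwards [hae, hne] with s hs hsne hsm
    obtain ⟨D, hD, hle⟩ := hs ⟨hsm.1, lt_of_le_of_ne (hsm.2.trans hσ.2) hsne⟩
    have : D = f' s := hD.unique (hd s)
    rw [this] at hle
    refine hle.trans ?_
    simp only [hF]
    have := sqrt_le_of_pos hη (pv_nonneg v s)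
    gcongr
  have hGk0 : ∀ σ, 0 ≤ ∫ s in Ioc (-1) σ, Gk v s₀ y₀ k s := fun σ =>
    integral_nonneg fun s => Gk_nonneg v s₀ y₀ k s
  refine ⟨fun σ hσ => ?_, ?_⟩
  · have := main σ hσ; have := hGk0 σ; linarith
  · have h3 := main s₀ ⟨by linarith [hA.s_ge], le_rfl⟩
    have h4 := Ak_nonneg v s₀ y₀ k s₀
    have h5 := hGk0 s₀
    linarith

lemma EB_succ (hv : ∀ i, Sm (v i)) {s₀ : ℝ} {y₀ : E3} {k : ℕ} {B : ℝ}
    (h : EB v s₀ y₀ k B) : EB v s₀ y₀ (k + 1) (8 * B) := by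
  have hr : (0 : ℝ) < (1 / 2) ^ k := by positivity
  have e : (1 / 2 : ℝ) ^ (k + 1) = (1 / 2) ^ k / 2 := by rw [pow_succ]; ring
  have key : ∀ (f : E3 → ℝ), Continuous f → (∀ x, 0 ≤ f x) → ∀ s ≤ s₀,
      ∫ x, f x * psi ((1 / 2) ^ (k + 1)) s₀ y₀ (s, x) ≤
        8 * ∫ x, f x * psi ((1 / 2) ^ k) s₀ y₀ (s, x) := fun f hf h0 s hs => by
    rw [← integral_const_mul]
    refine integral_mono (integrable_mul_psi hf (by positivity) s₀ y₀ s)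
      ((integrable_mul_psi hf hr s₀ y₀ s).const_mul 8) fun x => ?_
    have := mul_le_mul_of_nonneg_left (psi_half_le hr hs x (y₀ := y₀)) (h0 x)
    rw [← e] at this
    linarith
  refine ⟨fun s hs => ?_, ?_⟩
  · have h1 := key _ (continuous_slice (S2_smooth hv).continuous s) (fun _ => S2_nonneg v _) s hs.2
    exact h1.trans (mul_le_mul_of_nonneg_left (h.1 s hs) (by norm_num))
  · refine le_trans ?_ (mul_le_mul_of_nonneg_left h.2 (by norm_num : (0 : ℝ) ≤ 8))
    rw [← integral_const_mul]
    refine setIntegral_mono_on (Gk_continuous hv s₀ y₀ (k + 1)).integrableOn_Ioc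
      ((Gk_continuous hv s₀ y₀ k).integrableOn_Ioc.const_mul 8) measurableSet_Ioc fun s hs => ?_
    exact key _ (continuous_slice (G2_smooth hv).continuous s) (fun _ => G2_nonneg v _) s hs.2

lemma EB.mono {s₀ : ℝ} {y₀ : E3} {k : ℕ} {B B' : ℝ} (h : EB v s₀ y₀ k B) (hB : B ≤ B') :
    EB v s₀ y₀ k B' := ⟨fun s hs => (h.1 s hs).trans hB, h.2.trans hB⟩

/-- Small dissipation implies smallness of the velocity. -/
lemma small_velocity : ∃ M η₀ : ℝ, 0 < M ∧ 0 < η₀ ∧ ∀ (v : Fin 3 → Z → ℝ) (P : Z → ℝ)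
    (c : Fin 3 → ℝ → ℝ), CSol v P c → ∀ η : ℝ, 0 < η → η ≤ η₀ → pivot v ≤ ENNReal.ofReal η →
    ∀ (s₀ : ℝ) (y₀ : E3), -1 / 4 ≤ s₀ → s₀ ≤ 0 → ‖y₀‖ ≤ 1 / 4 → S2 v (s₀, y₀) ≤ M * η := by
  obtain ⟨C, hC, H⟩ := EB_step
  obtain ⟨C', hC', H'⟩ := psi_conc
  have hC2 : (1 : ℝ) ≤ C ^ 2 := one_le_pow₀ hC
  refine ⟨C' * (200 * C ^ 2), (640 * C ^ 2)⁻¹ ^ 2, by positivity, by positivity,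
    fun v P c h η hη hη0 hp s₀ y₀ h1 h2 h3 => ?_⟩
  have hA : Adm 1 s₀ y₀ := ⟨one_pos, le_rfl, h1, h2, h3⟩
  set e := Real.sqrt η with he
  have he0 : 0 < e := Real.sqrt_pos.2 hη
  have he2 : e ^ 2 = η := Real.sq_sqrt hη.le
  have he1 : e ≤ (640 * C ^ 2)⁻¹ := by
    rw [he]; exact Real.sqrt_le_iff.2 ⟨by positivity, hη0⟩
  have he1' : e * (640 * C ^ 2) ≤ 1 := by
    rwa [← one_div, le_div_iff₀ (by positivity)] at he1
  have hη1 : η ≤ 1 := by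
    have : e ≤ 1 := by nlinarith
    rw [← he2]; nlinarith
  have H1 := H v P c h η hη hη1 hp s₀ y₀ hA
  set δ := 200 * C ^ 2 * η with hδ
  have hδ0 : 0 < δ := by positivity
  have base : EB v s₀ y₀ 0 δ := by
    obtain ⟨σ, hσ, hmax⟩ := isCompact_Icc.exists_isMaxOn (s := Icc (-1) s₀) (nonempty_Icc.2 (by linarith))
      (Ak_continuous h.sm s₀ y₀ 0).continuousOn
    set B := max (Ak v s₀ y₀ 0 σ) (∫ s in Ioc (-1 : ℝ) s₀, Gk v s₀ y₀ 0 s) with hB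
    have hEB : EB v s₀ y₀ 0 B := ⟨fun s hs => (hmax hs).trans (le_max_left _ _), le_max_right _ _⟩
    have hX := H1 0 B fun j hj => by rw [Nat.le_zero.1 hj]; exact hEB
    simp only [if_true, mul_zero, add_zero] at hX
    have hBX : B ≤ C * (η + 2 * (Real.sqrt B * e)) := max_le (hX.1 σ hσ) hX.2
    refine hEB.mono ?_
    have hB0 : 0 ≤ B := (Ak_nonneg v s₀ y₀ 0 σ).trans (le_max_left _ _)
    have hb2 := Real.sq_sqrt hB0
    set b := Real.sqrt B
    have : 2 * C * (b * e) ≤ b ^ 2 / 2 + 2 * C ^ 2 * e ^ 2 := by nlinarith [sq_nonneg (b - 2 * C * e)]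
    have hCη : C * η ≤ C ^ 2 * η := by nlinarith
    rw [he2, hb2] at this
    rw [hδ]; nlinarith
  have all : ∀ k, ∀ j ≤ k, EB v s₀ y₀ j δ := by
    intro k
    induction k with
    | zero => intro j hj; rw [Nat.le_zero.1 hj]; exact base
    | succ k ih =>
      have h8 : ∀ j ≤ k + 1, EB v s₀ y₀ j (8 * δ) := fun j hj => by
        rcases Nat.lt_or_ge k j with hjk | hjk
        · have : j = k + 1 := by omega
          rw [this]; exact EB_succ h.sm (ih k le_rfl)
        · exact (ih j hjk).mono (by linarith)
      have hX := H1 (k + 1) (8 * δ) h8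
      rw [if_neg (by omega)] at hX
      have hs : Real.sqrt (8 * δ) = 40 * C * e := by
        rw [hδ, ← he2, show 8 * (200 * C ^ 2 * e ^ 2) = (40 * C * e) ^ 2 by ring]
        exact Real.sqrt_sq (by positivity)
      intro j hj
      rcases Nat.lt_or_ge k j with hjk | hjk
      · have : j = k + 1 := by omega
        rw [this]
        refine hX.mono ?_
        rw [hs, ← he]
        have x1 : C * η ≤ C ^ 2 * η := by nlinarith
        have x2 : C * (40 * C * e * (8 * δ)) ≤ δ / 2 := by nlinarith
        have x3 : C * (2 * (40 * C * e * e)) = 80 * C ^ 2 * η := by rw [← he2]; ring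
        have x4 : δ = 200 * C ^ 2 * η := hδ
        have : 0 < C ^ 2 * η := by positivity
        nlinarith
      · exact ih j hjk
  have := H' s₀ y₀ hA (fun x => S2 v (s₀, x)) (continuous_slice (S2_smooth h.sm).continuous s₀) δ
    fun k => by
      refine (abs_of_nonneg (Ak_nonneg v s₀ y₀ k s₀)).le.trans ?_
      exact (all k k le_rfl).1 s₀ ⟨by linarith, le_rfl⟩
  rw [abs_of_nonneg (S2_nonneg v _)] at this
  rw [hδ] at this
  linarith

end

/-! ### Interior gradient estimate for the heat equation -/

/-- The parabolic rescaling about `p`. -/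
def aff (r : ℝ) (p z : Z) : Z := (p.1 + r ^ 2 * z.1, p.2 + r • z.2)

lemma aff_smooth (r : ℝ) (p : Z) : ContDiff ℝ ((⊤ : ℕ∞) : WithTop ℕ∞) (aff r p) := by
  unfold aff; fun_prop

lemma aff_comp_smooth {f : Z → ℝ} (hf : Sm f) (r : ℝ) (p : Z) : Sm (fun z => f (aff r p z)) :=
  hf.comp (aff_smooth r p)

lemma dv_aff {f : Z → ℝ} (hf : Sm f) (r : ℝ) (p w z : Z) :
    dv w (fun z => f (aff r p z)) z = fderiv ℝ f (aff r p z) (r ^ 2 * w.1, r • w.2) := by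
  have h1 : HasFDerivAt (aff r p)
      ((((r ^ 2) • ContinuousLinearMap.fst ℝ ℝ E3)).prod (r • ContinuousLinearMap.snd ℝ ℝ E3)) z := by
    unfold aff
    refine HasFDerivAt.prodMk ?_ ?_
    · exact ((hasFDerivAt_fst (𝕜 := ℝ) (p := z)).const_mul (r ^ 2)).const_add p.1
    · exact ((hasFDerivAt_snd (𝕜 := ℝ) (p := z)).const_smul r).const_add p.2
  have h2 := ((hf.diff (aff r p z)).hasFDerivAt).comp z h1
  unfold dv
  rw [show (fun z => f (aff r p z)) = f ∘ aff r p from rfl, h2.fderiv]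
  simp

lemma dx_aff {f : Z → ℝ} (hf : Sm f) (r : ℝ) (p : Z) (j : Fin 3) :
    dx j (fun z => f (aff r p z)) = fun z => r * dx j f (aff r p z) := by
  funext z
  rw [dx, dv_aff hf]
  simp only [mul_zero]
  rw [show ((0 : ℝ), r • eb j) = r • ((0, eb j) : Z) by simp, map_smul]; rfl

lemma dt_aff {f : Z → ℝ} (hf : Sm f) (r : ℝ) (p : Z) :
    dt (fun z => f (aff r p z)) = fun z => r ^ 2 * dt f (aff r p z) := by
  funext z
  rw [dt, dv_aff hf]
  simp only [mul_one, smul_zero]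
  rw [show (r ^ 2, (0 : E3)) = (r ^ 2) • ((1, 0) : Z) by simp, map_smul]; rfl

lemma dx_cm {f : Z → ℝ} (hf : Sm f) (c : ℝ) (j : Fin 3) :
    dx j (fun z => c * f z) = fun z => c * dx j f z :=
  funext fun z => dv_const_mul _ c hf z

lemma lap_aff {f : Z → ℝ} (hf : Sm f) (r : ℝ) (p z : Z) :
    lap (fun z => f (aff r p z)) z = r ^ 2 * lap f (aff r p z) := by
  unfold lap
  rw [Finset.mul_sum]
  refine Finset.sum_congr rfl fun j _ => ?_
  rw [dx_aff hf, dx_cm (aff_comp_smooth (dv_smooth _ hf) r p), dx_aff (dv_smooth _ hf)]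
  ring

lemma adm_one : Adm 1 0 0 := ⟨one_pos, le_rfl, by norm_num, le_rfl, by simp⟩

lemma dx_psi_heat {r : ℝ} (hr : 0 < r) (i : Fin 3) {s : ℝ} (hs : s ≤ 0) (x : E3) :
    dt (dx i (psi r 0 0)) (s, x) + lap (dx i (psi r 0 0)) (s, x) = dx i (hcom r 0 0) (s, x) := by
  have hp := psi_smooth hr 0 0
  have e : (fun y => dt (psi r 0 0) (s, y) + lap (psi r 0 0) (s, y)) =
      fun y => hcom r 0 0 (s, y) := funext fun y => dt_add_lap_psi hr hs y
  rw [← dx_slice (hcom_smooth hr 0 0), ← e,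
    dv_add _ (slice_smooth (dv_smooth _ hp) s) (slice_smooth (lap_smooth hp) s),
    dx_slice (dv_smooth _ hp), dx_slice (lap_smooth hp), dt, dv_comm _ _ hp]
  congr 1
  unfold lap
  refine Eq.trans ?_ (dv_sum Finset.univ _ (fun j => dx j (dx j (psi r 0 0)))
    (fun j => dv_smooth _ (dv_smooth _ hp)) _).symm
  refine Finset.sum_congr rfl fun j _ => ?_
  rw [dx, dx, dx, dx, dv_comm _ _ hp, dv_comm _ _ (dv_smooth _ hp)]

lemma XSupp.lap {R : ℝ} {f : Z → ℝ} (h : XSupp R f) : XSupp R (lap f) := fun s x hx => by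
  unfold _root_.lap
  exact Finset.sum_eq_zero fun j _ => (h.dv _).dv _ s x hx

/-- Green's identity on a time slice. -/
lemma XSupp.green {R : ℝ} {f h : Z → ℝ} (hf : XSupp R f) (hfs : Sm f) (hh : Sm h) (s : ℝ) :
    ∫ x, (_root_.lap h (s, x) * f (s, x) - h (s, x) * _root_.lap f (s, x)) = 0 := by
  have hF : ∀ j, Sm (fun z => dx j h z * f z - h z * dx j f z) := fun j =>
    ((dv_smooth _ hh).mul hfs).sub (hh.mul (dv_smooth _ hfs))
  have hX : ∀ j, XSupp R (fun z => dx j h z * f z - h z * dx j f z) := fun j s x hx => by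
    simp [hf s x hx, hf.dv _ s x hx]
  have e : ∀ x, _root_.lap h (s, x) * f (s, x) - h (s, x) * _root_.lap f (s, x) =
      ∑ j, dx j (fun z => dx j h z * f z - h z * dx j f z) (s, x) := by
    intro x
    unfold _root_.lap
    rw [Finset.sum_mul, Finset.mul_sum, ← Finset.sum_sub_distrib]
    refine Finset.sum_congr rfl fun j _ => ?_
    refine Eq.trans ?_ (dv_sub _ ((dv_smooth _ hh).mul hfs) (hh.mul (dv_smooth _ hfs)) _).symm
    rw [dv_mul _ (dv_smooth _ hh) hfs, dv_mul _ hh (dv_smooth _ hfs)]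
    ring
  simp_rw [e]
  rw [integral_finsetSum _ fun j _ => ((hX j).dv _).integrable (dv_smooth _ (hF j)).continuous s]
  exact Finset.sum_eq_zero fun j _ => (hX j).integral_dx (hF j) j s

lemma heat_gradient_unit : ∃ C : ℝ, 0 < C ∧ ∀ (h : Z → ℝ), Sm h → ∀ a b : ℝ,
    (∀ s ∈ Icc (-1 : ℝ) 0, ∀ x : E3, ‖x‖ ≤ 1 → |h (s, x)| ≤ a ∧ |dt h (s, x) - lap h (s, x)| ≤ b) →
    ∀ i, |dx i h (0, 0)| ≤ C * (a + b) := by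
  obtain ⟨C1, hC1, H1⟩ := psi_dx_bound
  obtain ⟨C2, hC2, H2⟩ := integral_inv_pow_four
  obtain ⟨C3, hC3, H3⟩ := hcom_bound
  obtain ⟨C4, hC4, H4⟩ := psi_conc
  set Vb := (volume : Measure E3).real (closedBall 0 1)
  have hVb : 0 ≤ Vb := measureReal_nonneg
  refine ⟨C4 * (C3 * Vb + 4 * (C1 * C2)), by positivity, fun h hh a b hab i => ?_⟩
  have ha : 0 ≤ a := (abs_nonneg _).trans (hab 0 (by simp) 0 (by simp)).1
  have hb : 0 ≤ b := (abs_nonneg _).trans (hab 0 (by simp) 0 (by simp)).2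
  have goal := H4 0 0 adm_one (fun x => dx i h (0, x))
    ((slice_smooth (dv_smooth _ hh) 0).continuous) ((C3 * Vb + 4 * (C1 * C2)) * (a + b)) ?_
  · rwa [← mul_assoc] at goal
  intro k
  set r : ℝ := (1 / 2) ^ k
  have hr : 0 < r := by positivity
  have hadm : Adm r 0 0 := adm_one.scale k
  have hr1 : r ≤ 1 := hadm.r_le
  have hp := psi_smooth hr 0 0
  have hX := psi_xsupp r 0 0
  set φ := dx i (psi r 0 0) with hφ
  have hφs : Sm φ := dv_smooth _ hp
  have hφX : XSupp 1 φ := hX.dv _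
  have hφe : ∀ s ≤ 0, ∀ x, dt φ (s, x) + lap φ (s, x) = dx i (hcom r 0 0) (s, x) :=
    fun s hs x => dx_psi_heat hr i hs x
  have hz0 : ∀ s ≤ 0, ∀ x, 1 < ‖x‖ → dx i (hcom r 0 0) (s, x) = 0 := fun s hs x hx => by
    have h1 : dt φ (s, x) = 0 := hφX.dv _ s x hx
    rw [← hφe s hs, h1, hφX.lap s x hx, add_zero]
  have hprod : Sm (fun z => h z * φ z) := hh.mul hφs
  have hprodX : XSupp 1 (fun z => h z * φ z) := hφX.mul_left h
  -- the derivative of the pairing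
  have hder : ∀ s ∈ Icc (-1 : ℝ) 0, ∫ x, dt (fun z => h z * φ z) (s, x) =
      (∫ x, (dt h (s, x) - lap h (s, x)) * φ (s, x)) + ∫ x, h (s, x) * dx i (hcom r 0 0) (s, x) := by
    intro s hs
    have hg := hφX.green hφs hh s
    have i1 : Integrable (fun x => (dt h (s, x) - lap h (s, x)) * φ (s, x)) :=
      (hφX.mul_left (fun z => dt h z - lap h z)).integrable
        (((dv_smooth _ hh).sub (lap_smooth hh)).mul hφs).continuous s
    have hz := hz0 s hs.2
    have i2 : Integrable (fun x => h (s, x) * dx i (hcom r 0 0) (s, x)) :=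
      integrable_of_zero (R := 1) (((slice_smooth hh s).mul
        (slice_smooth (dv_smooth _ (hcom_smooth hr 0 0)) s)).continuous)
        (fun x hx => by rw [hz x hx, mul_zero])
    have i3 : Integrable (fun x => lap h (s, x) * φ (s, x) - h (s, x) * lap φ (s, x)) :=
      ((hφX.mul_left (lap h)).integrable ((lap_smooth hh).mul hφs).continuous s).sub
        ((hφX.lap.mul_left h).integrable (hh.mul (lap_smooth hφs)).continuous s)
    have e : ∀ x, dt (fun z => h z * φ z) (s, x) = ((dt h (s, x) - lap h (s, x)) * φ (s, x)
        + h (s, x) * dx i (hcom r 0 0) (s, x)) +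
        (lap h (s, x) * φ (s, x) - h (s, x) * lap φ (s, x)) := by
      intro x
      rw [dt, dv_mul _ hh hφs, ← hφe s hs.2]
      ring
    simp_rw [e]
    rw [integral_add (f := fun x => (dt h (s, x) - lap h (s, x)) * φ (s, x)
      + h (s, x) * dx i (hcom r 0 0) (s, x)) (i1.add i2) i3, hg, integral_add i1 i2, add_zero]
  have hbound : ∀ s ∈ Ico (-1 : ℝ) 0, ‖∫ x, dt (fun z => h z * φ z) (s, x)‖ ≤
      a * (C3 * Vb) + b * (C1 * C2) * (Real.sqrt (r ^ 2 - s))⁻¹ := by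
    intro s hs
    have hs' : s ∈ Icc (-1 : ℝ) 0 := ⟨hs.1, hs.2.le⟩
    rw [hder s hs', Real.norm_eq_abs]
    obtain ⟨ip, hip⟩ := H2 r 0 0 s hr
    rw [clk_eq hr (by nlinarith [hs.2, sq_nonneg r]), add_zero] at hip
    have b1 : |∫ x, (dt h (s, x) - lap h (s, x)) * φ (s, x)| ≤
        b * (C1 * C2) * (Real.sqrt (r ^ 2 - s))⁻¹ := by
      calc _ ≤ ∫ x, b * C1 * (pdist r 0 0 (s, x))⁻¹ ^ 4 := by
            rw [← Real.norm_eq_abs]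
            refine (norm_integral_le_of_norm_le (ip.const_mul (b * C1))
              (Filter.Eventually.of_forall fun x => ?_))
            have hpd : 0 ≤ (pdist r 0 0 (s, x))⁻¹ ^ 4 := by
              have := pdist_pos hr 0 0 (s, x); positivity
            rw [Real.norm_eq_abs, abs_mul]
            rcases le_or_gt ‖x‖ 1 with hx | hx
            · have h1 := H1 r 0 0 hadm s hs.1 hs.2.le x i
              have h2 : xi (s, x) * (pdist r 0 0 (s, x))⁻¹ ^ 4 ≤ (pdist r 0 0 (s, x))⁻¹ ^ 4 :=
                mul_le_of_le_one_left hpd (xi_le_one _)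
              calc _ ≤ b * (C1 * (pdist r 0 0 (s, x))⁻¹ ^ 4) :=
                    mul_le_mul (hab s hs' x hx).2 (h1.trans
                      (mul_le_mul_of_nonneg_left h2 hC1.le)) (abs_nonneg _) hb
                _ = _ := by ring
            · rw [hφX s x hx]; simp only [abs_zero, mul_zero]; positivity
        _ ≤ _ := by
            rw [integral_const_mul]
            calc _ ≤ b * C1 * (C2 * (Real.sqrt (r ^ 2 - s))⁻¹) :=
                  mul_le_mul_of_nonneg_left hip (by positivity)
              _ = _ := by ring
    have b2 : |∫ x, h (s, x) * dx i (hcom r 0 0) (s, x)| ≤ a * (C3 * Vb) := by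
      rw [← setIntegral_eq_integral_of_forall_compl_eq_zero (s := closedBall (0 : E3) 1)
        (fun x hx => by
          have hx : 1 < ‖x‖ := by simpa using hx
          rw [hz0 s hs'.2 x hx, mul_zero])]
      have := norm_setIntegral_le_of_norm_le_const (μ := (volume : Measure E3))
        (s := closedBall 0 1) (C := a * C3)
        (f := fun x => h (s, x) * dx i (hcom r 0 0) (s, x)) measure_closedBall_lt_top
        (fun x hx => by
          have hx : ‖x‖ ≤ 1 := by simpa using hx
          rw [Real.norm_eq_abs, abs_mul]
          exact mul_le_mul (hab s hs' x hx).1 ((H3 r 0 0 hadm s hs.1 hs.2.le x).2 i)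
            (abs_nonneg _) ha)
      rw [Real.norm_eq_abs] at this
      calc _ ≤ _ := this
        _ = _ := by ring
    exact (abs_add_le _ _).trans (by linarith)
  have hcomp := image_norm_le_of_norm_deriv_right_le_deriv_boundary'
    (f := fun s => ∫ x, h (s, x) * φ (s, x)) (a := -1) (b := 0)
    (f' := fun s => ∫ x, dt (fun z => h z * φ z) (s, x))
    (B := fun s => a * (C3 * Vb) * (s + 1) +
      b * (C1 * C2) * (2 * Real.sqrt (r ^ 2 + 1) - 2 * Real.sqrt (r ^ 2 - s)))
    (B' := fun s => a * (C3 * Vb) + b * (C1 * C2) * (Real.sqrt (r ^ 2 - s))⁻¹)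
    (hprodX.continuous_integral hprod.continuous).continuousOn
    (fun s _ => (hprodX.hasDerivAt_integral hprod s).hasDerivWithinAt)
    (by
      have : ∀ x, h (-1, x) * φ (-1, x) = 0 := fun x => by
        have e : (fun y => psi r 0 0 (-1, y)) = fun _ => (0 : ℝ) := funext fun y => psi_init r 0 0 y
        rw [hφ, ← dx_slice hp, e, dv_const, mul_zero]
      simp only [this, integral_zero, norm_zero]
      rw [show r ^ 2 - -1 = r ^ 2 + 1 by ring]; simp)
    (by fun_prop)
    (fun s hs => by
      have hpos : 0 < r ^ 2 - s := by nlinarith [hs.2, pow_pos hr 2]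
      have h1 : HasDerivAt (fun s => Real.sqrt (r ^ 2 - s)) (-1 / (2 * Real.sqrt (r ^ 2 - s))) s :=
        ((hasDerivAt_id s).const_sub (r ^ 2)).sqrt hpos.ne'
      have h2 := ((((hasDerivAt_id s).add_const 1).const_mul (a * (C3 * Vb))).add
        (((h1.const_mul 2).const_sub (2 * Real.sqrt (r ^ 2 + 1))).const_mul (b * (C1 * C2))))
      refine HasDerivAt.hasDerivWithinAt (h2.congr_deriv ?_)
      have := Real.sqrt_pos.2 hpos
      field_simp)
    hbound (right_mem_Icc.2 (by norm_num))
  have hibp : ∫ x, dx i h (0, x) * psi r 0 0 (0, x) = - ∫ x, h (0, x) * φ (0, x) := by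
    have h0 := (hX.mul_left h).integral_dx (hh.mul hp) i 0
    have e : ∀ x, dx i (fun z => h z * psi r 0 0 z) (0, x) =
        h (0, x) * φ (0, x) + dx i h (0, x) * psi r 0 0 (0, x) := fun x => by
      rw [dx, dv_mul _ hh hp]; ring
    simp_rw [e] at h0
    rw [integral_add (hprodX.integrable hprod.continuous 0)
      ((hX.mul_left (dx i h)).integrable ((dv_smooth _ hh).mul hp).continuous 0)] at h0
    linarith
  rw [hibp, abs_neg]
  have hsq : Real.sqrt (r ^ 2 + 1) ≤ 2 := Real.sqrt_le_iff.2 ⟨by norm_num, by nlinarith⟩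
  rw [Real.norm_eq_abs] at hcomp
  refine hcomp.trans ?_
  have hs0 := Real.sqrt_nonneg (r ^ 2 - 0)
  have hk : 0 ≤ C1 * C2 := by positivity
  have h5 : b * (C1 * C2) * (2 * Real.sqrt (r ^ 2 + 1) - 2 * Real.sqrt (r ^ 2 - 0)) ≤
      b * (C1 * C2) * 4 := mul_le_mul_of_nonneg_left (by linarith) (by positivity)
  have h6 : 0 ≤ b * (C3 * Vb) := by positivity
  have h7 : 0 ≤ a * (C1 * C2) := by positivity
  nlinarith

/-- Interior gradient estimate for the heat equation on a parabolic cylinder. -/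
lemma heat_gradient : ∃ C : ℝ, 0 < C ∧ ∀ (h : Z → ℝ), Sm h → ∀ (p : Z) (r a b : ℝ), 0 < r →
    (∀ s ∈ Icc (p.1 - r ^ 2) p.1, ∀ x : E3, ‖x - p.2‖ ≤ r →
      |h (s, x)| ≤ a ∧ |dt h (s, x) - lap h (s, x)| ≤ b) →
    ∀ i, r * |dx i h p| ≤ C * (a + r ^ 2 * b) := by
  obtain ⟨C, hC, H⟩ := heat_gradient_unit
  refine ⟨C, hC, fun h hh p r a b hr hab i => ?_⟩
  have := H _ (aff_comp_smooth hh r p) a (r ^ 2 * b) (fun s hs x hx => ?_) i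
  · rw [dx_aff hh] at this
    simp only [aff, mul_zero, smul_zero, add_zero, abs_mul, abs_of_pos hr] at this
    exact this
  · have h1 := hab (p.1 + r ^ 2 * s) ⟨by nlinarith [hs.1, sq_nonneg r], by nlinarith [hs.2, sq_nonneg r]⟩
      (p.2 + r • x) (by
        rw [add_sub_cancel_left, norm_smul, Real.norm_eq_abs, abs_of_pos hr]; nlinarith)
    rw [dt_aff hh, lap_aff hh]
    refine ⟨h1.1, ?_⟩
    rw [← mul_sub, abs_mul, abs_of_nonneg (sq_nonneg r)]
    exact mul_le_mul_of_nonneg_left h1.2 (sq_nonneg r)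

/-! ### Iterated spatial derivatives and the vorticity -/

/-- Iterated spatial partial derivatives. -/
def dl : List (Fin 3) → (Z → ℝ) → Z → ℝ
  | [], f => f
  | j :: l, f => dx j (dl l f)

lemma dl_smooth {f : Z → ℝ} (hf : Sm f) : ∀ l, Sm (dl l f)
  | [] => hf
  | _ :: l => dv_smooth _ (dl_smooth hf l)

lemma dl_dv {f : Z → ℝ} (hf : Sm f) (w : Z) : ∀ l, dl l (dv w f) = dv w (dl l f)
  | [] => rfl
  | j :: l => by
      change dv _ (dl l (dv w f)) = dv w (dv _ (dl l f))
      rw [dl_dv hf w l, dv_comm _ _ (dl_smooth hf l)]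

lemma dl_cons' {f : Z → ℝ} (hf : Sm f) (j : Fin 3) (l) : dl (j :: l) f = dl l (dx j f) :=
  (dl_dv hf _ l).symm

lemma dl_add {f g : Z → ℝ} (hf : Sm f) (hg : Sm g) :
    ∀ l, dl l (fun z => f z + g z) = fun z => dl l f z + dl l g z
  | [] => rfl
  | j :: l => by
      change dv _ (dl l _) = _
      rw [dl_add hf hg l]
      exact funext fun z => dv_add _ (dl_smooth hf l) (dl_smooth hg l) z

lemma dl_cm {f : Z → ℝ} (hf : Sm f) (c : ℝ) :
    ∀ l, dl l (fun z => c * f z) = fun z => c * dl l f z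
  | [] => rfl
  | j :: l => by
      change dv _ (dl l _) = _
      rw [dl_cm hf c l]
      exact funext fun z => dv_const_mul _ c (dl_smooth hf l) z

lemma dl_sub {f g : Z → ℝ} (hf : Sm f) (hg : Sm g) (l) :
    dl l (fun z => f z - g z) = fun z => dl l f z - dl l g z := by
  have e : (fun z => f z - g z) = fun z => f z + (-1) * g z := by ext; ring
  rw [e, dl_add hf (contDiff_const.mul hg), dl_cm hg]
  ext; ring

lemma dl_sum {ι : Type*} (s : Finset ι) (F : ι → Z → ℝ) (hF : ∀ i, Sm (F i)) :
    ∀ l, dl l (fun z => ∑ i ∈ s, F i z) = fun z => ∑ i ∈ s, dl l (F i) z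
  | [] => rfl
  | j :: l => by
      change dv _ (dl l _) = _
      rw [dl_sum s F hF l]
      exact funext fun z => dv_sum s _ (fun i => dl l (F i)) (fun i => dl_smooth (hF i) l) z

lemma dl_lap {f : Z → ℝ} (hf : Sm f) (l) : dl l (lap f) = lap (dl l f) := by
  unfold lap
  rw [dl_sum _ _ (fun j => dv_smooth _ (dv_smooth _ hf))]
  funext z
  refine Finset.sum_congr rfl fun j _ => ?_
  rw [dx, dl_dv (dv_smooth _ hf), dx, dl_dv hf]

lemma dl_congr_slice {f g : Z → ℝ} (hf : Sm f) (hg : Sm g) {s : ℝ}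
    (h : ∀ x, f (s, x) = g (s, x)) : ∀ l x, dl l f (s, x) = dl l g (s, x)
  | [] => h
  | j :: l => fun x => by
      change dx j (dl l f) (s, x) = dx j (dl l g) (s, x)
      rw [← dx_slice (dl_smooth hf l), ← dx_slice (dl_smooth hg l),
        funext (dl_congr_slice hf hg h l)]

lemma dl_aff {f : Z → ℝ} (hf : Sm f) (r : ℝ) (p : Z) :
    ∀ l, dl l (fun z => f (aff r p z)) = fun z => r ^ l.length * dl l f (aff r p z)
  | [] => by simp [dl]
  | j :: l => by
      change dx j (dl l _) = _
      rw [dl_aff hf r p l, dx_cm (aff_comp_smooth (dl_smooth hf l) r p),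
        dx_aff (dl_smooth hf l)]
      funext z
      simp only [List.length_cons, dl]; ring

lemma dl_mul_bound (m : ℕ) : ∀ {f g : Z → ℝ} {z : Z} {e₁ e₂ : ℝ}, Sm f → Sm g →
    (∀ l, l.length ≤ m → |dl l f z| ≤ e₁) → (∀ l, l.length ≤ m → |dl l g z| ≤ e₂) →
    ∀ l, l.length ≤ m → |dl l (fun z => f z * g z) z| ≤ 2 ^ m * (e₁ * e₂) := by
  induction m with
  | zero =>
    intro f g z e₁ e₂ hf hg h1 h2 l hl
    obtain rfl : l = [] := List.eq_nil_of_length_eq_zero (by omega)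
    simp only [dl, pow_zero, one_mul, abs_mul]
    exact mul_le_mul (h1 [] le_rfl) (h2 [] le_rfl) (abs_nonneg _)
      ((abs_nonneg _).trans (h1 [] le_rfl))
  | succ m ih =>
    intro f g z e₁ e₂ hf hg h1 h2 l hl
    have p1 : 0 ≤ e₁ := (abs_nonneg _).trans (h1 [] (by simp))
    have p2 : 0 ≤ e₂ := (abs_nonneg _).trans (h2 [] (by simp))
    have h12 := mul_nonneg p1 p2
    cases l with
    | nil =>
      simp only [dl, abs_mul]
      have h3 := mul_le_mul (h1 [] (by simp)) (h2 [] (by simp)) (abs_nonneg _) p1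
      exact h3.trans (le_mul_of_one_le_left h12 (one_le_pow₀ (by norm_num)))
    | cons j l =>
      have hl' : l.length ≤ m := by simpa using hl
      have e : dx j (fun z => f z * g z) = fun z => f z * dx j g z + g z * dx j f z :=
        funext fun z => dv_mul _ hf hg z
      rw [dl_cons' (hf.mul hg), e, dl_add (hf.mul (dv_smooth _ hg)) (hg.mul (dv_smooth _ hf))]
      have r1 := ih hf (dv_smooth (0, eb j) hg) (fun l hl => h1 l (by omega))
        (fun l hl => by rw [← dl_cons' hg]; exact h2 _ (by simpa using hl)) l hl'
      have r2 := ih hg (dv_smooth (0, eb j) hf) (fun l hl => h2 l (by omega))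
        (fun l hl => by rw [← dl_cons' hf]; exact h1 _ (by simpa using hl)) l hl'
      refine (abs_add_le _ _).trans ((add_le_add r1 r2).trans (le_of_eq ?_))
      rw [pow_succ]; ring

/-- Components of the vorticity. -/
def vort (v : Fin 3 → Z → ℝ) (a b : Fin 3) (z : Z) : ℝ := dx a (v b) z - dx b (v a) z

/-- The Lamb vector. -/
def lamb (v : Fin 3 → Z → ℝ) (b : Fin 3) (z : Z) : ℝ := ∑ k, v k z * vort v k b z

section
variable {v : Fin 3 → Z → ℝ}

lemma vort_smooth (hv : ∀ i, Sm (v i)) (a b) : Sm (vort v a b) :=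
  (dv_smooth _ (hv b)).sub (dv_smooth _ (hv a))

lemma lamb_smooth (hv : ∀ i, Sm (v i)) (b) : Sm (lamb v b) :=
  ContDiff.sum fun k _ => (hv k).mul (vort_smooth hv k b)

lemma lap_eq_vort (hv : ∀ i, Sm (v i)) {s : ℝ} (hdiv : ∀ x, ∑ i, dx i (v i) (s, x) = 0) (j : Fin 3)
    (x : E3) : lap (v j) (s, x) = ∑ i, dx i (vort v i j) (s, x) := by
  have h1 : dx j (fun z => ∑ i, dx i (v i) z) (s, x) = 0 := by
    rw [← dx_slice (ContDiff.sum fun i _ => dv_smooth _ (hv i)),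
      show (fun y => ∑ i, dx i (v i) (s, y)) = fun _ => 0 from funext hdiv, dv_const]
  rw [dx, dv_sum _ _ (fun i => dx i (v i)) (fun i => dv_smooth _ (hv i))] at h1
  have h2 : ∀ i, dx i (vort v i j) (s, x) = dx i (dx i (v j)) (s, x) - dx j (dx i (v i)) (s, x) := by
    intro i
    refine (dv_sub _ (dv_smooth _ (hv j)) (dv_smooth _ (hv i)) _).trans ?_
    rw [dv_comm (0, eb i) (0, eb j) (hv i)]
  simp_rw [h2, Finset.sum_sub_distrib]
  unfold lap
  rw [h1, sub_zero]

lemma vort_eq {P : Z → ℝ} {c : Fin 3 → ℝ} (hv : ∀ i, Sm (v i)) (hP : Sm P) {s : ℝ}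
    (heq : ∀ x i, dt (v i) (s, x) + ∑ j, v j (s, x) * dx j (v i) (s, x) + dx i P (s, x) + c i
      - lap (v i) (s, x) = 0) (a b : Fin 3) (x : E3) :
    dt (vort v a b) (s, x) - lap (vort v a b) (s, x) =
      dx b (lamb v a) (s, x) - dx a (lamb v b) (s, x) := by
  set Q : Z → ℝ := fun z => P z + (1 / 2) * S2 v z with hQ
  have hS := S2_smooth hv
  have hQs : Sm Q := hP.add (contDiff_const.mul hS)
  have hdQ : ∀ i z, dx i Q z = dx i P z + ∑ k, v k z * dx i (v k) z := by
    intro i z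
    refine (dv_add _ hP (contDiff_const.mul hS) z).trans ?_
    rw [dv_const_mul _ _ hS]
    unfold S2
    rw [dv_sum _ _ (fun i z => v i z ^ 2) (fun i => (hv i).pow 2), Finset.mul_sum]
    congr 1
    refine Finset.sum_congr rfl fun k _ => ?_
    rw [dv_sq _ (hv k)]; ring
  have he : ∀ i x, dt (v i) (s, x) - lap (v i) (s, x) + lamb v i (s, x) + dx i Q (s, x) = - c i := by
    intro i x
    have h := heq x i
    rw [hdQ]
    have : lamb v i (s, x) + ∑ k, v k (s, x) * dx i (v k) (s, x) =
        ∑ j, v j (s, x) * dx j (v i) (s, x) := by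
      unfold lamb vort
      rw [← Finset.sum_add_distrib]
      exact Finset.sum_congr rfl fun k _ => by ring
    linarith
  have hs1 : ∀ i, Sm (fun z => dt (v i) z - lap (v i) z) := fun i =>
    (dv_smooth _ (hv i)).sub (lap_smooth (hv i))
  have hs2 : ∀ i, Sm (fun z => dt (v i) z - lap (v i) z + lamb v i z) := fun i =>
    (hs1 i).add (lamb_smooth hv i)
  have hD : ∀ a b, dx a (dt (v b)) (s, x) - dx a (lap (v b)) (s, x) + dx a (lamb v b) (s, x)
      + dx a (dx b Q) (s, x) = 0 := by
    intro a b
    have h1 : dx a (fun z => dt (v b) z - lap (v b) z + lamb v b z + dx b Q z) (s, x) = 0 := by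
      rw [← dx_slice ((hs2 b).add (dv_smooth _ hQs)), funext (he b), dv_const]
    rw [dx, dv_add _ (hs2 b) (dv_smooth _ hQs), dv_add _ (hs1 b) (lamb_smooth hv b),
      dv_sub _ (dv_smooth _ (hv b)) (lap_smooth (hv b))] at h1
    exact h1
  have e1 : dt (vort v a b) (s, x) = dx a (dt (v b)) (s, x) - dx b (dt (v a)) (s, x) := by
    refine (dv_sub _ (dv_smooth _ (hv b)) (dv_smooth _ (hv a)) _).trans ?_
    rw [dv_comm (1, 0) _ (hv b), dv_comm (1, 0) _ (hv a)]
  have e2 : lap (vort v a b) (s, x) = dx a (lap (v b)) (s, x) - dx b (lap (v a)) (s, x) := by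
    have h1 : dx a (lap (v b)) = lap (dx a (v b)) := dl_lap (hv b) [a]
    have h2 : dx b (lap (v a)) = lap (dx b (v a)) := dl_lap (hv a) [b]
    rw [h1, h2]
    unfold lap
    rw [← Finset.sum_sub_distrib]
    refine Finset.sum_congr rfl fun j _ => ?_
    have h3 : dx j (vort v a b) = fun z => dx j (dx a (v b)) z - dx j (dx b (v a)) z :=
      funext fun z => dv_sub _ (dv_smooth _ (hv b)) (dv_smooth _ (hv a)) z
    rw [h3]
    exact dv_sub _ (dv_smooth _ (dv_smooth _ (hv b))) (dv_smooth _ (dv_smooth _ (hv a))) _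
  have e3 : dx a (dx b Q) = dx b (dx a Q) := dv_comm _ _ hQs
  have h1 := hD a b
  have h2 := hD b a
  rw [e1, e2]
  rw [e3] at h1
  linarith

end

/-- Interior gradient estimate for the Laplacian on a fixed time slice. -/
lemma slice_gradient : ∃ C : ℝ, 0 < C ∧ ∀ (h : Z → ℝ), Sm h → ∀ (p : Z) (r a b : ℝ), 0 < r →
    (∀ x : E3, ‖x - p.2‖ ≤ r → |h (p.1, x)| ≤ a ∧ |lap h (p.1, x)| ≤ b) →
    ∀ i, r * |dx i h p| ≤ C * (a + r ^ 2 * b) := by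
  obtain ⟨C, hC, H⟩ := heat_gradient
  refine ⟨C, hC, fun h hh p r a b hr hab i => ?_⟩
  have hpr : ContDiff ℝ ((⊤ : ℕ∞) : WithTop ℕ∞) (fun z : Z => ((p.1, z.2) : Z)) :=
    contDiff_const.prodMk contDiff_snd
  set f : Z → ℝ := fun z => h (p.1, z.2)
  have hf : Sm f := hh.comp hpr
  have ed : ∀ l, dl l f = fun z => dl l h (p.1, z.2) := by
    intro l
    induction l with
    | nil => rfl
    | cons k l ih =>
      change dx k (dl l f) = _
      funext z
      rw [← dx_slice (dl_smooth hf l) k z.1 z.2, ih]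
      exact dx_slice (dl_smooth hh l) k p.1 z.2
  have hl : ∀ z, lap f z = lap h (p.1, z.2) := fun z =>
    Finset.sum_congr rfl fun j _ => congrFun (ed [j, j]) z
  have ht : ∀ z, dt f z = 0 := fun z => by
    have h1 := hasDerivAt_slice hf z.1 z.2
    have h2 : HasDerivAt (fun s => f (s, z.2)) 0 z.1 := hasDerivAt_const z.1 (h (p.1, z.2))
    exact h1.unique h2
  have key := H f hf p r a b hr (fun s _ x hx => by
    rw [ht, hl, zero_sub, abs_neg]
    exact hab x hx) i
  rwa [show dx i f p = dx i h p from congrFun (ed [i]) p] at key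

/-- Derivatives of a small divergence-free field with bounded vorticity derivatives are small. -/
lemma velocity_chain (J : ℕ) : ∀ ρ ε : ℝ, 0 < ρ → 0 < ε → ∃ κ : ℝ, 0 < κ ∧
    ∀ (v : Fin 3 → Z → ℝ), (∀ i, Sm (v i)) → ∀ (s R : ℝ), (∀ x, ∑ i, dx i (v i) (s, x) = 0) →
    (∀ x : E3, ‖x‖ ≤ R + ρ → (∀ i, |v i (s, x)| ≤ κ) ∧
      ∀ a b l, l.length ≤ J → |dl l (vort v a b) (s, x)| ≤ 1) →
    ∀ x : E3, ‖x‖ ≤ R → ∀ i l, l.length ≤ J → |dl l (v i) (s, x)| ≤ ε := by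
  obtain ⟨C, hC, H⟩ := slice_gradient
  induction J with
  | zero =>
    intro ρ ε hρ hε
    refine ⟨ε, hε, fun v hv s R hdiv hh x hx i l hl => ?_⟩
    obtain rfl : l = [] := List.eq_nil_of_length_eq_zero (by omega)
    exact (hh x (by linarith)).1 i
  | succ J ih =>
    intro ρ ε hρ hε
    set r := min (ρ / 2) (ε / (6 * C)) with hr
    have hr0 : 0 < r := lt_min (by positivity) (by positivity)
    have hr1 : r ≤ ρ / 2 := min_le_left _ _
    have hr2 : r * (6 * C) ≤ ε := by
      have := min_le_right (ρ / 2) (ε / (6 * C))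
      rwa [← hr, le_div_iff₀ (by positivity)] at this
    set ε' := min ε (r * ε / (2 * C))
    have hε' : 0 < ε' := lt_min hε (by positivity)
    have he2 : ε' * (2 * C) ≤ r * ε := by
      have := min_le_right ε (r * ε / (2 * C))
      rwa [le_div_iff₀ (by positivity)] at this
    obtain ⟨κ, hκ, Hκ⟩ := ih (ρ / 2) ε' (by positivity) hε'
    refine ⟨κ, hκ, fun v hv s R hdiv hh x hx i l hl => ?_⟩
    have h1 := Hκ v hv s (R + ρ / 2) hdiv (fun y hy =>
      ⟨(hh y (by linarith)).1, fun a b l hl => (hh y (by linarith)).2 a b l (by omega)⟩)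
    rcases Nat.lt_or_ge l.length (J + 1) with hl' | hl'
    · exact (h1 x (by linarith) i l (by omega)).trans (min_le_left _ _)
    obtain ⟨j, l, rfl⟩ : ∃ j l', l = j :: l' := by
      cases l with
      | nil => simp at hl'
      | cons j l => exact ⟨j, l, rfl⟩
    simp only [List.length_cons, Nat.add_le_add_iff_right] at hl
    have hs := dl_smooth (hv i) l
    have h2 := H _ hs (s, x) r ε' 3 hr0 (fun y hy => by
      simp only at hy ⊢
      have hy' : ‖y‖ ≤ R + ρ / 2 := by
        have := norm_add_le x (y - x); rw [add_sub_cancel] at this; linarith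
      refine ⟨h1 y hy' i l hl, ?_⟩
      rw [← dl_lap (hv i), dl_congr_slice (lap_smooth (hv i))
        (ContDiff.sum fun k _ => dv_smooth (0, eb k) (vort_smooth hv k i))
        (lap_eq_vort hv hdiv i), dl_sum _ _ (fun k => dv_smooth _ (vort_smooth hv k i))]
      refine (Finset.abs_sum_le_sum_abs _ _).trans ?_
      calc _ ≤ ∑ _k : Fin 3, (1 : ℝ) := Finset.sum_le_sum fun k _ => by
            rw [← dl_cons' (vort_smooth hv k i)]
            exact (hh y (by linarith)).2 k i _ (by simpa using hl)
        _ = 3 := by simp) j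
    have h3 : r * |dx j (dl l (v i)) (s, x)| ≤ r * ε := by
      have h4 : r * (r * (6 * C)) ≤ r * ε := mul_le_mul_of_nonneg_left hr2 hr0.le
      nlinarith
    exact le_of_mul_le_mul_left h3 hr0

/-- Smallness of the vorticity derivatives propagates from smallness of the velocity. -/
lemma vorticity_small (J : ℕ) (δ : ℝ) (hδ : 0 < δ) : ∃ κ : ℝ, 0 < κ ∧
    ∀ (v : Fin 3 → Z → ℝ) (P : Z → ℝ) (c : Fin 3 → ℝ → ℝ), (∀ i, Sm (v i)) → Sm P →
    (∀ s ∈ Icc (-1 : ℝ) 0, ∀ x, (∀ i, dt (v i) (s, x) + ∑ j, v j (s, x) * dx j (v i) (s, x)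
      + dx i P (s, x) + c i s - lap (v i) (s, x) = 0) ∧ ∑ i, dx i (v i) (s, x) = 0) →
    (∀ s ∈ Icc (-1 : ℝ) 0, ∀ x : E3, ‖x‖ ≤ 3 → (∀ i, |v i (s, x)| ≤ κ) ∧
      ∀ a b l, l.length ≤ J + 1 → |dl l (vort v a b) (s, x)| ≤ 1) →
    ∀ a b l, l.length ≤ J + 1 → |dl l (vort v a b) (0, 0)| ≤ δ := by
  obtain ⟨C, hC, H⟩ := heat_gradient
  set K : ℝ := C * (2 + 6 * 2 ^ (J + 1)) with hK
  have hK0 : 0 < K := by positivity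
  obtain ⟨κ, hκ, Hκ⟩ := velocity_chain (J + 1) 1 (min (δ / 2) (δ / K)) one_pos
    (lt_min (by positivity) (by positivity))
  set ε := min (δ / 2) (δ / K)
  have hε1 : 2 * ε ≤ δ := by have := min_le_left (δ / 2) (δ / K); linarith
  have hε2 : ε * K ≤ δ := by
    have := min_le_right (δ / 2) (δ / K); rwa [le_div_iff₀ hK0] at this
  refine ⟨κ, hκ, fun v P c hv hP heq hh a b l hl => ?_⟩
  have hvel : ∀ s ∈ Icc (-1 : ℝ) 0, ∀ x : E3, ‖x‖ ≤ 2 → ∀ i l, l.length ≤ J + 1 →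
      |dl l (v i) (s, x)| ≤ ε := fun s hs =>
    Hκ v hv s 2 (fun x => (heq s hs x).2) (fun x hx => hh s hs x (by linarith))
  have hlow : ∀ s ∈ Icc (-1 : ℝ) 0, ∀ x : E3, ‖x‖ ≤ 2 → ∀ a b l, l.length ≤ J →
      |dl l (vort v a b) (s, x)| ≤ 2 * ε := by
    intro s hs x hx a b l hl
    unfold vort
    rw [dl_sub (dv_smooth _ (hv b)) (dv_smooth _ (hv a)), ← dl_cons' (hv b), ← dl_cons' (hv a)]
    have h1 := hvel s hs x hx b (a :: l) (by simpa using hl)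
    have h2 := hvel s hs x hx a (b :: l) (by simpa using hl)
    exact (abs_sub _ _).trans (by linarith)
  rcases Nat.lt_or_ge l.length (J + 1) with hl' | hl'
  · exact (hlow 0 (by simp) 0 (by simp) a b l (by omega)).trans hε1
  obtain ⟨j, l, rfl⟩ : ∃ j l', l = j :: l' := by
    cases l with
    | nil => simp at hl'
    | cons j l => exact ⟨j, l, rfl⟩
  simp only [List.length_cons, Nat.add_le_add_iff_right] at hl
  have hW := vort_smooth hv a b
  have hlamb : ∀ s ∈ Icc (-1 : ℝ) 0, ∀ x : E3, ‖x‖ ≤ 2 → ∀ b l, l.length ≤ J + 1 →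
      |dl l (lamb v b) (s, x)| ≤ 3 * (2 ^ (J + 1) * ε) := by
    intro s hs x hx b l hl
    unfold lamb
    rw [dl_sum _ _ (fun k => (hv k).mul (vort_smooth hv k b))]
    refine (Finset.abs_sum_le_sum_abs _ _).trans ?_
    calc _ ≤ ∑ _k : Fin 3, (2 : ℝ) ^ (J + 1) * ε := Finset.sum_le_sum fun k _ => by
          have := dl_mul_bound (J + 1) (hv k) (vort_smooth hv k b) (hvel s hs x hx k)
            ((hh s hs x (by linarith)).2 k b) l hl
          rwa [mul_one] at this
      _ = _ := by simp
  have h2 := H _ (dl_smooth hW l) (0, 0) 1 (2 * ε) (6 * (2 ^ (J + 1) * ε)) one_pos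
    (fun s hs x hx => by
      simp only [sub_zero, one_pow, zero_sub] at hs hx
      refine ⟨hlow s hs x (by linarith) a b l hl, ?_⟩
      have e : dt (dl l (vort v a b)) (s, x) - lap (dl l (vort v a b)) (s, x) =
          dl (b :: l) (lamb v a) (s, x) - dl (a :: l) (lamb v b) (s, x) := by
        rw [dt, ← dl_dv hW, ← dl_lap hW, dl_cons' (lamb_smooth hv a), dl_cons' (lamb_smooth hv b)]
        have h3 := dl_congr_slice (s := s)
          ((dv_smooth (1, 0) hW).sub (lap_smooth hW))
          ((dv_smooth (0, eb b) (lamb_smooth hv a)).sub (dv_smooth (0, eb a) (lamb_smooth hv b)))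
          (vort_eq hv hP (fun x => (heq s hs x).1) a b) l x
        rw [dl_sub (dv_smooth _ hW) (lap_smooth hW),
          dl_sub (dv_smooth _ (lamb_smooth hv a)) (dv_smooth _ (lamb_smooth hv b))] at h3
        exact h3
      rw [e]
      have h4 := hlamb s hs x (by linarith) a (b :: l) (by simpa using hl)
      have h5 := hlamb s hs x (by linarith) b (a :: l) (by simpa using hl)
      exact (abs_sub _ _).trans (by linarith)) j
  rw [one_mul, one_pow, one_mul] at h2
  exact h2.trans (by rw [hK] at hε2; linarith)

/-! ### Point picking -/

/-- A homogeneous quantity controlling the vorticity derivatives up to order `J`. -/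
def vsize (J : ℕ) (v : Fin 3 → Z → ℝ) (z : Z) : ℝ :=
  ∑ a, ∑ b, ∑ j ∈ Finset.range (J + 1), ∑ l : Fin j → Fin 3,
    |dl (List.ofFn l) (vort v a b) z| ^ (1 / ((j : ℝ) + 2))

lemma vsize_term_nonneg (v : Fin 3 → Z → ℝ) (a b : Fin 3) (j : ℕ) (l : Fin j → Fin 3) (z : Z) :
    0 ≤ |dl (List.ofFn l) (vort v a b) z| ^ (1 / ((j : ℝ) + 2)) :=
  Real.rpow_nonneg (abs_nonneg _) _

lemma vsize_nonneg (J : ℕ) (v : Fin 3 → Z → ℝ) (z : Z) : 0 ≤ vsize J v z :=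
  Finset.sum_nonneg fun a _ => Finset.sum_nonneg fun b _ => Finset.sum_nonneg fun _ _ =>
    Finset.sum_nonneg fun l _ => vsize_term_nonneg v a b _ l z

lemma le_vsize {J : ℕ} (v : Fin 3 → Z → ℝ) (a b : Fin 3) {l : List (Fin 3)} (hl : l.length ≤ J)
    (z : Z) : |dl l (vort v a b) z| ≤ vsize J v z ^ (l.length + 2) := by
  have h1 : |dl l (vort v a b) z| ^ (1 / ((l.length : ℝ) + 2)) ≤ vsize J v z := by
    unfold vsize
    have n1 := vsize_term_nonneg v
    refine le_trans ?_ (Finset.single_le_sum (f := fun a => ∑ b, ∑ j ∈ Finset.range (J + 1),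
      ∑ l : Fin j → Fin 3, |dl (List.ofFn l) (vort v a b) z| ^ (1 / ((j : ℝ) + 2)))
      (fun a _ => Finset.sum_nonneg fun b _ => Finset.sum_nonneg fun _ _ =>
        Finset.sum_nonneg fun l _ => n1 a b _ l z) (Finset.mem_univ a))
    refine le_trans ?_ (Finset.single_le_sum (f := fun b => ∑ j ∈ Finset.range (J + 1),
      ∑ l : Fin j → Fin 3, |dl (List.ofFn l) (vort v a b) z| ^ (1 / ((j : ℝ) + 2)))
      (fun b _ => Finset.sum_nonneg fun _ _ =>
        Finset.sum_nonneg fun l _ => n1 a b _ l z) (Finset.mem_univ b))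
    refine le_trans ?_ (Finset.single_le_sum (f := fun j : ℕ => ∑ l : Fin j → Fin 3,
      |dl (List.ofFn l) (vort v a b) z| ^ (1 / ((j : ℝ) + 2))) (fun _ _ =>
        Finset.sum_nonneg fun l _ => n1 a b _ l z)
        (Finset.mem_range.2 (Nat.lt_succ_of_le hl)))
    refine le_trans (le_of_eq ?_) (Finset.single_le_sum (f := fun m : Fin l.length → Fin 3 =>
      |dl (List.ofFn m) (vort v a b) z| ^ (1 / ((l.length : ℝ) + 2))) (fun m _ => n1 a b _ m z)
      (Finset.mem_univ l.get))
    simp only [List.ofFn_get]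
  calc _ = (|dl l (vort v a b) z| ^ (1 / ((l.length : ℝ) + 2))) ^ (l.length + 2) := by
        rw [← Real.rpow_natCast, ← Real.rpow_mul (abs_nonneg _)]
        push_cast
        rw [one_div_mul_cancel (by positivity), Real.rpow_one]
    _ ≤ _ := pow_le_pow_left₀ (Real.rpow_nonneg (abs_nonneg _) _) h1 _

lemma vsize_continuous (J : ℕ) {v : Fin 3 → Z → ℝ} (hv : ∀ i, Sm (v i)) :
    Continuous (vsize J v) := by
  unfold vsize
  refine continuous_finsetSum _ fun a _ => continuous_finsetSum _ fun b _ =>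
    continuous_finsetSum _ fun j _ => continuous_finsetSum _ fun l _ => ?_
  exact (dl_smooth (vort_smooth hv a b) _).continuous.abs.rpow_const fun _ => Or.inr (by positivity)

/-- Number of terms in `vsize`. -/
def vcount (J : ℕ) : ℝ := ∑ _a : Fin 3, ∑ _b : Fin 3, ∑ j ∈ Finset.range (J + 1),
  ∑ _l : Fin j → Fin 3, (1 : ℝ)

lemma vcount_pos (J : ℕ) : 0 < vcount J := by
  refine Finset.sum_pos (fun a _ => Finset.sum_pos (fun b _ => Finset.sum_pos (fun j _ =>
    Finset.sum_pos (fun l _ => one_pos) Finset.univ_nonempty) ⟨0, by simp⟩) Finset.univ_nonempty)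
    Finset.univ_nonempty

lemma vsize_le {J : ℕ} {v : Fin 3 → Z → ℝ} {z : Z} {e : ℝ} (he : 0 ≤ e) (he1 : e ≤ 1)
    (h : ∀ a b l, l.length ≤ J → |dl l (vort v a b) z| ≤ e ^ (J + 2)) :
    vsize J v z ≤ vcount J * e := by
  unfold vsize vcount
  simp only [Finset.sum_mul, one_mul]
  refine Finset.sum_le_sum fun a _ => Finset.sum_le_sum fun b _ => Finset.sum_le_sum fun j hj =>
    Finset.sum_le_sum fun l _ => ?_
  have hj : j ≤ J := Nat.lt_succ_iff.1 (Finset.mem_range.1 hj)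
  have h1 : |dl (List.ofFn l) (vort v a b) z| ≤ e ^ (j + 2) :=
    (h a b _ (by simpa using hj)).trans (pow_le_pow_of_le_one he he1 (by omega))
  refine (Real.rpow_le_rpow (abs_nonneg _) h1 (by positivity)).trans (le_of_eq ?_)
  rw [← Real.rpow_natCast, ← Real.rpow_mul he]
  push_cast
  rw [mul_one_div_cancel (by positivity), Real.rpow_one]

/-- The Navier–Stokes rescaling of a velocity field. -/
def rsc (r : ℝ) (p : Z) (v : Fin 3 → Z → ℝ) (i : Fin 3) (z : Z) : ℝ := r * v i (aff r p z)

section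
variable {v : Fin 3 → Z → ℝ}

lemma rsc_smooth (hv : ∀ i, Sm (v i)) (r : ℝ) (p : Z) (i) : Sm (rsc r p v i) :=
  contDiff_const.mul (aff_comp_smooth (hv i) r p)

lemma dx_rsc (hv : ∀ i, Sm (v i)) (r : ℝ) (p : Z) (j i) :
    dx j (rsc r p v i) = fun z => r ^ 2 * dx j (v i) (aff r p z) := by
  unfold rsc
  rw [dx_cm (aff_comp_smooth (hv i) r p), dx_aff (hv i)]
  ext; ring

lemma vort_rsc (hv : ∀ i, Sm (v i)) (r : ℝ) (p : Z) (a b) :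
    vort (rsc r p v) a b = fun z => r ^ 2 * vort v a b (aff r p z) := by
  funext z
  simp only [vort, dx_rsc hv]; ring

lemma dl_vort_rsc (hv : ∀ i, Sm (v i)) (r : ℝ) (p : Z) (a b l) (z : Z) :
    dl l (vort (rsc r p v) a b) z = r ^ (l.length + 2) * dl l (vort v a b) (aff r p z) := by
  rw [vort_rsc hv, dl_cm (aff_comp_smooth (vort_smooth hv a b) r p),
    dl_aff (vort_smooth hv a b)]
  ring

lemma vsize_rsc (hv : ∀ i, Sm (v i)) {r : ℝ} (hr : 0 ≤ r) (p : Z) (J : ℕ) (z : Z) :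
    vsize J (rsc r p v) z = r * vsize J v (aff r p z) := by
  unfold vsize
  simp only [Finset.mul_sum]
  refine Finset.sum_congr rfl fun a _ => Finset.sum_congr rfl fun b _ =>
    Finset.sum_congr rfl fun j _ => Finset.sum_congr rfl fun l _ => ?_
  rw [dl_vort_rsc hv, abs_mul, abs_of_nonneg (by positivity),
    Real.mul_rpow (by positivity) (abs_nonneg _), List.length_ofFn,
    ← Real.rpow_natCast, ← Real.rpow_mul hr]
  push_cast
  rw [mul_one_div_cancel (by positivity), Real.rpow_one]

lemma rsc_eq {P : Z → ℝ} {c : Fin 3 → ℝ → ℝ} (hv : ∀ i, Sm (v i)) (hP : Sm P) (r : ℝ) (p : Z)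
    (z : Z) (i : Fin 3)
    (h : dt (v i) (aff r p z) + ∑ j, v j (aff r p z) * dx j (v i) (aff r p z)
      + dx i P (aff r p z) + c i (aff r p z).1 - lap (v i) (aff r p z) = 0) :
    dt (rsc r p v i) z + ∑ j, rsc r p v j z * dx j (rsc r p v i) z
      + dx i (fun z => r ^ 2 * P (aff r p z)) z + r ^ 3 * c i (p.1 + r ^ 2 * z.1)
      - lap (rsc r p v i) z = 0 := by
  have e1 : dt (rsc r p v i) z = r ^ 3 * dt (v i) (aff r p z) := by
    refine (dv_const_mul _ r (aff_comp_smooth (hv i) r p) z).trans ?_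
    change r * dt (fun z => v i (aff r p z)) z = _
    rw [dt_aff (hv i)]; ring
  have e2 : dx i (fun z => r ^ 2 * P (aff r p z)) z = r ^ 3 * dx i P (aff r p z) := by
    rw [dx_cm (aff_comp_smooth hP r p), dx_aff hP]; ring
  have e3 : lap (rsc r p v i) z = r ^ 3 * lap (v i) (aff r p z) := by
    unfold lap
    rw [Finset.mul_sum]
    refine Finset.sum_congr rfl fun j _ => ?_
    rw [dx_rsc hv, dx_cm (aff_comp_smooth (dv_smooth _ (hv i)) r p), dx_aff (dv_smooth _ (hv i))]
    ring
  have e4 : ∑ j, rsc r p v j z * dx j (rsc r p v i) z =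
      r ^ 3 * ∑ j, v j (aff r p z) * dx j (v i) (aff r p z) := by
    rw [Finset.mul_sum]
    refine Finset.sum_congr rfl fun j _ => ?_
    rw [dx_rsc hv, rsc]; ring
  rw [e1, e2, e3, e4]
  have : c i (aff r p z).1 = c i (p.1 + r ^ 2 * z.1) := rfl
  rw [this] at h
  linear_combination r ^ 3 * h

end

lemma vorticity_bound (J : ℕ) : ∃ κ : ℝ, 0 < κ ∧
    ∀ (v : Fin 3 → Z → ℝ) (P : Z → ℝ) (c : Fin 3 → ℝ → ℝ), (∀ i, Sm (v i)) → Sm P →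
    (∀ s ∈ Icc (-1 : ℝ) 0, ∀ x, (∀ i, dt (v i) (s, x) + ∑ j, v j (s, x) * dx j (v i) (s, x)
      + dx i P (s, x) + c i s - lap (v i) (s, x) = 0) ∧ ∑ i, dx i (v i) (s, x) = 0) →
    (∀ s ∈ Icc (-1 / 4 : ℝ) 0, ∀ x : E3, ‖x‖ ≤ 1 / 4 → ∀ i, |v i (s, x)| ≤ κ) →
    ∀ x : E3, ‖x‖ ≤ 1 / 8 → vsize (J + 1) v (0, x) ≤ 24 := by
  have hcnt := vcount_pos (J + 1)
  set e : ℝ := min 1 (1 / (4 * vcount (J + 1)))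
  have he0 : 0 < e := lt_min one_pos (by positivity)
  have he1 : e ≤ 1 := min_le_left _ _
  have he2 : vcount (J + 1) * e ≤ 1 / 4 := by
    have := min_le_right 1 (1 / (4 * vcount (J + 1)))
    rw [le_div_iff₀ (by positivity)] at this
    linarith
  obtain ⟨κ, hκ, H⟩ := vorticity_small J (e ^ (J + 1 + 2)) (by positivity)
  refine ⟨κ, hκ, fun v P c hv hP heq hvb => ?_⟩
  set N := vsize (J + 1) v
  have hNc : Continuous N := vsize_continuous _ hv
  have hN0 : ∀ z, 0 ≤ N z := vsize_nonneg _ v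
  set d : Z → ℝ := fun z => 1 / 4 - max (Real.sqrt (-z.1)) ‖z.2‖ with hd
  have hdc : Continuous d := by fun_prop
  obtain ⟨z₀, hz₀, hmax⟩ := (isCompact_Icc.prod (isCompact_closedBall (0 : E3) (1 / 4))).exists_isMaxOn
    (s := Icc (-(1 / 16) : ℝ) 0 ×ˢ closedBall (0 : E3) (1 / 4))
    ⟨((0 : ℝ), (0 : E3)), by constructor <;> simp⟩ (hdc.mul hNc).continuousOn
  have hmax' : ∀ z ∈ Icc (-(1 / 16) : ℝ) 0 ×ˢ closedBall (0 : E3) (1 / 4),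
      d z * N z ≤ d z₀ * N z₀ := fun z hz => hmax hz
  rcases le_or_gt (d z₀ * N z₀) 3 with hD | hD
  · intro x hx
    have h1 := hmax' (0, x) ⟨by simp, by simp; linarith⟩
    have h2 : (1 : ℝ) / 8 ≤ d (0, x) := by
      simp only [hd, neg_zero, Real.sqrt_zero]
      have := max_le (norm_nonneg x |>.trans hx) hx
      linarith
    have := mul_le_mul_of_nonneg_right h2 (hN0 (0, x))
    linarith
  exfalso
  have hd0 : 0 < d z₀ := by
    by_contra hc
    have := mul_nonpos_of_nonpos_of_nonneg (not_lt.1 hc) (hN0 z₀)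
    linarith
  have hNpos : 0 < N z₀ := by
    by_contra hc
    have := mul_nonpos_of_nonneg_of_nonpos hd0.le (not_lt.1 hc)
    linarith
  have hdle : d z₀ ≤ 1 / 4 := by
    have : 0 ≤ max (Real.sqrt (-z₀.1)) ‖z₀.2‖ := le_max_of_le_left (Real.sqrt_nonneg _)
    simp only [hd]; linarith
  set r : ℝ := 1 / (2 * N z₀) with hr
  have hr0 : 0 < r := by positivity
  have hrN : r * N z₀ = 1 / 2 := by rw [hr]; field_simp
  have hrd : 6 * r ≤ d z₀ := by
    have h1 : 6 * r * N z₀ ≤ d z₀ * N z₀ := by nlinarith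
    exact le_of_mul_le_mul_right h1 hNpos
  have hr1 : r ≤ 1 := by linarith
  have haff : ∀ s ∈ Icc (-1 : ℝ) 0, ∀ x : E3, ‖x‖ ≤ 3 →
      aff r z₀ (s, x) ∈ Icc (-(1 / 16) : ℝ) 0 ×ˢ closedBall (0 : E3) (1 / 4) ∧
      d z₀ / 2 ≤ d (aff r z₀ (s, x)) := by
    intro s hs x hx
    have h1 : Real.sqrt (-(aff r z₀ (s, x)).1) ≤ Real.sqrt (-z₀.1) + r := by
      have e : -(aff r z₀ (s, x)).1 ≤ -z₀.1 + r ^ 2 := by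
        simp only [aff]; nlinarith [hs.1, sq_nonneg r]
      refine (Real.sqrt_le_sqrt e).trans ?_
      have h0 : 0 ≤ -z₀.1 := by have := hz₀.1.2; linarith
      refine Real.sqrt_le_iff.2 ⟨by positivity, ?_⟩
      nlinarith [Real.sq_sqrt h0, mul_nonneg (Real.sqrt_nonneg (-z₀.1)) hr0.le]
    have h2 : ‖(aff r z₀ (s, x)).2‖ ≤ ‖z₀.2‖ + 3 * r := by
      simp only [aff]
      refine (norm_add_le _ _).trans ?_
      rw [norm_smul, Real.norm_eq_abs, abs_of_pos hr0]
      nlinarith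
    have h3 : Real.sqrt (-z₀.1) ≤ 1 / 4 - d z₀ := by
      have := le_max_left (Real.sqrt (-z₀.1)) ‖z₀.2‖; simp only [hd]; linarith
    have h4 : ‖z₀.2‖ ≤ 1 / 4 - d z₀ := by
      have := le_max_right (Real.sqrt (-z₀.1)) ‖z₀.2‖; simp only [hd]; linarith
    have h5 : Real.sqrt (-(aff r z₀ (s, x)).1) ≤ 1 / 4 - d z₀ / 2 := by linarith
    have h6 : ‖(aff r z₀ (s, x)).2‖ ≤ 1 / 4 - d z₀ / 2 := by linarith
    refine ⟨⟨⟨?_, ?_⟩, ?_⟩, ?_⟩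
    · have h7 : Real.sqrt (-(aff r z₀ (s, x)).1) ≤ 1 / 4 := by linarith
      have := (Real.sqrt_le_left (by norm_num)).1 h7
      linarith
    · simp only [aff]; nlinarith [hs.2, sq_nonneg r, hz₀.1.2]
    · rw [mem_closedBall_zero_iff]; linarith
    · have := max_le h5 h6
      simp only [hd] at this ⊢; linarith
  have hsmall := H (rsc r z₀ v) (fun z => r ^ 2 * P (aff r z₀ z))
    (fun i s => r ^ 3 * c i (z₀.1 + r ^ 2 * s)) (rsc_smooth hv r z₀)
    (contDiff_const.mul (aff_comp_smooth hP r z₀)) (fun s hs x => by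
      have hs' : (aff r z₀ (s, x)).1 ∈ Icc (-1 : ℝ) 0 := by
        have h0 := (haff s hs 0 (by simp)).1.1
        exact ⟨by have := h0.1; simp only [aff] at this ⊢; linarith, h0.2⟩
      refine ⟨fun i => rsc_eq hv hP r z₀ (s, x) i ((heq _ hs' _).1 i), ?_⟩
      simp only [dx_rsc hv, ← Finset.mul_sum]
      rw [(heq _ hs' (aff r z₀ (s, x)).2).2, mul_zero]) (fun s hs x hx => by
      obtain ⟨hK, hdz⟩ := haff s hs x hx
      constructor
      · intro i
        rw [rsc, abs_mul, abs_of_pos hr0]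
        have := hvb (aff r z₀ (s, x)).1 ⟨by linarith [hK.1.1], hK.1.2⟩ (aff r z₀ (s, x)).2
          (by simpa using hK.2) i
        calc _ ≤ 1 * |v i (aff r z₀ (s, x))| := mul_le_mul_of_nonneg_right hr1 (abs_nonneg _)
          _ ≤ κ := by rw [one_mul]; exact this
      · intro a b l hl
        have h1 : vsize (J + 1) (rsc r z₀ v) (s, x) ≤ 1 := by
          rw [vsize_rsc hv hr0.le]
          have h2 := hmax' _ hK
          have h3 := mul_le_mul_of_nonneg_right hdz (hN0 (aff r z₀ (s, x)))
          have h4 : d z₀ * N (aff r z₀ (s, x)) ≤ d z₀ * (2 * N z₀) := by linarith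
          have h5 := le_of_mul_le_mul_left h4 hd0
          calc _ ≤ r * (2 * N z₀) := mul_le_mul_of_nonneg_left h5 hr0.le
            _ = 1 := by linarith
        exact (le_vsize _ a b hl _).trans (pow_le_one₀ (vsize_nonneg _ _ _) h1))
  have hfin := vsize_le he0.le he1 hsmall
  rw [vsize_rsc hv hr0.le] at hfin
  have : aff r z₀ (0, 0) = z₀ := by simp [aff]
  rw [this] at hfin
  have h8 : r * vsize (J + 1) v z₀ = 1 / 2 := hrN
  linarith

/-- Smallness of the pivot quantity controls all derivatives at the centre. -/
theorem derivative_bound (n : ℕ) : ∃ η C : ℝ, 0 < η ∧ 0 < C ∧ ∀ v P c, CSol v P c →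
    pivot v ≤ ENNReal.ofReal η → ∀ i l, l.length ≤ n → |dl l (v i) (0, 0)| ≤ C := by
  obtain ⟨M, η₀, hM, hη₀, H1⟩ := small_velocity
  obtain ⟨κ, hκ, H2⟩ := vorticity_bound n
  obtain ⟨κ', hκ', H3⟩ := velocity_chain n (1 / 8) 1 (by norm_num) one_pos
  set η := min η₀ (κ ^ 2 / M)
  have hη : 0 < η := lt_min hη₀ (by positivity)
  set q : ℝ := min (κ' / κ) (1 / 24 ^ (n + 2)) with hq
  have hq0 : 0 < q := lt_min (by positivity) (by positivity)
  refine ⟨η, 1 / q, hη, by positivity, fun v P c hC hp i l hl => ?_⟩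
  have hsv : ∀ s ∈ Icc (-1 / 4 : ℝ) 0, ∀ x : E3, ‖x‖ ≤ 1 / 4 → ∀ i, |v i (s, x)| ≤ κ := by
    intro s hs x hx i
    have h1 := H1 v P c hC η hη (min_le_left _ _) hp s x hs.1 hs.2 hx
    have h2 : M * η ≤ κ ^ 2 := by
      have := min_le_right η₀ (κ ^ 2 / M)
      rw [le_div_iff₀ hM] at this; linarith
    exact abs_le_of_sq_le_sq ((sq_le_S2 v i (s, x)).trans (h1.trans h2)) hκ.le
  have hw := H2 v P c hC.sm hC.smP (fun s hs x => ⟨hC.eq s hs x, hC.div s hs x⟩) hsv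
  have hqk : q * κ ≤ κ' := by
    have := min_le_left (κ' / κ) (1 / 24 ^ (n + 2))
    rwa [← hq, le_div_iff₀ hκ] at this
  have hq24 : q * 24 ^ (n + 2) ≤ 1 := by
    have := min_le_right (κ' / κ) (1 / 24 ^ (n + 2))
    rwa [← hq, le_div_iff₀ (by positivity)] at this
  have hsm : ∀ i, Sm (fun z => q * v i z) := fun i => contDiff_const.mul (hC.sm i)
  have hvq : ∀ a b, vort (fun i z => q * v i z) a b = fun z => q * vort v a b z := by
    intro a b
    funext z
    simp only [vort, dx_cm (hC.sm _)]; ring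
  have key := H3 (fun i z => q * v i z) hsm 0 0 (fun x => by
    simp only [dx_cm (hC.sm _), ← Finset.mul_sum]
    rw [hC.div 0 (by simp) x, mul_zero]) (fun x hx => by
      refine ⟨fun i => ?_, fun a b l hl => ?_⟩
      · rw [abs_mul, abs_of_pos hq0]
        exact (mul_le_mul_of_nonneg_left (hsv 0 (by norm_num) x (by linarith) i) hq0.le).trans hqk
      · rw [hvq, dl_cm (vort_smooth hC.sm a b), abs_mul, abs_of_pos hq0]
        have h1 := le_vsize (J := n + 1) v a b (l := l) (by omega) (0, x)
        have h2 : |dl l (vort v a b) (0, x)| ≤ 24 ^ (n + 2) :=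
          h1.trans ((pow_le_pow_left₀ (vsize_nonneg _ _ _) (hw x (by linarith)) _).trans
            (pow_le_pow_right₀ (by norm_num) (by omega)))
        exact (mul_le_mul_of_nonneg_left h2 hq0.le).trans hq24) 0 (by simp) i l hl
  rw [dl_cm (hC.sm i), abs_mul, abs_of_pos hq0] at key
  rw [le_div_iff₀ hq0]; linarith

/-! ### Flows of divergence-free fields -/

lemma det_perturbation {A : Matrix (Fin 3) (Fin 3) ℝ} {K h : ℝ} (hA : ∀ i j, |A i j| ≤ K)
    (htr : A.trace = 0) (hh : 0 ≤ h) (hK : h * K ≤ 1 / 2) :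
    1 - 9 * (h * K) ^ 2 ≤ (1 + h • A).det := by
  have hK0 : 0 ≤ K := (abs_nonneg _).trans (hA 0 0)
  have m2 : ∀ i j k l, |A i j * A k l| ≤ K ^ 2 := fun i j k l => by
    rw [abs_mul, sq]; exact mul_le_mul (hA _ _) (hA _ _) (abs_nonneg _) hK0
  have m3 : ∀ i j k l m n, |A i j * A k l * A m n| ≤ K ^ 3 := fun i j k l m n => by
    rw [abs_mul, pow_succ]; exact mul_le_mul (m2 _ _ _ _) (hA _ _) (abs_nonneg _) (by positivity)
  have e : (1 + h • A).det = 1 + h * A.trace + h ^ 2 * (A 0 0 * A 1 1 - A 0 1 * A 1 0 +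
      (A 0 0 * A 2 2 - A 0 2 * A 2 0) + (A 1 1 * A 2 2 - A 1 2 * A 2 1)) + h ^ 3 * A.det := by
    simp [Matrix.det_fin_three, Matrix.trace, Fin.sum_univ_three]
    ring
  have h2 : -(6 * K ^ 2) ≤ A 0 0 * A 1 1 - A 0 1 * A 1 0 +
      (A 0 0 * A 2 2 - A 0 2 * A 2 0) + (A 1 1 * A 2 2 - A 1 2 * A 2 1) := by
    have a1 := abs_le.1 (m2 0 0 1 1)
    have a2 := abs_le.1 (m2 0 1 1 0)
    have a3 := abs_le.1 (m2 0 0 2 2)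
    have a4 := abs_le.1 (m2 0 2 2 0)
    have a5 := abs_le.1 (m2 1 1 2 2)
    have a6 := abs_le.1 (m2 1 2 2 1)
    linarith [a1.1, a2.2, a3.1, a4.2, a5.1, a6.2]
  have h3 : -(6 * K ^ 3) ≤ A.det := by
    rw [Matrix.det_fin_three]
    have a1 := abs_le.1 (m3 0 0 1 1 2 2)
    have a2 := abs_le.1 (m3 0 0 1 2 2 1)
    have a3 := abs_le.1 (m3 0 1 1 0 2 2)
    have a4 := abs_le.1 (m3 0 1 1 2 2 0)
    have a5 := abs_le.1 (m3 0 2 1 0 2 1)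
    have a6 := abs_le.1 (m3 0 2 1 1 2 0)
    linarith [a1.1, a2.2, a3.2, a4.1, a5.1, a6.2]
  have h2' := mul_le_mul_of_nonneg_left h2 (sq_nonneg h)
  have h3' := mul_le_mul_of_nonneg_left h3 (pow_nonneg hh 3)
  have h4 : (h * K) ^ 2 * (h * K) ≤ (h * K) ^ 2 * (1 / 2) :=
    mul_le_mul_of_nonneg_left hK (sq_nonneg _)
  rw [e, htr]
  nlinarith

lemma euler_step {g : E3 → E3} (hg : Sm g) {K : ℝ≥0} {h : ℝ} (hK : LipschitzWith K g)
    (hdiv : ∀ x, ∑ i, fderiv ℝ g x (eb i) i = 0) (hh : 0 ≤ h) (hhK : h * K ≤ 1 / 2)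
    (f : E3 → ℝ≥0∞) :
    ENNReal.ofReal (1 - 9 * (h * K) ^ 2) * ∫⁻ x, f (x + h • g x) ≤ ∫⁻ x, f x := by
  set S : E3 → E3 := fun x => x + h • g x
  have hd : ∀ x, HasFDerivAt S (ContinuousLinearMap.id ℝ E3 + h • fderiv ℝ g x) x := fun x =>
    (hasFDerivAt_id x).add (((hg.differentiable (by simp)) x).hasFDerivAt.const_smul h)
  have hinj : InjOn S univ := by
    intro x _ y _ hxy
    have e : x - y = h • (g y - g x) := by
      have : x + h • g x = y + h • g y := hxy
      rw [smul_sub, sub_eq_sub_iff_add_eq_add, this, add_comm]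
    have h1 : ‖x - y‖ ≤ h * (K * ‖y - x‖) := by
      rw [e, norm_smul, Real.norm_of_nonneg hh]
      exact mul_le_mul_of_nonneg_left (by simpa [dist_eq_norm] using hK.dist_le_mul y x) hh
    rw [norm_sub_rev y x] at h1
    have h2 : ‖x - y‖ = 0 := by nlinarith [norm_nonneg (x - y)]
    exact sub_eq_zero.1 (norm_eq_zero.1 h2)
  have hdet : ∀ x, 1 - 9 * (h * K) ^ 2 ≤
      |(ContinuousLinearMap.id ℝ E3 + h • fderiv ℝ g x).det| := by
    intro x
    refine le_trans ?_ (le_abs_self _)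
    set b := (EuclideanSpace.basisFun (Fin 3) ℝ).toBasis
    set A := LinearMap.toMatrix b b (fderiv ℝ g x).toLinearMap
    have hA : ∀ i j, A i j = fderiv ℝ g x (eb j) i := fun i j => by
      simp [A, b, LinearMap.toMatrix_apply, eb]
    have e : (ContinuousLinearMap.id ℝ E3 + h • fderiv ℝ g x).det = (1 + h • A).det := by
      rw [ContinuousLinearMap.det, ← LinearMap.det_toMatrix b]
      congr 1
      rw [ContinuousLinearMap.toLinearMap_add, map_add, ContinuousLinearMap.toLinearMap_smul,
        map_smul]
      congr 1
      exact LinearMap.toMatrix_id b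
    rw [e]
    refine det_perturbation (fun i j => ?_) ?_ hh hhK
    · rw [hA]
      calc _ ≤ ‖fderiv ℝ g x (eb j)‖ := abs_coord_le _ _
        _ ≤ ‖fderiv ℝ g x‖ * ‖eb j‖ := ContinuousLinearMap.le_opNorm _ _
        _ ≤ K * 1 := by
          gcongr
          · exact norm_fderiv_le_of_lipschitz ℝ hK
          · simp [eb]
        _ = K := mul_one _
    · simp [Matrix.trace, hA, hdiv]
  have key := lintegral_image_eq_lintegral_abs_det_fderiv_mul volume MeasurableSet.univ
    (fun x _ => (hd x).hasFDerivWithinAt) hinj f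
  calc _ = ∫⁻ x in univ, ENNReal.ofReal (1 - 9 * (h * K) ^ 2) * f (S x) := by
        rw [Measure.restrict_univ, lintegral_const_mul' _ _ ENNReal.ofReal_ne_top]
    _ ≤ ∫⁻ x in univ, ENNReal.ofReal
          |(ContinuousLinearMap.id ℝ E3 + h • fderiv ℝ g x).det| * f (S x) :=
        lintegral_mono fun x => mul_le_mul_left (ENNReal.ofReal_le_ofReal (hdet x)) _
    _ = ∫⁻ x in S '' univ, f x := key.symm
    _ ≤ _ := setLIntegral_le_lintegral _ _

/-- Explicit Euler iterates with step `h`. -/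
def euler (b : Z → E3) (h : ℝ) : ℕ → E3 → E3
  | 0, x => x
  | k + 1, x => euler b h k x + h • b (k * h, euler b h k x)

lemma euler_volume {b : Z → E3} (hb : Sm b) {K : ℝ≥0}
    (hK : ∀ s, LipschitzWith K fun x => b (s, x))
    (hdiv : ∀ s ∈ Icc (0 : ℝ) 1, ∀ x, ∑ i, fderiv ℝ (fun y => b (s, y)) x (eb i) i = 0)
    {h : ℝ} (hh : 0 ≤ h) (hhK : h * K ≤ 1 / 2) (N : ℕ) (hN : N * h ≤ 1) (f : E3 → ℝ≥0∞) :
    ENNReal.ofReal (1 - 9 * (h * K) ^ 2) ^ N * ∫⁻ x, f (euler b h N x) ≤ ∫⁻ x, f x := by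
  induction N generalizing f with
  | zero => simp [euler]
  | succ k ih =>
    have hk : (k : ℝ) * h ≤ 1 := by push_cast at hN; nlinarith
    calc _ = ENNReal.ofReal (1 - 9 * (h * K) ^ 2) * (ENNReal.ofReal (1 - 9 * (h * K) ^ 2) ^ k *
            ∫⁻ x, (fun y => f (y + h • b (k * h, y))) (euler b h k x)) := by
          rw [pow_succ', mul_assoc]; rfl
      _ ≤ ENNReal.ofReal (1 - 9 * (h * K) ^ 2) * ∫⁻ y, f (y + h • b (k * h, y)) :=
          mul_le_mul_right (ih hk _) _
      _ ≤ _ := euler_step (hb.comp (by fun_prop : Sm fun y : E3 => ((k * h, y) : Z))) (hK _)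
          (hdiv _ ⟨by positivity, hk⟩) hh hhK f

/-- Trajectories of the field `b`. -/
structure FlowOf (b : Z → E3) (Y : E3 → ℝ → E3) : Prop where
  sm : ∀ x, Sm (Y x)
  zero : ∀ x, Y x 0 = x
  eq : ∀ x, ∀ s ∈ Icc (0 : ℝ) 1, HasDerivAt (Y x) (b (s, Y x s)) s

lemma euler_error {b : Z → E3} {Y : E3 → ℝ → E3} (hY : FlowOf b Y) {K : ℝ≥0}
    (hK : ∀ s, LipschitzWith K fun x => b (s, x)) (x : E3) :
    ∃ M : ℝ, 0 ≤ M ∧ ∀ h : ℝ, 0 ≤ h → ∀ k : ℕ, k * h ≤ 1 →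
      ‖euler b h k x - Y x (k * h)‖ ≤ (1 + h * K) ^ k * (k * (M * h ^ 2)) := by
  have hd2 : Sm (deriv (Y x)) := ((contDiff_infty_iff_deriv (𝕜 := ℝ)).1 (hY.sm x)).2
  obtain ⟨M, hM⟩ := isCompact_Icc.exists_bound_of_continuousOn (s := Icc (0 : ℝ) 1)
    ((contDiff_infty_iff_deriv (𝕜 := ℝ)).1 hd2).2.continuous.continuousOn
  have hM0 : 0 ≤ M := (norm_nonneg _).trans (hM 0 (by simp))
  refine ⟨M, hM0, fun h hh k => ?_⟩
  induction k with
  | zero => simp [euler, hY.zero]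
  | succ k ih =>
    intro hk1
    have hk : (k : ℝ) * h ≤ 1 := by push_cast at hk1; nlinarith
    set s : ℝ := k * h
    have hs0 : 0 ≤ s := by positivity
    have hs1 : ((k + 1 : ℕ) : ℝ) * h = s + h := by push_cast; ring
    rw [hs1] at hk1 ⊢
    have hsI : ∀ t ∈ Icc s (s + h), t ∈ Icc (0 : ℝ) 1 :=
      fun t ht => ⟨hs0.trans ht.1, ht.2.trans hk1⟩
    have hsub : Icc s (s + h) ⊆ Icc (0 : ℝ) 1 := hsI
    have hsm : s ∈ Icc s (s + h) := ⟨le_rfl, by linarith⟩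
    have hD : ∀ t, HasDerivAt (Y x) (deriv (Y x) t) t := fun t =>
      (((hY.sm x).differentiable (by simp)) t).hasDerivAt
    have hlip : ∀ t ∈ Icc s (s + h), ‖deriv (Y x) t - deriv (Y x) s‖ ≤ M * h := fun t ht => by
      have := (convex_Icc s (s + h)).norm_image_sub_le_of_norm_deriv_le (f := deriv (Y x)) (C := M)
        (fun t _ => (hd2.differentiable (by simp)) t) (fun t ht => hM t (hsI t ht)) hsm ht
      refine this.trans (mul_le_mul_of_nonneg_left ?_ hM0)
      rw [Real.norm_of_nonneg (by linarith [ht.1])]; linarith [ht.2]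
    have hloc : ‖Y x (s + h) - Y x s - h • deriv (Y x) s‖ ≤ M * h * h := by
      have hder : ∀ t ∈ Icc s (s + h), HasDerivWithinAt (fun t => Y x t - (t - s) • deriv (Y x) s)
          (deriv (Y x) t - deriv (Y x) s) (Icc s (s + h)) t := fun t _ => by
        have := (hD t).sub (((hasDerivAt_id t).sub_const s).smul_const (deriv (Y x) s))
        rw [one_smul] at this
        exact this.hasDerivWithinAt
      have := (convex_Icc s (s + h)).norm_image_sub_le_of_norm_hasDerivWithin_le hder hlip hsm
        (⟨by linarith, le_rfl⟩ : s + h ∈ Icc s (s + h))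
      have e : Y x (s + h) - (s + h - s) • deriv (Y x) s - (Y x s - (s - s) • deriv (Y x) s) =
          Y x (s + h) - Y x s - h • deriv (Y x) s := by
        rw [sub_self, zero_smul, add_sub_cancel_left]; abel
      rw [e, add_sub_cancel_left, Real.norm_of_nonneg hh] at this
      exact this
    have hb : deriv (Y x) s = b (s, Y x s) := (hY.eq x s (hsI s hsm)).deriv
    have e : euler b h (k + 1) x - Y x (s + h) = (euler b h k x - Y x s) +
        h • (b (s, euler b h k x) - b (s, Y x s)) -
        (Y x (s + h) - Y x s - h • deriv (Y x) s) := by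
      rw [hb, smul_sub]; simp only [euler, s]; abel
    have h1 : ‖b (s, euler b h k x) - b (s, Y x s)‖ ≤ K * ‖euler b h k x - Y x s‖ := by
      simpa [dist_eq_norm] using (hK s).dist_le_mul (euler b h k x) (Y x s)
    have h2 := ih hk
    have hpow : 1 ≤ (1 + h * (K : ℝ)) ^ (k + 1) :=
      one_le_pow₀ (by have := mul_nonneg hh K.coe_nonneg; linarith)
    have hMh : 0 ≤ M * h ^ 2 := by positivity
    rw [e]
    calc _ ≤ ‖euler b h k x - Y x s‖ + h * (K * ‖euler b h k x - Y x s‖) + M * h * h := by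
          refine (norm_sub_le _ _).trans (add_le_add ((norm_add_le _ _).trans
            (add_le_add_right ?_ _)) hloc)
          rw [norm_smul, Real.norm_of_nonneg hh]
          exact mul_le_mul_of_nonneg_left h1 hh
      _ = (1 + h * K) * ‖euler b h k x - Y x s‖ + M * h ^ 2 := by ring
      _ ≤ (1 + h * K) * ((1 + h * K) ^ k * (k * (M * h ^ 2))) + (1 + h * K) ^ (k + 1) * (M * h ^ 2) :=
          add_le_add (mul_le_mul_of_nonneg_left h2 (by have := mul_nonneg hh K.coe_nonneg; linarith))
            (le_mul_of_one_le_left hMh hpow)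
      _ = _ := by push_cast; ring

/-- Up to a factor `2`, flows of divergence-free fields do not concentrate volume. -/
lemma flow_volume {b : Z → E3} (hb : Sm b) {Y : E3 → ℝ → E3} (hY : FlowOf b Y) {K : ℝ≥0}
    (hK : ∀ s, LipschitzWith K fun x => b (s, x))
    (hdiv : ∀ s ∈ Icc (0 : ℝ) 1, ∀ x, ∑ i, fderiv ℝ (fun y => b (s, y)) x (eb i) i = 0)
    {τ : ℝ} (hτ : τ ∈ Icc (0 : ℝ) 1) {f : E3 → ℝ≥0∞} (hf : Continuous f) :
    ∫⁻ x, f (Y x τ) ≤ 2 * ∫⁻ x, f x := by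
  set h : ℕ → ℝ := fun N => τ / (N + 1)
  have hNp : ∀ N : ℕ, (0 : ℝ) < N + 1 := fun N => by positivity
  have hh : ∀ N, 0 ≤ h N := fun N => div_nonneg hτ.1 (hNp N).le
  have hNh : ∀ N : ℕ, ((N + 1 : ℕ) : ℝ) * h N = τ := fun N => by
    have := (hNp N).ne'
    simp only [h]; push_cast; field_simp
  have hlim : Filter.Tendsto h Filter.atTop (nhds 0) := by
    simpa [h, div_eq_mul_inv] using (tendsto_one_div_add_atTop_nhds_zero_nat (𝕜 := ℝ)).const_mul τ
  have hbc : Continuous b := hb.continuous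
  have hec : ∀ h k, Continuous (euler b h k) := fun h k => by
    induction k with
    | zero => exact continuous_id
    | succ k ih => exact ih.add ((hbc.comp (continuous_const.prodMk ih)).const_smul h)
  have hpt : ∀ x, Filter.Tendsto (fun N => euler b (h N) (N + 1) x) Filter.atTop
      (nhds (Y x τ)) := by
    intro x
    obtain ⟨M, hM0, hM⟩ := euler_error hY hK x
    rw [tendsto_iff_norm_sub_tendsto_zero]
    refine squeeze_zero (fun _ => norm_nonneg _)
      (g := fun N => Real.exp (τ * K) * (τ * (M * h N))) (fun N => ?_) ?_
    · have := hM (h N) (hh N) (N + 1) ((hNh N).le.trans hτ.2)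
      rw [hNh N] at this
      refine this.trans (mul_le_mul ?_ (le_of_eq ?_) (by positivity) (Real.exp_pos _).le)
      · calc _ ≤ Real.exp (h N * K) ^ (N + 1) := by
              refine pow_le_pow_left₀ (by have := mul_nonneg (hh N) K.coe_nonneg; linarith) ?_ _
              linarith [Real.add_one_le_exp (h N * (K : ℝ))]
          _ = _ := by
              rw [← Real.exp_nat_mul, ← mul_assoc, hNh N]
      · rw [sq, ← hNh N]; ring
    · simpa using ((hlim.const_mul M).const_mul τ).const_mul (Real.exp (τ * K))
  have hev : ∀ᶠ N in Filter.atTop, ∫⁻ x, f (euler b (h N) (N + 1) x) ≤ 2 * ∫⁻ x, f x := by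
    have h1 : ∀ᶠ N in Filter.atTop, h N * (18 * (K : ℝ) ^ 2 + 2 * K) < 1 :=
      (by simpa using hlim.mul_const (18 * (K : ℝ) ^ 2 + 2 * K) :
        Filter.Tendsto (fun N => h N * (18 * (K : ℝ) ^ 2 + 2 * K)) _ (nhds 0)).eventually_lt_const
          one_pos
    filter_upwards [h1] with N hN
    have hp1 : 0 ≤ h N * (K : ℝ) := mul_nonneg (hh N) K.coe_nonneg
    have hp2 : 0 ≤ h N * (K : ℝ) ^ 2 := mul_nonneg (hh N) (by positivity)
    have hhK : h N * K ≤ 1 / 2 := by linarith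
    have hv := euler_volume hb hK hdiv (hh N) hhK (N + 1) ((hNh N).le.trans hτ.2) f
    have hq : 9 * (h N * (K : ℝ)) ^ 2 ≤ 1 / 2 := by
      have h18 : h N * (K : ℝ) ^ 2 ≤ 1 / 18 := by linarith
      have hN1 : h N ≤ 1 := (div_le_one (hNp N)).2
        (by linarith [hτ.2, (Nat.cast_nonneg N : (0 : ℝ) ≤ N)])
      nlinarith
    have hber := one_add_mul_le_pow (a := -(9 * (h N * (K : ℝ)) ^ 2)) (by linarith) (N + 1)
    have hge : 1 / 2 ≤ (1 - 9 * (h N * (K : ℝ)) ^ 2) ^ (N + 1) := by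
      rw [← sub_eq_add_neg] at hber
      refine le_trans ?_ hber
      have : ((N + 1 : ℕ) : ℝ) * -(9 * (h N * (K : ℝ)) ^ 2) = -(9 * τ * (h N * K ^ 2)) := by
        rw [← hNh N]; ring
      rw [this]
      nlinarith [hτ.2, hτ.1]
    have hpos : 0 ≤ 1 - 9 * (h N * (K : ℝ)) ^ 2 := by linarith
    calc _ = 2 * (ENNReal.ofReal (1 / 2) * ∫⁻ x, f (euler b (h N) (N + 1) x)) := by
          rw [← mul_assoc]
          have : (2 : ℝ≥0∞) * ENNReal.ofReal (1 / 2) = 1 := by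
            rw [← ENNReal.ofReal_ofNat 2, ← ENNReal.ofReal_mul (by norm_num)]; norm_num
          rw [this, one_mul]
      _ ≤ 2 * ∫⁻ x, f x := by
          refine mul_le_mul_right (le_trans (mul_le_mul_left ?_ _) hv) _
          rw [← ENNReal.ofReal_pow hpos]
          exact ENNReal.ofReal_le_ofReal hge
  calc _ = ∫⁻ x, Filter.liminf (fun N => f (euler b (h N) (N + 1) x)) Filter.atTop :=
        lintegral_congr fun x => (((hf.tendsto _).comp (hpt x)).liminf_eq).symm
    _ ≤ Filter.liminf (fun N => ∫⁻ x, f (euler b (h N) (N + 1) x)) Filter.atTop :=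
        lintegral_liminf_le fun N => (hf.comp (hec _ _)).measurable
    _ ≤ Filter.liminf (fun _ : ℕ => 2 * ∫⁻ x, f x) Filter.atTop := Filter.liminf_le_liminf hev
    _ = _ := by simp

lemma flow_exists {b : Z → E3} (hb : Sm b) {B : ℝ≥0} (hB : ∀ z, ‖b z‖ ≤ B) {K : ℝ≥0}
    (hK : ∀ s, LipschitzWith K fun x => b (s, x)) :
    ∃ Y, FlowOf b Y ∧ ∀ x x', ∀ s ∈ Icc (0 : ℝ) 1, ∀ s' ∈ Icc (0 : ℝ) 1,
      ‖Y x s - Y x' s'‖ ≤ Real.exp K * ‖x - x'‖ + B * |s - s'| := by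
  have hex : ∀ x : E3, ∃ α : ℝ → E3, α 0 = x ∧ ∀ t ∈ Icc (-1 : ℝ) 2,
      HasDerivWithinAt α (b (t, α t)) (Icc (-1) 2) t := fun x => by
    have hPL : IsPicardLindelof (fun t x => b (t, x))
        (⟨0, by norm_num⟩ : Icc (-1 : ℝ) 2) x (B * 2) 0 B K :=
      { lipschitzOnWith := fun t _ => (hK t).lipschitzOnWith
        continuousOn := fun y _ => (hb.continuous.comp (by fun_prop :
          Continuous fun t : ℝ => ((t, y) : Z))).continuousOn
        norm_le := fun t _ y _ => hB _
        mul_max_le := by simp }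
    exact hPL.exists_eq_forall_mem_Icc_hasDerivWithinAt₀
  choose α hα0 hα using hex
  let χ : ContDiffBump (1 / 2 : ℝ) := ⟨1, 5 / 4, by norm_num, by norm_num⟩
  have hχ1 : ∀ s ∈ Icc (0 : ℝ) 1, χ =ᶠ[nhds s] 1 := fun s hs =>
    χ.eventuallyEq_one_of_mem_ball (by
      rw [mem_ball, Real.dist_eq, abs_lt]; constructor <;> simp only [χ] <;> linarith [hs.1, hs.2])
  have hIn : ∀ s ∈ Icc (0 : ℝ) 1, Icc (-1 : ℝ) 2 ∈ nhds s := fun s hs =>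
    Icc_mem_nhds (by linarith [hs.1]) (by linarith [hs.2])
  have hsα : ∀ x, ContDiffOn ℝ ((⊤ : ℕ∞) : WithTop ℕ∞) (α x) (Icc (-1) 2) := fun x =>
    ODE.contDiffOn_enat_Icc_of_hasDerivWithinAt (f := fun t x => b (t, x)) (u := univ)
      (hb.contDiffOn) (hα x) (mapsTo_univ _ _)
  have hYα : ∀ x, ∀ s ∈ Icc (0 : ℝ) 1, (fun s => χ s • α x s) =ᶠ[nhds s] α x := fun x s hs => by
    filter_upwards [hχ1 s hs] with t ht
    simp [ht]
  have hd : ∀ x, ∀ s ∈ Icc (0 : ℝ) 1, HasDerivAt (α x) (b (s, α x s)) s := fun x s hs =>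
    (hα x s ⟨by linarith [hs.1], by linarith [hs.2]⟩).hasDerivAt (hIn s hs)
  refine ⟨fun x s => χ s • α x s, ⟨fun x => ?_, fun x => ?_, fun x s hs => ?_⟩, ?_⟩
  · rw [contDiff_iff_contDiffAt]
    intro s
    by_cases hs : s ∈ Ioo (-1 : ℝ) 2
    · exact χ.contDiff.contDiffAt.smul ((hsα x).contDiffAt (Icc_mem_nhds hs.1 hs.2))
    · have h0 : s ∉ tsupport χ := by
        rw [χ.tsupport_eq, mem_closedBall, Real.dist_eq, abs_le]
        rintro ⟨h1, h2⟩
        simp only [χ] at h1 h2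
        exact hs ⟨by linarith, by linarith⟩
      refine (contDiffAt_const (c := (0 : E3))).congr_of_eventuallyEq ?_
      filter_upwards [notMem_tsupport_iff_eventuallyEq.1 h0] with t ht
      simp [ht]
  · have := (hYα x 0 (by simp)).eq_of_nhds
    simpa [hα0] using this
  · have e := (hYα x s hs).eq_of_nhds
    simp only at e ⊢
    rw [e]
    exact (hd x s hs).congr_of_eventuallyEq (hYα x s hs)
  · intro x x' s hs s' hs'
    have e : ∀ x, ∀ s ∈ Icc (0 : ℝ) 1, χ s • α x s = α x s := fun x s hs => (hYα x s hs).eq_of_nhds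
    beta_reduce
    rw [e x s hs, e x' s' hs']
    have hco : ∀ x, ContinuousOn (α x) (Icc 0 1) := fun x s hs =>
      (hd x s hs).continuousAt.continuousWithinAt
    have h1 := dist_le_of_trajectories_ODE (v := fun t x => b (t, x)) hK (hco x)
      (fun t ht => (hd x t (Ico_subset_Icc_self ht)).hasDerivWithinAt) (hco x')
      (fun t ht => (hd x' t (Ico_subset_Icc_self ht)).hasDerivWithinAt) le_rfl s hs
    have h2 := (convex_Icc (0 : ℝ) 1).norm_image_sub_le_of_norm_hasDerivWithin_le
      (fun t ht => (hd x' t ht).hasDerivWithinAt) (fun t _ => hB _) hs' hs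
    rw [hα0, hα0, dist_eq_norm, dist_eq_norm] at h1
    have h3 : ‖x - x'‖ * Real.exp (K * (s - 0)) ≤ Real.exp K * ‖x - x'‖ := by
      rw [mul_comm]
      refine mul_le_mul_of_nonneg_right (Real.exp_le_exp.2 ?_) (norm_nonneg _)
      have := mul_le_mul_of_nonneg_left hs.2 K.coe_nonneg
      linarith
    rw [Real.norm_eq_abs] at h2
    calc _ ≤ ‖α x s - α x' s‖ + ‖α x' s - α x' s'‖ := norm_sub_le_norm_sub_add_norm_sub _ _ _
      _ ≤ _ := add_le_add (h1.trans h3) h2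

/-! ### The locally averaged velocity -/

lemma hasDerivAt_line {V : Type*} [NormedAddCommGroup V] [NormedSpace ℝ V] {f : V → ℝ} (hf : Sm f)
    (z w : V) : HasDerivAt (fun h : ℝ => f (z + h • w)) (dv w f z) 0 := by
  have h1 : HasDerivAt (fun h : ℝ => z + h • w) w 0 := by
    simpa using ((hasDerivAt_id (0 : ℝ)).smul_const w).const_add z
  have h2 : HasFDerivAt f (fderiv ℝ f z) (z + (0 : ℝ) • w) := by
    simpa using (hf.diff z).hasFDerivAt
  exact h2.comp_hasDerivAt (0 : ℝ) h1

/-- Local average of `f` around a point. -/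
def lavg (f : Z → ℝ) (z : Z) : ℝ := ∫ y, avk y * f (z.1, z.2 + y)

lemma lavg_smooth {f : Z → ℝ} (hf : Sm f) : Sm (lavg f) := by
  have h := contDiffOn_convolution_right_with_param (𝕜 := ℝ) (μ := (volume : Measure E3))
    (f := fun _ : E3 => (1 : ℝ)) (n := ⊤) (ContinuousLinearMap.mul ℝ ℝ)
    (g := fun (p : Z) (y : E3) => avk (-y) * f (p.1, p.2 - y)) (s := univ) (k := closedBall 0 1)
    isOpen_univ (isCompact_closedBall _ _)
    (fun p x _ hx => by
      rw [avk_zero' (-x) (by simpa using hx), zero_mul])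
    (locallyIntegrable_const _)
    (by
      have h1 : Sm fun q : Z × E3 => avk (-q.2) := avk_smooth.comp (by fun_prop)
      have h2 : Sm fun q : Z × E3 => f (q.1.1, q.1.2 - q.2) := hf.comp (by fun_prop)
      exact (h1.mul h2).contDiffOn)
  rw [univ_prod_univ, contDiffOn_univ] at h
  have h2 := h.comp (by fun_prop : Sm fun z : Z => (z, (0 : E3)))
  have e : lavg f = (fun q : Z × E3 => convolution (fun _ => (1 : ℝ))
      (fun y => avk (-y) * f (q.1.1, q.1.2 - y)) (ContinuousLinearMap.mul ℝ ℝ) volume q.2) ∘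
      fun z => (z, 0) := by
    funext z
    simp [lavg, convolution_def]
  rw [e]
  exact h2

lemma dx_lavg {f : Z → ℝ} (hf : Sm f) (j : Fin 3) (z : Z) :
    dx j (lavg f) z = lavg (dx j f) z := by
  set g : Z → ℝ := fun q => avk q.2 * f (z.1, z.2 + q.1 • eb j + q.2)
  have hgs : Sm g := (avk_smooth.comp contDiff_snd).mul (hf.comp (by fun_prop))
  have hgx : XSupp 1 g := fun s x hx => by simp [g, avk_zero' x hx]
  have h1 := hgx.hasDerivAt_integral hgs 0
  have h2 := hasDerivAt_line (lavg_smooth hf) z (0, eb j)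
  have e : (fun h : ℝ => lavg f (z + h • ((0, eb j) : Z))) = fun h => ∫ x, g (h, x) := by
    funext h; simp [lavg, g]
  rw [e] at h2
  rw [dx, h2.unique h1]
  refine integral_congr_ae (Filter.Eventually.of_forall fun y => ?_)
  have h3 := hasDerivAt_line hgs (0, y) (1, 0)
  have h4 := (hasDerivAt_line hf (z.1, z.2 + y) (0, eb j)).const_mul (avk y)
  refine h3.unique ?_
  have e2 : (fun h : ℝ => g ((0, y) + h • ((1, 0) : Z))) =
      fun h : ℝ => avk y * f ((z.1, z.2 + y) + h • ((0, eb j) : Z)) := by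
    funext h; simp [g, add_right_comm]
  rw [e2]
  exact h4

lemma abs_integral_mul_le {k f : E3 → ℝ} {L : ℝ≥0} {V 𝓔 : ℝ} (hV : 0 ≤ V) (h𝓔 : 0 ≤ 𝓔) {A : Set E3}
    (hA : MeasurableSet A) (hAV : volume A ≤ ENNReal.ofReal V) (hk : ∀ y, |k y| ≤ L)
    (hkA : ∀ y ∉ A, k y = 0) (hf : ∫⁻ y, ENNReal.ofReal (f y ^ 2) ≤ ENNReal.ofReal 𝓔) :
    |∫ y, k y * f y| ≤ L * (V + 𝓔) := by
  rw [← Real.norm_eq_abs]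
  refine (norm_integral_le_lintegral_norm _).trans
    (ENNReal.toReal_le_of_le_ofReal (by positivity) ?_)
  calc _ ≤ ∫⁻ y, L * (A.indicator 1 y + ENNReal.ofReal (f y ^ 2)) := by
        refine lintegral_mono fun y => ?_
        by_cases hy : y ∈ A
        · rw [indicator_of_mem hy, Pi.one_apply, ← ENNReal.ofReal_one,
            ← ENNReal.ofReal_add zero_le_one (sq_nonneg _), ← ENNReal.ofReal_coe_nnreal,
            ← ENNReal.ofReal_mul L.coe_nonneg]
          refine ENNReal.ofReal_le_ofReal ?_
          rw [norm_mul, Real.norm_eq_abs, Real.norm_eq_abs]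
          refine mul_le_mul (hk y) ?_ (abs_nonneg _) L.coe_nonneg
          nlinarith [sq_nonneg (|f y| - 1), sq_abs (f y)]
        · simp [hkA y hy]
    _ = L * (volume A + ∫⁻ y, ENNReal.ofReal (f y ^ 2)) := by
        rw [lintegral_const_mul' _ _ ENNReal.coe_ne_top,
          lintegral_add_left (measurable_one.indicator hA), lintegral_indicator_one hA]
    _ ≤ L * (ENNReal.ofReal V + ENNReal.ofReal 𝓔) :=
        mul_le_mul_right (add_le_add hAV hf) _
    _ = _ := by
        rw [← ENNReal.ofReal_add hV h𝓔, ← ENNReal.ofReal_coe_nnreal,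
          ← ENNReal.ofReal_mul L.coe_nonneg]

/-- The field driving the moving frames, with time reversed. -/
def drift (u : Fin 3 → Z → ℝ) (z : Z) : E3 :=
  WithLp.toLp 2 fun i => -lavg (u i) (-z.1, z.2)

lemma drift_smooth {u : Fin 3 → Z → ℝ} (hu : ∀ i, Sm (u i)) : Sm (drift u) := by
  rw [contDiff_euclidean]
  exact fun i => ((lavg_smooth (hu i)).comp (by fun_prop : Sm fun z : Z => ((-z.1, z.2) : Z))).neg

lemma drift_div {u : Fin 3 → Z → ℝ} (hu : ∀ i, Sm (u i))
    (hdiv : ∀ s ∈ Icc (-1 : ℝ) 0, ∀ x, ∑ i, dx i (u i) (s, x) = 0) (s : ℝ) (hs : s ∈ Icc (0 : ℝ) 1)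
    (x : E3) : ∑ i, fderiv ℝ (fun y => drift u (s, y)) x (eb i) i = 0 := by
  have e : ∀ i, fderiv ℝ (fun y => drift u (s, y)) x (eb i) i = -lavg (dx i (u i)) (-s, x) := by
    intro i
    have hd : DifferentiableAt ℝ (fun y => drift u (s, y)) x :=
      (((drift_smooth hu).comp (by fun_prop : Sm fun y : E3 => ((s, y) : Z))).differentiable
        (by simp)) x
    have h1 : HasFDerivAt (fun y => drift u (s, y) i) ((EuclideanSpace.proj i : E3 →L[ℝ] ℝ).comp
        (fderiv ℝ (fun y => drift u (s, y)) x)) x :=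
      (EuclideanSpace.proj i : E3 →L[ℝ] ℝ).hasFDerivAt.comp x hd.hasFDerivAt
    have h2 : dv (eb i) (fun y => -lavg (u i) (-s, y)) x = -lavg (dx i (u i)) (-s, x) := by
      rw [dv_neg, dx_slice (lavg_smooth (hu i)), dx_lavg (hu i)]
    rw [← h2]
    unfold dv
    have h3 : (fun y => -lavg (u i) (-s, y)) = fun y => drift u (s, y) i := rfl
    rw [h3, h1.fderiv]
    rfl
  have hintg : ∀ i, Integrable fun y => avk y * dx i (u i) (-s, x + y) := fun i =>
    integrable_of_zero (R := 1) (by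
      have := avk_smooth.continuous
      have := (dv_smooth ((0, eb i) : Z) (hu i)).continuous
      fun_prop) (fun y hy => by rw [avk_zero' y hy, zero_mul])
  simp_rw [e, Finset.sum_neg_distrib, lavg]
  rw [← integral_finsetSum _ fun i _ => hintg i]
  simp_rw [← Finset.mul_sum, hdiv (-s) ⟨by linarith [hs.2], by linarith [hs.1]⟩]
  simp

lemma norm_toLp_le {w : Fin 3 → ℝ} {a : ℝ} (h : ∀ i, |w i| ≤ a) :
    ‖(WithLp.toLp 2 w : E3)‖ ≤ 3 * a := by
  have ha : 0 ≤ a := (abs_nonneg _).trans (h 0)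
  refine le_of_sq_le_sq ?_ (by positivity)
  rw [norm_sq_eq_sum, Fin.sum_univ_three]
  have := fun i => sq_le_sq' (abs_le.1 (h i)).1 (abs_le.1 (h i)).2
  have h0 := this 0
  have h1 := this 1
  have h2 := this 2
  simp only at h0 h1 h2 ⊢
  nlinarith

lemma drift_bounds {u : Fin 3 → Z → ℝ} (hu : ∀ i, Sm (u i)) {𝓔 : ℝ} (h𝓔 : 0 ≤ 𝓔)
    (hE : ∀ s, ∫⁻ y, ENNReal.ofReal (S2 u (s, y)) ≤ ENNReal.ofReal 𝓔) :
    ∃ B K : ℝ≥0, (∀ z, ‖drift u z‖ ≤ B) ∧ ∀ s, LipschitzWith K fun x => drift u (s, x) := by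
  obtain ⟨M, hM0, hM⟩ := avk_bdd
  obtain ⟨L, hL⟩ := avk_smooth.lipschitzWith_of_hasCompactSupport
    (hasCompactSupport_of_zero avk_zero') (by simp)
  set V : ℝ := (volume (closedBall (0 : E3) 1)).toReal
  have hV0 : 0 ≤ V := ENNReal.toReal_nonneg
  have hV : ∀ x : E3, volume (closedBall x 1) = ENNReal.ofReal V := fun x => by
    rw [Measure.addHaar_closedBall_center, ENNReal.ofReal_toReal measure_closedBall_lt_top.ne]
  have hsq : ∀ s i, ∫⁻ y, ENNReal.ofReal (u i (s, y) ^ 2) ≤ ENNReal.ofReal 𝓔 := fun s i =>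
    (lintegral_mono fun y => ENNReal.ofReal_le_ofReal (sq_le_S2 u i _)).trans (hE s)
  have hsh : ∀ s x i, lavg (u i) (s, x) = ∫ y, avk (y - x) * u i (s, y) := fun s x i => by
    rw [← integral_add_right_eq_self _ x, lavg]
    simp [add_comm]
  have hz : ∀ x y : E3, y ∉ closedBall x 1 → avk (y - x) = 0 := fun x y hy =>
    avk_zero' _ (by simpa [dist_eq_norm] using hy)
  refine ⟨3 * (M.toNNReal * (V + 𝓔).toNNReal), 3 * (L * (V + V + 𝓔).toNNReal), fun z => ?_,
    fun s => LipschitzWith.of_dist_le_mul fun x x' => ?_⟩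
  · push_cast
    rw [Real.coe_toNNReal _ hM0.le, Real.coe_toNNReal _ (by positivity)]
    refine norm_toLp_le fun i => ?_
    rw [abs_neg, hsh, ← Real.coe_toNNReal _ hM0.le]
    refine abs_integral_mul_le hV0 h𝓔 measurableSet_closedBall (hV z.2).le (fun y => ?_) (hz z.2)
      (hsq _ i)
    rw [abs_of_nonneg (avk_nonneg _), Real.coe_toNNReal _ hM0.le]
    exact hM _
  · push_cast
    rw [Real.coe_toNNReal _ (by positivity), dist_eq_norm, dist_eq_norm, mul_assoc]
    refine norm_toLp_le (w := fun i => -lavg (u i) (-s, x) - -lavg (u i) (-s, x')) fun i => ?_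
    have hintg : ∀ x : E3, Integrable fun y => avk (y - x) * u i (-s, y) := fun x => by
      refine integrable_of_zero (R := ‖x‖ + 1) ?_ fun y hy => ?_
      · have := avk_smooth.continuous
        have := (hu i).continuous
        fun_prop
      · rw [avk_zero' _ (by linarith [norm_sub_norm_le y x]), zero_mul]
    rw [neg_sub_neg, hsh, hsh, ← integral_sub (hintg _) (hintg _)]
    simp_rw [← sub_mul]
    have := abs_integral_mul_le (k := fun y => avk (y - x') - avk (y - x)) (f := fun y => u i (-s, y))
      (L := L * ‖x - x'‖₊) (add_nonneg hV0 hV0) h𝓔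
      (A := closedBall x 1 ∪ closedBall x' 1) (measurableSet_closedBall.union
      measurableSet_closedBall) ((measure_union_le _ _).trans (by
        rw [hV, hV, ENNReal.ofReal_add hV0 hV0])) (fun y => ?_) (fun y hy => ?_) (hsq _ i)
    · push_cast at this
      refine this.trans (le_of_eq ?_)
      ring
    · have := hL.dist_le_mul (y - x') (y - x)
      rw [Real.dist_eq, dist_eq_norm, sub_sub_sub_cancel_left] at this
      simpa using this
    · rw [mem_union, not_or] at hy
      simp only [hz _ _ hy.1, hz _ _ hy.2, sub_self]

/-! ### Moving frames -/

/-- Change to a frame following the path `X`. -/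
def fr (X : ℝ → E3) (f : Z → ℝ) (z : Z) : ℝ := f (z.1, X z.1 + z.2)

section
variable {X : ℝ → E3}

lemma fr_smooth (hX : Sm X) {f : Z → ℝ} (hf : Sm f) : Sm (fr X f) :=
  hf.comp (contDiff_fst.prodMk ((hX.comp contDiff_fst).add contDiff_snd))

lemma dx_fr (hX : Sm X) {f : Z → ℝ} (hf : Sm f) (j : Fin 3) : dx j (fr X f) = fr X (dx j f) := by
  funext z
  refine (hasDerivAt_line (fr_smooth hX hf) z (0, eb j)).unique ?_
  have e : (fun h : ℝ => fr X f (z + h • ((0, eb j) : Z))) =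
      fun h : ℝ => f ((z.1, X z.1 + z.2) + h • ((0, eb j) : Z)) := by
    funext h; simp [fr, add_assoc]
  rw [e]
  exact hasDerivAt_line hf _ _

lemma dl_fr (hX : Sm X) {f : Z → ℝ} (hf : Sm f) : ∀ l, dl l (fr X f) = fr X (dl l f)
  | [] => rfl
  | j :: l => by
      change dx j (dl l (fr X f)) = _
      rw [dl_fr hX hf l, dx_fr hX (dl_smooth hf l)]
      rfl

lemma dt_fr (hX : Sm X) {f : Z → ℝ} (hf : Sm f) (z : Z) :
    dt (fr X f) z = fr X (dt f) z + ∑ j, deriv X z.1 j * fr X (dx j f) z := by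
  have hXd : HasDerivAt X (deriv X z.1) z.1 := (hX.differentiable (by simp) z.1).hasDerivAt
  have h1 : HasDerivAt (fun s : ℝ => (s, X s + z.2)) (1, deriv X z.1) z.1 :=
    (hasDerivAt_id z.1).prodMk (hXd.add_const z.2)
  have h2 : HasDerivAt (fun s : ℝ => f (s, X s + z.2)) _ z.1 :=
    (hf.diff (z.1, X z.1 + z.2)).hasFDerivAt.comp_hasDerivAt z.1 h1
  refine ((hasDerivAt_slice (fr_smooth hX hf) z.1 z.2).unique h2).trans ?_
  have e : ((1, deriv X z.1) : Z) = (1, 0) + ∑ j, deriv X z.1 j • ((0, eb j) : Z) := by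
    have := E3_decomp (deriv X z.1)
    simp only [Prod.smul_mk, smul_zero]
    rw [Prod.ext_iff]
    simp only [Prod.fst_add, Prod.fst_sum, Prod.snd_add, Prod.snd_sum]
    refine ⟨by simp, ?_⟩
    simpa using this
  rw [e, map_add, map_sum]
  simp_rw [map_smul]
  rfl

end

/-- The velocity in the frame following `X`. -/
def frv (X : ℝ → E3) (u : Fin 3 → Z → ℝ) (i : Fin 3) (z : Z) : ℝ := fr X (u i) z - deriv X z.1 i

section
variable {X : ℝ → E3} {u : Fin 3 → Z → ℝ}

lemma coord_deriv_smooth (hX : Sm X) (i : Fin 3) : Sm fun s => deriv X s i :=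
  (contDiff_euclidean.1 ((contDiff_infty_iff_deriv (𝕜 := ℝ)).1 hX).2) i

lemma dl_frv (hX : Sm X) (hu : ∀ i, Sm (u i)) (i : Fin 3) {l : List (Fin 3)} (hl : l ≠ []) :
    dl l (frv X u i) = fr X (dl l (u i)) := by
  have hs : Sm fun z : Z => deriv X z.1 i := (coord_deriv_smooth hX i).comp contDiff_fst
  have h0 : ∀ l : List (Fin 3), l ≠ [] → dl l (fun z : Z => deriv X z.1 i) = fun _ => 0 := by
    intro l hl
    induction l with
    | nil => exact absurd rfl hl
    | cons j l ih =>
      funext z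
      change dx j (dl l _) z = 0
      rcases eq_or_ne l [] with rfl | h
      · refine (hasDerivAt_line hs z (0, eb j)).unique ?_
        simpa using hasDerivAt_const (0 : ℝ) (deriv X z.1 i)
      · rw [ih h]; exact dv_const _ _ _
  have := dl_sub (fr_smooth hX (hu i)) hs l
  rw [h0 l hl, dl_fr hX (hu i)] at this
  simp only [sub_zero] at this
  exact this

lemma G2_frv (hX : Sm X) (hu : ∀ i, Sm (u i)) (z : Z) : G2 (frv X u) z = G2 u (z.1, X z.1 + z.2) := by
  have e : ∀ i j, dx j (frv X u i) = fr X (dx j (u i)) := fun i j =>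
    dl_frv hX hu i (l := [j]) (by simp)
  simp_rw [G2, e]; rfl

lemma frame_csol (hX : Sm X) (hu : ∀ i, Sm (u i)) {P : Z → ℝ} (hP : Sm P)
    (heq : ∀ s ∈ Icc (-1 : ℝ) 0, ∀ x i, dt (u i) (s, x) + ∑ j, u j (s, x) * dx j (u i) (s, x)
      + dx i P (s, x) - lap (u i) (s, x) = 0)
    (hdiv : ∀ s ∈ Icc (-1 : ℝ) 0, ∀ x, ∑ i, dx i (u i) (s, x) = 0)
    (hpres : ∀ᵐ s, s ∈ Icc (-1 : ℝ) 0 → ∀ x,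
      P (s, x) = (1 / (4 * Real.pi)) * ∫ y, gp u (s, y) / ‖x - y‖)
    (hfin : ∀ᵐ s, s ∈ Icc (-1 : ℝ) 0 → ∫⁻ y, ENNReal.ofReal (G2 u (s, y)) < ⊤)
    (hXu : ∀ s ∈ Icc (-1 : ℝ) 0, ∀ i, deriv X s i = lavg (u i) (s, X s)) :
    CSol (frv X u) (fr X P) (fun i s => deriv (fun s => deriv X s i) s) := by
  have hs : ∀ i, Sm fun z : Z => deriv X z.1 i := fun i =>
    (coord_deriv_smooth hX i).comp contDiff_fst
  have e : ∀ i j, dx j (frv X u i) = fr X (dx j (u i)) := fun i j =>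
    dl_frv hX hu i (l := [j]) (by simp)
  have el : ∀ i, lap (frv X u i) = fr X (lap (u i)) := fun i => by
    funext z
    simp_rw [lap, e, dx_fr hX (dv_smooth _ (hu _))]; rfl
  refine ⟨fun i => (fr_smooth hX (hu i)).sub (hs i), fr_smooth hX hP, fun s hs' x i => ?_,
    fun s hs' x => ?_, fun s hs' i => ?_, ?_, ?_⟩
  · have h1 : dt (frv X u i) (s, x) = dt (fr X (u i)) (s, x) -
        deriv (fun s => deriv X s i) s := by
      refine (dv_sub _ (fr_smooth hX (hu i)) (hs i) _).trans ?_
      congr 1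
      refine (hasDerivAt_slice (hs i) s x).unique ?_
      exact (((coord_deriv_smooth hX i).differentiable (by simp)) s).hasDerivAt
    rw [h1, dt_fr hX (hu i), el, dx_fr hX hP]
    simp_rw [e, frv, sub_mul, Finset.sum_sub_distrib]
    have := heq s hs' (X s + x) i
    simp only [fr] at this ⊢
    linarith
  · simp_rw [e]; exact hdiv s hs' _
  · have hc := avk_smooth.continuous
    have hc2 : Continuous fun x => u i (s, X s + x) := (hu i).continuous.comp (by fun_prop)
    have e1 : ∀ x, avk x * frv X u i (s, x) = avk x * u i (s, X s + x) - avk x * deriv X s i :=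
      fun x => by simp only [frv, fr]; ring
    simp_rw [e1]
    rw [integral_sub, integral_mul_const, avk_integral, one_mul, hXu s hs' i, lavg, sub_self]
    · exact integrable_of_zero (R := 1) (by fun_prop) fun y hy => by rw [avk_zero' y hy, zero_mul]
    · exact integrable_of_zero (R := 1) (by fun_prop) fun y hy => by rw [avk_zero' y hy, zero_mul]
  · filter_upwards [hpres] with s h hs' x
    rw [fr, h hs', ← integral_add_left_eq_self _ (X s)]
    simp_rw [gp, e, add_sub_add_left_eq_sub]
    rfl
  · filter_upwards [hfin] with s h hs'
    simp_rw [G2_frv hX hu]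
    rw [lintegral_add_left_eq_self (fun y => ENNReal.ofReal (G2 u (s, y)))]
    exact h hs'

end

/-! ### The exceptional set at unit scale -/

/-- Smooth solutions on `[-1,0] × ℝ³` with bounded energy. -/
structure USol (u : Fin 3 → Z → ℝ) (P : Z → ℝ) : Prop where
  sm : ∀ i, Sm (u i)
  smP : Sm P
  eq : ∀ s ∈ Icc (-1 : ℝ) 0, ∀ x i, dt (u i) (s, x) + ∑ j, u j (s, x) * dx j (u i) (s, x)
    + dx i P (s, x) - lap (u i) (s, x) = 0
  div : ∀ s ∈ Icc (-1 : ℝ) 0, ∀ x, ∑ i, dx i (u i) (s, x) = 0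
  pres : ∀ᵐ s, s ∈ Icc (-1 : ℝ) 0 → ∀ x, P (s, x) = (1 / (4 * Real.pi)) * ∫ y, gp u (s, y) / ‖x - y‖
  fin : ∀ᵐ s, s ∈ Icc (-1 : ℝ) 0 → ∫⁻ y, ENNReal.ofReal (G2 u (s, y)) < ⊤
  energy : ∃ 𝓔 : ℝ, 0 ≤ 𝓔 ∧ ∀ s, ∫⁻ y, ENNReal.ofReal (S2 u (s, y)) ≤ ENNReal.ofReal 𝓔

/-- Total dissipation on `[-1,0]`. -/
def diss (u : Fin 3 → Z → ℝ) : ℝ≥0∞ :=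
  ∫⁻ s in Icc (-1 : ℝ) 0, ∫⁻ y, ENNReal.ofReal (G2 u (s, y))

/-- A weight decaying slightly faster than `wt`. -/
def wk (κ : ℝ) (y : E3) : ℝ := (1 + ‖y‖) ^ (-(3 + κ))

lemma wk_continuous (κ : ℝ) : Continuous (wk κ) := by
  unfold wk
  refine (continuous_const.add continuous_norm).rpow_const fun y => Or.inl ?_
  have := norm_nonneg y
  exact (by linarith : (0 : ℝ) < 1 + ‖y‖).ne'

lemma wk_nonneg (κ : ℝ) (y : E3) : 0 ≤ wk κ y :=
  Real.rpow_nonneg (by positivity) _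

lemma wt_le_wk {κ ρ : ℝ} (hκ : 0 < κ) (hρ : 0 < ρ) (y : E3) :
    wt y ≤ (ρ ^ 3)⁻¹ + (1 + ρ) ^ κ * wk κ y := by
  have hy := norm_nonneg y
  have hk := wk_nonneg κ y
  rcases le_total ρ ‖y‖ with h | h
  · have : wt y ≤ (ρ ^ 3)⁻¹ := inv_anti₀ (by positivity) (by gcongr; linarith)
    have h2 : 0 ≤ (1 + ρ) ^ κ * wk κ y := mul_nonneg (Real.rpow_nonneg (by positivity) _) hk
    linarith
  · have e : wt y = (1 + ‖y‖) ^ κ * wk κ y := by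
      rw [wt, wk, ← Real.rpow_add (by positivity), ← Real.rpow_natCast, ← Real.rpow_neg (by positivity)]
      congr 1
      push_cast
      ring
    rw [e]
    have h1 : (1 + ‖y‖) ^ κ ≤ (1 + ρ) ^ κ := Real.rpow_le_rpow (by positivity) (by linarith) hκ.le
    have h2 : 0 ≤ (ρ ^ 3)⁻¹ := by positivity
    nlinarith [mul_le_mul_of_nonneg_right h1 hk]

lemma wk_lintegral {κ : ℝ} (hκ : 0 < κ) : ∫⁻ y, ENNReal.ofReal (wk κ y) < ⊤ :=
  finite_integral_one_add_norm (μ := (volume : Measure E3)) (by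
    simp only [finrank_euclideanSpace, Fintype.card_fin]; push_cast; linarith)

/-- Every solution has moving frames starting at every point, with volume control. -/
lemma exists_frames {u : Fin 3 → Z → ℝ} {P : Z → ℝ} (h : USol u P) :
    ∃ X : E3 → ℝ → E3, (∀ x, Sm (X x)) ∧ (∀ x, X x 0 = x) ∧
      (∀ x, ∀ s ∈ Icc (-1 : ℝ) 0, ∀ i, deriv (X x) s i = lavg (u i) (s, X x s)) ∧
      (∃ Φ : E3 × ℝ → E3, Continuous Φ ∧ ∀ x, ∀ s ∈ Icc (-1 : ℝ) 0, Φ (x, s) = X x s) ∧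
      ∀ s ∈ Icc (-1 : ℝ) 0, ∀ f : E3 → ℝ≥0∞, Continuous f →
        ∫⁻ x, f (X x s) ≤ 2 * ∫⁻ x, f x := by
  obtain ⟨𝓔, h𝓔, hE⟩ := h.energy
  obtain ⟨B, K, hB, hK⟩ := drift_bounds h.sm h𝓔 hE
  obtain ⟨Y, hY, hYc⟩ := flow_exists (drift_smooth h.sm) hB hK
  have hI : ∀ s ∈ Icc (-1 : ℝ) 0, -s ∈ Icc (0 : ℝ) 1 := fun s hs =>
    ⟨by linarith [hs.2], by linarith [hs.1]⟩
  refine ⟨fun x s => Y x (-s), fun x => (hY.sm x).comp contDiff_neg, fun x => by simp [hY.zero],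
    fun x s hs i => ?_, ⟨fun q => Y q.1 (max 0 (min 1 (-q.2))), ?_, fun x s hs => ?_⟩,
    fun s hs f hf => flow_volume (drift_smooth h.sm) hY hK (drift_div h.sm h.div) (hI s hs) hf⟩
  · have h1 := (hY.eq x (-s) (hI s hs)).scomp s (hasDerivAt_neg s)
    have h2 : deriv (fun s => Y x (-s)) s = (-1 : ℝ) • drift u (-s, Y x (-s)) := h1.deriv
    rw [h2]
    simp [drift]
  · have hm : ∀ s : ℝ, max 0 (min 1 (-s)) ∈ Icc (0 : ℝ) 1 := fun s =>
      ⟨le_max_left _ _, max_le zero_le_one (min_le_left _ _)⟩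
    rw [continuous_iff_continuousAt]
    intro q
    rw [ContinuousAt, tendsto_iff_norm_sub_tendsto_zero]
    refine squeeze_zero (fun _ => norm_nonneg _) (fun q' => hYc q'.1 q.1 _ (hm q'.2) _ (hm q.2)) ?_
    have hc : Continuous fun q' : E3 × ℝ => Real.exp K * ‖q'.1 - q.1‖ +
        B * |max 0 (min 1 (-q'.2)) - max 0 (min 1 (-q.2))| := by fun_prop
    simpa using hc.tendsto q
  · have := hI s hs
    simp only [min_eq_right this.2, max_eq_right this.1]

lemma unit_scale {n : ℕ} (hn : 1 ≤ n) : ∃ η C : ℝ, 0 < η ∧ 0 < C ∧ ∀ κ : ℝ, 0 < κ →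
    ∃ K : ℝ, 0 ≤ K ∧ ∀ u P, USol u P → ∀ ρ : ℝ, 0 < ρ →
      ENNReal.ofReal (ρ ^ 3)⁻¹ * diss u ≤ ENNReal.ofReal (η / 2) →
      volume {x | ∃ i l, l.length = n ∧ C < |dl l (u i) (0, x)|} ≤
        ENNReal.ofReal (K * (1 + ρ) ^ κ) * diss u := by
  obtain ⟨η, C, hη, hC, hbd⟩ := derivative_bound n
  refine ⟨η, C, hη, hC, fun κ hκ => ?_⟩
  set I : ℝ := (∫⁻ y, ENNReal.ofReal (wk κ y)).toReal
  have hI0 : 0 ≤ I := ENNReal.toReal_nonneg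
  have hI : ∫⁻ y, ENNReal.ofReal (wk κ y) = ENNReal.ofReal I :=
    (ENNReal.ofReal_toReal (wk_lintegral hκ).ne).symm
  refine ⟨4 * I / η, by positivity, fun u P h ρ hρ hsmall => ?_⟩
  obtain ⟨X, hX, hX0, hXd, ⟨Φ, hΦ, hΦX⟩, hvol⟩ := exists_frames h
  have hG : Continuous (G2 u) := (G2_smooth h.sm).continuous
  obtain ⟨H, hH⟩ : ∃ H : E3 → ℝ → E3 → ℝ≥0∞, ∀ x s y, H x s y =
    ENNReal.ofReal (G2 u (s, Φ (x, s) + y)) * ENNReal.ofReal (wk κ y) := ⟨_, fun _ _ _ => rfl⟩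
  have hHm : Measurable fun q : (E3 × ℝ) × E3 => H q.1.1 q.1.2 q.2 := by
    have := wk_continuous κ
    simp_rw [hH]
    exact ((by fun_prop : Continuous fun q : (E3 × ℝ) × E3 =>
      G2 u (q.1.2, Φ q.1 + q.2)).measurable.ennreal_ofReal).mul
        (by fun_prop : Continuous fun q : (E3 × ℝ) × E3 => wk κ q.2).measurable.ennreal_ofReal
  have hHm2 : Measurable fun q : E3 × ℝ => ∫⁻ y, H q.1 q.2 y := hHm.lintegral_prod_right'
  set W : E3 → ℝ≥0∞ := fun x => ∫⁻ s in Icc (-1 : ℝ) 0, ∫⁻ y, H x s y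
  have hWm : Measurable W := hHm2.lintegral_prod_right'
  have hρκ : 0 ≤ (1 + ρ) ^ κ := Real.rpow_nonneg (by positivity) _
  have hGs : ∀ s a, ∫⁻ y, ENNReal.ofReal (G2 u (s, a + y)) = ∫⁻ y, ENNReal.ofReal (G2 u (s, y)) :=
    fun s a => lintegral_add_left_eq_self (fun y => ENNReal.ofReal (G2 u (s, y))) a
  have hpiv : ∀ x, pivot (frv (X x) u) ≤
      ENNReal.ofReal (η / 2) + ENNReal.ofReal ((1 + ρ) ^ κ) * W x := by
    intro x
    refine le_trans ?_ (add_le_add_left hsmall _)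
    rw [diss, ← lintegral_const_mul' _ _ ENNReal.ofReal_ne_top,
      ← lintegral_const_mul' _ _ ENNReal.ofReal_ne_top, ← lintegral_add_right]
    · refine setLIntegral_mono' measurableSet_Icc fun s hs => ?_
      rw [← hGs s (X x s), ← lintegral_const_mul' _ _ ENNReal.ofReal_ne_top,
        ← lintegral_const_mul' _ _ ENNReal.ofReal_ne_top, ← lintegral_add_left]
      · refine lintegral_mono fun y => ?_
        rw [hH, hΦX x s hs, mul_left_comm, ← ENNReal.ofReal_mul hρκ, mul_comm (ENNReal.ofReal (ρ ^ 3)⁻¹),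
          ← mul_add, ← ENNReal.ofReal_add (by positivity)
          (mul_nonneg hρκ (wk_nonneg κ y)), G2_frv (hX x) h.sm,
          ENNReal.ofReal_mul (G2_nonneg _ _)]
        exact mul_le_mul_right (ENNReal.ofReal_le_ofReal (wt_le_wk hκ hρ y)) _
      · exact ((by fun_prop : Continuous fun y =>
          G2 u (s, X x s + y)).measurable.ennreal_ofReal).const_mul _
    · exact (hHm2.comp (measurable_prodMk_left (x := x))).const_mul _
  have hsub : {x | ∃ i l, l.length = n ∧ C < |dl l (u i) (0, x)|} ⊆
      {x | ENNReal.ofReal (η / 2) ≤ ENNReal.ofReal ((1 + ρ) ^ κ) * W x} := by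
    rintro x ⟨i, l, hl, hlt⟩
    by_contra hcon
    rw [mem_ofPred_eq, not_le] at hcon
    have hle : pivot (frv (X x) u) ≤ ENNReal.ofReal η := by
      refine (hpiv x).trans ((add_le_add_right hcon.le _).trans (le_of_eq ?_))
      rw [← ENNReal.ofReal_add (by positivity) (by positivity), add_halves]
    have := hbd _ _ _ (frame_csol (hX x) h.sm h.smP h.eq h.div h.pres h.fin (hXd x)) hle i l hl.le
    rw [dl_frv (hX x) h.sm i (by rintro rfl; simp at hl; omega)] at this
    simp only [fr, hX0, add_zero] at this
    linarith
  have hWi : ∫⁻ x, W x ≤ ENNReal.ofReal (2 * I) * diss u := by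
    rw [lintegral_lintegral_swap hHm2.aemeasurable, diss,
      ← lintegral_const_mul' _ _ ENNReal.ofReal_ne_top]
    refine setLIntegral_mono' measurableSet_Icc fun s hs => ?_
    have hms : Measurable (Function.uncurry fun x y => H x s y) := hHm.comp
      (by fun_prop : Measurable fun q : E3 × E3 => (((q.1, s), q.2) : (E3 × ℝ) × E3))
    rw [lintegral_lintegral_swap hms.aemeasurable]
    calc _ ≤ ∫⁻ y, (2 * ∫⁻ z, ENNReal.ofReal (G2 u (s, z))) * ENNReal.ofReal (wk κ y) := by
          refine lintegral_mono fun y => ?_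
          simp_rw [hH]
          rw [lintegral_mul_const' _ _ ENNReal.ofReal_ne_top]
          refine mul_le_mul_left ?_ _
          simp_rw [hΦX _ s hs]
          refine (hvol s hs (fun a => ENNReal.ofReal (G2 u (s, a + y)))
            (ENNReal.continuous_ofReal.comp (by fun_prop))).trans ?_
          rw [lintegral_add_right_eq_self (fun y => ENNReal.ofReal (G2 u (s, y)))]
      _ = _ := by
          rw [lintegral_const_mul _ (wk_continuous κ).measurable.ennreal_ofReal, hI,
            ENNReal.ofReal_mul zero_le_two, ENNReal.ofReal_ofNat]
          ring
  refine (measure_mono hsub).trans ((meas_ge_le_lintegral_div (hWm.const_mul _).aemeasurable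
    (by simpa using hη) ENNReal.ofReal_ne_top).trans ?_)
  rw [lintegral_const_mul _ hWm, ENNReal.div_le_iff (by simpa using hη) ENNReal.ofReal_ne_top]
  refine (mul_le_mul_right hWi _).trans (le_of_eq ?_)
  rw [mul_right_comm, ← mul_assoc, ← ENNReal.ofReal_mul hρκ, ← ENNReal.ofReal_mul (by positivity)]
  congr 2
  field_simp
  ring

/-! ### Norms of iterated derivatives -/

section

variable {V F : Type*} [NormedAddCommGroup V] [NormedSpace ℝ V] [NormedAddCommGroup F]
  [NormedSpace ℝ F]

lemma norm_iteratedFDeriv_sum_clm {g : Fin 3 → V → ℝ} (hg : ∀ j, Sm (g j)) (L : Fin 3 → ℝ →L[ℝ] F)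
    (hL : ∀ j, ‖L j‖ ≤ 1) (n : ℕ) (x : V) {a : ℝ} (h : ∀ j, ‖iteratedFDeriv ℝ n (g j) x‖ ≤ a) :
    ‖iteratedFDeriv ℝ n (fun y => ∑ j, L j (g j y)) x‖ ≤ 3 * a := by
  have hn : (n : WithTop ℕ∞) ≤ ((⊤ : ℕ∞) : WithTop ℕ∞) := by exact_mod_cast le_top
  have hc : ∀ j, ContDiff ℝ n (L j ∘ g j) := fun j => ((L j).contDiff.comp (hg j)).of_le hn
  have e : (fun y => ∑ j, L j (g j y)) = fun y => ∑ j, (L j ∘ g j) y := rfl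
  rw [e, iteratedFDeriv_fun_sum_apply fun j _ => (hc j).contDiffAt]
  refine (norm_sum_le _ _).trans ?_
  calc _ ≤ ∑ j : Fin 3, a := by
        refine Finset.sum_le_sum fun j _ =>
          ((L j).norm_iteratedFDeriv_comp_left (hg j).contDiffAt hn).trans ?_
        calc _ ≤ 1 * a := by gcongr; exacts [hL j, h j]
          _ = a := one_mul a
    _ = 3 * a := by simp

end

lemma norm_iteratedFDeriv_slice {f : Z → ℝ} (hf : Sm f) (t : ℝ) (x : E3) (n : ℕ) {a : ℝ}
    (h : ∀ l : List (Fin 3), l.length = n → |dl l f (t, x)| ≤ a) :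
    ‖iteratedFDeriv ℝ n (fun y => f (t, y)) x‖ ≤ 3 ^ n * a := by
  induction n generalizing f with
  | zero =>
    rw [norm_iteratedFDeriv_zero, pow_zero, one_mul]
    exact h [] rfl
  | succ n ih =>
    rw [← norm_iteratedFDeriv_fderiv]
    have e : fderiv ℝ (fun y => f (t, y)) = fun y => ∑ j, ContinuousLinearMap.smulRight
        (1 : ℝ →L[ℝ] ℝ) (EuclideanSpace.proj j : E3 →L[ℝ] ℝ) (dx j f (t, y)) := by
      funext y
      ext w
      conv_lhs => rw [E3_decomp w]
      rw [map_sum, _root_.sum_apply]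
      refine Finset.sum_congr rfl fun j _ => ?_
      rw [map_smul, ← dx_slice hf]
      simp [dv, mul_comm]
    rw [e, pow_succ', mul_assoc]
    refine norm_iteratedFDeriv_sum_clm (fun j => slice_smooth (dv_smooth _ hf) t) _ (fun j => ?_) n x
      fun j => ih (dv_smooth _ hf) fun l hl => ?_
    · rw [ContinuousLinearMap.norm_smulRight_apply, norm_one, one_mul]
      exact ContinuousLinearMap.opNorm_le_bound _ zero_le_one fun w => by
        rw [one_mul]; exact abs_coord_le w j
    · rw [← dl_cons' hf]
      exact h _ (by simp [hl])

lemma norm_iteratedFDeriv_vec {v : Fin 3 → Z → ℝ} (hv : ∀ i, Sm (v i)) {f : E3 → E3} (t : ℝ)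
    (hf : ∀ y i, f y i = v i (t, y)) (x : E3) (n : ℕ) {a : ℝ}
    (h : ∀ i (l : List (Fin 3)), l.length = n → |dl l (v i) (t, x)| ≤ a) :
    ‖iteratedFDeriv ℝ n f x‖ ≤ 3 ^ (n + 1) * a := by
  have e : f = fun y => ∑ j, ContinuousLinearMap.smulRight (1 : ℝ →L[ℝ] ℝ) (eb j) (v j (t, y)) := by
    funext y
    rw [E3_decomp (f y)]
    exact Finset.sum_congr rfl fun j _ => by rw [hf]; simp
  rw [e, pow_succ', mul_assoc]
  exact norm_iteratedFDeriv_sum_clm (fun j => slice_smooth (hv j) t) _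
    (fun j => by simp) n x fun j => norm_iteratedFDeriv_slice (hv j) t x n (h j)

/-! ### Rescaling to unit scale -/

/-- Spatial integral of `|∇v|²`. -/
def gl (v : Fin 3 → Z → ℝ) (s : ℝ) : ℝ≥0∞ := ∫⁻ y, ENNReal.ofReal (G2 v (s, y))

/-- Globally smooth functions solving the Navier–Stokes equations for times in `[a, b]`, with
energy and dissipation bounded by `E ^ 2`. -/
structure GSol (E a b : ℝ) (v : Fin 3 → Z → ℝ) (Q : Z → ℝ) : Prop where
  sm : ∀ i, Sm (v i)
  smP : Sm Q
  eq : ∀ s ∈ Icc a b, ∀ x i, dt (v i) (s, x) + ∑ j, v j (s, x) * dx j (v i) (s, x)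
    + dx i Q (s, x) - lap (v i) (s, x) = 0
  div : ∀ s ∈ Icc a b, ∀ x, ∑ i, dx i (v i) (s, x) = 0
  pres : ∀ s ∈ Icc a b, ∀ x, Q (s, x) = (1 / (4 * Real.pi)) * ∫ y, gp v (s, y) / ‖x - y‖
  energy : ∀ s, ∫⁻ y, ENNReal.ofReal (S2 v (s, y)) ≤ ENNReal.ofReal (E ^ 2)
  diss_le : ∫⁻ s in Icc a b, gl v s ≤ ENNReal.ofReal (E ^ 2)

lemma measurable_gl {v : Fin 3 → Z → ℝ} (hv : ∀ i, Sm (v i)) : Measurable (gl v) :=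
  ((G2_smooth hv).continuous.measurable.ennreal_ofReal).lintegral_prod_right'

lemma lintegral_comp_affine_real {c : ℝ} (hc : 0 < c) (a : ℝ) {G : ℝ → ℝ≥0∞} (hG : Measurable G) :
    ∫⁻ x, G (a + c * x) = ENNReal.ofReal c⁻¹ * ∫⁻ x, G x := by
  have h1 : ∫⁻ x, G (a + c * x) = ∫⁻ y, G (a + y) ∂(Measure.map (fun x : ℝ => c • x) volume) := by
    rw [lintegral_map (by fun_prop) (by fun_prop)]
    rfl
  rw [h1, Measure.map_addHaar_smul _ hc.ne', lintegral_smul_measure, lintegral_add_left_eq_self]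
  simp only [Module.finrank_self, pow_one, smul_eq_mul]
  rw [abs_of_pos (by positivity)]

section
variable {v : Fin 3 → Z → ℝ} {Q : Z → ℝ} {E a b ε t : ℝ}

lemma G2_rsc (hv : ∀ i, Sm (v i)) (r : ℝ) (p z : Z) :
    G2 (rsc r p v) z = r ^ 4 * G2 v (aff r p z) := by
  simp only [G2, dx_rsc hv, Finset.mul_sum]
  exact Finset.sum_congr rfl fun i _ => Finset.sum_congr rfl fun j _ => by ring

lemma gp_rsc (hv : ∀ i, Sm (v i)) (r : ℝ) (p z : Z) :
    gp (rsc r p v) z = r ^ 4 * gp v (aff r p z) := by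
  simp only [gp, dx_rsc hv, Finset.mul_sum]
  exact Finset.sum_congr rfl fun i _ => Finset.sum_congr rfl fun j _ => by ring

lemma gl_rsc (hv : ∀ i, Sm (v i)) (hε : 0 < ε) (s : ℝ) :
    gl (rsc ε (t, 0) v) s = ENNReal.ofReal ε * gl v (t + ε ^ 2 * s) := by
  have hm : Measurable fun y => ENNReal.ofReal (G2 v (t + ε ^ 2 * s, y)) :=
    (slice_smooth (G2_smooth hv) _).continuous.measurable.ennreal_ofReal
  have h := lintegral_comp_affine hε 0 hm
  unfold gl
  simp only [G2_rsc hv, aff]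
  simp_rw [ENNReal.ofReal_mul (by positivity : 0 ≤ ε ^ 4)]
  rw [lintegral_const_mul' _ _ ENNReal.ofReal_ne_top, h, ← mul_assoc,
    ← ENNReal.ofReal_mul (by positivity)]
  congr 2
  field_simp

lemma diss_rsc (hv : ∀ i, Sm (v i)) (hε : 0 < ε) :
    diss (rsc ε (t, 0) v) = ENNReal.ofReal ε * ∫⁻ s in Icc (-1 : ℝ) 0, gl v (t + ε ^ 2 * s) := by
  rw [← lintegral_const_mul' _ _ ENNReal.ofReal_ne_top]
  exact lintegral_congr fun s => gl_rsc hv hε s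

lemma mem_Icc_of_scaled (hb : t ≤ b) (ha : a ≤ t - ε ^ 2) {s : ℝ} (hs : s ∈ Icc (-1 : ℝ) 0) :
    t + ε ^ 2 * s ∈ Icc a b := by
  have := sq_nonneg ε
  constructor <;> nlinarith [hs.1, hs.2]

lemma GSol.diss_rsc_le (h : GSol E a b v Q) (hε : 0 < ε) (hb : t ≤ b) (ha : a ≤ t - ε ^ 2) :
    diss (rsc ε (t, 0) v) ≤ ENNReal.ofReal (ε⁻¹ * E ^ 2) := by
  have hm := (measurable_gl h.sm).indicator (measurableSet_Icc (a := a) (b := b))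
  have h1 := lintegral_comp_affine_real (pow_pos hε 2) t hm
  rw [lintegral_indicator measurableSet_Icc] at h1
  calc _ ≤ ENNReal.ofReal ε * ∫⁻ s, (Icc a b).indicator (gl v) (t + ε ^ 2 * s) := by
        rw [diss_rsc h.sm hε, ← lintegral_indicator measurableSet_Icc]
        gcongr with s
        by_cases hs : s ∈ Icc (-1 : ℝ) 0
        · rw [indicator_of_mem hs, indicator_of_mem (mem_Icc_of_scaled hb ha hs)]
        · rw [indicator_of_notMem hs]; exact zero_le
    _ ≤ ENNReal.ofReal ε * (ENNReal.ofReal (ε ^ 2)⁻¹ * ENNReal.ofReal (E ^ 2)) := by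
        rw [h1]; gcongr; exact h.diss_le
    _ = _ := by
        rw [← mul_assoc, ← ENNReal.ofReal_mul hε.le, ← ENNReal.ofReal_mul (by positivity)]
        congr 2
        field_simp

lemma GSol.usol (h : GSol E a b v Q) (hε : 0 < ε) (hb : t ≤ b) (ha : a ≤ t - ε ^ 2) :
    USol (rsc ε (t, 0) v) (fun z => ε ^ 2 * Q (aff ε (t, 0) z)) := by
  have hm' := fun s hs => mem_Icc_of_scaled (s := s) hb ha hs
  refine ⟨fun i => rsc_smooth h.sm _ _ i, contDiff_const.mul (aff_comp_smooth h.smP _ _),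
    fun s hs x i => ?_, fun s hs x => ?_, .of_forall fun s hs x => ?_, ?_,
    ε⁻¹ * E ^ 2, by positivity, fun s => ?_⟩
  · have := rsc_eq (c := fun _ _ => 0) h.sm h.smP ε (t, 0) (s, x) i
      (by rw [add_zero]; exact h.eq _ (hm' s hs) _ i)
    simpa using this
  · simp only [dx_rsc h.sm, ← Finset.mul_sum]
    rw [show aff ε (t, 0) (s, x) = (t + ε ^ 2 * s, (0 : E3) + ε • x) from rfl,
      h.div _ (hm' s hs), mul_zero]
  · have e : (fun y => gp (rsc ε (t, 0) v) (s, y) / ‖x - y‖) = fun y => ε ^ 5 *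
        (fun w => gp v (t + ε ^ 2 * s, w) / ‖ε • x - w‖) (ε • y) := by
      funext y
      beta_reduce
      rw [gp_rsc h.sm, ← smul_sub, norm_smul, Real.norm_of_nonneg hε.le]
      simp only [aff, zero_add]
      rcases eq_or_ne ‖x - y‖ 0 with h0 | h0
      · simp [h0]
      · field_simp
    rw [e, integral_const_mul, Measure.integral_comp_smul volume
      (fun w => gp v (t + ε ^ 2 * s, w) / ‖ε • x - w‖)]
    simp only [aff, zero_add, finrank_euclideanSpace, Fintype.card_fin, smul_eq_mul]
    rw [h.pres _ (hm' s hs), abs_of_pos (by positivity)]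
    field_simp
  · have h1 := ae_lt_top (μ := volume.restrict (Icc (-1 : ℝ) 0))
      (measurable_gl fun i => rsc_smooth h.sm ε (t, 0) i)
      ((h.diss_rsc_le hε hb ha).trans_lt ENNReal.ofReal_lt_top).ne
    exact (ae_restrict_iff' measurableSet_Icc).1 h1
  · have hm : Measurable fun y => ENNReal.ofReal (S2 v (t + ε ^ 2 * s, y)) :=
      (slice_smooth (S2_smooth h.sm) _).continuous.measurable.ennreal_ofReal
    have h1 := lintegral_comp_affine hε 0 hm
    have e : ∀ y, S2 (rsc ε (t, 0) v) (s, y) = ε ^ 2 * S2 v (t + ε ^ 2 * s, 0 + ε • y) := fun y => by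
      simp only [S2, rsc, aff, Finset.mul_sum, mul_pow]
    simp_rw [e, ENNReal.ofReal_mul (by positivity : 0 ≤ ε ^ 2)]
    rw [lintegral_const_mul' _ _ ENNReal.ofReal_ne_top, h1]
    calc _ ≤ ENNReal.ofReal (ε ^ 2) * (ENNReal.ofReal (ε ^ 3)⁻¹ * ENNReal.ofReal (E ^ 2)) := by
          gcongr; exact h.energy _
      _ = _ := by
          rw [← mul_assoc, ← ENNReal.ofReal_mul (by positivity), ← ENNReal.ofReal_mul (by positivity)]
          congr 2
          field_simp

/-- Points of the time slice `t` where some spatial derivative of order `n` exceeds `c`. -/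
def bad (n : ℕ) (c : ℝ) (v : Fin 3 → Z → ℝ) (t : ℝ) : Set E3 :=
  {x | ∃ i, ∃ l : List (Fin 3), l.length = n ∧ c < |dl l (v i) (t, x)|}

lemma GSol.volume_bad_le (h : GSol E a b v Q) {n : ℕ} {η C K κ R : ℝ} (hε : 0 < ε) (hε1 : ε ≤ 1)
    (hb : t ≤ b) (ha : a ≤ t - ε ^ 2) (hK : 0 ≤ K) (hR : 0 < R)
    (hER : E ^ 2 ≤ η / 2 * R ^ 3)
    (H : ∀ u P, USol u P → ∀ ρ : ℝ, 0 < ρ →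
      ENNReal.ofReal (ρ ^ 3)⁻¹ * diss u ≤ ENNReal.ofReal (η / 2) →
      volume (bad n C u 0) ≤ ENNReal.ofReal (K * (1 + ρ) ^ κ) * diss u) :
    volume (bad n (C * (ε ^ (n + 1))⁻¹) v t) ≤
      ENNReal.ofReal (ε ^ 4 * (K * (1 + R / ε) ^ κ)) *
        ∫⁻ s in Icc (-1 : ℝ) 0, gl v (t + ε ^ 2 * s) := by
  have h1 := H _ _ (h.usol hε hb ha) (R / ε) (by positivity) (by
    calc _ ≤ ENNReal.ofReal ((R / ε) ^ 3)⁻¹ * ENNReal.ofReal (ε⁻¹ * E ^ 2) := by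
          gcongr; exact h.diss_rsc_le hε hb ha
      _ ≤ _ := by
          rw [← ENNReal.ofReal_mul (by positivity)]
          refine ENNReal.ofReal_le_ofReal ?_
          rw [show ((R / ε) ^ 3)⁻¹ * (ε⁻¹ * E ^ 2) = ε ^ 2 * (E ^ 2 / R ^ 3) by field_simp]
          calc _ ≤ 1 * (E ^ 2 / R ^ 3) := by gcongr; exact pow_le_one₀ hε.le hε1
            _ ≤ η / 2 := by rw [one_mul, div_le_iff₀ (by positivity)]; exact hER)
  have e : bad n C (rsc ε (t, 0) v) 0 = (fun x => ε • x) ⁻¹' bad n (C * (ε ^ (n + 1))⁻¹) v t := by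
    ext x
    refine exists_congr fun i => exists_congr fun l => and_congr_right fun hl => ?_
    unfold rsc
    rw [dl_cm (aff_comp_smooth (h.sm i) _ _), dl_aff (h.sm i), hl]
    simp only [aff, mul_zero, add_zero, zero_add]
    rw [← mul_assoc, ← pow_succ', abs_mul, abs_of_pos (pow_pos hε _), ← div_eq_mul_inv,
      div_lt_iff₀' (pow_pos hε _)]
  rw [e, Measure.addHaar_preimage_smul _ hε.ne', finrank_euclideanSpace, Fintype.card_fin,
    abs_of_pos (by positivity), diss_rsc h.sm hε] at h1
  have h2 := mul_le_mul_right h1 (ENNReal.ofReal (ε ^ 3))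
  rw [← mul_assoc, ← ENNReal.ofReal_mul (by positivity), mul_inv_cancel₀ (by positivity),
    ENNReal.ofReal_one, one_mul, ← mul_assoc, ← mul_assoc, ← ENNReal.ofReal_mul (by positivity),
    ← ENNReal.ofReal_mul (by positivity)] at h2
  rwa [show ε ^ 4 * (K * (1 + R / ε) ^ κ) = ε ^ 3 * (K * (1 + R / ε) ^ κ) * ε by ring]

end

/-! ### Summation over dyadic levels -/

lemma setLIntegral_le_tsum_levels {α : Type*} [MeasurableSpace α] {μ : Measure α} {S : Set α}
    (hS : MeasurableSet S) {F : α → ℝ≥0∞} {B : ℕ → Set α} (hB : ∀ k, MeasurableSet (B k))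
    {A : ℕ → ℝ≥0∞} {δ : ℝ≥0∞} (hδ : δ ≠ 0) (hA : ∀ k, δ ≤ A k)
    (h : ∀ k, ∀ x ∈ S, x ∉ B k → F x ≤ A k) :
    ∫⁻ x in S, F x ∂μ ≤ A 0 * μ S + ∑' k, A (k + 1) * μ (B k ∩ S) := by
  have hm : ∀ k, Measurable ((B k).indicator fun _ => A (k + 1)) := fun k =>
    measurable_const.indicator (hB k)
  calc _ ≤ ∫⁻ x in S, (A 0 + ∑' k, (B k).indicator (fun _ => A (k + 1)) x) ∂μ := by
        refine setLIntegral_mono' hS fun x hx => ?_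
        by_cases hx' : ∃ k, x ∉ B k
        · classical
          rcases hk : Nat.find hx' with _ | j
          · exact (h 0 x hx (hk ▸ Nat.find_spec hx')).trans le_self_add
          · have hj : x ∈ B j := by
              have := Nat.find_min hx' (m := j) (by omega)
              simpa using this
            refine (h (j + 1) x hx (hk ▸ Nat.find_spec hx')).trans
              (le_trans ?_ le_add_self)
            calc _ = (B j).indicator (fun _ => A (j + 1)) x := by rw [indicator_of_mem hj]
              _ ≤ _ := ENNReal.le_tsum j
        · push Not at hx'
          have : ∑' k, (B k).indicator (fun _ => A (k + 1)) x = ⊤ := by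
            refine top_le_iff.1 ?_
            rw [← ENNReal.tsum_const_eq_top_of_ne_zero (α := ℕ) hδ]
            refine ENNReal.tsum_le_tsum fun k => ?_
            rw [indicator_of_mem (hx' k)]
            exact hA _
          rw [this, add_top]
          exact le_top
    _ = _ := by
        rw [lintegral_add_left measurable_const, lintegral_tsum fun k => (hm k).aemeasurable, lintegral_const,
          Measure.restrict_apply_univ]
        congr 1
        refine tsum_congr fun k => ?_
        rw [lintegral_indicator_const (hB k), Measure.restrict_apply (hB k)]

section

variable {v : Fin 3 → Z → ℝ} {Q : Z → ℝ} {E a b ε t₀ : ℝ}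

/-- Space-time points where some spatial derivative of order `n` exceeds `c`. -/
def badZ (n : ℕ) (c : ℝ) (v : Fin 3 → Z → ℝ) : Set Z :=
  {q | ∃ i, ∃ l : List (Fin 3), l.length = n ∧ c < |dl l (v i) q|}

lemma isOpen_badZ (hv : ∀ i, Sm (v i)) (n : ℕ) (c : ℝ) : IsOpen (badZ n c v) := by
  have e : badZ n c v = ⋃ i, ⋃ l : {l : List (Fin 3) // l.length = n},
      {q | c < |dl l.1 (v i) q|} := by
    ext q; simp [badZ]
  rw [e]
  exact isOpen_iUnion fun i => isOpen_iUnion fun l =>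
    isOpen_lt continuous_const (dl_smooth (hv i) l.1).continuous.abs

lemma GSol.lintegral_gl_le (h : GSol E a b v Q) (ha : a ≤ t₀ - ε ^ 2) :
    ∫⁻ t in Ioo t₀ b, ∫⁻ s in Icc (-1 : ℝ) 0, gl v (t + ε ^ 2 * s) ≤ ENNReal.ofReal (E ^ 2) := by
  have hm : Measurable (Function.uncurry fun t s : ℝ => gl v (t + ε ^ 2 * s)) :=
    (measurable_gl h.sm).comp (by fun_prop : Measurable fun q : ℝ × ℝ => q.1 + ε ^ 2 * q.2)
  rw [lintegral_lintegral_swap hm.aemeasurable]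
  calc _ ≤ ∫⁻ s in Icc (-1 : ℝ) 0, ENNReal.ofReal (E ^ 2) := by
        refine setLIntegral_mono' measurableSet_Icc fun s hs => ?_
        calc _ ≤ ∫⁻ t, (Icc a b).indicator (gl v) (t + ε ^ 2 * s) := by
              rw [← lintegral_indicator measurableSet_Ioo]
              gcongr with t
              by_cases ht : t ∈ Ioo t₀ b
              · rw [indicator_of_mem ht, indicator_of_mem
                  (mem_Icc_of_scaled ht.2.le (ha.trans (by linarith [ht.1])) hs)]
              · rw [indicator_of_notMem ht]; exact zero_le
          _ = ∫⁻ t in Icc a b, gl v t := by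
              rw [lintegral_add_right_eq_self, lintegral_indicator measurableSet_Icc]
          _ ≤ _ := h.diss_le
    _ = _ := by simp

lemma GSol.volume_badZ_le (h : GSol E a b v Q) {n : ℕ} {η C K κ R : ℝ} (hε : 0 < ε) (hε1 : ε ≤ 1)
    (ha : a ≤ t₀ - ε ^ 2) (hK : 0 ≤ K) (hR : 0 < R) (hκ : 0 < κ) (hER : E ^ 2 ≤ η / 2 * R ^ 3)
    (H : ∀ u P, USol u P → ∀ ρ : ℝ, 0 < ρ →
      ENNReal.ofReal (ρ ^ 3)⁻¹ * diss u ≤ ENNReal.ofReal (η / 2) →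
      volume (bad n C u 0) ≤ ENNReal.ofReal (K * (1 + ρ) ^ κ) * diss u) :
    volume (badZ n (C * (ε ^ (n + 1))⁻¹) v ∩ Ioo t₀ b ×ˢ univ) ≤
      ENNReal.ofReal (ε ^ (4 - κ) * (K * ((1 + R) ^ κ * E ^ 2))) := by
  have hm := ((isOpen_badZ h.sm n (C * (ε ^ (n + 1))⁻¹)).measurableSet).inter
    (measurableSet_Ioo (a := t₀) (b := b) |>.prod (MeasurableSet.univ (α := E3)))
  rw [Measure.volume_eq_prod, Measure.prod_apply hm]
  calc _ ≤ ∫⁻ t in Ioo t₀ b, volume (bad n (C * (ε ^ (n + 1))⁻¹) v t) := by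
        rw [← lintegral_indicator measurableSet_Ioo]
        gcongr with t
        by_cases ht : t ∈ Ioo t₀ b
        · rw [indicator_of_mem ht]
          exact measure_mono fun x hx => hx.1
        · rw [indicator_of_notMem ht, nonpos_iff_eq_zero, ← measure_empty (μ := (volume : Measure E3))]
          congr 1
          exact eq_empty_of_forall_notMem fun x hx => ht hx.2.1
    _ ≤ ∫⁻ t in Ioo t₀ b, ENNReal.ofReal (ε ^ 4 * (K * (1 + R / ε) ^ κ)) *
        ∫⁻ s in Icc (-1 : ℝ) 0, gl v (t + ε ^ 2 * s) :=
        setLIntegral_mono' measurableSet_Ioo fun t ht =>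
          h.volume_bad_le hε hε1 ht.2.le (ha.trans (by linarith [ht.1])) hK hR hER H
    _ ≤ ENNReal.ofReal (ε ^ 4 * (K * (1 + R / ε) ^ κ)) * ENNReal.ofReal (E ^ 2) := by
        rw [lintegral_const_mul' _ _ ENNReal.ofReal_ne_top]
        gcongr
        exact h.lintegral_gl_le ha
    _ ≤ _ := by
        rw [← ENNReal.ofReal_mul (by positivity)]
        refine ENNReal.ofReal_le_ofReal ?_
        have h1 : (1 + R / ε) ^ κ ≤ (1 + R) ^ κ * (ε ^ κ)⁻¹ := by
          rw [← div_eq_mul_inv, ← Real.div_rpow (by positivity) hε.le]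
          refine Real.rpow_le_rpow (by positivity) ?_ hκ.le
          rw [add_div]
          gcongr
          exact (one_le_div hε).2 hε1
        calc _ ≤ ε ^ 4 * (K * ((1 + R) ^ κ * (ε ^ κ)⁻¹)) * E ^ 2 := by gcongr
          _ = _ := by
            rw [Real.rpow_sub hε]
            norm_cast
            ring

lemma one_add_rpow_le {E q : ℝ} (hE : 0 ≤ E) (hq : 0 ≤ q) : (1 + E) ^ q ≤ 2 ^ q * (E ^ q + 1) := by
  have hE' := Real.rpow_nonneg hE q
  rcases le_total E 1 with h | h
  · calc _ ≤ (2 : ℝ) ^ q := by gcongr; linarith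
      _ ≤ _ := le_mul_of_one_le_right (by positivity) (by linarith)
  · calc _ ≤ (2 * E) ^ q := by gcongr; linarith
      _ = 2 ^ q * E ^ q := Real.mul_rpow (by norm_num) hE
      _ ≤ _ := by gcongr; linarith

lemma rpow_level_mul {D e κ p Y : ℝ} {n : ℕ} (hD : 0 ≤ D) (he : 0 < e) :
    (D * ((e / 2) ^ (n + 1))⁻¹) ^ p * (e ^ (4 - κ) * Y) =
      D ^ p * 2 ^ ((n + 1 : ℝ) * p) * Y * e ^ (4 - κ - (n + 1) * p) := by
  rw [Real.mul_rpow hD (by positivity), Real.inv_rpow (by positivity), ← Real.rpow_natCast (e / 2),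
    ← Real.rpow_mul (by positivity), Real.div_rpow he.le (by norm_num),
    Real.rpow_sub he (4 - κ) ((n + 1) * p)]
  push_cast
  have h1 : 0 < e ^ ((n + 1 : ℝ) * p) := by positivity
  field_simp

lemma GSol.uniform_bound {Ω : Set Z} (ht₀ : 0 < t₀) (hΩm : MeasurableSet Ω)
    (hΩb : Bornology.IsBounded Ω) (hΩs : Ω ⊆ {q | t₀ < q.1}) {n : ℕ} (hn : 1 ≤ n) {γ p : ℝ}
    (hγ : 0 < γ) (hp : 0 < p) (hscale : (n : ℝ) + 1 < 4 / p) :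
    ∃ C > (0 : ℝ), ∀ b E : ℝ, 0 ≤ E → ∀ v Q, GSol E (t₀ / 2) b v Q → ∀ w : ℝ → E3 → E3,
      (∀ t ∈ Ioo t₀ b, ∀ y i, w t y i = v i (t, y)) →
      (∫⁻ q in Ω ∩ (Iio b ×ˢ univ), ENNReal.ofReal (‖iteratedFDeriv ℝ n (w q.1) q.2‖ ^ p))
        ≤ ENNReal.ofReal (C ^ p * (E ^ (2 * (1 + γ) / p) + 1) ^ p) := by
  obtain ⟨η, C, hη, hC, H⟩ := unit_scale hn
  have hnp : (n + 1 : ℝ) * p < 4 := by rwa [lt_div_iff₀ hp] at hscale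
  obtain ⟨κ, hκ⟩ : ∃ κ, κ = min (2 * γ) ((4 - (n + 1 : ℝ) * p) / 2) := ⟨_, rfl⟩
  have hκ0 : 0 < κ := by rw [hκ]; exact lt_min (by linarith) (by linarith)
  have hκγ : κ ≤ 2 * γ := hκ ▸ min_le_left _ _
  obtain ⟨θ, hθ⟩ : ∃ θ, θ = 4 - κ - (n + 1 : ℝ) * p := ⟨_, rfl⟩
  have hθ0 : 0 < θ := by
    have : κ ≤ (4 - (n + 1 : ℝ) * p) / 2 := hκ ▸ min_le_right _ _
    linarith
  obtain ⟨K, hK, H⟩ := H κ hκ0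
  obtain ⟨m, hm⟩ : ∃ m, m = max 1 (2 / η) := ⟨_, rfl⟩
  have hm1 : 1 ≤ m := hm ▸ le_max_left _ _
  have hmη : 1 ≤ η / 2 * m := by
    have : 2 / η ≤ m := hm ▸ le_max_right _ _
    rw [div_le_iff₀ hη] at this
    linarith
  obtain ⟨e, he⟩ : ∃ e : ℕ → ℝ, e = fun k => min 1 (t₀ / 2) * (1 / 2) ^ k := ⟨_, rfl⟩
  have hε0 : 0 < min 1 (t₀ / 2) := lt_min one_pos (by linarith)
  have he0 : ∀ k, 0 < e k := fun k => by rw [he]; positivity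
  have hele : ∀ k, e k ≤ min 1 (t₀ / 2) := fun k => by
    rw [he]
    exact mul_le_of_le_one_right hε0.le (pow_le_one₀ (by norm_num) (by norm_num))
  have he1 : ∀ k, e k ≤ 1 := fun k => (hele k).trans (min_le_left _ _)
  have hea : ∀ k, t₀ / 2 ≤ t₀ - e k ^ 2 := fun k => by
    have := (hele k).trans (min_le_right _ _)
    nlinarith [he1 k, he0 k]
  obtain ⟨r, hr⟩ : ∃ r : ℝ, r = (1 / 2) ^ θ := ⟨_, rfl⟩
  have hr0 : 0 ≤ r := by rw [hr]; positivity
  have hr1 : r < 1 := by rw [hr]; exact Real.rpow_lt_one (by norm_num) (by norm_num) hθ0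
  have heθ : ∀ k, e k ^ θ = min 1 (t₀ / 2) ^ θ * r ^ k := fun k => by
    rw [he, Real.mul_rpow hε0.le (by positivity), hr, ← Real.rpow_natCast, ← Real.rpow_natCast,
      ← Real.rpow_mul (by norm_num), ← Real.rpow_mul (by norm_num), mul_comm θ]
  obtain ⟨D, hD⟩ : ∃ D : ℝ, D = 3 ^ (n + 1) * C := ⟨_, rfl⟩
  have hD0 : 0 < D := by rw [hD]; positivity
  obtain ⟨A, hA⟩ : ∃ A : ℕ → ℝ, A = fun k => (D * (e k ^ (n + 1))⁻¹) ^ p := ⟨_, rfl⟩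
  have hA0 : ∀ k, 0 < A k := fun k => by
    have := he0 k
    rw [hA]; positivity
  obtain ⟨M, hM⟩ : ∃ M, M = D ^ p * 2 ^ ((n + 1 : ℝ) * p) * K * min 1 (t₀ / 2) ^ θ := ⟨_, rfl⟩
  have hM0 : 0 ≤ M := by rw [hM]; positivity
  obtain ⟨N, hN⟩ : ∃ N, N = A 0 * (volume Ω).toReal + M * (1 + m) ^ κ * (1 - r)⁻¹ + 1 := ⟨_, rfl⟩
  have hr1' : 0 < (1 - r)⁻¹ := inv_pos.2 (by linarith)
  have hN0 : 0 < N := by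
    have := hA0 0
    rw [hN]; positivity
  refine ⟨N ^ p⁻¹ * 2 ^ (2 * (1 + γ) / p), by positivity, fun b E hE v Q h w hw => ?_⟩
  obtain ⟨R, hR⟩ : ∃ R, R = (1 + E) * m := ⟨_, rfl⟩
  have hR0 : 0 < R := by rw [hR]; positivity
  have hER : E ^ 2 ≤ η / 2 * R ^ 3 := by
    have h1 : 1 ≤ (1 + E) * m ^ 2 := by nlinarith [mul_nonneg hE (sq_nonneg m)]
    calc E ^ 2 ≤ (1 + E) ^ 2 * 1 * 1 := by nlinarith
      _ ≤ (1 + E) ^ 2 * (η / 2 * m) * ((1 + E) * m ^ 2) := by gcongr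
      _ = _ := by rw [hR]; ring
  obtain ⟨X, hX⟩ : ∃ X, X = (1 + R) ^ κ * E ^ 2 := ⟨_, rfl⟩
  have hX0 : 0 ≤ X := by rw [hX]; positivity
  have hXle : X ≤ (1 + m) ^ κ * (1 + E) ^ (2 * (1 + γ)) := by
    calc X ≤ ((1 + m) * (1 + E)) ^ κ * (1 + E) ^ 2 := by
          rw [hX]
          gcongr
          · rw [hR]; nlinarith
          · linarith
      _ = (1 + m) ^ κ * ((1 + E) ^ κ * (1 + E) ^ (2 : ℝ)) := by
          rw [Real.mul_rpow (by positivity) (by positivity), mul_assoc, Real.rpow_two]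
      _ ≤ _ := by
          rw [← Real.rpow_add (by positivity)]
          gcongr <;> linarith
  have hSm : MeasurableSet (Ω ∩ (Iio b ×ˢ (univ : Set E3))) :=
    hΩm.inter (measurableSet_Iio.prod MeasurableSet.univ)
  have hS : Ω ∩ (Iio b ×ˢ (univ : Set E3)) ⊆ Ioo t₀ b ×ˢ univ := fun q hq =>
    ⟨⟨hΩs hq.1, hq.2.1⟩, trivial⟩
  have hAmono : ∀ k, A 0 ≤ A k := fun k => by
    have h1 : e k ≤ e 0 := by simpa [he] using hele k
    have := he0 k
    have := he0 0
    rw [hA]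
    beta_reduce
    gcongr
  have main := setLIntegral_le_tsum_levels (μ := volume) hSm
    (F := fun q => ENNReal.ofReal (‖iteratedFDeriv ℝ n (w q.1) q.2‖ ^ p))
    (B := fun k => badZ n (C * (e k ^ (n + 1))⁻¹) v)
    (fun k => (isOpen_badZ h.sm n _).measurableSet) (A := fun k => ENNReal.ofReal (A k))
    (δ := ENNReal.ofReal (A 0)) (ENNReal.ofReal_pos.2 (hA0 0)).ne'
    (fun k => ENNReal.ofReal_le_ofReal (hAmono k)) fun k q hq hqB => by
      refine ENNReal.ofReal_le_ofReal ?_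
      rw [hA]
      refine Real.rpow_le_rpow (norm_nonneg _) ?_ hp.le
      rw [hD, mul_assoc]
      refine norm_iteratedFDeriv_vec h.sm q.1 (hw q.1 (hS hq).1) q.2 n fun i l hl => ?_
      by_contra hlt
      exact hqB ⟨i, l, hl, not_le.1 hlt⟩
  have hterm : ∀ k, ENNReal.ofReal (A (k + 1)) *
      volume (badZ n (C * (e k ^ (n + 1))⁻¹) v ∩ (Ω ∩ (Iio b ×ˢ (univ : Set E3)))) ≤
      ENNReal.ofReal (M * X * r ^ k) := fun k => by
    calc _ ≤ ENNReal.ofReal (A (k + 1)) * ENNReal.ofReal (e k ^ (4 - κ) * (K * X)) := by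
          gcongr
          rw [hX]
          exact (measure_mono (inter_subset_inter_right _ hS)).trans
            (h.volume_badZ_le (he0 k) (he1 k) (hea k) hK hR0 hκ0 hER H)
      _ = _ := by
          rw [← ENNReal.ofReal_mul (hA0 _).le]
          congr 1
          have : e (k + 1) = e k / 2 := by rw [he]; ring
          rw [hA]
          beta_reduce
          rw [this, rpow_level_mul hD0.le (he0 k), ← hθ, heθ, hM]
          ring
  have hsum : ∑' k, ENNReal.ofReal (M * X * r ^ k) = ENNReal.ofReal (M * X * (1 - r)⁻¹) := by
    rw [← ENNReal.ofReal_tsum_of_nonneg (fun k => by positivity)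
      ((summable_geometric_of_lt_one hr0 hr1).mul_left _), tsum_mul_left,
      tsum_geometric_of_lt_one hr0 hr1]
  have hvol : volume (Ω ∩ (Iio b ×ˢ (univ : Set E3))) ≤ ENNReal.ofReal (volume Ω).toReal := by
    rw [ENNReal.ofReal_toReal hΩb.measure_lt_top.ne]
    exact measure_mono inter_subset_left
  calc _ ≤ _ := main
    _ ≤ ENNReal.ofReal (A 0) * ENNReal.ofReal (volume Ω).toReal +
        ENNReal.ofReal (M * X * (1 - r)⁻¹) := by
        rw [← hsum]
        gcongr with k
        exact hterm k
    _ ≤ _ := by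
        have h0 := (hA0 0).le
        rw [← ENNReal.ofReal_mul h0, ← ENNReal.ofReal_add (by positivity) (by positivity)]
        refine ENNReal.ofReal_le_ofReal ?_
        have h1 : (1 : ℝ) ≤ (1 + E) ^ (2 * (1 + γ)) :=
          Real.one_le_rpow (by linarith) (by positivity)
        have hB : 0 ≤ (1 - r)⁻¹ := hr1'.le
        calc _ ≤ A 0 * (volume Ω).toReal * (1 + E) ^ (2 * (1 + γ)) +
              M * ((1 + m) ^ κ * (1 + E) ^ (2 * (1 + γ))) * (1 - r)⁻¹ + (1 + E) ^ (2 * (1 + γ)) := by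
              refine le_add_of_le_of_nonneg (add_le_add (le_mul_of_one_le_right (by positivity) h1)
                (by gcongr)) (by positivity)
          _ = N * ((1 + E) ^ (2 * (1 + γ) / p)) ^ p := by
              rw [← Real.rpow_mul (by positivity), div_mul_cancel₀ _ hp.ne', hN]
              ring
          _ ≤ N * (2 ^ (2 * (1 + γ) / p) * (E ^ (2 * (1 + γ) / p) + 1)) ^ p := by
              gcongr
              exact one_add_rpow_le hE (by positivity)
          _ = _ := by
              have hE' := Real.rpow_nonneg hE (2 * (1 + γ) / p)
              rw [Real.mul_rpow (by positivity) (by positivity),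
                Real.mul_rpow (by positivity) (by positivity), Real.rpow_inv_rpow hN0.le hp.ne']
              ring

end

/-! ### Cutting off in time -/

lemma exists_time_cutoff {a b T : ℝ} (ha : 0 < a) (hab : a < b) (hb : b < T) :
    ∃ χ : ℝ → ℝ, Sm χ ∧ tsupport χ ⊆ Ioo 0 T ∧ (∀ s, χ s ∈ Icc (0 : ℝ) 1) ∧
      ∀ s ∈ Icc a b, ∀ᶠ τ in nhds s, χ τ = 1 := by
  obtain ⟨δ, hδ0, hδa, hδb⟩ : ∃ δ : ℝ, 0 < δ ∧ 2 * δ < a ∧ 2 * δ < T - b := by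
    refine ⟨min a (T - b) / 3, by have := lt_min ha (sub_pos.2 hb); positivity, ?_, ?_⟩ <;>
      linarith [min_le_left a (T - b), min_le_right a (T - b), lt_min ha (sub_pos.2 hb)]
  let B : ContDiffBump ((a + b) / 2) := ⟨(b - a) / 2 + δ, (b - a) / 2 + 2 * δ,
    by linarith, by linarith⟩
  refine ⟨B, B.contDiff, ?_, fun s => ⟨B.nonneg, B.le_one⟩, fun s hs => ?_⟩
  · rw [B.tsupport_eq, Real.closedBall_eq_Icc]
    have h : B.rOut = (b - a) / 2 + 2 * δ := rfl
    exact fun x hx => ⟨by linarith [hx.1], by linarith [hx.2]⟩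
  · have : ball ((a + b) / 2) ((b - a) / 2 + δ) ∈ nhds s := by
      refine isOpen_ball.mem_nhds ?_
      rw [Real.ball_eq_Ioo]
      exact ⟨by linarith [hs.1], by linarith [hs.2]⟩
    filter_upwards [this] with τ hτ
    exact B.one_of_mem_closedBall (ball_subset_closedBall hτ)

lemma smooth_cutoff_mul {T : ℝ} {χ : ℝ → ℝ} (hχ : Sm χ) (hs : tsupport χ ⊆ Ioo 0 T) {f : Z → ℝ}
    (hf : ContDiffOn ℝ (⊤ : ℕ∞) f (Ioo 0 T ×ˢ univ)) : Sm (fun z : Z => χ z.1 * f z) := by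
  refine contDiff_iff_contDiffAt.2 fun z => ?_
  by_cases hz : z.1 ∈ Ioo 0 T
  · exact (hχ.comp contDiff_fst).contDiffAt.mul
      (hf.contDiffAt ((isOpen_Ioo.prod isOpen_univ).mem_nhds ⟨hz, trivial⟩))
  · have h1 : ∀ᶠ τ in nhds z.1, χ τ = 0 := notMem_tsupport_iff_eventuallyEq.1 fun h => hz (hs h)
    refine (contDiffAt_const (c := (0 : ℝ))).congr_of_eventuallyEq ?_
    filter_upwards [continuous_fst.continuousAt.eventually h1] with y hy
    rw [hy, zero_mul]

lemma exists_gsol {t₀ T b En : ℝ} (ht₀ : 0 < t₀) (htb : t₀ < b) (hbT : b < T)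
    {u : ℝ → E3 → E3} {P : ℝ → E3 → ℝ} (hu : IsNSSolution u P (Ioo 0 T ×ˢ (univ : Set E3)))
    (hP : ∀ t ∈ Ioo (0:ℝ) T, ∀ x : E3, P t x = (1 / (4 * Real.pi)) *
      ∫ y : E3, (∑ i, ∑ j, pd (fun z => u t z j) i y * pd (fun z => u t z i) j y) / ‖x - y‖)
    (hE : ∀ t ∈ Ioo (0:ℝ) T, (∫⁻ x : E3, ENNReal.ofReal (‖u t x‖ ^ 2)) ≤ ENNReal.ofReal (En ^ 2))
    (hG : (∫⁻ t in Ioo (0:ℝ) T, ∫⁻ x : E3, ENNReal.ofReal (gradSq (u t) x))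
      ≤ ENNReal.ofReal (En ^ 2)) :
    ∃ v Q, GSol En (t₀ / 2) b v Q ∧ ∀ t ∈ Ioo t₀ b, ∀ y i, u t y i = v i (t, y) := by
  obtain ⟨hus, hPs, heq, hdiv⟩ := hu
  obtain ⟨χ, hχ, hsupp, hχ01, hχ1⟩ := exists_time_cutoff (a := t₀ / 2) (by linarith)
    (by linarith : t₀ / 2 < b) hbT
  obtain ⟨v, hv⟩ : ∃ v : Fin 3 → Z → ℝ, v = fun i z => χ z.1 * u z.1 z.2 i := ⟨_, rfl⟩
  obtain ⟨Q, hQ⟩ : ∃ Q : Z → ℝ, Q = fun z => χ z.1 * P z.1 z.2 := ⟨_, rfl⟩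
  have hvs : ∀ i, Sm (v i) := fun i => by
    rw [hv]
    exact smooth_cutoff_mul hχ hsupp
      ((EuclideanSpace.proj i : E3 →L[ℝ] ℝ).contDiff.comp_contDiffOn hus)
  have hQs : Sm Q := by rw [hQ]; exact smooth_cutoff_mul hχ hsupp hPs
  have hI : ∀ s ∈ Icc (t₀ / 2) b, s ∈ Ioo 0 T := fun s hs =>
    ⟨by linarith [hs.1], by linarith [hs.2]⟩
  have hone : ∀ s ∈ Icc (t₀ / 2) b, χ s = 1 := fun s hs => (hχ1 s hs).self_of_nhds
  have huv : ∀ s ∈ Icc (t₀ / 2) b, ∀ y i, u s y i = v i (s, y) := fun s hs y i => by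
    rw [hv]; simp [hone s hs]
  have hpd : ∀ s ∈ Icc (t₀ / 2) b, ∀ i j, pd (fun y => u s y i) j = fun x => dx j (v i) (s, x) :=
    fun s hs i j => by
      simp_rw [huv s hs]
      exact funext fun x => dx_slice (hvs i) j s x
  have hpdP : ∀ s ∈ Icc (t₀ / 2) b, ∀ i x, pd (fun y => P s y) i x = dx i Q (s, x) :=
    fun s hs i x => by
      rw [← dx_slice hQs, hQ]
      simp [hone s hs, pd, dv]
  have hgp : ∀ s ∈ Icc (t₀ / 2) b, ∀ y,
      ∑ i, ∑ j, pd (fun z => u s z j) i y * pd (fun z => u s z i) j y = gp v (s, y) :=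
    fun s hs y => by simp only [hpd s hs, gp]
  have hgrad : ∀ s ∈ Icc (t₀ / 2) b, ∀ y, gradSq (u s) y = G2 v (s, y) :=
    fun s hs y => by simp only [gradSq, hpd s hs, G2]
  refine ⟨v, Q, ⟨hvs, hQs, fun s hs x i => ?_, fun s hs x => ?_, fun s hs x => ?_, fun s => ?_, ?_⟩,
    fun t ht => huv t ⟨by linarith [ht.1], ht.2.le⟩⟩
  · have h1 := heq (s, x) ⟨hI s hs, trivial⟩ i
    have h2 : deriv (fun s => u s x i) s = dt (v i) (s, x) := by
      rw [← (hasDerivAt_slice (hvs i) s x).deriv]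
      refine Filter.EventuallyEq.deriv_eq ?_
      filter_upwards [hχ1 s hs] with τ hτ
      rw [hv]; simp [hτ]
    have h3 : ∀ j, pd (fun x => dx j (v i) (s, x)) j x = dx j (dx j (v i)) (s, x) := fun j =>
      dx_slice (dv_smooth _ (hvs i)) j s x
    simp only [h2, hpd s hs, h3, hpdP s hs] at h1
    simp only [huv s hs] at h1
    exact h1
  · simpa only [hpd s hs] using hdiv (s, x) ⟨hI s hs, trivial⟩
  · have h1 := hP s (hI s hs) x
    simp only [hgp s hs] at h1
    rw [← h1, hQ]
    simp [hone s hs]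
  · by_cases hs : s ∈ Ioo 0 T
    · refine le_trans (lintegral_mono fun y => ENNReal.ofReal_le_ofReal ?_) (hE s hs)
      have h1 : S2 v (s, y) = χ s ^ 2 * ‖u s y‖ ^ 2 := by
        rw [hv, norm_sq_eq_sum, Finset.mul_sum]
        exact Finset.sum_congr rfl fun i _ => by ring
      rw [h1]
      exact mul_le_of_le_one_left (by positivity) (pow_le_one₀ (hχ01 s).1 (hχ01 s).2)
    · have h1 : χ s = 0 := image_eq_zero_of_notMem_tsupport fun h => hs (hsupp h)
      simp [S2, hv, h1]
  · refine le_trans (le_of_eq ?_) ((lintegral_mono_set hI).trans hG)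
    exact setLIntegral_congr_fun measurableSet_Icc fun s hs =>
      lintegral_congr fun y => by rw [hgrad s hs]

/-- Main theorem: uniform higher-derivative estimates. For `t₀ > 0`, `Ω` a bounded measurable
subset of `(t₀,∞) × ℝ³`, `n ≥ 1`, `γ > 0` and `p > 0` with `4/p > n+1`, there is `C > 0` such
that for every `T > 0`, `E ≥ 0` and every smooth solution `(u,P)` on `(0,T) × ℝ³` whose pressure
is the Newtonian potential of `Σ ∂ᵢuⱼ ∂ⱼuᵢ`, with `sup_t ‖u(t)‖_{L²} ≤ E` and
`∫∫ |∇u|² ≤ E²`, one has `∫_{Ω ∩ (0,T)×ℝ³} |∇ⁿu|^p ≤ Cᵖ (E^{2(1+γ)/p} + 1)ᵖ`. -/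
theorem ns_uniform_higher_derivatives (t₀ : ℝ) (ht₀ : 0 < t₀) (Ω : Set (ℝ × E3))
    (hΩm : MeasurableSet Ω) (hΩb : Bornology.IsBounded Ω)
    (hΩs : Ω ⊆ {q : ℝ × E3 | t₀ < q.1}) (n : ℕ) (hn : 1 ≤ n) (γ p : ℝ)
    (hγ : 0 < γ) (hp : 0 < p) (hscale : (n : ℝ) + 1 < 4 / p) :
    ∃ C > (0:ℝ), ∀ T : ℝ, 0 < T → ∀ En : ℝ, 0 ≤ En →
      ∀ (u : ℝ → E3 → E3) (P : ℝ → E3 → ℝ),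
      IsNSSolution u P (Set.Ioo 0 T ×ˢ (Set.univ : Set E3)) →
      (∀ t ∈ Set.Ioo (0:ℝ) T, ∀ x : E3,
        P t x = (1 / (4 * Real.pi)) *
          ∫ y : E3, (∑ i, ∑ j, pd (fun z => u t z j) i y * pd (fun z => u t z i) j y)
            / ‖x - y‖) →
      (∀ t ∈ Set.Ioo (0:ℝ) T,
        (∫⁻ x : E3, ENNReal.ofReal (‖u t x‖ ^ 2)) ≤ ENNReal.ofReal (En ^ 2)) →
      (∫⁻ t in Set.Ioo (0:ℝ) T, ∫⁻ x : E3, ENNReal.ofReal (gradSq (u t) x))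
        ≤ ENNReal.ofReal (En ^ 2) →
      (∫⁻ q in Ω ∩ (Set.Ioo (0:ℝ) T ×ˢ (Set.univ : Set E3)),
          ENNReal.ofReal (‖iteratedFDeriv ℝ n (u q.1) q.2‖ ^ p))
        ≤ ENNReal.ofReal (C ^ p * (En ^ (2 * (1 + γ) / p) + 1) ^ p) := by
  obtain ⟨C, hC, H⟩ := GSol.uniform_bound ht₀ hΩm hΩb hΩs hn hγ hp hscale
  refine ⟨C, hC, fun T _ En hEn u P hu hP hE hG => ?_⟩
  obtain ⟨b, hb⟩ : ∃ b : ℕ → ℝ, b = fun m : ℕ => T - 1 / ((m : ℝ) + 1) := ⟨_, rfl⟩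
  have hbm : Monotone b := by
    rw [hb]
    exact fun k m hkm => sub_le_sub_left (Nat.one_div_le_one_div hkm) T
  have hcov : Ω ∩ (Ioo (0:ℝ) T ×ˢ (univ : Set E3)) ⊆ ⋃ m, Ω ∩ (Iio (b m) ×ˢ univ) := fun q hq => by
    obtain ⟨m, hm⟩ := exists_nat_one_div_lt (sub_pos.2 hq.2.1.2)
    exact mem_iUnion.2 ⟨m, hq.1, by rw [hb]; exact lt_sub_comm.1 hm, trivial⟩
  have hmono : Monotone fun m => Ω ∩ (Iio (b m) ×ˢ (univ : Set E3)) := fun k m hkm =>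
    inter_subset_inter_right _ (prod_mono (Iio_subset_Iio (hbm hkm)) subset_rfl)
  refine (lintegral_mono_set hcov).trans ?_
  rw [setLIntegral_iUnion_of_directed _ hmono.directed_le]
  refine iSup_le fun m => ?_
  rcases le_or_gt (b m) t₀ with h | h
  · have : Ω ∩ (Iio (b m) ×ˢ (univ : Set E3)) = ∅ := eq_empty_of_forall_notMem fun q hq =>
      absurd (hΩs hq.1) (not_lt.2 ((le_of_lt hq.2.1).trans h))
    rw [this]
    simp
  · obtain ⟨v, Q, hv, huv⟩ := exists_gsol ht₀ h (by
      rw [hb]; exact sub_lt_self T Nat.one_div_pos_of_nat) hu hP hE hG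
    exact H (b m) En hEn v Q hv u huv
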